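/- Fix τ > 2 and let α satisfy the Diophantine condition DC_τ. Let v : ℝ/ℤ → ℝ satisfy condition (V). Then there exists λ₀ = λ₀(α,v) > 0 such that for every λ > λ₀ and every interval S ⊂ ℝ containing more than one point, there exists E ∈ S such that the cocycle (α, A^{(E−λv)}) is uniformly hyperbolic. -/

import Mathlib

open scoped Real
open Matrix

noncomputable section

/-- 2×2 real matrices. -/
abbrev M2 : Type := Matrix (Fin 2) (Fin 2) ℝ

/-- Rotation matrix by angle θ. -/
def rot (θ : ℝ) : M2 := !![Real.cos θ, -Real.sin θ; Real.sin θ, Real.cos θ]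

/-- Euclidean norm of a vector in ℝ². -/
def vnorm (w : Fin 2 → ℝ) : ℝ := ‖(WithLp.equiv 2 (Fin 2 → ℝ)).symm w‖

/-- Operator norm of a 2×2 real matrix acting on Euclidean ℝ². -/
def opNorm (A : M2) : ℝ := ‖Matrix.toEuclideanCLM (𝕜 := ℝ) A‖

/-- Forward iterates B_n(x) = B(x+(n-1)β)⋯B(x+β)B(x). -/
def fwdIter (β : ℝ) (B : ℝ → M2) : ℕ → ℝ → M2
  | 0, _ => 1
  | n + 1, x => B (x + n * β) * fwdIter β B n x

/-- Cocycle iterates indexed by ℤ: B₀ = Id, B_n for n ≥ 1 as above, and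
B_n(x) = [B_{-n}(x+nβ)]⁻¹ for n ≤ -1. -/
def cocycleIter (β : ℝ) (B : ℝ → M2) (n : ℤ) (x : ℝ) : M2 :=
  if 0 ≤ n then fwdIter β B n.toNat x else (fwdIter β B (-n).toNat (x + (n : ℝ) * β))⁻¹

/-- Uniform hyperbolicity of the cocycle (β, B) over the circle ℝ/ℤ
(B is understood as a 1-periodic function of x): there are invariant 1-periodic line fields
s̄ (stable) and ū (unstable) with uniform exponential contraction forwards resp. backwards. -/
def IsUH (β : ℝ) (B : ℝ → M2) : Prop :=
  ∃ (s u : ℝ → Submodule ℝ (Fin 2 → ℝ)) (c ρ : ℝ),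
    0 < c ∧ 1 < ρ ∧
    (∀ x, Module.finrank ℝ (s x) = 1 ∧ Module.finrank ℝ (u x) = 1) ∧
    (∀ x, s (x + 1) = s x ∧ u (x + 1) = u x) ∧
    (∀ x, (s x).map (Matrix.toLin' (B x)) = s (x + β) ∧
          (u x).map (Matrix.toLin' (B x)) = u (x + β)) ∧
    (∀ x, ∀ n : ℕ, 1 ≤ n →
      (∀ w : Fin 2 → ℝ, w ∈ s x → vnorm w = 1 →
        vnorm ((cocycleIter β B n x) *ᵥ w) < c / ρ ^ n) ∧
      (∀ w : Fin 2 → ℝ, w ∈ u x → vnorm w = 1 →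
        vnorm ((cocycleIter β B (-(n : ℤ)) x) *ᵥ w) < c / ρ ^ n))

/-- The Diophantine condition DC_{τ,γ}. -/
def DCwith (τ γ α : ℝ) : Prop :=
  ∀ p q : ℤ, q ≠ 0 → γ / |(q : ℝ)| ^ τ ≤ |α - (p : ℝ) / (q : ℝ)|

/-- The Diophantine condition DC_τ = ∪_{γ>0} DC_{τ,γ}. -/
def DC (τ α : ℝ) : Prop := ∃ γ > 0, DCwith τ γ α

/-- Condition (V) for a 1-periodic potential: C², the derivative vanishes at exactly two
points of the circle, one a global minimum and the other a global maximum, both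
non-degenerate. -/
def ConditionV (v : ℝ → ℝ) : Prop :=
  ContDiff ℝ 2 v ∧
  ∃ z₁ z₂ : ℝ, z₁ ∈ Set.Ico (0 : ℝ) 1 ∧ z₂ ∈ Set.Ico (0 : ℝ) 1 ∧ z₁ ≠ z₂ ∧
    (∀ x ∈ Set.Ico (0 : ℝ) 1, deriv v x = 0 ↔ x = z₁ ∨ x = z₂) ∧
    (∀ x, v z₁ ≤ v x) ∧ (∀ x, v x ≤ v z₂) ∧
    iteratedDeriv 2 v z₁ ≠ 0 ∧ iteratedDeriv 2 v z₂ ≠ 0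

/-- The Schrödinger cocycle map A^{(E-λv)}. -/
def schCocycle (lam : ℝ) (v : ℝ → ℝ) (E : ℝ) (x : ℝ) : M2 :=
  !![E - lam * v x, -1; 1, 0]

/-- A jet of a function of `(x, E)`: value, first `x`-derivative, half the second `x`-derivative,
and `E`-derivative. -/
@[ext] structure Jet where
  v0 : ℝ
  dx : ℝ
  dxx : ℝ
  dE : ℝ

namespace Jet

instance : Zero Jet := ⟨⟨0, 0, 0, 0⟩⟩
instance : One Jet := ⟨⟨1, 0, 0, 0⟩⟩
instance : Add Jet := ⟨fun a b => ⟨a.v0 + b.v0, a.dx + b.dx, a.dxx + b.dxx, a.dE + b.dE⟩⟩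
instance : Neg Jet := ⟨fun a => ⟨-a.v0, -a.dx, -a.dxx, -a.dE⟩⟩
instance : Sub Jet := ⟨fun a b => ⟨a.v0 - b.v0, a.dx - b.dx, a.dxx - b.dxx, a.dE - b.dE⟩⟩
instance : Mul Jet := ⟨fun a b => ⟨a.v0 * b.v0, a.v0 * b.dx + a.dx * b.v0,
  a.v0 * b.dxx + a.dx * b.dx + a.dxx * b.v0, a.v0 * b.dE + a.dE * b.v0⟩⟩
instance : Inv Jet := ⟨fun a => ⟨a.v0⁻¹, -a.dx * a.v0⁻¹ ^ 2,
  a.dx ^ 2 * a.v0⁻¹ ^ 3 - a.dxx * a.v0⁻¹ ^ 2, -a.dE * a.v0⁻¹ ^ 2⟩⟩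

@[simp] lemma zero_v0 : (0 : Jet).v0 = 0 := rfl
@[simp] lemma zero_dx : (0 : Jet).dx = 0 := rfl
@[simp] lemma zero_dxx : (0 : Jet).dxx = 0 := rfl
@[simp] lemma zero_dE : (0 : Jet).dE = 0 := rfl
@[simp] lemma one_v0 : (1 : Jet).v0 = 1 := rfl
@[simp] lemma one_dx : (1 : Jet).dx = 0 := rfl
@[simp] lemma one_dxx : (1 : Jet).dxx = 0 := rfl
@[simp] lemma one_dE : (1 : Jet).dE = 0 := rfl

variable (a b c : Jet)

@[simp] lemma add_v0 : (a + b).v0 = a.v0 + b.v0 := rfl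
@[simp] lemma add_dx : (a + b).dx = a.dx + b.dx := rfl
@[simp] lemma add_dxx : (a + b).dxx = a.dxx + b.dxx := rfl
@[simp] lemma add_dE : (a + b).dE = a.dE + b.dE := rfl
@[simp] lemma neg_v0 : (-a).v0 = -a.v0 := rfl
@[simp] lemma neg_dx : (-a).dx = -a.dx := rfl
@[simp] lemma neg_dxx : (-a).dxx = -a.dxx := rfl
@[simp] lemma neg_dE : (-a).dE = -a.dE := rfl
@[simp] lemma sub_v0 : (a - b).v0 = a.v0 - b.v0 := rfl
@[simp] lemma sub_dx : (a - b).dx = a.dx - b.dx := rfl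
@[simp] lemma sub_dxx : (a - b).dxx = a.dxx - b.dxx := rfl
@[simp] lemma sub_dE : (a - b).dE = a.dE - b.dE := rfl
@[simp] lemma mul_v0 : (a * b).v0 = a.v0 * b.v0 := rfl
lemma mul_dx : (a * b).dx = a.v0 * b.dx + a.dx * b.v0 := rfl
lemma mul_dxx : (a * b).dxx = a.v0 * b.dxx + a.dx * b.dx + a.dxx * b.v0 := rfl
lemma mul_dE : (a * b).dE = a.v0 * b.dE + a.dE * b.v0 := rfl
@[simp] lemma inv_v0 : (a⁻¹).v0 = a.v0⁻¹ := rfl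
lemma inv_dx : (a⁻¹).dx = -a.dx * a.v0⁻¹ ^ 2 := rfl
lemma inv_dxx : (a⁻¹).dxx = a.dx ^ 2 * a.v0⁻¹ ^ 3 - a.dxx * a.v0⁻¹ ^ 2 := rfl
lemma inv_dE : (a⁻¹).dE = -a.dE * a.v0⁻¹ ^ 2 := rfl

instance : CommRing Jet where
  add_assoc a b c := by ext <;> simp [add_assoc]
  zero_add a := by ext <;> simp
  add_zero a := by ext <;> simp
  add_comm a b := by ext <;> simp [add_comm]
  mul_assoc a b c := by ext <;> simp [mul_dx, mul_dxx, mul_dE] <;> ring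
  one_mul a := by ext <;> simp [mul_dx, mul_dxx, mul_dE]
  mul_one a := by ext <;> simp [mul_dx, mul_dxx, mul_dE]
  mul_comm a b := by ext <;> simp [mul_dx, mul_dxx, mul_dE] <;> ring
  left_distrib a b c := by ext <;> simp [mul_dx, mul_dxx, mul_dE] <;> ring
  right_distrib a b c := by ext <;> simp [mul_dx, mul_dxx, mul_dE] <;> ring
  zero_mul a := by ext <;> simp [mul_dx, mul_dxx, mul_dE]
  mul_zero a := by ext <;> simp [mul_dx, mul_dxx, mul_dE]
  neg_add_cancel a := by ext <;> simp
  sub_eq_add_neg a b := by ext <;> simp [sub_eq_add_neg]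
  nsmul := nsmulRec
  zsmul := zsmulRec

/-- Evaluation of a jet, as a ring homomorphism. -/
def val : Jet →+* ℝ where
  toFun := v0
  map_zero' := rfl
  map_one' := rfl
  map_add' _ _ := rfl
  map_mul' _ _ := rfl

@[simp] lemma val_apply : val a = a.v0 := rfl

/-- The constant jet. -/
def cst (r : ℝ) : Jet := ⟨r, 0, 0, 0⟩

lemma cst_mul (r : ℝ) : cst r * a = ⟨r * a.v0, r * a.dx, r * a.dxx, r * a.dE⟩ := by
  ext <;> simp [cst, mul_dx, mul_dxx, mul_dE]

lemma mul_inv_self (h : a.v0 ≠ 0) : a * a⁻¹ = 1 := by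
  ext
  · simp [h]
  · simp [mul_dx, inv_dx]; field_simp; ring
  · simp [mul_dxx, inv_dxx, inv_dx]; field_simp; ring
  · simp [mul_dE, inv_dE]; field_simp; ring

variable {a b} in
lemma eq_inv_of_mul_eq_one (h : a * b = 1) : b = a⁻¹ := by
  have h0 : a.v0 * b.v0 = 1 := congrArg v0 h
  have ha : a.v0 ≠ 0 := left_ne_zero_of_mul_eq_one h0
  calc b = (a * a⁻¹) * b := by rw [mul_inv_self a ha, one_mul]
    _ = (a * b) * a⁻¹ := by ring
    _ = a⁻¹ := by rw [h, one_mul]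

/-- The `ℓ¹` norm of a jet. -/
def nrm : ℝ := |a.v0| + |a.dx| + |a.dxx| + |a.dE|

lemma nrm_nonneg : 0 ≤ nrm a := by unfold nrm; positivity

@[simp] lemma nrm_zero : nrm 0 = 0 := by simp [nrm]
@[simp] lemma nrm_one : nrm 1 = 1 := by simp [nrm]
@[simp] lemma nrm_neg : nrm (-a) = nrm a := by simp [nrm]
@[simp] lemma nrm_cst (r : ℝ) : nrm (cst r) = |r| := by simp [nrm, cst]

lemma abs_v0_le : |a.v0| ≤ nrm a := by
  unfold nrm; linarith [abs_nonneg a.dx, abs_nonneg a.dxx, abs_nonneg a.dE]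
lemma abs_dx_le : |a.dx| ≤ nrm a := by
  unfold nrm; linarith [abs_nonneg a.v0, abs_nonneg a.dxx, abs_nonneg a.dE]
lemma abs_dxx_le : |a.dxx| ≤ nrm a := by
  unfold nrm; linarith [abs_nonneg a.v0, abs_nonneg a.dx, abs_nonneg a.dE]
lemma abs_dE_le : |a.dE| ≤ nrm a := by
  unfold nrm; linarith [abs_nonneg a.v0, abs_nonneg a.dx, abs_nonneg a.dxx]

lemma nrm_add_le : nrm (a + b) ≤ nrm a + nrm b := by
  simp only [nrm, add_v0, add_dx, add_dxx, add_dE]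
  linarith [abs_add_le a.v0 b.v0, abs_add_le a.dx b.dx, abs_add_le a.dxx b.dxx,
    abs_add_le a.dE b.dE]

lemma nrm_sub_comm : nrm (a - b) = nrm (b - a) := by rw [← nrm_neg, neg_sub]

lemma nrm_sub_le_add (a b c : Jet) : nrm (a - c) ≤ nrm (a - b) + nrm (b - c) := by
  have := nrm_add_le (a - b) (b - c); rwa [sub_add_sub_cancel] at this

lemma nrm_le_add (a b : Jet) : nrm a ≤ nrm b + nrm (a - b) := by
  have := nrm_add_le b (a - b); rwa [add_sub_cancel] at this

lemma nrm_mul_le : nrm (a * b) ≤ nrm a * nrm b := by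
  simp only [nrm, mul_v0, mul_dx, mul_dxx, mul_dE]
  have h1 := abs_add_le (a.v0 * b.dx) (a.dx * b.v0)
  have h2 := abs_add_three (a.v0 * b.dxx) (a.dx * b.dx) (a.dxx * b.v0)
  have h3 := abs_add_le (a.v0 * b.dE) (a.dE * b.v0)
  simp only [abs_mul] at *
  have := abs_nonneg a.v0
  have := abs_nonneg a.dx
  have := abs_nonneg a.dxx
  have := abs_nonneg a.dE
  have := abs_nonneg b.v0
  have := abs_nonneg b.dx
  have := abs_nonneg b.dxx
  have := abs_nonneg b.dE
  have : 0 ≤ |a.dx| * |b.dxx| + |a.dx| * |b.dE| + |a.dxx| * |b.dx| + |a.dxx| * |b.dxx|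
    + |a.dxx| * |b.dE| + |a.dE| * |b.dx| + |a.dE| * |b.dxx| + |a.dE| * |b.dE| := by positivity
  nlinarith

variable {a b} in
lemma nrm_mul_le_of_le {r s : ℝ} (ha : nrm a ≤ r) (hb : nrm b ≤ s) : nrm (a * b) ≤ r * s :=
  (nrm_mul_le a b).trans (mul_le_mul ha hb (nrm_nonneg b) ((nrm_nonneg a).trans ha))

lemma nrm_cst_mul (r : ℝ) : nrm (cst r * a) = |r| * nrm a := by
  rw [cst_mul]; simp only [nrm, abs_mul]; ring

variable {a} in
lemma nrm_inv_le {m K : ℝ} (hm : 0 < m) (h : m ≤ |a.v0|) (hK : nrm a ≤ K) :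
    nrm a⁻¹ ≤ 3 * K ^ 2 / m ^ 3 := by
  have hi : |a.v0⁻¹| ≤ m⁻¹ := by rw [abs_inv]; exact inv_anti₀ hm h
  have hmK : m ≤ K := h.trans ((abs_v0_le a).trans hK)
  have hKp : 0 < K := hm.trans_le hmK
  set i := |a.v0⁻¹| with hi'
  have hi0 : 0 ≤ i := abs_nonneg _
  simp only [nrm, inv_v0, inv_dx, inv_dxx, inv_dE]
  have h1 := abs_sub (a.dx ^ 2 * a.v0⁻¹ ^ 3) (a.dxx * a.v0⁻¹ ^ 2)
  simp only [abs_mul, abs_neg, abs_pow, ← hi'] at *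
  have hx := abs_dx_le a
  have hsum : |a.dx| + |a.dxx| + |a.dE| ≤ K := by
    unfold nrm at hK; linarith [abs_nonneg a.v0]
  have h0 := abs_nonneg a.dx
  have e1 : i ≤ K ^ 2 * (m⁻¹) ^ 3 := by
    calc i ≤ m⁻¹ := hi
      _ = m ^ 2 * (m⁻¹) ^ 3 := by field_simp
      _ ≤ _ := by gcongr
  have e2 : (|a.dx| + |a.dxx| + |a.dE|) * i ^ 2 ≤ K ^ 2 * (m⁻¹) ^ 3 := by
    calc _ ≤ K * (m⁻¹) ^ 2 := by gcongr
      _ = K * m * (m⁻¹) ^ 3 := by field_simp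
      _ ≤ K * K * (m⁻¹) ^ 3 := by gcongr
      _ = _ := by ring
  have e3 : |a.dx| ^ 2 * i ^ 3 ≤ K ^ 2 * (m⁻¹) ^ 3 := by
    have : |a.dx| ≤ K := hx.trans hK
    gcongr
  have : 3 * K ^ 2 / m ^ 3 = 3 * (K ^ 2 * (m⁻¹) ^ 3) := by field_simp
  rw [this]
  nlinarith

/-- `F` is, at the point `(x, E)`, the jet of the function `(y, e) ↦ (F y e).v0`. -/
structure IsAt (F : ℝ → ℝ → Jet) (x E : ℝ) : Prop where
  hdx : HasDerivAt (fun y => (F y E).v0) (F x E).dx x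
  hdxx : HasDerivAt (fun y => (F y E).dx) (2 * (F x E).dxx) x
  hdE : HasDerivAt (fun e => (F x e).v0) (F x E).dE E

namespace IsAt

variable {F G : ℝ → ℝ → Jet} {x E : ℝ}

lemma const (c : Jet) (hx : c.dx = 0) (hxx : c.dxx = 0) (hE : c.dE = 0) :
    IsAt (fun _ _ => c) x E := by
  refine ⟨?_, ?_, ?_⟩
  · simpa [hx] using hasDerivAt_const x c.v0
  · simpa [hxx] using hasDerivAt_const x c.dx
  · simpa [hE] using hasDerivAt_const E c.v0

lemma add (hF : IsAt F x E) (hG : IsAt G x E) : IsAt (fun y e => F y e + G y e) x E := by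
  refine ⟨hF.hdx.add hG.hdx, (hF.hdxx.add hG.hdxx).congr_deriv ?_, hF.hdE.add hG.hdE⟩
  simp; ring

lemma mul (hF : IsAt F x E) (hG : IsAt G x E) : IsAt (fun y e => F y e * G y e) x E := by
  refine ⟨(hF.hdx.mul hG.hdx).congr_deriv ?_,
    ((hF.hdx.mul hG.hdxx).add (hF.hdxx.mul hG.hdx)).congr_deriv ?_,
    (hF.hdE.mul hG.hdE).congr_deriv ?_⟩
  · simp [mul_dx]; ring
  · simp [mul_dxx]; ring
  · simp [mul_dE]; ring

lemma cst_mul (r : ℝ) (hF : IsAt F x E) : IsAt (fun y e => cst r * F y e) x E :=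
  (const (cst r) rfl rfl rfl).mul hF

lemma inv (hF : IsAt F x E) (h : (F x E).v0 ≠ 0) : IsAt (fun y e => (F y e)⁻¹) x E := by
  refine ⟨(hF.hdx.inv h).congr_deriv ?_,
    ((hF.hdxx.neg).mul ((hF.hdx.inv h).pow 2)).congr_deriv ?_, (hF.hdE.inv h).congr_deriv ?_⟩
  · simp [inv_dx]; field_simp
  · simp [inv_dxx]; field_simp; ring
  · simp [inv_dE]; field_simp

lemma shift (s : ℝ) (hF : IsAt F (x + s) E) : IsAt (fun y e => F (y + s) e) x E := by
  refine ⟨?_, ?_, hF.hdE⟩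
  · simpa using hF.hdx.comp_add_const x s
  · simpa using hF.hdxx.comp_add_const x s

end IsAt
end Jet

/-- 2×2 matrices of jets. -/
abbrev JM : Type := Matrix (Fin 2) (Fin 2) Jet

namespace JM
open Jet

/-- Inverse of the top-left entry. -/
def U (X : JM) : Jet := (X 0 0)⁻¹
/-- Normalized top-right entry. -/
def Be (X : JM) : Jet := X 0 1 * X.U
/-- Normalized bottom-left entry. -/
def Ga (X : JM) : Jet := X 1 0 * X.U
/-- The coupling factor of a block `C` between a left direction `γ` and a right direction `β`. -/
def gf (β : Jet) (C : JM) (γ : Jet) : Jet := C 0 0 + C 0 1 * γ + β * C 1 0 + β * γ * C 1 1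
/-- Right coupling coefficient. -/
def z2 (β : Jet) (C : JM) : Jet := C 0 1 + β * C 1 1
/-- Left coupling coefficient. -/
def w2 (C : JM) (γ : Jet) : Jet := C 1 0 + C 1 1 * γ

variable {X Y C P : JM}

lemma mul_U (h : (X 0 0).v0 ≠ 0) : X 0 0 * X.U = 1 := mul_inv_self _ h

lemma e01 (h : (X 0 0).v0 ≠ 0) : X 0 1 = X 0 0 * X.Be := by
  unfold Be; linear_combination (-X 0 1) * mul_U h

lemma e10 (h : (X 0 0).v0 ≠ 0) : X 1 0 = X 0 0 * X.Ga := by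
  unfold Ga; linear_combination (-X 1 0) * mul_U h

lemma e11 (h : (X 0 0).v0 ≠ 0) (hd : X.det = 1) :
    X 1 1 = X 0 0 * (X.Be * X.Ga + X.U ^ 2) := by
  rw [det_fin_two] at hd
  have h1 := e01 h
  have h2 := e10 h
  have h3 := mul_U h
  rw [h1, h2] at hd
  linear_combination X.U * hd + (-X 1 1 + X 0 0 * X.Be * X.Ga - X.U) * h3

lemma gf_mul_e11 (hd : C.det = 1) (β γ : Jet) :
    gf β C γ * C 1 1 - z2 β C * w2 C γ = 1 := by
  rw [det_fin_two] at hd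
  unfold gf z2 w2; linear_combination hd

section comp
variable (hX : (X 0 0).v0 ≠ 0) (hY : (Y 0 0).v0 ≠ 0)
include hX hY

lemma comp_e00 : (X * C * Y) 0 0 = X 0 0 * Y 0 0 * gf X.Be C Y.Ga := by
  simp only [Matrix.mul_apply, Fin.sum_univ_two, gf]
  rw [e01 hX, e10 hY]; ring

lemma comp_U : U (X * C * Y) = X.U * Y.U * (gf X.Be C Y.Ga)⁻¹ := by
  unfold U; rw [comp_e00 hX hY]
  ext
  · simp; ring
  all_goals
    simp [mul_dx, mul_dxx, mul_dE, inv_dx, inv_dxx, inv_dE]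
    field_simp
    try ring

lemma comp_Be (hd : Y.det = 1) (hG : (gf X.Be C Y.Ga).v0 ≠ 0) :
    Be (X * C * Y) = Y.Be + z2 X.Be C * Y.U ^ 2 * (gf X.Be C Y.Ga)⁻¹ := by
  have h1 : (X * C * Y) 0 1 = X 0 0 * Y 0 0 * (gf X.Be C Y.Ga * Y.Be + z2 X.Be C * Y.U ^ 2) := by
    simp only [Matrix.mul_apply, Fin.sum_univ_two, gf, z2]
    rw [e01 hX, e01 hY, e11 hY hd]; ring
  rw [Be, h1, comp_U hX hY]
  linear_combination (exp := 1) (gf X.Be C Y.Ga * Y.Be + z2 X.Be C * Y.U ^ 2) *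
      (gf X.Be C Y.Ga)⁻¹ * X 0 0 * X.U * mul_U hY
    + (gf X.Be C Y.Ga * Y.Be + z2 X.Be C * Y.U ^ 2) * (gf X.Be C Y.Ga)⁻¹ * mul_U hX
    + Y.Be * mul_inv_self _ hG

lemma comp_Ga (hd : X.det = 1) (hG : (gf X.Be C Y.Ga).v0 ≠ 0) :
    Ga (X * C * Y) = X.Ga + w2 C Y.Ga * X.U ^ 2 * (gf X.Be C Y.Ga)⁻¹ := by
  have h1 : (X * C * Y) 1 0 = X 0 0 * Y 0 0 * (gf X.Be C Y.Ga * X.Ga + w2 C Y.Ga * X.U ^ 2) := by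
    simp only [Matrix.mul_apply, Fin.sum_univ_two, gf, w2]
    rw [e10 hX, e10 hY, e11 hX hd]; ring
  rw [Ga, h1, comp_U hX hY]
  linear_combination (exp := 1) (gf X.Be C Y.Ga * X.Ga + w2 C Y.Ga * X.U ^ 2) *
      (gf X.Be C Y.Ga)⁻¹ * X 0 0 * X.U * mul_U hY
    + (gf X.Be C Y.Ga * X.Ga + w2 C Y.Ga * X.U ^ 2) * (gf X.Be C Y.Ga)⁻¹ * mul_U hX
    + X.Ga * mul_inv_self _ hG

end comp

lemma Ga_mul_sub (hd : X.det = 1) (h : (X 0 0).v0 ≠ 0) (h' : ((X * P) 0 0).v0 ≠ 0) :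
    Ga (X * P) - X.Ga = P 1 0 * X.U * U (X * P) := by
  have h1 := mul_U h
  have h2 := mul_U h'
  rw [det_fin_two] at hd
  have e0 : (X * P) 0 0 = X 0 0 * P 0 0 + X 0 1 * P 1 0 := by
    simp [Matrix.mul_apply, Fin.sum_univ_two]
  have e1 : (X * P) 1 0 = X 1 0 * P 0 0 + X 1 1 * P 1 0 := by
    simp [Matrix.mul_apply, Fin.sum_univ_two]
  rw [e0] at h2
  unfold Ga
  rw [e1]
  linear_combination (-(X 1 0 * P 0 0 + X 1 1 * P 1 0) * U (X * P)) * h1 + X 1 0 * X.U * h2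
    + P 1 0 * X.U * U (X * P) * hd

lemma Be_mul_sub (hd : X.det = 1) (h : (X 0 0).v0 ≠ 0) (h' : ((P * X) 0 0).v0 ≠ 0) :
    Be (P * X) - X.Be = P 0 1 * X.U * U (P * X) := by
  have h1 := mul_U h
  have h2 := mul_U h'
  rw [det_fin_two] at hd
  have e0 : (P * X) 0 0 = P 0 0 * X 0 0 + P 0 1 * X 1 0 := by
    simp [Matrix.mul_apply, Fin.sum_univ_two]
  have e1 : (P * X) 0 1 = P 0 0 * X 0 1 + P 0 1 * X 1 1 := by
    simp [Matrix.mul_apply, Fin.sum_univ_two]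
  rw [e0] at h2
  unfold Be
  rw [e1]
  linear_combination (-(P 0 0 * X 0 1 + P 0 1 * X 1 1) * U (P * X)) * h1 + X 0 1 * X.U * h2
    + P 0 1 * X.U * U (P * X) * hd

/-- Coupling factor of two blocks joined by a long hyperbolic matrix `X`. -/
lemma gf_join (hd : X.det = 1) (h : (X 0 0).v0 ≠ 0) (Ca Cb : JM) (β γ : Jet) :
    gf β (Cb * X * Ca) γ =
      X 0 0 * (gf X.Be Ca γ * gf β Cb X.Ga + X.U ^ 2 * z2 β Cb * w2 Ca γ) := by
  simp only [gf, z2, w2, Matrix.mul_apply, Fin.sum_univ_two]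
  rw [e01 h, e10 h, e11 h hd]; ring

lemma w2_join (hd : X.det = 1) (h : (X 0 0).v0 ≠ 0) (Ca Cb : JM) (γ : Jet) :
    w2 (Cb * X * Ca) γ =
      X 0 0 * (w2 Cb X.Ga * gf X.Be Ca γ + X.U ^ 2 * Cb 1 1 * w2 Ca γ) := by
  simp only [gf, w2, Matrix.mul_apply, Fin.sum_univ_two]
  rw [e01 h, e10 h, e11 h hd]; ring

end JM

/-- Standing data: a frequency, a `C²` periodic potential, a coupling, and a growth constant `b`
such that the transfer matrices have norm at most `b ^ 10` for bounded energies. -/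
structure Ctx where
  α : ℝ
  lam : ℝ
  v : ℝ → ℝ
  v1 : ℝ → ℝ
  v2 : ℝ → ℝ
  b : ℝ
  Emax : ℝ
  γ : ℝ
  T : ℕ
  hv : ∀ x, HasDerivAt v (v1 x) x
  hv1 : ∀ x, HasDerivAt v1 (v2 x) x
  per : ∀ x, v (x + 1) = v x
  per1 : ∀ x, v1 (x + 1) = v1 x
  per2 : ∀ x, v2 (x + 1) = v2 x
  hlam : 0 < lam
  hb : 1 < b
  hΛ : ∀ x E, |E| ≤ Emax →
    |lam * (E - v x)| + |lam * v1 x| + |lam * v2 x / 2| + lam + 1 ≤ b ^ 10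
  hγ : 0 < γ
  dc : ∀ p q : ℤ, q ≠ 0 → γ ≤ |q * α - p| * |(q : ℝ)| ^ T

namespace Ctx
open Jet JM

variable (c : Ctx)

/-- Jet of `lam * (E - v x)`. -/
def aJ (x E : ℝ) : Jet := ⟨c.lam * (E - c.v x), -(c.lam * c.v1 x), -(c.lam * c.v2 x / 2), c.lam⟩

/-- Jet of the transfer matrix. -/
def TJ (x E : ℝ) : JM := !![c.aJ x E, -1; 1, 0]

/-- Jet of the iterated transfer matrix. -/
def Mj (x E : ℝ) : ℕ → JM
  | 0 => 1
  | n + 1 => c.TJ (x + n * c.α) E * Mj x E n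

lemma Mj_add (x E : ℝ) (m n : ℕ) :
    c.Mj x E (m + n) = c.Mj (x + n * c.α) E m * c.Mj x E n := by
  induction m with
  | zero => simp [Mj]
  | succ m ih =>
    rw [show m + 1 + n = (m + n) + 1 by ring, Mj, Mj, ih, mul_assoc,
      show x + ((m + n : ℕ) : ℝ) * c.α = x + n * c.α + m * c.α by push_cast; ring]

lemma Mj_one (x E : ℝ) : c.Mj x E 1 = c.TJ x E := by simp [Mj]

lemma det_Mj (x E : ℝ) (n : ℕ) : (c.Mj x E n).det = 1 := by
  induction n with
  | zero => simp [Mj]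
  | succ n ih => rw [Mj, det_mul, ih, TJ, det_fin_two]; simp

lemma per_int {f : ℝ → ℝ} (h : ∀ x, f (x + 1) = f x) (x : ℝ) (m : ℤ) : f (x + m) = f x := by
  have : Function.Periodic f 1 := h
  simpa using this.int_mul m x

lemma TJ_int (x E : ℝ) (m : ℤ) : c.TJ (x + m) E = c.TJ x E := by
  simp [TJ, aJ, per_int c.per, per_int c.per1, per_int c.per2]

lemma Mj_int (x E : ℝ) (m : ℤ) (n : ℕ) : c.Mj (x + m) E n = c.Mj x E n := by
  induction n with
  | zero => rfl
  | succ n ih => rw [Mj, Mj, ih, add_right_comm, TJ_int]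

lemma isAt_aJ (x E : ℝ) : IsAt c.aJ x E := by
  refine ⟨?_, ?_, ?_⟩
  · exact (((c.hv x).const_sub E).const_mul c.lam).congr_deriv (by simp [aJ])
  · exact (((c.hv1 x).const_mul c.lam).neg).congr_deriv (by simp [aJ]; ring)
  · exact (((hasDerivAt_id E).sub_const (c.v x)).const_mul c.lam).congr_deriv (by simp [aJ])

lemma isAt_TJ (x E : ℝ) (i j : Fin 2) : IsAt (fun y e => c.TJ y e i j) x E := by
  fin_cases i <;> fin_cases j <;> simp only [TJ, Fin.zero_eta, Fin.mk_one, of_apply, cons_val',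
    cons_val_zero, cons_val_one, cons_val_fin_one, Fin.isValue]
  · exact c.isAt_aJ x E
  all_goals exact IsAt.const _ (by simp) (by simp) (by simp)

lemma isAt_Mj (x E : ℝ) (n : ℕ) (i j : Fin 2) : IsAt (fun y e => c.Mj y e n i j) x E := by
  induction n generalizing i j with
  | zero => fin_cases i <;> fin_cases j <;> exact IsAt.const _ (by simp) (by simp) (by simp)
  | succ n ih =>
    simp only [Mj, Matrix.mul_apply, Fin.sum_univ_two]
    exact (((c.isAt_TJ _ E i 0).shift _).mul (ih 0 j)).add (((c.isAt_TJ _ E i 1).shift _).mul (ih 1 j))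

lemma nrm_aJ {x E : ℝ} (hE : |E| ≤ c.Emax) : nrm (c.aJ x E) + 1 ≤ c.b ^ 10 := by
  have := c.hΛ x E hE
  simp only [nrm, aJ, abs_neg, abs_of_pos c.hlam] at *
  linarith

lemma one_le_b : 1 ≤ c.b := c.hb.le

lemma nrm_Mj {E : ℝ} (hE : |E| ≤ c.Emax) (x : ℝ) (n : ℕ) (i j : Fin 2) :
    nrm (c.Mj x E n i j) ≤ c.b ^ (10 * n) := by
  induction n generalizing i j with
  | zero => fin_cases i <;> fin_cases j <;> simp [Mj]
  | succ n ih =>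
    have h1 : 1 ≤ c.b ^ 10 := one_le_pow₀ c.one_le_b
    have hB : 0 ≤ c.b ^ (10 * n) := by have := c.hb; positivity
    have ha := c.nrm_aJ (x := x + n * c.α) hE
    rw [mul_add, mul_one, pow_add]
    have h0 := ih 0 j
    have h1' := ih 1 j
    simp only [Mj, Matrix.mul_apply, Fin.sum_univ_two]
    fin_cases i
    · simp only [TJ, Fin.zero_eta, of_apply, cons_val', cons_val_zero, cons_val_one,
        cons_val_fin_one, Fin.isValue]
      calc _ ≤ _ := nrm_add_le _ _
        _ ≤ nrm (c.aJ (x + n * c.α) E) * c.b ^ (10 * n) + 1 * c.b ^ (10 * n) :=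
          add_le_add (nrm_mul_le_of_le le_rfl h0) (nrm_mul_le_of_le (by simp) h1')
        _ ≤ _ := by nlinarith
    · simp only [TJ, Fin.mk_one, of_apply, cons_val', cons_val_zero, cons_val_one,
        cons_val_fin_one, Fin.isValue, one_mul, zero_mul, add_zero]
      nlinarith

lemma fwdIter_eq (x E : ℝ) (n : ℕ) :
    fwdIter c.α (schCocycle c.lam c.v (c.lam * E)) n x = (c.Mj x E n).map val := by
  induction n with
  | zero => simp only [fwdIter, Mj]; exact (Matrix.map_one _ (map_zero val) (map_one val)).symm
  | succ n ih =>
    rw [fwdIter, Mj, ih, Matrix.map_mul]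
    congr 1
    ext i j
    fin_cases i <;> fin_cases j <;> simp [schCocycle, TJ, aJ, mul_sub]

end Ctx

namespace Ctx
open Jet JM

/-- An orbit segment is admissible when it starts in `S`, ends in `Eo` and avoids `J`. -/
def Adm (c : Ctx) (S Eo J : Set ℝ) (k : ℕ) (x : ℝ) (n : ℕ) : Prop :=
  x ∈ S ∧ x + n * c.α ∈ Eo ∧ ∀ t : ℤ, -(k : ℤ) ≤ t → t < n → x + t * c.α ∉ J

/-- Hyperbolicity estimates for the transfer matrix over an orbit segment. -/
structure Good (c : Ctx) (ρ B : ℝ) (x E : ℝ) (n : ℕ) : Prop where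
  ne : ((c.Mj x E n) 0 0).v0 ≠ 0
  hU : nrm (U (c.Mj x E n)) ≤ ρ ^ n
  hBe : nrm (Be (c.Mj x E n)) ≤ B
  hGa : nrm (Ga (c.Mj x E n)) ≤ B

/-- Left direction carried to `y` by the preceding segment of length `l`. -/
def gaL (c : Ctx) (y E : ℝ) (l : ℕ) : Jet := Ga (c.Mj (y - l * c.α) E l)
/-- Right direction at `y` seen by the following segment of length `r`. -/
def beR (c : Ctx) (y E : ℝ) (r : ℕ) : Jet := Be (c.Mj y E r)
/-- Block of length `k + 1` at `y`. -/
def blk (c : Ctx) (y E : ℝ) (k : ℕ) : JM := c.Mj y E (k + 1)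

end Ctx

open Jet JM

/-- The inductive structure at one scale: outside the critical set `J` (two intervals around
`ctr`), products are hyperbolic; passages through `J` are governed by the functions `G`. -/
structure Core (c : Ctx) where
  W : Set ℝ
  S : Set ℝ
  Eo : Set ℝ
  ctr : Bool → ℝ
  r : ℝ
  rD : ℝ
  k : ℕ
  h : ℕ
  Ret : ℕ
  H : ℕ
  ρ : ℝ
  B : ℝ
  K : ℝ
  νb : ℝ
  νlow : ℝ
  Q : ℝ
  e : ℝ
  ν : Bool → ℝ → ℝ → Jet
  G : Bool → ℝ → ℝ → Jet
  w : Bool → ℝ → ℝ → ℝ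
  hW : ∀ E ∈ W, |E| ≤ c.Emax
  S_int : ∀ (x : ℝ) (m : ℤ), x + m ∈ S ↔ x ∈ S
  Eo_int : ∀ (x : ℝ) (m : ℤ), x + m ∈ Eo ↔ x ∈ Eo
  r_le : r ≤ rD
  ρ_pos : 0 < ρ
  ρ_le : ρ ≤ 1
  B_nonneg : 0 ≤ B
  B_le : B ≤ 2
  K_pos : 0 < K
  Q_pos : 0 < Q
  νlow_pos : 0 < νlow
  νb_pos : 0 < νb
  e_nonneg : 0 ≤ e
  good : ∀ E ∈ W, ∀ x n, c.Adm S Eo {y | ∃ j, ∃ m : ℤ, |y - m - ctr j| ≤ r} k x n →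
    c.Good ρ B x E n
  nearE : ∀ j y (m : ℤ), |y - m - ctr j| ≤ rD → y ∈ Eo
  nearS : ∀ j y (m : ℤ), |y - m - ctr j| ≤ rD → y + (k + 1) * c.α ∈ S
  ret : ∀ j j' (t m : ℤ), t ≠ 0 → |t| ≤ Ret → 2 * rD < |ctr j + t * c.α - m - ctr j'|
  hk_le : h + k ≤ Ret
  cover : ∀ x0, ∃ s < H, ∀ x, |x - x0| ≤ rD → x + s * c.α ∈ S ∧ x + s * c.α ∈ Eo
  approx : ∀ j y (m : ℤ), |y - m - ctr j| ≤ rD → ∀ E ∈ W, ∀ l ≥ h, ∀ r' ≥ h,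
    c.Adm S Eo {y | ∃ j, ∃ m : ℤ, |y - m - ctr j| ≤ r} k (y - l * c.α) l →
    c.Adm S Eo {y | ∃ j, ∃ m : ℤ, |y - m - ctr j| ≤ r} k (y + (k + 1) * c.α) r' →
    nrm (ν j (y - m) E * gf (c.beR (y + (k + 1) * c.α) E r') (c.blk y E k) (c.gaL y E l)
      - G j (y - m) E) ≤ e
  approxw : ∀ j y (m : ℤ), |y - m - ctr j| ≤ rD → ∀ E ∈ W, ∀ l ≥ h,
    c.Adm S Eo {y | ∃ j, ∃ m : ℤ, |y - m - ctr j| ≤ r} k (y - l * c.α) l →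
    |(ν j (y - m) E * w2 (c.blk y E k) (c.gaL y E l)).v0 - w j (y - m) E| ≤ e
  isG : ∀ j y, |y - ctr j| ≤ rD → ∀ E ∈ W, IsAt (G j) y E
  isν : ∀ j y, |y - ctr j| ≤ rD → ∀ E ∈ W, IsAt (ν j) y E
  ν_le : ∀ j y, |y - ctr j| ≤ rD → ∀ E ∈ W, nrm (ν j y E) ≤ νb
  ν_ge : ∀ j y, |y - ctr j| ≤ rD → ∀ E ∈ W, νlow ≤ |(ν j y E).v0|
  G_le : ∀ j y, |y - ctr j| ≤ rD → ∀ E ∈ W, nrm (G j y E) ≤ K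
  Q01 : ∀ y, ∀ E ∈ W, nrm (c.blk y E k 0 1) ≤ Q
  Q10 : ∀ y, ∀ E ∈ W, nrm (c.blk y E k 1 0) ≤ Q
  Q11 : ∀ y, ∀ E ∈ W, nrm (c.blk y E k 1 1) ≤ Q
  C11_le : ∀ j y, |y - ctr j| ≤ rD → ∀ E ∈ W,
    |(c.blk y E k 1 1).v0| ≤ K * |(ν j y E).v0|

namespace Core

variable {c : Ctx} (C : Core c)

/-- The critical set. -/
def J : Set ℝ := {y | ∃ j, ∃ m : ℤ, |y - m - C.ctr j| ≤ C.r}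

/-- Admissibility at the scale of the core. -/
def adm (x : ℝ) (n : ℕ) : Prop := c.Adm C.S C.Eo C.J C.k x n

/-- Starting set at the next scale. -/
def S1 : Set ℝ := {x | x ∈ C.S ∧ ∀ t : ℤ, -(C.k : ℤ) ≤ t → t < C.h → x + t * c.α ∉ C.J}

/-- Ending set at the next scale. -/
def E1 : Set ℝ :=
  {x | x ∈ C.Eo ∧ ∀ t : ℤ, -((C.h : ℤ) + C.k + 1) < t → t < 0 → x + t * c.α ∉ C.J}

lemma J_int (x : ℝ) (m : ℤ) : x + m ∈ C.J ↔ x ∈ C.J := by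
  constructor
  · rintro ⟨j, m', h⟩
    exact ⟨j, m' - m, by push_cast; convert h using 2; ring⟩
  · rintro ⟨j, m', h⟩
    exact ⟨j, m' + m, by push_cast; convert h using 2; ring⟩

lemma S1_int (x : ℝ) (m : ℤ) : x + m ∈ C.S1 ↔ x ∈ C.S1 := by
  simp only [S1, Set.mem_ofPred_eq, C.S_int, add_right_comm x (m : ℝ), C.J_int]

lemma E1_int (x : ℝ) (m : ℤ) : x + m ∈ C.E1 ↔ x ∈ C.E1 := by
  simp only [E1, Set.mem_ofPred_eq, C.Eo_int, add_right_comm x (m : ℝ), C.J_int]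

lemma J_separated {y : ℝ} {t : ℤ} (hy : y ∈ C.J) (ht : y + t * c.α ∈ C.J) (h0 : t ≠ 0)
    (hR : |t| ≤ C.Ret) : False := by
  obtain ⟨j, m, h1⟩ := hy
  obtain ⟨j', m', h2⟩ := ht
  have := C.ret j j' t (m' - m) h0 hR
  have hr := C.r_le
  have e : C.ctr j + t * c.α - (m' - m : ℤ) - C.ctr j' =
      (y + t * c.α - m' - C.ctr j') - (y - m - C.ctr j) := by push_cast; ring
  rw [e] at this
  have := abs_sub (y + t * c.α - m' - C.ctr j') (y - m - C.ctr j)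
  linarith

lemma mem_E1_of_mem_J {y : ℝ} (hy : y ∈ C.J) : y ∈ C.E1 := by
  obtain ⟨j, m, h⟩ := id hy
  refine ⟨C.nearE j y m (h.trans C.r_le), fun t h1 h2 ht => ?_⟩
  have := C.hk_le
  exact C.J_separated hy ht (by omega) (by rw [abs_of_neg h2]; omega)

lemma mem_S1_of_mem_J {y : ℝ} (hy : y ∈ C.J) : y + (C.k + 1) * c.α ∈ C.S1 := by
  obtain ⟨j, m, h⟩ := id hy
  refine ⟨C.nearS j y m (h.trans C.r_le), fun t h1 h2 ht => ?_⟩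
  have := C.hk_le
  refine C.J_separated (t := C.k + 1 + t) hy ?_ (by omega) (by rw [abs_of_nonneg] <;> omega)
  convert ht using 1; push_cast; ring

lemma nrm_gf_sub_le {b : ℝ} {β β' γ γ' : Jet} {M : JM} {q η : ℝ}
    (h01 : nrm (M 0 1) ≤ q) (h10 : nrm (M 1 0) ≤ q) (h11 : nrm (M 1 1) ≤ q)
    (hb : b = 2) (hβ' : nrm β' ≤ b) (hγ : nrm γ ≤ b)
    (hβ : nrm (β - β') ≤ η) (hγ' : nrm (γ - γ') ≤ η) :
    nrm (gf β M γ - gf β' M γ') ≤ 6 * q * η := by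
  subst hb
  have e : gf β M γ - gf β' M γ' =
      (β - β') * (M 1 0 + M 1 1 * γ) + (γ - γ') * (M 0 1 + β' * M 1 1) := by unfold gf; ring
  rw [e]
  have hq : 0 ≤ q := (nrm_nonneg _).trans h01
  have a1 : nrm (M 1 0 + M 1 1 * γ) ≤ q + q * 2 :=
    (nrm_add_le _ _).trans (add_le_add h10 (nrm_mul_le_of_le h11 hγ))
  have a2 : nrm (M 0 1 + β' * M 1 1) ≤ q + 2 * q :=
    (nrm_add_le _ _).trans (add_le_add h01 (nrm_mul_le_of_le hβ' h11))
  calc _ ≤ _ := nrm_add_le _ _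
    _ ≤ η * (q + q * 2) + η * (q + 2 * q) :=
      add_le_add (nrm_mul_le_of_le hβ a1) (nrm_mul_le_of_le hγ' a2)
    _ = _ := by ring

lemma nrm_z2_le {β : Jet} {M : JM} {q : ℝ} (h01 : nrm (M 0 1) ≤ q) (h11 : nrm (M 1 1) ≤ q)
    (hβ : nrm β ≤ 2) : nrm (z2 β M) ≤ 3 * q :=
  calc nrm (z2 β M) ≤ q + 2 * q :=
      (nrm_add_le _ _).trans (add_le_add h01 (nrm_mul_le_of_le hβ h11))
    _ = 3 * q := by ring

lemma nrm_w2_le {γ : Jet} {M : JM} {q : ℝ} (h10 : nrm (M 1 0) ≤ q) (h11 : nrm (M 1 1) ≤ q)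
    (hγ : nrm γ ≤ 2) : nrm (w2 M γ) ≤ 3 * q :=
  calc nrm (w2 M γ) ≤ q + q * 2 :=
      (nrm_add_le _ _).trans (add_le_add h10 (nrm_mul_le_of_le h11 hγ))
    _ = 3 * q := by ring

/-- The left direction `γ` at `y` is `η`-close to one coming from an admissible segment. -/
def NearL (y E η : ℝ) (γ : Jet) : Prop :=
  ∃ l ≥ C.h, C.adm (y - l * c.α) l ∧ nrm (γ - c.gaL y E l) ≤ η

/-- The right direction `β` at `y` is `η`-close to one coming from an admissible segment. -/
def NearR (y E η : ℝ) (β : Jet) : Prop :=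
  ∃ l ≥ C.h, C.adm y l ∧ nrm (β - c.beR y E l) ≤ η

lemma nrm_beR {y E : ℝ} {l : ℕ} (hE : E ∈ C.W) (h : C.adm y l) : nrm (c.beR y E l) ≤ 2 :=
  ((C.good E hE y l h).hBe).trans C.B_le

lemma approx_near {j : Bool} {y : ℝ} {m : ℤ} (hy : |y - m - C.ctr j| ≤ C.rD) {E η : ℝ}
    (hE : E ∈ C.W) {β γ : Jet} (hγ : C.NearL y E η γ) (hβ : C.NearR (y + (C.k + 1) * c.α) E η β)
    (hγ2 : nrm γ ≤ 2) :
    nrm (C.ν j (y - m) E * gf β (c.blk y E C.k) γ - C.G j (y - m) E) ≤ C.e + 6 * C.Q * C.νb * η := by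
  obtain ⟨l, hl, hla, hlη⟩ := hγ
  obtain ⟨r', hr, hra, hrη⟩ := hβ
  have h1 := C.approx j y m hy E hE l hl r' hr hla hra
  have h2 := nrm_gf_sub_le (C.Q01 y E hE) (C.Q10 y E hE) (C.Q11 y E hE) rfl
    (C.nrm_beR hE hra) hγ2 hrη hlη
  have h3 := nrm_mul_le_of_le (C.ν_le j (y - m) hy E hE) h2
  rw [mul_sub] at h3
  have := nrm_sub_le_add _ _ _ |>.trans (add_le_add h3 h1)
  linarith

lemma approxw_near {j : Bool} {y : ℝ} {m : ℤ} (hy : |y - m - C.ctr j| ≤ C.rD) {E η : ℝ}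
    (hE : E ∈ C.W) {γ : Jet} (hγ : C.NearL y E η γ) :
    |(C.ν j (y - m) E * w2 (c.blk y E C.k) γ).v0 - C.w j (y - m) E|
      ≤ C.e + 6 * C.Q * C.νb * η := by
  obtain ⟨l, hl, hla, hlη⟩ := hγ
  have h1 := C.approxw j y m hy E hE l hl hla
  have h2 : nrm (w2 (c.blk y E C.k) γ - w2 (c.blk y E C.k) (c.gaL y E l)) ≤ C.Q * η := by
    have : w2 (c.blk y E C.k) γ - w2 (c.blk y E C.k) (c.gaL y E l) =
      c.blk y E C.k 1 1 * (γ - c.gaL y E l) := by unfold w2; ring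
    rw [this]; exact nrm_mul_le_of_le (C.Q11 y E hE) hlη
  have h3 := (abs_v0_le _).trans (nrm_mul_le_of_le (C.ν_le j (y - m) hy E hE) h2)
  rw [mul_sub, sub_v0] at h3
  have := (abs_sub_le _ _ _).trans (add_le_add h3 h1)
  have h5 : 0 ≤ C.Q * C.νb * η :=
    mul_nonneg (mul_nonneg C.Q_pos.le C.νb_pos.le) ((nrm_nonneg _).trans hlη)
  linarith

/-- Numerical requirements for passing through visits with `|G| ≥ δ`. -/
structure StepNum (δ ρ' B' η : ℝ) : Prop where
  δ_pos : 0 < δ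
  δ_le : δ ≤ C.K
  η_ge : 3 * C.Q * C.ρ ^ (2 * C.h) * (96 * C.νb * C.K ^ 2 / δ ^ 3) ≤ η
  e_le : C.e + 6 * C.Q * C.νb * η ≤ δ / 4
  rate : ∀ l ≥ C.h, C.ρ ^ l * (96 * C.νb * C.K ^ 2 / δ ^ 3) ≤ ρ' ^ (l + C.k + 1)
  B_le : C.B + η ≤ B'
  B'_le : B' ≤ 2
  ρ_le : C.ρ ≤ ρ'

variable {δ ρ' B' η : ℝ}

lemma StepNum.η_nonneg (hN : C.StepNum δ ρ' B' η) : 0 ≤ η := by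
  refine le_trans ?_ hN.η_ge
  have := C.Q_pos; have := C.ρ_pos; have := C.νb_pos; have := hN.δ_pos
  positivity

/-- A visit with `|G| ≥ δ` has a controlled coupling factor. -/
lemma visit (hN : C.StepNum δ ρ' B' η) {j : Bool} {y : ℝ} {m : ℤ}
    (hy : |y - m - C.ctr j| ≤ C.rD) {E : ℝ}
    (hE : E ∈ C.W) {β γ : Jet} (hγ : C.NearL y E η γ) (hβ : C.NearR (y + (C.k + 1) * c.α) E η β)
    (hγ2 : nrm γ ≤ 2) (hG : δ ≤ |(C.G j (y - m) E).v0|) :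
    (gf β (c.blk y E C.k) γ).v0 ≠ 0 ∧
      nrm (gf β (c.blk y E C.k) γ)⁻¹ ≤ 96 * C.νb * C.K ^ 2 / δ ^ 3 := by
  have h1 := (C.approx_near hy hE hγ hβ hγ2).trans hN.e_le
  set g := gf β (c.blk y E C.k) γ
  set n := C.ν j (y - m) E
  have hδ := hN.δ_pos
  have hδK := hN.δ_le
  have h2 : δ / 2 ≤ |(n * g).v0| := by
    have := (abs_v0_le _).trans h1
    rw [sub_v0] at this
    have h4 := abs_sub_abs_le_abs_sub (C.G j (y - m) E).v0 (n * g).v0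
    rw [abs_sub_comm] at h4
    linarith
  have h3 : nrm (n * g) ≤ 2 * C.K := by
    have := nrm_le_add (n * g) (C.G j (y - m) E)
    have := C.G_le j (y - m) hy E hE
    linarith
  have h0 : (n * g).v0 ≠ 0 := by
    intro h; rw [h, abs_zero] at h2; linarith
  have hg0 : g.v0 ≠ 0 := right_ne_zero_of_mul h0
  refine ⟨hg0, ?_⟩
  have h4 : n * (n * g)⁻¹ = g⁻¹ :=
    eq_inv_of_mul_eq_one (by rw [← mul_inv_self _ h0]; ring)
  rw [← h4]
  calc _ ≤ C.νb * (3 * (2 * C.K) ^ 2 / (δ / 2) ^ 3) :=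
      nrm_mul_le_of_le (C.ν_le j (y - m) hy E hE) (nrm_inv_le (by positivity) h2 h3)
    _ = _ := by field_simp; ring

/-- `Jh` contains all points of `J` with `|G| < δ`. -/
def Catches (E δ : ℝ) (Jh : Set ℝ) : Prop :=
  ∀ j y (m : ℤ), |y - m - C.ctr j| ≤ C.r → |(C.G j (y - m) E).v0| < δ → y ∈ Jh

/-- New-scale admissible segments: hyperbolic, with end directions close to old ones. -/
structure Step (ρ' B' η E x : ℝ) (n : ℕ) : Prop where
  good : c.Good ρ' B' x E n
  nearL : ∃ t ≤ n, (t = n ∨ C.h ≤ t) ∧ C.adm (x + n * c.α - t * c.α) t ∧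
    nrm (Ga (c.Mj x E n) - c.gaL (x + n * c.α) E t) ≤ η
  nearR : ∃ t ≤ n, (t = n ∨ C.h ≤ t) ∧ C.adm x t ∧ nrm (Be (c.Mj x E n) - c.beR x E t) ≤ η

variable {C} in
lemma Step.toNearL {E x : ℝ} {n : ℕ} (hS : C.Step ρ' B' η E x n) (hn : C.h ≤ n) :
    C.NearL (x + n * c.α) E η (Ga (c.Mj x E n)) := by
  obtain ⟨t, -, ht, h1, h2⟩ := hS.nearL
  exact ⟨t, by rcases ht with rfl | ht <;> assumption, h1, h2⟩

variable {C} in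
lemma Step.toNearR {E x : ℝ} {n : ℕ} (hS : C.Step ρ' B' η E x n) (hn : C.h ≤ n) :
    C.NearR x E η (Be (c.Mj x E n)) := by
  obtain ⟨t, -, ht, h1, h2⟩ := hS.nearR
  exact ⟨t, by rcases ht with rfl | ht <;> assumption, h1, h2⟩

theorem step (hN : C.StepNum δ ρ' B' η) {E : ℝ} (hE : E ∈ C.W) {Jh : Set ℝ}
    (hJ : C.Catches E δ Jh) (n : ℕ) :
    ∀ x, c.Adm C.S1 C.E1 Jh C.k x n → C.Step ρ' B' η E x n := by
  have hη := hN.η_nonneg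
  have hρ' : 0 < ρ' := C.ρ_pos.trans_le hN.ρ_le
  have hg0 : 0 ≤ 96 * C.νb * C.K ^ 2 / δ ^ 3 := by
    have := C.νb_pos; have := hN.δ_pos; positivity
  have hsmall : ∀ l ≥ C.h, ∀ M, nrm M ≤ 3 * C.Q → ∀ u, nrm u ≤ C.ρ ^ l → ∀ g,
      nrm g ≤ 96 * C.νb * C.K ^ 2 / δ ^ 3 → nrm (M * u ^ 2 * g) ≤ η := by
    intro l hl M hM u hu g hg
    have h1 : nrm (u ^ 2) ≤ C.ρ ^ (2 * C.h) := by
      have hu' : nrm u ≤ C.ρ ^ C.h := hu.trans (pow_le_pow_of_le_one C.ρ_pos.le C.ρ_le hl)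
      rw [pow_two, two_mul, pow_add]; exact nrm_mul_le_of_le hu' hu'
    exact (nrm_mul_le_of_le (nrm_mul_le_of_le hM h1) hg).trans hN.η_ge
  induction n using Nat.strong_induction_on with
  | _ n ih =>
  intro x ⟨hx, hxn, hav⟩
  by_cases hv : ∃ t : ℕ, t < n ∧ x + t * c.α ∈ C.J
  swap
  · push Not at hv
    have ha : C.adm x n := by
      refine ⟨hx.1, hxn.1, fun t h1 h2 => ?_⟩
      by_cases h3 : t < C.h
      · exact hx.2 t h1 h3
      · obtain ⟨s, rfl⟩ := Int.eq_ofNat_of_zero_le (show 0 ≤ t by omega)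
        simpa using hv s (by exact_mod_cast h2)
    have hg := C.good E hE x n ha
    have hB : C.B ≤ B' := by linarith [hN.B_le]
    refine ⟨⟨hg.ne, hg.hU.trans (pow_le_pow_left₀ C.ρ_pos.le hN.ρ_le n), hg.hBe.trans hB,
      hg.hGa.trans hB⟩, ⟨n, le_rfl, Or.inl rfl, by simpa using ha, ?_⟩,
      ⟨n, le_rfl, Or.inl rfl, ha, ?_⟩⟩
    · simpa [Ctx.gaL] using hη
    · simpa [Ctx.beR] using hη
  -- decomposition at an arbitrary visit
  have key : ∀ l : ℕ, l < n → x + l * c.α ∈ C.J → ∃ r' : ℕ, n = r' + (C.k + 1) + l ∧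
      C.h ≤ l ∧ C.h ≤ r' ∧ c.Adm C.S1 C.E1 Jh C.k x l ∧
      c.Adm C.S1 C.E1 Jh C.k (x + l * c.α + (C.k + 1) * c.α) r' ∧
      c.Mj x E n = c.Mj (x + l * c.α + (C.k + 1) * c.α) E r' * c.blk (x + l * c.α) E C.k
        * c.Mj x E l ∧
      ∃ j, ∃ m : ℤ, |x + l * c.α - m - C.ctr j| ≤ C.r ∧
        δ ≤ |(C.G j (x + l * c.α - m) E).v0| := by
    intro l hl hlJ
    have h1 : C.h ≤ l := by
      by_contra h
      exact hx.2 l (by omega) (by omega) (by simpa using hlJ)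
    have h2 : C.h + C.k + 1 + l ≤ n := by
      by_contra h
      refine hxn.2 ((l : ℤ) - n) (by omega) (by omega) ?_
      convert hlJ using 1; push_cast; ring
    obtain ⟨d, hd⟩ := Nat.exists_eq_add_of_le h2
    have hn : n = C.h + d + (C.k + 1) + l := by omega
    refine ⟨C.h + d, hn, h1, by omega, ⟨hx, C.mem_E1_of_mem_J hlJ, fun t h1 h2 =>
      hav t h1 (by omega)⟩, ⟨C.mem_S1_of_mem_J hlJ, ?_, fun t h3 h4 => ?_⟩, ?_, ?_⟩
    · convert hxn using 1; rw [hn]; push_cast; ring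
    · have := hav (l + (C.k + 1) + t) (by omega) (by omega)
      convert this using 2; push_cast; ring
    · rw [hn, Ctx.blk, mul_assoc]
      have e : x + ((C.k + 1 + l : ℕ) : ℝ) * c.α = x + l * c.α + (C.k + 1) * c.α := by
        push_cast; ring
      rw [show C.h + d + (C.k + 1) + l = C.h + d + (C.k + 1 + l) by ring, c.Mj_add x E (C.h + d),
        c.Mj_add x E (C.k + 1) l, e]
    · obtain ⟨j, m, hjm⟩ := hlJ
      refine ⟨j, m, hjm, ?_⟩
      by_contra hlt
      push Not at hlt
      exact hav l (by omega) (by omega) (by simpa using hJ j _ m hjm hlt)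
  classical
  -- first visit
  obtain ⟨hlt, hlJ⟩ := Nat.find_spec hv
  have hmin : ∀ t, t < Nat.find hv → x + t * c.α ∉ C.J := fun t ht htJ =>
    Nat.find_min hv ht ⟨ht.trans hlt, htJ⟩
  set l := Nat.find hv with hl
  obtain ⟨r', hn, hlh, hr', -, hR, hM, j, m, hjm, hGδ⟩ := key l hlt hlJ
  have hLa : c.Adm C.S C.Eo C.J C.k x l := by
    refine ⟨hx.1, (C.mem_E1_of_mem_J hlJ).1, fun t h1 h2 => ?_⟩
    by_cases h3 : t < C.h
    · exact hx.2 t h1 h3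
    · obtain ⟨s, rfl⟩ := Int.eq_ofNat_of_zero_le (show 0 ≤ t by omega)
      simpa using hmin s (by exact_mod_cast h2)
  have hLg := C.good E hE x l hLa
  have hRs := ih r' (by omega) _ hR
  have hLn : C.NearL (x + l * c.α) E η (Ga (c.Mj x E l)) :=
    ⟨l, hlh, by simpa using (show C.adm x l from hLa), by simpa [Ctx.gaL] using hη⟩
  have hV := C.visit hN (hjm.trans C.r_le) hE hLn (hRs.toNearR hr') (hLg.hGa.trans C.B_le) hGδ
  have h00 : ((c.Mj x E n) 0 0).v0 ≠ 0 := by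
    rw [hM, comp_e00 hRs.good.ne hLg.ne]
    exact mul_ne_zero (mul_ne_zero hRs.good.ne hLg.ne) hV.1
  have hU : nrm (U (c.Mj x E n)) ≤ ρ' ^ n := by
    rw [hM, comp_U hRs.good.ne hLg.ne]
    calc _ ≤ ρ' ^ r' * C.ρ ^ l * (96 * C.νb * C.K ^ 2 / δ ^ 3) :=
          nrm_mul_le_of_le (nrm_mul_le_of_le hRs.good.hU hLg.hU) hV.2
      _ = ρ' ^ r' * (C.ρ ^ l * (96 * C.νb * C.K ^ 2 / δ ^ 3)) := by ring
      _ ≤ ρ' ^ r' * ρ' ^ (l + C.k + 1) := by gcongr; exact hN.rate l hlh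
      _ = ρ' ^ n := by rw [← pow_add, hn]; congr 1; ring
  have hBe : nrm (Be (c.Mj x E n) - Be (c.Mj x E l)) ≤ η := by
    rw [hM, comp_Be hRs.good.ne hLg.ne (c.det_Mj _ _ _) hV.1, add_sub_cancel_left]
    exact hsmall l hlh _ (nrm_z2_le (C.Q01 _ E hE) (C.Q11 _ E hE) (hRs.good.hBe.trans hN.B'_le))
      _ hLg.hU _ hV.2
  -- last visit
  obtain ⟨p, hpP, hpmax⟩ : ∃ p : ℕ, (p < n ∧ x + p * c.α ∈ C.J) ∧
      ∀ q : ℕ, q < n → x + q * c.α ∈ C.J → q ≤ p := by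
    have hb : BddAbove {t : ℕ | t < n ∧ x + t * c.α ∈ C.J} := ⟨n, fun t ht => ht.1.le⟩
    exact ⟨_, Nat.sSup_mem (s := {t : ℕ | t < n ∧ x + t * c.α ∈ C.J}) hv hb,
      fun q h1 h2 => le_csSup hb ⟨h1, h2⟩⟩
  obtain ⟨q, hn2, hph, hq, hL2, hR2, hM2, j2, m2, hjm2, hGδ2⟩ := key p hpP.1 hpP.2
  have hRa : c.Adm C.S C.Eo C.J C.k (x + p * c.α + (C.k + 1) * c.α) q := by
    refine ⟨hR2.1.1, hR2.2.1.1, fun t h1 h2 => ?_⟩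
    by_cases h3 : t < C.h
    · exact hR2.1.2 t h1 h3
    · obtain ⟨s, rfl⟩ := Int.eq_ofNat_of_zero_le (show 0 ≤ t by omega)
      intro hs
      have := hpmax (p + (C.k + 1) + s) (by omega) (by convert hs using 1; push_cast; ring)
      omega
  have hRg := C.good E hE _ q hRa
  have hLs := ih p hpP.1 _ hL2
  have hRn : C.NearR (x + p * c.α + (C.k + 1) * c.α) E η
      (Be (c.Mj (x + p * c.α + (C.k + 1) * c.α) E q)) :=
    ⟨q, hq, hRa, by simpa [Ctx.beR] using hη⟩
  have hV2 := C.visit hN (hjm2.trans C.r_le) hE (hLs.toNearL hph) hRn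
    (hLs.good.hGa.trans hN.B'_le) hGδ2
  have hGa : nrm (Ga (c.Mj x E n) - Ga (c.Mj (x + p * c.α + (C.k + 1) * c.α) E q)) ≤ η := by
    rw [hM2, comp_Ga hRg.ne hLs.good.ne (c.det_Mj _ _ _) hV2.1, add_sub_cancel_left]
    exact hsmall q hq _ (nrm_w2_le (C.Q10 _ E hE) (C.Q11 _ E hE) (hLs.good.hGa.trans hN.B'_le))
      _ hRg.hU _ hV2.2
  have e2 : x + n * c.α - q * c.α = x + p * c.α + (C.k + 1) * c.α := by
    rw [hn2]; push_cast; ring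
  refine ⟨⟨h00, hU, ?_, ?_⟩, ⟨q, by omega, Or.inr hq, by rw [e2]; exact hRa, ?_⟩,
    ⟨l, hlt.le, Or.inr hlh, hLa, hBe⟩⟩
  · have := nrm_le_add (Be (c.Mj x E n)) (Be (c.Mj x E l))
    have := hLg.hBe; have := hN.B_le
    linarith
  · have := nrm_le_add (Ga (c.Mj x E n)) (Ga (c.Mj (x + p * c.α + (C.k + 1) * c.α) E q))
    have := hRg.hGa; have := hN.B_le
    linarith
  · rw [Ctx.gaL, e2]; exact hGa

end Core

/-- Planar cross product. -/
def cross (a b : Fin 2 → ℝ) : ℝ := a 0 * b 1 - a 1 * b 0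

/-- Sum of squares of the entries. -/
def hs (M : M2) : ℝ := M 0 0 ^ 2 + M 0 1 ^ 2 + M 1 0 ^ 2 + M 1 1 ^ 2

lemma vnorm_eq (w : Fin 2 → ℝ) : vnorm w = √(w 0 ^ 2 + w 1 ^ 2) := by
  simp [vnorm, EuclideanSpace.norm_eq, Fin.sum_univ_two]

lemma vnorm_sq (w : Fin 2 → ℝ) : vnorm w ^ 2 = w 0 ^ 2 + w 1 ^ 2 := by
  rw [vnorm_eq, Real.sq_sqrt (by positivity)]

lemma vnorm_nonneg (w : Fin 2 → ℝ) : 0 ≤ vnorm w := norm_nonneg _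

lemma vnorm_add_le (a b : Fin 2 → ℝ) : vnorm (a + b) ≤ vnorm a + vnorm b := by
  simpa [vnorm] using norm_add_le (WithLp.toLp 2 a) (WithLp.toLp 2 b)

lemma vnorm_smul (r : ℝ) (a : Fin 2 → ℝ) : vnorm (r • a) = |r| * vnorm a := by
  simpa [vnorm] using norm_smul r (WithLp.toLp 2 a)

lemma abs_cross_le (a b : Fin 2 → ℝ) : |cross a b| ≤ vnorm a * vnorm b := by
  apply abs_le_of_sq_le_sq _ (mul_nonneg (vnorm_nonneg _) (vnorm_nonneg _))
  rw [mul_pow, vnorm_sq, vnorm_sq, cross]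
  nlinarith [sq_nonneg (a 0 * b 0 + a 1 * b 1)]

lemma abs_dot_le (a b : Fin 2 → ℝ) : |a 0 * b 0 + a 1 * b 1| ≤ vnorm a * vnorm b := by
  apply abs_le_of_sq_le_sq _ (mul_nonneg (vnorm_nonneg _) (vnorm_nonneg _))
  rw [mul_pow, vnorm_sq, vnorm_sq]
  nlinarith [sq_nonneg (a 0 * b 1 - a 1 * b 0)]

lemma abs_cross_le_add {a b d : Fin 2 → ℝ} (ha : vnorm a = 1) (hb : vnorm b = 1)
    (hd : vnorm d = 1) : |cross a d| ≤ |cross a b| + |cross b d| := by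
  have hb2 := vnorm_sq b
  have h1 := abs_dot_le b d
  have h2 := abs_dot_le a b
  rw [hb, hd, one_mul] at h1
  rw [ha, hb, one_mul] at h2
  have e : cross a d = cross a b * (b 0 * d 0 + b 1 * d 1) + cross b d * (a 0 * b 0 + a 1 * b 1) := by
    rw [hb] at hb2
    unfold cross
    linear_combination (a 0 * d 1 - a 1 * d 0) * hb2
  rw [e]
  refine (abs_add_le _ _).trans ?_
  rw [abs_mul, abs_mul]
  exact add_le_add (mul_le_of_le_one_right (abs_nonneg _) h1)
    (mul_le_of_le_one_right (abs_nonneg _) h2)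

lemma mulVec0 (M : M2) (w : Fin 2 → ℝ) : (M *ᵥ w) 0 = M 0 0 * w 0 + M 0 1 * w 1 := by
  simp [Matrix.mulVec, dotProduct, Fin.sum_univ_two]

lemma mulVec1 (M : M2) (w : Fin 2 → ℝ) : (M *ᵥ w) 1 = M 1 0 * w 0 + M 1 1 * w 1 := by
  simp [Matrix.mulVec, dotProduct, Fin.sum_univ_two]

lemma hs_nonneg (M : M2) : 0 ≤ hs M := by unfold hs; positivity

lemma vnorm_mulVec_sq_le (M : M2) (w : Fin 2 → ℝ) : vnorm (M *ᵥ w) ^ 2 ≤ hs M * vnorm w ^ 2 := by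
  rw [vnorm_sq, vnorm_sq, mulVec0, mulVec1, hs]
  nlinarith [sq_nonneg (M 0 0 * w 1 - M 0 1 * w 0), sq_nonneg (M 1 0 * w 1 - M 1 1 * w 0)]

lemma vnorm_mulVec_le {M : M2} {L : ℝ} (hL : 0 ≤ L) (h : hs M ≤ L ^ 2) (w : Fin 2 → ℝ) :
    vnorm (M *ᵥ w) ≤ L * vnorm w := by
  apply le_of_sq_le_sq _ (mul_nonneg hL (vnorm_nonneg _))
  rw [mul_pow]
  exact (vnorm_mulVec_sq_le M w).trans (mul_le_mul_of_nonneg_right h (sq_nonneg _))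

lemma cross_mulVec {M : M2} (hM : M.det = 1) (a b : Fin 2 → ℝ) :
    cross (M *ᵥ a) (M *ᵥ b) = cross a b := by
  rw [det_fin_two] at hM
  simp only [cross, mulVec0, mulVec1]
  linear_combination (a 0 * b 1 - a 1 * b 0) * hM

lemma hs_mul_le (A B : M2) : hs (A * B) ≤ hs A * hs B := by
  simp only [hs, Matrix.mul_apply, Fin.sum_univ_two]
  nlinarith [sq_nonneg (A 0 0 * B 1 0 - A 0 1 * B 0 0), sq_nonneg (A 0 0 * B 1 1 - A 0 1 * B 0 1),
    sq_nonneg (A 1 0 * B 1 0 - A 1 1 * B 0 0), sq_nonneg (A 1 0 * B 1 1 - A 1 1 * B 0 1)]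

lemma inv_eq_of_det {M : M2} (hM : M.det = 1) : M⁻¹ = !![M 1 1, -M 0 1; -M 1 0, M 0 0] := by
  rw [Matrix.inv_def, hM]; simp [Matrix.adjugate_fin_two]

lemma hs_inv {M : M2} (hM : M.det = 1) : hs M⁻¹ = hs M := by
  rw [inv_eq_of_det hM]; simp [hs]; ring

lemma det_inv_eq {M : M2} (hM : M.det = 1) : M⁻¹.det = 1 := by
  rw [Matrix.det_nonsing_inv, hM]; simp

/-- A direction strongly contracted by a large unimodular matrix. -/
lemma exists_contracted {M : M2} (hM : M.det = 1) (hpos : 0 < hs M) :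
    ∃ w, vnorm w = 1 ∧ vnorm (M *ᵥ w) ^ 2 ≤ 2 / hs M := by
  obtain ⟨i, hi⟩ : ∃ i, hs M / 2 ≤ M i 0 ^ 2 + M i 1 ^ 2 := by
    by_contra! h
    have h0 := h 0
    have h1 := h 1
    unfold hs at h0 h1
    linarith
  set R := M i 0 ^ 2 + M i 1 ^ 2 with hR
  have hRp : 0 < R := by linarith
  obtain ⟨s, hsp, hs2⟩ : ∃ s > 0, s ^ 2 = R := ⟨√R, Real.sqrt_pos.mpr hRp, Real.sq_sqrt hRp.le⟩
  rw [det_fin_two] at hM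
  refine ⟨![-M i 1 / s, M i 0 / s], ?_, ?_⟩
  · rw [← abs_of_nonneg (vnorm_nonneg _), ← sq_eq_sq₀ (abs_nonneg _) zero_le_one, sq_abs, vnorm_sq]
    simp only [cons_val_zero, cons_val_one, div_pow, hs2, neg_sq]
    field_simp; rw [hR]; ring
  · have : vnorm (M *ᵥ ![-M i 1 / s, M i 0 / s]) ^ 2 = 1 / R := by
      rw [vnorm_sq, mulVec0, mulVec1]
      have : (M 0 0 * (-M i 1 / s) + M 0 1 * (M i 0 / s)) ^ 2 +
          (M 1 0 * (-M i 1 / s) + M 1 1 * (M i 0 / s)) ^ 2 =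
          ((M 0 1 * M i 0 - M 0 0 * M i 1) ^ 2 + (M 1 1 * M i 0 - M 1 0 * M i 1) ^ 2) / R := by
        rw [← hs2]; field_simp; ring
      simp only [cons_val_zero, cons_val_one, Fin.isValue, cons_val_fin_one]
      rw [this]
      congr 1
      fin_cases i <;> simp only [Fin.zero_eta, Fin.mk_one, Fin.isValue]
      · linear_combination (M 1 1 * M 0 0 - M 1 0 * M 0 1 + 1) * hM
      · linear_combination (M 1 1 * M 0 0 - M 1 0 * M 0 1 + 1) * hM
    rw [this, div_le_div_iff₀ hRp hpos]
    linarith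

/-- A product of unimodular matrices with steps bounded by `L` and growth faster than `√L`
has a direction contracted at all times. -/
theorem exists_stable {L c g q : ℝ} (hL : 1 ≤ L) (hc : 0 < c) (hg : 1 < g)
    (hq : g⁻¹ ≤ q) (hq' : L / g ^ 2 ≤ q) : ∃ D > 0, ∀ P : ℕ → M2, (∀ n, (P n).det = 1) →
    (∀ n w, vnorm (P n *ᵥ w) ≤ L * vnorm (P (n + 1) *ᵥ w)) →
    (∀ n, hs (P n) ≤ 2 * (L ^ n) ^ 2) → (∀ n, c * (g ^ n) ^ 2 ≤ hs (P n)) →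
    ∃ w, vnorm w = 1 ∧ ∀ n, vnorm (P n *ᵥ w) ≤ D * q ^ n := by
  have hg0 : 0 < g := by linarith
  have hq0 : 0 < q := (inv_pos.mpr hg0).trans_le hq
  set D := √(2 / c)
  have hD2 : D ^ 2 = 2 / c := Real.sq_sqrt (by positivity)
  have hD : 0 < D := Real.sqrt_pos.mpr (by positivity)
  set p := (g ^ 2)⁻¹ with hp
  have hp0 : 0 < p := by positivity
  have hp1 : p < 1 := inv_lt_one_of_one_lt₀ (one_lt_pow₀ hg two_ne_zero)
  set F := D ^ 2 * L / (1 - p)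
  have h1p : 0 < 1 - p := by linarith
  have hF : 0 < F := by positivity
  refine ⟨D + 2 * F, by positivity, fun P hdet hstep hup hlow => ?_⟩
  have hpos : ∀ n, 0 < hs (P n) := fun n => lt_of_lt_of_le (by positivity) (hlow n)
  choose w hw1 hw2 using fun n => exists_contracted (hdet n) (hpos n)
  have hwn : ∀ n, vnorm (P n *ᵥ w n) ≤ D * (g⁻¹) ^ n := by
    intro n
    apply le_of_sq_le_sq _ (by positivity)
    refine (hw2 n).trans ?_
    rw [mul_pow, hD2, div_le_iff₀ (hpos n)]
    calc (2 : ℝ) = 2 / c * (g⁻¹ ^ n) ^ 2 * (c * (g ^ n) ^ 2) := by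
          rw [inv_pow]; field_simp
      _ ≤ _ := by gcongr; exact hlow n
  have hcr : ∀ n, |cross (w n) (w (n + 1))| ≤ D ^ 2 * L * p ^ n := by
    intro n
    rw [← cross_mulVec (hdet n)]
    have h1 : vnorm (P n *ᵥ w (n + 1)) ≤ L * (D * (g⁻¹) ^ n) := by
      refine (hstep n _).trans ?_
      gcongr
      refine (hwn (n + 1)).trans ?_
      gcongr _ * ?_
      exact pow_le_pow_of_le_one (by positivity) (inv_le_one_of_one_le₀ hg.le) (Nat.le_succ n)
    calc _ ≤ _ := abs_cross_le _ _
      _ ≤ (D * (g⁻¹) ^ n) * (L * (D * (g⁻¹) ^ n)) :=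
        mul_le_mul (hwn n) h1 (vnorm_nonneg _) (by positivity)
      _ = D ^ 2 * L * p ^ n := by
        rw [hp, ← inv_pow, ← pow_mul, mul_comm 2 n, pow_mul]; ring
  have hcr2 : ∀ n k, |cross (w n) (w (n + k))| ≤ F * (p ^ n - p ^ (n + k)) := by
    intro n k
    induction k with
    | zero => simp [cross]; linarith [mul_comm (w n 0) (w n 1)]
    | succ k ih =>
      have h1 := abs_cross_le_add (hw1 n) (hw1 (n + k)) (hw1 (n + k + 1))
      have h2 := hcr (n + k)
      have e : D ^ 2 * L * p ^ (n + k) = F * (p ^ (n + k) - p ^ (n + k + 1)) := by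
        simp only [F]; rw [pow_succ p (n + k)]; field_simp
      rw [← add_assoc]
      linarith
  have hall : ∀ n k, vnorm (P n *ᵥ w (n + k)) ≤ (D + 2 * F) * q ^ n := by
    intro n k
    set a := w n
    set d := w (n + k)
    have ha := vnorm_sq a
    rw [hw1 n, one_pow] at ha
    have e : d = (a 0 * d 0 + a 1 * d 1) • a + cross a d • ![-a 1, a 0] := by
      ext i
      fin_cases i <;> simp [cross] <;> linear_combination (d _) * ha
    have hdot := abs_dot_le a d
    rw [hw1, hw1, one_mul] at hdot
    have hperp : vnorm (P n *ᵥ ![-a 1, a 0]) ≤ 2 * L ^ n := by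
      have h1 : hs (P n) ≤ (2 * L ^ n) ^ 2 := (hup n).trans (by nlinarith [sq_nonneg (L ^ n)])
      refine (vnorm_mulVec_le (by positivity) h1 _).trans_eq ?_
      rw [vnorm_eq]
      simp only [cons_val_zero, cons_val_one, neg_sq, cons_val_fin_one, Fin.isValue]
      rw [add_comm (a 1 ^ 2), ← ha, Real.sqrt_one, mul_one]
    rw [e, mulVec_add, mulVec_smul, mulVec_smul]
    refine (vnorm_add_le _ _).trans ?_
    rw [vnorm_smul, vnorm_smul]
    have h3 : |cross a d| ≤ F * p ^ n := (hcr2 n k).trans (by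
      gcongr; linarith [pow_pos hp0 (n + k)])
    calc _ ≤ 1 * (D * (g⁻¹) ^ n) + F * p ^ n * (2 * L ^ n) := by
          gcongr <;> first | exact vnorm_nonneg _ | exact hwn n
      _ = D * (g⁻¹) ^ n + 2 * F * (L / g ^ 2) ^ n := by
          rw [div_eq_mul_inv, mul_pow, ← hp]; ring
      _ ≤ D * q ^ n + 2 * F * q ^ n := by gcongr
      _ = _ := by ring
  have hcpt : IsCompact {w : Fin 2 → ℝ | vnorm w = 1} := by
    have hcont : Continuous vnorm := by
      have : vnorm = fun w => √(w 0 ^ 2 + w 1 ^ 2) := funext vnorm_eq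
      rw [this]; fun_prop
    refine (isCompact_Icc (a := fun _ : Fin 2 => (-1 : ℝ)) (b := fun _ => 1)).of_isClosed_subset
      (isClosed_eq hcont continuous_const) ?_
    intro w hw
    have h := vnorm_sq w
    rw [Set.mem_ofPred_eq] at hw
    rw [hw] at h
    constructor <;> intro i <;> fin_cases i <;> simp <;> nlinarith [sq_nonneg (w 0), sq_nonneg (w 1)]
  obtain ⟨z, hz, φ, hφ, hlim⟩ := hcpt.tendsto_subseq hw1
  refine ⟨z, hz, fun n => ?_⟩
  have hcont : Continuous fun w => vnorm (P n *ᵥ w) := by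
    have : (fun w => vnorm (P n *ᵥ w)) = fun w => √((P n *ᵥ w) 0 ^ 2 + (P n *ᵥ w) 1 ^ 2) :=
      funext fun w => vnorm_eq _
    rw [this]; simp only [mulVec0, mulVec1]; fun_prop
  refine le_of_tendsto ((hcont.tendsto z).comp hlim) ?_
  filter_upwards [Filter.eventually_ge_atTop n] with m hm
  obtain ⟨k, hk⟩ := Nat.exists_eq_add_of_le (hm.trans (hφ.id_le m))
  simp only [Function.comp, hk]
  exact hall n k

lemma fwdIter_succ' (β : ℝ) (B : ℝ → M2) (n : ℕ) (x : ℝ) :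
    fwdIter β B (n + 1) x = fwdIter β B n (x + β) * B x := by
  induction n with
  | zero => simp [fwdIter]
  | succ n ih =>
    rw [fwdIter, ih, fwdIter, mul_assoc]
    congr 2; push_cast; ring

section criterion

variable {β : ℝ} {B : ℝ → M2}

lemma det_fwdIter (hdet : ∀ x, (B x).det = 1) (n : ℕ) (x : ℝ) : (fwdIter β B n x).det = 1 := by
  induction n with
  | zero => simp [fwdIter]
  | succ n ih => rw [fwdIter, det_mul, ih, hdet, one_mul]

lemma fwdIter_per (hper : ∀ x, B (x + 1) = B x) (n : ℕ) (x : ℝ) :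
    fwdIter β B n (x + 1) = fwdIter β B n x := by
  induction n with
  | zero => rfl
  | succ n ih => rw [fwdIter, fwdIter, ih, add_right_comm, hper]

/-- Vectors decaying at rate `q` along a sequence of matrices. -/
def decaying (P : ℕ → M2) (q : ℝ) : Submodule ℝ (Fin 2 → ℝ) where
  carrier := {w | ∃ C, ∀ n, vnorm (P n *ᵥ w) ≤ C * q ^ n}
  zero_mem' := ⟨0, fun n => by simp [vnorm_eq]⟩
  add_mem' := by
    rintro a b ⟨C, hC⟩ ⟨D, hD⟩
    refine ⟨C + D, fun n => ?_⟩
    rw [mulVec_add, add_mul]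
    exact (vnorm_add_le _ _).trans (add_le_add (hC n) (hD n))
  smul_mem' := by
    rintro r a ⟨C, hC⟩
    refine ⟨|r| * C, fun n => ?_⟩
    rw [mulVec_smul, vnorm_smul, mul_assoc]
    exact mul_le_mul_of_nonneg_left (hC n) (abs_nonneg _)

lemma decaying_spec {P : ℕ → M2} {q D : ℝ} (hq0 : 0 < q) (hq : q < 1) (hP : ∀ n, (P n).det = 1)
    {w : Fin 2 → ℝ} (hw : vnorm w = 1) (hD : ∀ n, vnorm (P n *ᵥ w) ≤ D * q ^ n) :
    Module.finrank ℝ (decaying P q) = 1 ∧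
      ∀ z ∈ decaying P q, vnorm z = 1 → ∀ n, vnorm (P n *ᵥ z) ≤ D * q ^ n := by
  have hwm : w ∈ decaying P q := ⟨D, hD⟩
  have hcol : ∀ z ∈ decaying P q, cross w z = 0 := by
    rintro z ⟨C, hC⟩
    have h1 : ∀ n : ℕ, |cross w z| ≤ D * C * (q ^ 2) ^ n := by
      intro n
      rw [← cross_mulVec (hP n)]
      calc _ ≤ _ := abs_cross_le _ _
        _ ≤ (D * q ^ n) * (C * q ^ n) :=
          mul_le_mul (hD n) (hC n) (vnorm_nonneg _) ((vnorm_nonneg _).trans (hD n))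
        _ = _ := by rw [← pow_mul, mul_comm 2 n, pow_mul]; ring
    have h2 : Filter.Tendsto (fun n : ℕ => D * C * (q ^ 2) ^ n) Filter.atTop (nhds 0) := by
      simpa using (tendsto_pow_atTop_nhds_zero_of_lt_one (sq_nonneg q)
        (pow_lt_one₀ hq0.le hq two_ne_zero)).const_mul (D * C)
    exact abs_nonpos_iff.mp (ge_of_tendsto' h2 h1)
  have hw2 := vnorm_sq w
  rw [hw, one_pow] at hw2
  have hmul : ∀ z ∈ decaying P q, z = (w 0 * z 0 + w 1 * z 1) • w := by
    intro z hz
    have h := hcol z hz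
    unfold cross at h
    ext i
    fin_cases i <;> simp
    · linear_combination z 0 * hw2 - w 1 * h
    · linear_combination z 1 * hw2 + w 0 * h
  constructor
  · have hw0 : w ≠ 0 := by rintro rfl; simp at hw2
    refine finrank_eq_one_iff_of_nonzero' (⟨w, hwm⟩ : decaying P q) (by simpa using hw0) |>.mpr ?_
    rintro ⟨z, hz⟩
    exact ⟨_, Subtype.ext (hmul z hz).symm⟩
  · intro z hz hz1 n
    have h := hmul z hz
    have h1 : |w 0 * z 0 + w 1 * z 1| = 1 := by
      have := vnorm_smul (w 0 * z 0 + w 1 * z 1) w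
      rw [← h, hz1, hw, mul_one] at this
      exact this.symm
    rw [h, mulVec_smul, vnorm_smul, h1, one_mul]
    exact hD n

/-- Uniform exponential growth of the iterates, at a rate beating the square root of the one-step
norm, implies uniform hyperbolicity. -/
theorem isUH_of_growth {L c g : ℝ} (hdet : ∀ x, (B x).det = 1) (hper : ∀ x, B (x + 1) = B x)
    (hL : 1 ≤ L) (hBL : ∀ x, hs (B x) ≤ L ^ 2) (hc : 0 < c) (hg : 1 < g) (hLg : L < g ^ 2)
    (hlow : ∀ n x, c * (g ^ n) ^ 2 ≤ hs (fwdIter β B n x)) : IsUH β B := by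
  obtain ⟨q, hq1, hq⟩ : ∃ q, max g⁻¹ (L / g ^ 2) ≤ q ∧ q < 1 :=
    ⟨_, le_rfl, max_lt (inv_lt_one_of_one_lt₀ hg) ((div_lt_one (by positivity)).mpr hLg)⟩
  have hq0 : 0 < q := (inv_pos.mpr (by linarith : (0 : ℝ) < g)).trans_le ((le_max_left _ _).trans hq1)
  obtain ⟨D, hD, key⟩ := exists_stable hL hc hg ((le_max_left _ _).trans hq1)
    ((le_max_right _ _).trans hq1)
  have hL0 : 0 ≤ L := by linarith
  have hunit : ∀ x, IsUnit (B x).det := fun x => by rw [hdet]; exact isUnit_one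
  let P : ℝ → ℕ → M2 := fun x n => fwdIter β B n x
  let R : ℝ → ℕ → M2 := fun x n => (fwdIter β B n (x - n * β))⁻¹
  have hPdet : ∀ x n, (P x n).det = 1 := fun x n => det_fwdIter hdet n x
  have hRdet : ∀ x n, (R x n).det = 1 := fun x n => det_inv_eq (det_fwdIter hdet n _)
  have hPup : ∀ n x, hs (P x n) ≤ 2 * (L ^ n) ^ 2 := by
    intro n x
    induction n with
    | zero => simp [P, fwdIter, hs]; norm_num
    | succ n ih =>
      simp only [P, fwdIter] at *
      refine (hs_mul_le _ _).trans ?_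
      calc _ ≤ L ^ 2 * (2 * (L ^ n) ^ 2) :=
            mul_le_mul (hBL _) ih (hs_nonneg _) (sq_nonneg _)
        _ = _ := by ring
  have hPstep : ∀ x n w, vnorm (P x n *ᵥ w) ≤ L * vnorm (P x (n + 1) *ᵥ w) := by
    intro x n w
    have e : P x n = (B (x + n * β))⁻¹ * P x (n + 1) := by
      simp only [P, fwdIter]
      rw [nonsing_inv_mul_cancel_left _ _ (hunit _)]
    rw [e, ← mulVec_mulVec]
    exact vnorm_mulVec_le hL0 ((hs_inv (hdet _)).trans_le (hBL _)) _
  have hRsucc : ∀ x n, R x n = B (x - (n + 1) * β) * R x (n + 1) := by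
    intro x n
    simp only [R]
    rw [fwdIter_succ', Matrix.mul_inv_rev, Nat.cast_succ, mul_nonsing_inv_cancel_left _ _ (hunit _)]
    congr 2; ring
  have hRstep : ∀ x n w, vnorm (R x n *ᵥ w) ≤ L * vnorm (R x (n + 1) *ᵥ w) := by
    intro x n w
    rw [hRsucc, ← mulVec_mulVec]
    exact vnorm_mulVec_le hL0 (hBL _) _
  have hPs := fun x => key (P x) (hPdet x) (hPstep x) (fun n => hPup n x) (fun n => hlow n x)
  have hRs := fun x => key (R x) (hRdet x) (hRstep x)
    (fun n => (hs_inv (det_fwdIter hdet n _)).trans_le (hPup n _))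
    (fun n => (hlow n _).trans_eq (hs_inv (det_fwdIter hdet n _)).symm)
  choose ws hws1 hws2 using hPs
  choose wu hwu1 hwu2 using hRs
  have hs' := fun x => decaying_spec hq0 hq (hPdet x) (hws1 x) (hws2 x)
  have hu' := fun x => decaying_spec hq0 hq (hRdet x) (hwu1 x) (hwu2 x)
  have hmap : ∀ x (N N' : Submodule ℝ (Fin 2 → ℝ)), Module.finrank ℝ N = 1 →
      Module.finrank ℝ N' = 1 → (∀ w ∈ N, B x *ᵥ w ∈ N') → N.map (Matrix.toLin' (B x)) = N' := by
    intro x N N' h1 h2 h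
    apply Submodule.eq_of_le_of_finrank_eq
    · rintro _ ⟨w, hw, rfl⟩
      simpa [Matrix.toLin'_apply] using h w hw
    · rw [h2, ← h1]
      refine (Submodule.equivMapOfInjective (Matrix.toLin' (B x)) ?_ N).finrank_eq.symm
      intro a b hab
      simp only [Matrix.toLin'_apply] at hab
      have := congrArg ((B x)⁻¹ *ᵥ ·) hab
      simpa only [mulVec_mulVec, nonsing_inv_mul _ (hunit x), one_mulVec] using this
  refine ⟨fun x => decaying (P x) q, fun x => decaying (R x) q, D + 1, q⁻¹, by linarith,
    (one_lt_inv₀ hq0).mpr hq, fun x => ⟨(hs' x).1, (hu' x).1⟩, fun x => ?_, fun x => ⟨?_, ?_⟩,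
    fun x n hn => ⟨fun w hw hw1 => ?_, fun w hw hw1 => ?_⟩⟩
  · have e1 : P (x + 1) = P x := funext fun n => fwdIter_per hper n x
    have e2 : R (x + 1) = R x := funext fun n => by
      simp only [R]; rw [add_sub_right_comm, fwdIter_per hper]
    exact ⟨congrArg (decaying · q) e1, congrArg (decaying · q) e2⟩
  · refine hmap x _ _ (hs' x).1 (hs' _).1 ?_
    rintro w ⟨C, hC⟩
    refine ⟨C * q, fun n => ?_⟩
    have := hC (n + 1)
    simp only [P] at this ⊢
    rw [fwdIter_succ', ← mulVec_mulVec] at this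
    refine this.trans_eq ?_
    ring
  · refine hmap x _ _ (hu' x).1 (hu' _).1 ?_
    rintro w ⟨C, hC⟩
    refine ⟨max (vnorm (B x *ᵥ w)) (C / q), fun n => ?_⟩
    cases n with
    | zero => simp [R, fwdIter]
    | succ n =>
      have e : R (x + β) (n + 1) *ᵥ (B x *ᵥ w) = R x n *ᵥ w := by
        simp only [R]
        rw [mulVec_mulVec]
        congr 1
        rw [fwdIter, Matrix.mul_inv_rev]
        have e1 : x + β - ((n + 1 : ℕ) : ℝ) * β = x - n * β := by push_cast; ring
        rw [e1, sub_add_cancel, nonsing_inv_mul_cancel_right _ _ (hunit x)]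
      rw [e]
      calc _ ≤ C * q ^ n := hC n
        _ = C / q * q ^ (n + 1) := by field_simp; ring
        _ ≤ _ := by gcongr; exact le_max_right _ _
  · have h := (hs' x).2 w hw hw1 n
    have e : cocycleIter β B n x = P x n := by simp [cocycleIter, P]
    rw [e, inv_pow, div_inv_eq_mul]
    exact h.trans_lt (by gcongr; linarith)
  · have h := (hu' x).2 w hw hw1 n
    have e : cocycleIter β B (-(n : ℤ)) x = R x n := by
      have : ¬ (0 : ℤ) ≤ -(n : ℤ) := by omega
      simp only [cocycleIter, R, if_neg this, neg_neg, Int.toNat_natCast]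
      rw [show x + ((-(n : ℤ) : ℤ) : ℝ) * β = x - n * β by push_cast; ring]
    rw [e, inv_pow, div_inv_eq_mul]
    exact h.trans_lt (by gcongr; linarith)

end criterion

namespace Ctx

variable (c : Ctx)

/-- From every base point the orbit enters `S ∩ Eo` within time `H`, uniformly on balls. -/
def Cov (S Eo : Set ℝ) (R : ℝ) (H : ℕ) : Prop :=
  ∀ x0, ∃ s < H, ∀ x, |x - x0| ≤ R → x + s * c.α ∈ S ∧ x + s * c.α ∈ Eo

variable {c} {S Eo J : Set ℝ} {k H : ℕ} {ρ B E : ℝ}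

lemma Adm.suffix {x : ℝ} {n t : ℕ} (h : c.Adm S Eo J k x n) (ht : t ≤ n)
    (hS : x + t * c.α ∈ S) : c.Adm S Eo J k (x + t * c.α) (n - t) := by
  refine ⟨hS, ?_, fun s h1 h2 => ?_⟩
  · convert h.2.1 using 1; push_cast [ht]; ring
  · have := h.2.2 (t + s) (by omega) (by omega)
    convert this using 2; push_cast; ring

lemma Adm.prefix {x : ℝ} {n t : ℕ} (h : c.Adm S Eo J k x n) (ht : t ≤ n)
    (hE : x + t * c.α ∈ Eo) : c.Adm S Eo J k x t :=
  ⟨h.1, hE, fun s h1 h2 => h.2.2 s h1 (by omega)⟩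

/-- Quantitative convergence of the directions along admissible segments. -/
lemma cauchy_aux {u1 u2 P : Jet} {n1 n2 : ℕ} {b : ℝ} (hb : 1 ≤ b) (hρ0 : 0 ≤ ρ) (hρ : ρ * b ^ 6 ≤ 1)
    (h12 : n1 ≤ n2) (h3 : n2 ≤ 3 * n1) (hP : nrm P ≤ b ^ (10 * (n2 - n1))) (h1 : nrm u1 ≤ ρ ^ n1)
    (h2 : nrm u2 ≤ ρ ^ n2) : nrm (P * u1 * u2) ≤ (b ^ 4)⁻¹ ^ n1 := by
  have hb0 : 0 < b := by linarith
  obtain ⟨d, rfl⟩ := Nat.exists_eq_add_of_le h12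
  have h := nrm_mul_le_of_le (nrm_mul_le_of_le hP h1) h2
  rw [Nat.add_sub_cancel_left] at h
  refine h.trans ?_
  have e : b ^ (10 * d) * ρ ^ n1 * ρ ^ (n1 + d) =
      (ρ * b ^ 6) ^ (2 * n1 + d) * b ^ (4 * d) / b ^ (12 * n1) := by
    rw [eq_div_iff (by positivity)]
    ring
  rw [e, inv_pow, ← pow_mul, inv_eq_one_div, div_le_div_iff₀ (by positivity) (by positivity)]
  have h5 : (ρ * b ^ 6) ^ (2 * n1 + d) ≤ 1 := pow_le_one₀ (by positivity) hρ
  have h6 : b ^ (4 * d) * b ^ (4 * n1) ≤ b ^ (12 * n1) := by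
    rw [← pow_add]; exact pow_le_pow_right₀ hb (by omega)
  calc _ = (ρ * b ^ 6) ^ (2 * n1 + d) * (b ^ (4 * d) * b ^ (4 * n1)) := by ring
    _ ≤ 1 * b ^ (12 * n1) := by gcongr

lemma geom_tail {q : ℝ} (hq0 : 0 ≤ q) (hq : q ≤ 1 / 2) (n m : ℕ) :
    ∑ i ∈ Finset.Ico n m, q ^ i ≤ 2 * q ^ n := by
  rcases le_total m n with h | h
  · rw [Finset.Ico_eq_empty_of_le h]; simp; positivity
  rw [geom_sum_Ico' (by linarith) h, div_le_iff₀ (by linarith)]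
  have h1 : 0 ≤ q ^ m := by positivity
  have h2 : 0 ≤ q ^ n := by positivity
  nlinarith

lemma sum_Ico_add_le {q : ℝ} (hq : 0 ≤ q) {n1 n3 n2 : ℕ} (h : n1 ≤ n3) (h' : n3 < n2) :
    ∑ m ∈ Finset.Ico n1 n3, q ^ m + q ^ n3 ≤ ∑ m ∈ Finset.Ico n1 n2, q ^ m := by
  rw [← Finset.sum_Ico_succ_top h]
  exact Finset.sum_le_sum_of_subset_of_nonneg (Finset.Ico_subset_Ico le_rfl h')
    fun _ _ _ => by positivity

lemma cauchy_gaL (hE : |E| ≤ c.Emax) (hρ0 : 0 ≤ ρ) (hρ : ρ * c.b ^ 6 ≤ 1)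
    (hgood : ∀ x n, c.Adm S Eo J k x n → c.Good ρ B x E n)
    {R : ℝ} (hR : 0 ≤ R) (hcov : c.Cov S Eo R H) {y : ℝ} {n1 : ℕ} (hn1 : H + 2 ≤ n1)
    (h1 : c.Adm S Eo J k (y - n1 * c.α) n1) (n2 : ℕ) : n1 ≤ n2 →
    c.Adm S Eo J k (y - n2 * c.α) n2 →
    nrm (c.gaL y E n2 - c.gaL y E n1) ≤ ∑ m ∈ Finset.Ico n1 n2, (c.b ^ 4)⁻¹ ^ m := by
  have hb := c.one_le_b
  have hb0 : 0 < c.b := by linarith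
  have hdir : ∀ n n' : ℕ, n ≤ n' → n' ≤ 3 * n → c.Adm S Eo J k (y - n * c.α) n →
      c.Adm S Eo J k (y - n' * c.α) n' →
      nrm (c.gaL y E n' - c.gaL y E n) ≤ (c.b ^ 4)⁻¹ ^ n := by
    intro n n' h12 h3 ha ha'
    have hg := hgood _ _ ha
    have hg' := hgood _ _ ha'
    have e : c.Mj (y - n' * c.α) E n' =
        c.Mj (y - n * c.α) E n * c.Mj (y - n' * c.α) E (n' - n) := by
      conv_lhs => rw [show n' = n + (n' - n) by omega, c.Mj_add]
      rw [show n + (n' - n) = n' by omega]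
      congr 2; push_cast [h12]; ring
    have hne := hg'.ne
    have hU := hg'.hU
    have hs := Ga_mul_sub (P := c.Mj (y - n' * c.α) E (n' - n)) (c.det_Mj _ _ _) hg.ne (e ▸ hne)
    rw [← e] at hs
    unfold gaL
    rw [hs]
    exact cauchy_aux hb hρ0 hρ h12 h3 (c.nrm_Mj hE _ _ _ _) hg.hU hg'.hU
  induction n2 using Nat.strong_induction_on with
  | _ n2 ih =>
  intro h12 h2
  by_cases h3 : n2 ≤ 3 * n1
  · rcases h12.eq_or_lt with rfl | h
    · simp
    · exact (hdir _ _ h12 h3 h1 h2).trans (Finset.single_le_sum (f := fun m => (c.b ^ 4)⁻¹ ^ m)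
        (fun i _ => by positivity) (Finset.mem_Ico.mpr ⟨le_rfl, h⟩))
  · obtain ⟨s, hs, hsx⟩ := hcov (y - (n2 / 3 + 1 + H : ℕ) * c.α)
    have hsS := (hsx (y - (n2 / 3 + 1 + H : ℕ) * c.α) (by simpa only [sub_self, abs_zero] using hR)).1
    set n3 := n2 / 3 + 1 + H - s with hn3
    have e3 : y - (n2 / 3 + 1 + H : ℕ) * c.α + s * c.α = y - n3 * c.α := by
      rw [hn3]; push_cast [show s ≤ n2 / 3 + 1 + H by omega]; ring
    have e4 : y - n2 * c.α + (n2 - n3 : ℕ) * c.α = y - n3 * c.α := by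
      push_cast [show n3 ≤ n2 by omega]; ring
    have ha3 : c.Adm S Eo J k (y - n3 * c.α) n3 := by
      have := h2.suffix (t := n2 - n3) (by omega) (by rw [e4, ← e3]; exact hsS)
      rwa [e4, show n2 - (n2 - n3) = n3 by omega] at this
    have hd := hdir n3 n2 (by omega) (by omega) ha3 h2
    have hi := ih n3 (by omega) (by omega) ha3
    have hlast := sum_Ico_add_le (q := (c.b ^ 4)⁻¹) (by positivity) (show n1 ≤ n3 by omega)
      (show n3 < n2 by omega)
    have := nrm_sub_le_add (c.gaL y E n2) (c.gaL y E n3) (c.gaL y E n1)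
    linarith

lemma cauchy_beR (hE : |E| ≤ c.Emax) (hρ0 : 0 ≤ ρ) (hρ : ρ * c.b ^ 6 ≤ 1)
    (hgood : ∀ x n, c.Adm S Eo J k x n → c.Good ρ B x E n)
    {R : ℝ} (hR : 0 ≤ R) (hcov : c.Cov S Eo R H) {y : ℝ} {n1 : ℕ} (hn1 : H + 2 ≤ n1)
    (h1 : c.Adm S Eo J k y n1) (n2 : ℕ) : n1 ≤ n2 → c.Adm S Eo J k y n2 →
    nrm (c.beR y E n2 - c.beR y E n1) ≤ ∑ m ∈ Finset.Ico n1 n2, (c.b ^ 4)⁻¹ ^ m := by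
  have hb := c.one_le_b
  have hb0 : 0 < c.b := by linarith
  have hdir : ∀ n n' : ℕ, n ≤ n' → n' ≤ 3 * n → c.Adm S Eo J k y n →
      c.Adm S Eo J k y n' → nrm (c.beR y E n' - c.beR y E n) ≤ (c.b ^ 4)⁻¹ ^ n := by
    intro n n' h12 h3 ha ha'
    have hg := hgood _ _ ha
    have hg' := hgood _ _ ha'
    have e : c.Mj y E n' = c.Mj (y + n * c.α) E (n' - n) * c.Mj y E n := by
      rw [← c.Mj_add, Nat.sub_add_cancel h12]
    have hne := hg'.ne
    have hs := Be_mul_sub (P := c.Mj (y + n * c.α) E (n' - n)) (c.det_Mj _ _ _) hg.ne (e ▸ hne)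
    rw [← e] at hs
    unfold beR
    rw [hs]
    exact cauchy_aux hb hρ0 hρ h12 h3 (c.nrm_Mj hE _ _ _ _) hg.hU hg'.hU
  induction n2 using Nat.strong_induction_on with
  | _ n2 ih =>
  intro h12 h2
  by_cases h3 : n2 ≤ 3 * n1
  · rcases h12.eq_or_lt with rfl | h
    · simp
    · exact (hdir _ _ h12 h3 h1 h2).trans (Finset.single_le_sum (f := fun m => (c.b ^ 4)⁻¹ ^ m)
        (fun i _ => by positivity) (Finset.mem_Ico.mpr ⟨le_rfl, h⟩))
  · obtain ⟨s, hs, hsx⟩ := hcov (y + (n2 / 3 + 1 : ℕ) * c.α)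
    have hsE := (hsx (y + (n2 / 3 + 1 : ℕ) * c.α) (by simpa only [sub_self, abs_zero] using hR)).2
    set n3 := n2 / 3 + 1 + s with hn3
    have e3 : y + (n2 / 3 + 1 : ℕ) * c.α + s * c.α = y + n3 * c.α := by
      rw [hn3]; push_cast; ring
    have ha3 : c.Adm S Eo J k y n3 := h2.prefix (by omega) (e3 ▸ hsE)
    have hd := hdir n3 n2 (by omega) (by omega) ha3 h2
    have hi := ih n3 (by omega) (by omega) ha3
    have hlast := sum_Ico_add_le (q := (c.b ^ 4)⁻¹) (by positivity) (show n1 ≤ n3 by omega)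
      (show n3 < n2 by omega)
    have := nrm_sub_le_add (c.beR y E n2) (c.beR y E n3) (c.beR y E n1)
    linarith

lemma tail_le {b : ℝ} (hb : 2 ≤ b) {h n m : ℕ} (hn : h ≤ n) :
    ∑ i ∈ Finset.Ico n m, (b ^ 4)⁻¹ ^ i ≤ 2 * (b ^ 4)⁻¹ ^ h := by
  have h16 : (16 : ℝ) ≤ b ^ 4 := by
    calc (16 : ℝ) = 2 ^ 4 := by norm_num
      _ ≤ b ^ 4 := by gcongr
  have hq : (b ^ 4)⁻¹ ≤ 1 / 2 := by
    rw [inv_eq_one_div]; exact one_div_le_one_div_of_le (by norm_num) (by linarith)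
  have hq0 : 0 ≤ (b ^ 4)⁻¹ := by positivity
  refine (geom_tail hq0 hq n m).trans ?_
  have := pow_le_pow_of_le_one hq0 (by linarith) hn
  linarith

lemma gaL_close (hb : 2 ≤ c.b) (hE : |E| ≤ c.Emax) (hρ0 : 0 ≤ ρ) (hρ : ρ * c.b ^ 6 ≤ 1)
    (hgood : ∀ x n, c.Adm S Eo J k x n → c.Good ρ B x E n)
    {R : ℝ} (hR : 0 ≤ R) (hcov : c.Cov S Eo R H) {y : ℝ} {h n1 n2 : ℕ} (hh : H + 2 ≤ h)
    (hn1 : h ≤ n1) (hn2 : h ≤ n2)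
    (h1 : c.Adm S Eo J k (y - n1 * c.α) n1) (h2 : c.Adm S Eo J k (y - n2 * c.α) n2) :
    nrm (c.gaL y E n2 - c.gaL y E n1) ≤ 2 * (c.b ^ 4)⁻¹ ^ h := by
  rcases le_total n1 n2 with h12 | h12
  · exact (cauchy_gaL hE hρ0 hρ hgood hR hcov (hh.trans hn1) h1 n2 h12 h2).trans (tail_le hb hn1)
  · rw [nrm_sub_comm]
    exact (cauchy_gaL hE hρ0 hρ hgood hR hcov (hh.trans hn2) h2 n1 h12 h1).trans (tail_le hb hn2)

lemma beR_close (hb : 2 ≤ c.b) (hE : |E| ≤ c.Emax) (hρ0 : 0 ≤ ρ) (hρ : ρ * c.b ^ 6 ≤ 1)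
    (hgood : ∀ x n, c.Adm S Eo J k x n → c.Good ρ B x E n)
    {R : ℝ} (hR : 0 ≤ R) (hcov : c.Cov S Eo R H) {y : ℝ} {h n1 n2 : ℕ} (hh : H + 2 ≤ h)
    (hn1 : h ≤ n1) (hn2 : h ≤ n2)
    (h1 : c.Adm S Eo J k y n1) (h2 : c.Adm S Eo J k y n2) :
    nrm (c.beR y E n2 - c.beR y E n1) ≤ 2 * (c.b ^ 4)⁻¹ ^ h := by
  rcases le_total n1 n2 with h12 | h12
  · exact (cauchy_beR hE hρ0 hρ hgood hR hcov (hh.trans hn1) h1 n2 h12 h2).trans (tail_le hb hn1)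
  · rw [nrm_sub_comm]
    exact (cauchy_beR hE hρ0 hρ hgood hR hcov (hh.trans hn2) h2 n1 h12 h1).trans (tail_le hb hn2)

end Ctx

namespace Core
open Ctx

variable {c : Ctx} (C : Core c)

lemma cover1 (hr : 2 * C.r ≤ C.rD) (hRet : 2 * C.H + 4 * C.h + 2 * C.k + 2 ≤ C.Ret) :
    c.Cov C.S1 C.E1 (C.rD / 2) (2 * C.H + 2 * C.h + C.k + 1) := by
  intro x0
  obtain ⟨s0, hs0, h0⟩ := C.cover x0
  obtain ⟨s1, hs1, h1⟩ := C.cover (x0 + (C.H + 2 * C.h + C.k + 1 : ℕ) * c.α)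
  by_cases hx : ∀ x, |x - x0| ≤ C.rD / 2 → ∀ t : ℤ, -((C.h : ℤ) + C.k + 1) < t → t < C.h →
      x + s0 * c.α + t * c.α ∉ C.J
  · refine ⟨s0, by omega, fun x hxx => ?_⟩
    have hx2 : |x - x0| ≤ C.rD := by linarith [abs_nonneg (x - x0)]
    exact ⟨⟨(h0 x hx2).1, fun t h1 h2 => hx x hxx t (by omega) h2⟩,
      ⟨(h0 x hx2).2, fun t h1 h2 => hx x hxx t (by omega) (by omega)⟩⟩
  · push Not at hx
    obtain ⟨x, hxx, t, ht1, ht2, j, m, hJ⟩ := hx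
    set N := C.H + 2 * C.h + C.k + 1 with hN
    refine ⟨N + s1, by omega, fun x' hxx' => ?_⟩
    have key : ∀ t' : ℤ, -((C.h : ℤ) + C.k + 1) < t' → t' < C.h →
        x' + (N + s1 : ℕ) * c.α + t' * c.α ∉ C.J := by
      rintro t' ht1' ht2' ⟨j', m', hJ'⟩
      have := C.ret j j' ((N + s1 + t') - (s0 + t)) (m' - m) (by omega)
        (by rw [abs_of_nonneg] <;> omega)
      have e : C.ctr j + ((N + s1 + t') - (s0 + t) : ℤ) * c.α - (m' - m : ℤ) - C.ctr j' =
          (x' + (N + s1 : ℕ) * c.α + t' * c.α - m' - C.ctr j')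
          - (x + s0 * c.α + t * c.α - m - C.ctr j) + ((x - x0) - (x' - x0)) := by
        push_cast; ring
      rw [e] at this
      have h2 := abs_add_le ((x' + (N + s1 : ℕ) * c.α + t' * c.α - m' - C.ctr j')
          - (x + s0 * c.α + t * c.α - m - C.ctr j)) ((x - x0) - (x' - x0))
      have h3 := abs_sub (x' + (N + s1 : ℕ) * c.α + t' * c.α - m' - C.ctr j')
        (x + s0 * c.α + t * c.α - m - C.ctr j)
      have h4 := abs_sub (x - x0) (x' - x0)
      linarith
    have e : x' + (N + s1 : ℕ) * c.α = (x' + N * c.α) + s1 * c.α := by push_cast; ring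
    have hm := h1 (x' + N * c.α) (by
      rw [show x' + N * c.α - (x0 + N * c.α) = x' - x0 by ring]
      linarith [abs_nonneg (x' - x0)])
    rw [← e] at hm
    exact ⟨⟨hm.1, fun t h1 h2 => key t (by omega) h2⟩,
      ⟨hm.2, fun t h1 h2 => key t (by omega) (by omega)⟩⟩

lemma mem_E1_of_nearD {j : Bool} {y : ℝ} {m : ℤ} (h : |y - m - C.ctr j| ≤ C.rD) : y ∈ C.E1 := by
  refine ⟨C.nearE j y m h, fun t h1 h2 ht => ?_⟩
  obtain ⟨j', m', h'⟩ := ht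
  have hk := C.hk_le
  have := C.ret j j' t (m' - m) (by omega) (by rw [abs_of_neg h2]; omega)
  have e : C.ctr j + t * c.α - (m' - m : ℤ) - C.ctr j' =
      (y + t * c.α - m' - C.ctr j') - (y - m - C.ctr j) := by push_cast; ring
  rw [e] at this
  have := abs_sub (y + t * c.α - m' - C.ctr j') (y - m - C.ctr j)
  linarith [C.r_le]

lemma mem_S1_of_nearD {j : Bool} {y : ℝ} {m : ℤ} (h : |y - m - C.ctr j| ≤ C.rD) :
    y + (C.k + 1) * c.α ∈ C.S1 := by
  refine ⟨C.nearS j y m h, fun t h1 h2 ht => ?_⟩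
  obtain ⟨j', m', h'⟩ := ht
  have hk := C.hk_le
  have := C.ret j j' (C.k + 1 + t) (m' - m) (by omega) (by rw [abs_of_nonneg] <;> omega)
  have e : C.ctr j + (C.k + 1 + t : ℤ) * c.α - (m' - m : ℤ) - C.ctr j' =
      (y + (C.k + 1) * c.α + t * c.α - m' - C.ctr j') - (y - m - C.ctr j) := by push_cast; ring
  rw [e] at this
  have := abs_sub (y + (C.k + 1) * c.α + t * c.α - m' - C.ctr j') (y - m - C.ctr j)
  linarith [C.r_le]

end Core

namespace Ctx

variable {c : Ctx} {S Eo J : Set ℝ} {k H : ℕ} {ρ B E : ℝ}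

lemma hs_map_le (hE : |E| ≤ c.Emax) (x : ℝ) (n : ℕ) :
    hs ((c.Mj x E n).map val) ≤ 4 * (c.b ^ 10) ^ (2 * n) := by
  have h : ∀ i j, ((c.Mj x E n).map val) i j ^ 2 ≤ (c.b ^ 10) ^ (2 * n) := by
    intro i j
    have := (abs_v0_le _).trans (c.nrm_Mj hE x n i j)
    have h2 := pow_le_pow_left₀ (abs_nonneg _) this 2
    rw [sq_abs] at h2
    simp only [Matrix.map_apply, val_apply]
    refine h2.trans_eq ?_
    ring
  unfold hs
  linarith [h 0 0, h 0 1, h 1 0, h 1 1]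

lemma one_le_hs {M : M2} (hM : M.det = 1) : 1 ≤ hs M := by
  rw [det_fin_two] at hM
  unfold hs
  nlinarith [sq_nonneg (M 0 0 - M 1 1), sq_nonneg (M 0 1 + M 1 0)]

lemma det_map_Mj (c : Ctx) (x E : ℝ) (n : ℕ) : ((c.Mj x E n).map val).det = 1 := by
  have := congrArg val (c.det_Mj x E n)
  rw [RingHom.map_det, map_one] at this
  exact this

lemma hs_middle_le {X Y Z : M2} (hX : X.det = 1) (hZ : Z.det = 1) :
    hs Y ≤ hs X * hs (X * Y * Z) * hs Z := by
  have e : Y = X⁻¹ * (X * Y * Z) * Z⁻¹ := by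
    rw [mul_assoc X, ← mul_assoc X⁻¹, nonsing_inv_mul _ (by rw [hX]; exact isUnit_one), one_mul,
      mul_assoc, mul_nonsing_inv _ (by rw [hZ]; exact isUnit_one), mul_one]
  calc hs Y = hs (X⁻¹ * (X * Y * Z) * Z⁻¹) := by rw [← e]
    _ ≤ hs (X⁻¹ * (X * Y * Z)) * hs Z⁻¹ := hs_mul_le _ _
    _ ≤ hs X⁻¹ * hs (X * Y * Z) * hs Z⁻¹ := by
      gcongr
      · exact hs_nonneg _
      · exact hs_mul_le _ _
    _ = _ := by rw [hs_inv hX, hs_inv hZ]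

/-- If all long orbit segments are hyperbolic then the cocycle is uniformly hyperbolic. -/
theorem uh_of_good (hb : 2 ≤ c.b) (hE : |E| ≤ c.Emax) (hρ0 : 0 ≤ ρ) (hρ : ρ * c.b ^ 6 ≤ 1)
    (hgood : ∀ x n, c.Adm S Eo ∅ k x n → c.Good ρ B x E n)
    {R : ℝ} (hR : 0 ≤ R) (hcov : c.Cov S Eo R H) :
    IsUH c.α (schCocycle c.lam c.v (c.lam * E)) := by
  have hb0 : 0 < c.b := by linarith
  have hb1 : 1 ≤ c.b := by linarith
  have hb1024 : (1024 : ℝ) ≤ c.b ^ 10 := by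
    calc (1024 : ℝ) = 2 ^ 10 := by norm_num
      _ ≤ c.b ^ 10 := by gcongr
  set c0 : ℝ := (16 * ((c.b ^ 10) ^ (4 * H) * (c.b ^ 6) ^ (4 * H)))⁻¹ with hc0
  have hc0p : 0 < c0 := by positivity
  refine isUH_of_growth (L := c.b ^ 10) (c := c0) (g := c.b ^ 6) (fun x => ?_) (fun x => ?_)
    (one_le_pow₀ hb1) (fun x => ?_) hc0p (one_lt_pow₀ (by linarith) (by norm_num)) ?_ ?_
  · simp [schCocycle, det_fin_two]
  · simp [schCocycle, c.per]
  · have h1 := (abs_v0_le _).trans (show nrm (c.aJ x E) ≤ c.b ^ 10 - 1 by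
      linarith [c.nrm_aJ (x := x) hE])
    have h2 := pow_le_pow_left₀ (abs_nonneg _) h1 2
    rw [sq_abs] at h2
    simp only [aJ] at h2
    simp only [hs, schCocycle, of_apply, cons_val', cons_val_zero, cons_val_one,
      cons_val_fin_one]
    nlinarith
  · rw [← pow_mul]; exact pow_lt_pow_right₀ (by linarith) (by norm_num)
  · intro n x
    rw [fwdIter_eq]
    have hdet := c.det_map_Mj x E n
    by_cases hn : n < 2 * H
    · refine le_trans ?_ (one_le_hs hdet)
      rw [hc0, inv_mul_le_iff₀ (by positivity), mul_one]
      have h1 : 1 ≤ (c.b ^ 10) ^ (4 * H) := one_le_pow₀ (one_le_pow₀ hb1)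
      have h2 : ((c.b ^ 6) ^ n) ^ 2 ≤ (c.b ^ 6) ^ (4 * H) := by
        rw [← pow_mul (c.b ^ 6) n]; exact pow_le_pow_right₀ (one_le_pow₀ hb1) (by omega)
      have h3 : 0 ≤ (c.b ^ 6) ^ (4 * H) := by positivity
      nlinarith
    · push Not at hn
      obtain ⟨s, hsH, hsx⟩ := hcov x
      obtain ⟨t, ht, htx⟩ := hcov (x + (n - H : ℕ) * c.α)
      have hS := (hsx x (by simpa only [sub_self, abs_zero] using hR)).1
      have hEo := (htx (x + (n - H : ℕ) * c.α) (by simpa only [sub_self, abs_zero] using hR)).2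
      obtain ⟨l, hl⟩ : ∃ l, s + l = n - H + t := ⟨n - H + t - s, by omega⟩
      obtain ⟨q, hq⟩ : ∃ q, n = q + (l + s) := ⟨H - t, by omega⟩
      have hg := hgood (x + s * c.α) l ⟨hS, by
        convert hEo using 1
        rw [add_assoc, add_assoc, ← add_mul, ← add_mul]; congr 2; exact_mod_cast hl,
        fun _ _ _ h => h⟩
      have hA : (c.b ^ 6) ^ l ≤ |((c.Mj (x + s * c.α) E l) 0 0).v0| := by
        have h1 := (abs_v0_le _).trans hg.hU
        rw [U, inv_v0, abs_inv] at h1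
        have hp := abs_pos.mpr hg.ne
        rw [inv_le_iff_one_le_mul₀ hp] at h1
        have h2 : (ρ * c.b ^ 6) ^ l ≤ 1 := pow_le_one₀ (by positivity) hρ
        rw [mul_pow] at h2
        have h3 : 0 ≤ (c.b ^ 6) ^ l := by positivity
        calc (c.b ^ 6) ^ l ≤ (c.b ^ 6) ^ l * (ρ ^ l * |((c.Mj (x + s * c.α) E l) 0 0).v0|) :=
              le_mul_of_one_le_right h3 h1
          _ = ρ ^ l * (c.b ^ 6) ^ l * |((c.Mj (x + s * c.α) E l) 0 0).v0| := by ring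
          _ ≤ 1 * |((c.Mj (x + s * c.α) E l) 0 0).v0| := by gcongr
          _ = _ := one_mul _
      have hmid : ((c.b ^ 6) ^ l) ^ 2 ≤ hs ((c.Mj (x + s * c.α) E l).map val) := by
        have := pow_le_pow_left₀ (by positivity) hA 2
        rw [sq_abs] at this
        unfold hs
        simp only [Matrix.map_apply, val_apply]
        nlinarith [sq_nonneg ((c.Mj (x + s * c.α) E l) 0 1).v0,
          sq_nonneg ((c.Mj (x + s * c.α) E l) 1 0).v0, sq_nonneg ((c.Mj (x + s * c.α) E l) 1 1).v0]
      have hM : (c.Mj x E n).map val = (c.Mj (x + (l + s : ℕ) * c.α) E q).map val *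
          (c.Mj (x + s * c.α) E l).map val * (c.Mj x E s).map val := by
        rw [hq, c.Mj_add x E q, c.Mj_add x E l s, Matrix.map_mul, Matrix.map_mul, mul_assoc]
      have h1 := hs_middle_le (Y := (c.Mj (x + s * c.α) E l).map val)
        (c.det_map_Mj (x + (l + s : ℕ) * c.α) E q) (c.det_map_Mj x E s)
      rw [← hM] at h1
      have hLq : hs ((c.Mj (x + (l + s : ℕ) * c.α) E q).map val) ≤ 4 * (c.b ^ 10) ^ (2 * H) :=
        (hs_map_le hE _ _).trans (by
          gcongr 4 * ?_; exact pow_le_pow_right₀ (one_le_pow₀ hb1) (by omega))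
      have hLs : hs ((c.Mj x E s).map val) ≤ 4 * (c.b ^ 10) ^ (2 * H) :=
        (hs_map_le hE _ _).trans (by
          gcongr 4 * ?_; exact pow_le_pow_right₀ (one_le_pow₀ hb1) (by omega))
      rw [hc0, inv_mul_le_iff₀ (by positivity)]
      have hn2 : ((c.b ^ 6) ^ n) ^ 2 ≤ ((c.b ^ 6) ^ l) ^ 2 * (c.b ^ 6) ^ (4 * H) := by
        rw [← pow_mul (c.b ^ 6) n, ← pow_mul (c.b ^ 6) l, ← pow_add]
        exact pow_le_pow_right₀ (one_le_pow₀ hb1) (by omega)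
      have h0 := hs_nonneg ((c.Mj x E n).map val)
      calc _ ≤ _ := hn2
        _ ≤ (4 * (c.b ^ 10) ^ (2 * H) * hs ((c.Mj x E n).map val) * (4 * (c.b ^ 10) ^ (2 * H)))
            * (c.b ^ 6) ^ (4 * H) := by
          gcongr
          refine (hmid.trans h1).trans ?_
          gcongr
          exact hs_nonneg _
        _ = _ := by rw [show 4 * H = 2 * H + 2 * H by ring, pow_add, pow_add]; ring

end Ctx

namespace Ctx

variable (c : Ctx)

lemma isAt_beR {y E : ℝ} {n : ℕ} (h : ((c.Mj y E n) 0 0).v0 ≠ 0) :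
    IsAt (fun y E => c.beR y E n) y E := by
  unfold beR Be U
  exact (c.isAt_Mj y E n 0 1).mul ((c.isAt_Mj y E n 0 0).inv h)

lemma isAt_gaL {y E : ℝ} {n : ℕ} (h : ((c.Mj (y - n * c.α) E n) 0 0).v0 ≠ 0) :
    IsAt (fun y E => c.gaL y E n) y E := by
  have h1 : IsAt (fun y E => Ga (c.Mj y E n)) (y + -(n * c.α)) E :=
    (c.isAt_Mj _ E n 1 0).mul ((c.isAt_Mj _ E n 0 0).inv (by rwa [← sub_eq_add_neg]))
  simpa only [gaL, sub_eq_add_neg] using h1.shift (-(n * c.α))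

lemma isAt_gf {β γ : ℝ → ℝ → Jet} {x E : ℝ} {k : ℕ} (hβ : IsAt β x E) (hγ : IsAt γ x E) :
    IsAt (fun y E => gf (β y E) (c.blk y E k) (γ y E)) x E := by
  unfold gf blk
  have h := fun i j => c.isAt_Mj x E (k + 1) i j
  exact (((h 0 0).add ((h 0 1).mul hγ)).add (hβ.mul (h 1 0))).add ((hβ.mul hγ).mul (h 1 1))

lemma nrm_blk {y E : ℝ} (hE : |E| ≤ c.Emax) (k : ℕ) (i j : Fin 2) :
    nrm (c.blk y E k i j) ≤ c.b ^ (10 * (k + 1)) := c.nrm_Mj hE y (k + 1) i j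

lemma blk_int (y E : ℝ) (m : ℤ) (k : ℕ) : c.blk (y + m) E k = c.blk y E k := c.Mj_int y E m _

lemma beR_int (y E : ℝ) (m : ℤ) (k : ℕ) : c.beR (y + m) E k = c.beR y E k := by
  rw [beR, Mj_int, beR]

lemma gaL_int (y E : ℝ) (m : ℤ) (k : ℕ) : c.gaL (y + m) E k = c.gaL y E k := by
  rw [gaL, add_sub_right_comm, Mj_int, gaL]

end Ctx

namespace Core
open Ctx

variable {c : Ctx}

/-- Periodic neighbourhoods of two centres. -/
def balls (z : Bool → ℝ) (r : ℝ) : Set ℝ := {y | ∃ j, ∃ m : ℤ, |y - m - z j| ≤ r}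

/-- Data for the core at the next scale. -/
structure Nxt (C : Core c) where
  W : Set ℝ
  ctr : Bool → ℝ
  r : ℝ
  rD : ℝ
  k : ℕ
  h : ℕ
  Ret : ℕ
  H : ℕ
  ρ : ℝ
  B : ℝ
  K : ℝ
  νb : ℝ
  νlow : ℝ
  ν : Bool → ℝ → ℝ → Jet
  l0 : Bool → ℕ
  r0 : Bool → ℕ
  hW : ∀ E ∈ W, |E| ≤ c.Emax
  r_nonneg : 0 ≤ r
  r_le : r ≤ rD
  ρ_pos : 0 < ρ
  ρ_le : ρ * c.b ^ 6 ≤ 1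
  B_nonneg : 0 ≤ B
  B_le : B ≤ 2
  K_pos : 0 < K
  νlow_pos : 0 < νlow
  νb_pos : 0 < νb
  good : ∀ E ∈ W, ∀ x n, c.Adm C.S1 C.E1 (balls ctr r) k x n → c.Good ρ B x E n
  nearE : ∀ j y (m : ℤ), |y - m - ctr j| ≤ rD → y ∈ C.E1
  nearS : ∀ j y (m : ℤ), |y - m - ctr j| ≤ rD → y + (k + 1) * c.α ∈ C.S1
  ret : ∀ j j' (t m : ℤ), t ≠ 0 → |t| ≤ Ret → 2 * rD < |ctr j + t * c.α - m - ctr j'|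
  hk_le : h + k ≤ Ret
  cov : c.Cov C.S1 C.E1 rD H
  hH : H + 2 ≤ h
  hb : 2 ≤ c.b
  hl0 : ∀ j, h ≤ l0 j ∧ l0 j + k ≤ Ret
  hr0 : ∀ j, h ≤ r0 j ∧ r0 j + k ≤ Ret
  memL : ∀ j y, |y - ctr j| ≤ rD → y - l0 j * c.α ∈ C.S1
  memR : ∀ j y, |y - ctr j| ≤ rD → y + (k + 1) * c.α + r0 j * c.α ∈ C.E1
  isν : ∀ j y, |y - ctr j| ≤ rD → ∀ E ∈ W, IsAt (ν j) y E
  ν_le : ∀ j y, |y - ctr j| ≤ rD → ∀ E ∈ W, nrm (ν j y E) ≤ νb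
  ν_ge : ∀ j y, |y - ctr j| ≤ rD → ∀ E ∈ W, νlow ≤ |(ν j y E).v0|
  G_le : ∀ j y, |y - ctr j| ≤ rD → ∀ E ∈ W, nrm (ν j y E *
    gf (c.beR (y + (k + 1) * c.α) E (r0 j)) (c.blk y E k) (c.gaL y E (l0 j))) ≤ K
  C11_le : ∀ j y, |y - ctr j| ≤ rD → ∀ E ∈ W,
    |(c.blk y E k 1 1).v0| ≤ K * |(ν j y E).v0|

namespace Nxt

variable {C : Core c} (N : C.Nxt)

lemma admL (j : Bool) {y : ℝ} (hy : |y - N.ctr j| ≤ N.rD) :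
    c.Adm C.S1 C.E1 (balls N.ctr N.r) N.k (y - N.l0 j * c.α) (N.l0 j) := by
  refine ⟨N.memL j y hy, ?_, fun t h1 h2 ht => ?_⟩
  · rw [sub_add_cancel]; exact N.nearE j y 0 (by simpa using hy)
  · obtain ⟨j', m, h⟩ := ht
    have hl := (N.hl0 j).2
    have := N.ret j j' (t - N.l0 j) m (by omega) (by rw [abs_of_neg] <;> omega)
    have e : N.ctr j + (t - N.l0 j : ℤ) * c.α - m - N.ctr j' =
      (y - N.l0 j * c.α + t * c.α - m - N.ctr j') - (y - N.ctr j) := by push_cast; ring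
    rw [e] at this
    have := abs_sub (y - N.l0 j * c.α + t * c.α - m - N.ctr j') (y - N.ctr j)
    linarith [N.r_le]

lemma admR (j : Bool) {y : ℝ} (hy : |y - N.ctr j| ≤ N.rD) :
    c.Adm C.S1 C.E1 (balls N.ctr N.r) N.k (y + (N.k + 1) * c.α) (N.r0 j) := by
  refine ⟨by simpa using N.nearS j y 0 (by simpa using hy), N.memR j y hy, fun t h1 h2 ht => ?_⟩
  obtain ⟨j', m, h⟩ := ht
  have hl := (N.hr0 j).2
  have := N.ret j j' (N.k + 1 + t) m (by omega) (by rw [abs_of_pos] <;> omega)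
  have e : N.ctr j + (N.k + 1 + t : ℤ) * c.α - m - N.ctr j' =
    (y + (N.k + 1) * c.α + t * c.α - m - N.ctr j') - (y - N.ctr j) := by push_cast; ring
  rw [e] at this
  have := abs_sub (y + (N.k + 1) * c.α + t * c.α - m - N.ctr j') (y - N.ctr j)
  linarith [N.r_le]

/-- The coupling function at the next scale. -/
def G (j : Bool) (y E : ℝ) : Jet := N.ν j y E *
  gf (c.beR (y + (N.k + 1) * c.α) E (N.r0 j)) (c.blk y E N.k) (c.gaL y E (N.l0 j))

lemma ρ_le_one : N.ρ ≤ 1 := by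
  have h1 : 1 ≤ c.b ^ 6 := one_le_pow₀ c.one_le_b
  have := N.ρ_le
  have := N.ρ_pos
  nlinarith

lemma goodL {j : Bool} {y E : ℝ} (hy : |y - N.ctr j| ≤ N.rD) (hE : E ∈ N.W) :
    c.Good N.ρ N.B (y - N.l0 j * c.α) E (N.l0 j) := N.good E hE _ _ (N.admL j hy)

lemma goodR {j : Bool} {y E : ℝ} (hy : |y - N.ctr j| ≤ N.rD) (hE : E ∈ N.W) :
    c.Good N.ρ N.B (y + (N.k + 1) * c.α) E (N.r0 j) := N.good E hE _ _ (N.admR j hy)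

lemma rD_nonneg : 0 ≤ N.rD := N.r_nonneg.trans N.r_le

lemma near_gaL {j : Bool} {y E : ℝ} {m : ℤ} (hy : |y - m - N.ctr j| ≤ N.rD) (hE : E ∈ N.W)
    {l : ℕ} (hl : N.h ≤ l) (ha : c.Adm C.S1 C.E1 (balls N.ctr N.r) N.k (y - l * c.α) l) :
    nrm (c.gaL y E l - c.gaL (y - m) E (N.l0 j)) ≤ 2 * (c.b ^ 4)⁻¹ ^ N.h := by
  have hI : c.gaL (y - m) E (N.l0 j) = c.gaL y E (N.l0 j) := by
    have := c.gaL_int y E (-m) (N.l0 j)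
    rwa [Int.cast_neg, ← sub_eq_add_neg] at this
  rw [hI]
  have h1 := N.admL j hy
  refine gaL_close N.hb (N.hW E hE) N.ρ_pos.le N.ρ_le (N.good E hE) N.rD_nonneg N.cov N.hH
    (N.hl0 j).1 hl ⟨?_, by simpa using ha.2.1, fun t h2 h3 h4 => h1.2.2 t h2 h3 ?_⟩ ha
  · have := h1.1
    rw [← C.S1_int _ m] at this
    convert this using 1; ring
  · obtain ⟨j', m', h⟩ := h4
    refine ⟨j', m' - m, ?_⟩
    convert h using 2; push_cast; ring

lemma near_beR {j : Bool} {y E : ℝ} {m : ℤ} (hy : |y - m - N.ctr j| ≤ N.rD) (hE : E ∈ N.W)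
    {l : ℕ} (hl : N.h ≤ l)
    (ha : c.Adm C.S1 C.E1 (balls N.ctr N.r) N.k (y + (N.k + 1) * c.α) l) :
    nrm (c.beR (y + (N.k + 1) * c.α) E l - c.beR (y - m + (N.k + 1) * c.α) E (N.r0 j))
      ≤ 2 * (c.b ^ 4)⁻¹ ^ N.h := by
  have hI : c.beR (y - m + (N.k + 1) * c.α) E (N.r0 j) =
      c.beR (y + (N.k + 1) * c.α) E (N.r0 j) := by
    have := c.beR_int (y + (N.k + 1) * c.α) E (-m) (N.r0 j)
    rw [← this]; congr 1; push_cast; ring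
  rw [hI]
  have h1 := N.admR j hy
  refine beR_close N.hb (N.hW E hE) N.ρ_pos.le N.ρ_le (N.good E hE) N.rD_nonneg N.cov N.hH
    (N.hr0 j).1 hl ⟨ha.1, ?_, fun t h2 h3 h4 => h1.2.2 t h2 h3 ?_⟩ ha
  · have := h1.2.1
    rw [← C.E1_int _ m] at this
    convert this using 1; ring
  · obtain ⟨j', m', h⟩ := h4
    refine ⟨j', m' - m, ?_⟩
    convert h using 2; push_cast; ring

/-- The core at the next scale. -/
def core : Core c where
  W := N.W
  S := C.S1
  Eo := C.E1
  ctr := N.ctr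
  r := N.r
  rD := N.rD
  k := N.k
  h := N.h
  Ret := N.Ret
  H := N.H
  ρ := N.ρ
  B := N.B
  K := N.K
  νb := N.νb
  νlow := N.νlow
  Q := c.b ^ (10 * (N.k + 1))
  e := 12 * N.νb * c.b ^ (10 * (N.k + 1)) * (c.b ^ 4)⁻¹ ^ N.h
  ν := N.ν
  G := N.G
  w j y E := (N.ν j y E * w2 (c.blk y E N.k) (c.gaL y E (N.l0 j))).v0
  hW := N.hW
  S_int := C.S1_int
  Eo_int := C.E1_int
  r_le := N.r_le
  ρ_pos := N.ρ_pos
  ρ_le := N.ρ_le_one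
  B_nonneg := N.B_nonneg
  B_le := N.B_le
  K_pos := N.K_pos
  Q_pos := pow_pos (by linarith [c.hb]) _
  νlow_pos := N.νlow_pos
  νb_pos := N.νb_pos
  e_nonneg := by have := N.νb_pos; have := c.one_le_b; positivity
  good := N.good
  nearE := N.nearE
  nearS := N.nearS
  ret := N.ret
  hk_le := N.hk_le
  cover := N.cov
  approx j y m hy E hE l hl r' hr hla hra := by
    have h1 := N.near_gaL hy hE hl hla
    have h2 := N.near_beR hy hE hr hra
    have hI : c.blk (y - m) E N.k = c.blk y E N.k := by
      have := c.blk_int y E (-m) N.k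
      rwa [Int.cast_neg, ← sub_eq_add_neg] at this
    have hB := fun i i' => c.nrm_blk (y := y) (N.hW E hE) N.k i i'
    have h3 := nrm_gf_sub_le (hB 0 1) (hB 1 0) (hB 1 1) rfl
      ((N.goodR hy hE).hBe.trans N.B_le) ((N.good E hE _ _ hla).hGa.trans N.B_le) h2 h1
    have h4 := nrm_mul_le_of_le (N.ν_le j (y - m) hy E hE) h3
    rw [mul_sub] at h4
    rw [G, hI]
    refine h4.trans_eq ?_
    ring
  approxw j y m hy E hE l hl hla := by
    have h1 := N.near_gaL hy hE hl hla
    have hI : c.blk (y - m) E N.k = c.blk y E N.k := by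
      have := c.blk_int y E (-m) N.k
      rwa [Int.cast_neg, ← sub_eq_add_neg] at this
    have h3 := nrm_mul_le_of_le (N.ν_le j (y - m) hy E hE)
      (nrm_mul_le_of_le (c.nrm_blk (y := y) (N.hW E hE) N.k 1 1) h1)
    have h4 := (abs_v0_le _).trans h3
    rw [hI, ← sub_v0, ← mul_sub]
    have e : w2 (c.blk y E N.k) (c.gaL y E l) - w2 (c.blk y E N.k) (c.gaL (y - m) E (N.l0 j)) =
      c.blk y E N.k 1 1 * (c.gaL y E l - c.gaL (y - m) E (N.l0 j)) := by unfold w2; ring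
    rw [e]
    refine h4.trans ?_
    have := N.νb_pos; have := c.one_le_b
    have : 0 ≤ N.νb * c.b ^ (10 * (N.k + 1)) * (c.b ^ 4)⁻¹ ^ N.h := by positivity
    linarith
  isG j y hy E hE := by
    have hR := N.goodR hy hE
    have hL := N.goodL hy hE
    exact (N.isν j y hy E hE).mul (c.isAt_gf ((c.isAt_beR hR.ne).shift _) (c.isAt_gaL hL.ne))
  isν := N.isν
  ν_le := N.ν_le
  ν_ge := N.ν_ge
  G_le := N.G_le
  Q01 y E hE := c.nrm_blk (N.hW E hE) N.k 0 1
  Q10 y E hE := c.nrm_blk (N.hW E hE) N.k 1 0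
  Q11 y E hE := c.nrm_blk (N.hW E hE) N.k 1 1
  C11_le := N.C11_le

end Nxt

/-- Segments of controlled length ending at (starting from) a neighbourhood of a point. -/
lemma exists_len {S Eo : Set ℝ} {R : ℝ} {H : ℕ} (hcov : c.Cov S Eo R H) (h : ℕ) (z : ℝ) :
    ∃ l, h ≤ l ∧ l < h + H ∧ ∀ y, |y - z| ≤ R → y - l * c.α ∈ S := by
  obtain ⟨s, hs, hx⟩ := hcov (z - (h + H - 1 : ℕ) * c.α)
  refine ⟨h + H - 1 - s, by omega, by omega, fun y hy => ?_⟩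
  have := (hx (y - (h + H - 1 : ℕ) * c.α) (by rwa [sub_sub_sub_cancel_right])).1
  convert this using 1
  rw [Nat.cast_sub (by omega)]; ring

lemma exists_len' {S Eo : Set ℝ} {R : ℝ} {H : ℕ} (hcov : c.Cov S Eo R H) (h : ℕ) (z : ℝ) :
    ∃ l, h ≤ l ∧ l < h + H ∧ ∀ y, |y - z| ≤ R → y + l * c.α ∈ Eo := by
  obtain ⟨s, hs, hx⟩ := hcov (z + h * c.α)
  refine ⟨h + s, by omega, by omega, fun y hy => ?_⟩
  have := (hx (y + h * c.α) (by rwa [add_sub_add_right_eq_sub])).2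
  convert this using 1
  push_cast; ring

end Core

namespace Core
open Ctx

variable {c : Ctx}

/-- Length scale of the covering property at the next scale. -/
def H1 (C : Core c) : ℕ := 2 * C.H + 2 * C.h + C.k + 1

/-- Data for refining the critical set of a core to small balls around new centres. -/
structure Ref (C : Core c) where
  W : Set ℝ
  z : Bool → ℝ
  par : Bool → Bool
  rh : ℝ
  R : ℝ
  h : ℕ
  δ : ℝ
  ρ : ℝ
  B : ℝ
  η : ℝ
  W_sub : W ⊆ C.W
  num : C.StepNum δ ρ B η
  near : ∀ j, |z j - C.ctr (par j)| + R ≤ C.rD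
  R_le : R ≤ C.rD / 2
  rh_pos : 0 < rh
  rh_le : rh ≤ R
  catches : ∀ E ∈ W, C.Catches E δ (balls z rh)
  cov : c.Cov C.S1 C.E1 (C.rD / 2) C.H1
  hh : C.H1 + 2 ≤ h
  hb : 2 ≤ c.b
  hρ : ρ * c.b ^ 6 ≤ 1

/-- Explicit description of the data of a core. -/
structure Spec (C : Core c) (W : Set ℝ) (ctr : Bool → ℝ) (r rD : ℝ) (k h Ret H : ℕ)
    (ρ B K νb νlow : ℝ) (G : Bool → ℝ → ℝ → Jet) (w : Bool → ℝ → ℝ → ℝ) : Prop where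
  W_eq : C.W = W
  ctr_eq : C.ctr = ctr
  r_eq : C.r = r
  rD_eq : C.rD = rD
  k_eq : C.k = k
  h_eq : C.h = h
  Ret_eq : C.Ret = Ret
  H_eq : C.H = H
  ρ_eq : C.ρ = ρ
  B_eq : C.B = B
  K_eq : C.K = K
  νb_eq : C.νb = νb
  νlow_eq : C.νlow = νlow
  Q_eq : C.Q = c.b ^ (10 * (k + 1))
  e_eq : C.e = 12 * νb * c.b ^ (10 * (k + 1)) * (c.b ^ 4)⁻¹ ^ h
  G_eq : C.G = G
  w_eq : C.w = w

namespace Ref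

variable {C : Core c} (A : C.Ref)

/-- Approximation error of the refinement. -/
def eh : ℝ := C.e + 6 * C.Q * C.νb * A.η

lemma near' {j : Bool} {y : ℝ} {m : ℤ} (hy : |y - m - A.z j| ≤ A.R) :
    |y - m - C.ctr (A.par j)| ≤ C.rD := by
  have := abs_sub_le (y - m) (A.z j) (C.ctr (A.par j))
  linarith [A.near j]

lemma near0 {j : Bool} {y : ℝ} (hy : |y - A.z j| ≤ A.R) : |y - C.ctr (A.par j)| ≤ C.rD := by
  simpa using A.near' (m := 0) (by simpa using hy)

lemma memE {j : Bool} {y : ℝ} {m : ℤ} (hy : |y - m - A.z j| ≤ A.R) : y ∈ C.E1 :=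
  C.mem_E1_of_nearD (A.near' hy)

lemma memS {j : Bool} {y : ℝ} {m : ℤ} (hy : |y - m - A.z j| ≤ A.R) :
    y + (C.k + 1) * c.α ∈ C.S1 := C.mem_S1_of_nearD (A.near' hy)

lemma h_le : C.h ≤ A.h := by have := A.hh; unfold H1 at this; omega

lemma step {E x : ℝ} {n : ℕ} (hE : E ∈ A.W) (h : c.Adm C.S1 C.E1 (balls A.z A.rh) C.k x n) :
    C.Step A.ρ A.B A.η E x n :=
  C.step A.num (A.W_sub hE) (A.catches E hE) n x h

lemma lens (z : ℝ) : ∃ l, A.h ≤ l ∧ l < A.h + C.H1 ∧ ∀ y, |y - z| ≤ A.R → y - l * c.α ∈ C.S1 := by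
  obtain ⟨l, h1, h2, h3⟩ := exists_len A.cov A.h z
  exact ⟨l, h1, h2, fun y hy => h3 y (hy.trans A.R_le)⟩

lemma lens' (z : ℝ) : ∃ l, A.h ≤ l ∧ l < A.h + C.H1 ∧ ∀ y, |y - z| ≤ A.R → y + l * c.α ∈ C.E1 := by
  obtain ⟨l, h1, h2, h3⟩ := exists_len' A.cov A.h z
  exact ⟨l, h1, h2, fun y hy => h3 y (hy.trans A.R_le)⟩

/-- Length of the reference segment on the left of `z`. -/
def ll (z : ℝ) : ℕ := (A.lens z).choose
/-- Length of the reference segment starting near `z`. -/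
def lr (z : ℝ) : ℕ := (A.lens' z).choose

lemma ll_spec (z : ℝ) : A.h ≤ A.ll z ∧ A.ll z < A.h + C.H1 ∧
    ∀ y, |y - z| ≤ A.R → y - A.ll z * c.α ∈ C.S1 := (A.lens z).choose_spec

lemma lr_spec (z : ℝ) : A.h ≤ A.lr z ∧ A.lr z < A.h + C.H1 ∧
    ∀ y, |y - z| ≤ A.R → y + A.lr z * c.α ∈ C.E1 := (A.lens' z).choose_spec

lemma eh_le : A.eh ≤ A.δ / 4 := A.num.e_le

lemma B_nonneg : 0 ≤ A.B := by
  have := C.B_nonneg; have := A.num.B_le; have := A.num.η_nonneg; linarith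

lemma ρ_pos : 0 < A.ρ := C.ρ_pos.trans_le A.num.ρ_le

/-- Coupling function over the old block. -/
def Gn (j : Bool) (y E : ℝ) : Jet := C.ν (A.par j) y E *
  gf (c.beR (y + (C.k + 1) * c.α) E (A.lr (A.z j + (C.k + 1) * c.α))) (c.blk y E C.k)
    (c.gaL y E (A.ll (A.z j)))

/-- Energy slope weight over the old block. -/
def wn (j : Bool) (y E : ℝ) : ℝ :=
  (C.ν (A.par j) y E * w2 (c.blk y E C.k) (c.gaL y E (A.ll (A.z j)))).v0

/-- Absence of returns of the new centres. -/
def NonRes (Ret : ℕ) (rr : ℝ) : Prop :=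
  ∀ j j' (t m : ℤ), t ≠ 0 → |t| ≤ Ret → rr < |A.z j + t * c.α - m - A.z j'|

section keep

variable {A} {Ret : ℕ} {rr : ℝ}

lemma stepL_keep (hnon : A.NonRes Ret rr) (hRet : A.h + C.H1 + C.k ≤ Ret) (hrr : A.R + A.rh ≤ rr)
    {j : Bool} {y E : ℝ} (hy : |y - A.z j| ≤ A.R) (hE : E ∈ A.W) :
    C.Step A.ρ A.B A.η E (y - A.ll (A.z j) * c.α) (A.ll (A.z j)) := by
  have hl := A.ll_spec (A.z j)
  refine A.step hE ⟨hl.2.2 y hy, ?_, fun t h1 h2 ht => ?_⟩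
  · rw [sub_add_cancel]; exact A.memE (j := j) (m := 0) (by simpa using hy)
  · obtain ⟨j', m, h⟩ := ht
    have := hnon j j' (t - A.ll (A.z j)) m (by omega) (by rw [abs_of_neg] <;> omega)
    have e : A.z j + (t - A.ll (A.z j) : ℤ) * c.α - m - A.z j' =
      (y - A.ll (A.z j) * c.α + t * c.α - m - A.z j') - (y - A.z j) := by push_cast; ring
    rw [e] at this
    have := abs_sub (y - A.ll (A.z j) * c.α + t * c.α - m - A.z j') (y - A.z j)
    linarith

lemma stepR_keep (hnon : A.NonRes Ret rr) (hRet : A.h + C.H1 + C.k ≤ Ret) (hrr : A.R + A.rh ≤ rr)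
    {j : Bool} {y E : ℝ} (hy : |y - A.z j| ≤ A.R) (hE : E ∈ A.W) :
    C.Step A.ρ A.B A.η E (y + (C.k + 1) * c.α) (A.lr (A.z j + (C.k + 1) * c.α)) := by
  set l := A.lr (A.z j + (C.k + 1) * c.α) with hl'
  have hl := A.lr_spec (A.z j + (C.k + 1) * c.α)
  rw [← hl'] at hl
  refine A.step hE ⟨A.memS (j := j) (m := 0) (by simpa using hy), hl.2.2 _ (by
    rwa [add_sub_add_right_eq_sub]), fun t h1 h2 ht => ?_⟩
  obtain ⟨j', m, h⟩ := ht
  have := hnon j j' (C.k + 1 + t) m (by omega) (by rw [abs_of_pos] <;> omega)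
  have e : A.z j + (C.k + 1 + t : ℤ) * c.α - m - A.z j' =
    (y + (C.k + 1) * c.α + t * c.α - m - A.z j') - (y - A.z j) := by push_cast; ring
  rw [e] at this
  have := abs_sub (y + (C.k + 1) * c.α + t * c.α - m - A.z j') (y - A.z j)
  linarith

lemma isAt_Gn (hnon : A.NonRes Ret rr) (hRet : A.h + C.H1 + C.k ≤ Ret) (hrr : A.R + A.rh ≤ rr)
    {j : Bool} {y E : ℝ} (hy : |y - A.z j| ≤ A.R) (hE : E ∈ A.W) : IsAt (A.Gn j) y E := by
  have hL := (stepL_keep hnon hRet hrr hy hE).good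
  have hR := (stepR_keep hnon hRet hrr hy hE).good
  exact (C.isν _ y (A.near0 hy) E (A.W_sub hE)).mul
    (c.isAt_gf ((c.isAt_beR hR.ne).shift _) (c.isAt_gaL hL.ne))

lemma Gn_close (hnon : A.NonRes Ret rr) (hRet : A.h + C.H1 + C.k ≤ Ret) (hrr : A.R + A.rh ≤ rr)
    {j : Bool} {y E : ℝ} (hy : |y - A.z j| ≤ A.R) (hE : E ∈ A.W) :
    nrm (A.Gn j y E - C.G (A.par j) y E) ≤ A.eh := by
  have hL := stepL_keep hnon hRet hrr hy hE
  have hR := stepR_keep hnon hRet hrr hy hE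
  have hl := (A.ll_spec (A.z j)).1
  have hr := (A.lr_spec (A.z j + (C.k + 1) * c.α)).1
  have h1 := hL.toNearL (A.h_le.trans hl)
  rw [sub_add_cancel] at h1
  have := C.approx_near (j := A.par j) (y := y) (m := 0) (by simpa using A.near0 hy) (A.W_sub hE) h1
    (hR.toNearR (A.h_le.trans hr)) (hL.good.hGa.trans A.num.B'_le)
  simp only [Int.cast_zero, sub_zero] at this
  exact this

lemma wn_close (hnon : A.NonRes Ret rr) (hRet : A.h + C.H1 + C.k ≤ Ret) (hrr : A.R + A.rh ≤ rr)
    {j : Bool} {y E : ℝ} (hy : |y - A.z j| ≤ A.R) (hE : E ∈ A.W) :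
    |A.wn j y E - C.w (A.par j) y E| ≤ A.eh := by
  have hL := stepL_keep hnon hRet hrr hy hE
  have hl := (A.ll_spec (A.z j)).1
  have h1 := hL.toNearL (A.h_le.trans hl)
  rw [sub_add_cancel] at h1
  have := C.approxw_near (j := A.par j) (y := y) (m := 0) (by simpa using A.near0 hy) (A.W_sub hE) h1
  simp only [Int.cast_zero, sub_zero] at this
  exact this

/-- Refinement without resonance: the blocks are kept. -/
theorem keep (hnon : A.NonRes Ret rr) (hRet : A.h + C.H1 + C.k ≤ Ret) (hrr : A.R + A.rh ≤ rr)
    {rD : ℝ} (hrD : rD + A.rh ≤ A.R) (h2 : 2 * A.rh ≤ rD) (hrr2 : 2 * rD + 2 * A.rh ≤ rr)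
    (ctr : Bool → ℝ) (hctr : ∀ j, |ctr j - A.z j| ≤ A.rh) :
    ∃ C' : Core c, C'.Spec A.W ctr (2 * A.rh) rD C.k A.h Ret C.H1 A.ρ A.B (2 * C.K) C.νb C.νlow
      A.Gn A.wn := by
  have hz : ∀ {j y}, |y - ctr j| ≤ rD → |y - A.z j| ≤ A.R := fun {j y} hy => by
    have := abs_sub_le y (ctr j) (A.z j)
    linarith [hctr j]
  have hrh := A.rh_pos
  have hK := C.K_pos
  let N : C.Nxt :=
    { W := A.W
      ctr := ctr
      r := 2 * A.rh
      rD := rD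
      k := C.k
      h := A.h
      Ret := Ret
      H := C.H1
      ρ := A.ρ
      B := A.B
      K := 2 * C.K
      νb := C.νb
      νlow := C.νlow
      ν := fun j => C.ν (A.par j)
      l0 := fun j => A.ll (A.z j)
      r0 := fun j => A.lr (A.z j + (C.k + 1) * c.α)
      hW := fun E hE => C.hW E (A.W_sub hE)
      r_nonneg := by linarith
      r_le := h2
      ρ_pos := A.ρ_pos
      ρ_le := A.hρ
      B_nonneg := A.B_nonneg
      B_le := A.num.B'_le
      K_pos := by linarith
      νlow_pos := C.νlow_pos
      νb_pos := C.νb_pos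
      good := fun E hE x n h => (A.step hE ⟨h.1, h.2.1, fun t h1 h2 ht => h.2.2 t h1 h2 (by
        obtain ⟨j, m, h3⟩ := ht
        refine ⟨j, m, ?_⟩
        have := abs_sub_le (x + t * c.α - m) (A.z j) (ctr j)
        have := hctr j
        rw [abs_sub_comm] at this
        linarith)⟩).good
      nearE := fun j y m h => A.memE (hz h)
      nearS := fun j y m h => A.memS (hz h)
      ret := fun j j' t m ht h => by
        have h3 := hnon j j' t m ht h
        have e : A.z j + t * c.α - m - A.z j' =
          (ctr j + t * c.α - m - ctr j') + (-(ctr j - A.z j) + (ctr j' - A.z j')) := by ring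
        rw [e] at h3
        have h4 := abs_add_le (ctr j + t * c.α - m - ctr j') (-(ctr j - A.z j) + (ctr j' - A.z j'))
        have h5 := abs_add_le (-(ctr j - A.z j)) (ctr j' - A.z j')
        rw [abs_neg] at h5
        linarith [hctr j, hctr j']
      hk_le := by omega
      cov := fun x0 => by
        obtain ⟨s, hs, h⟩ := A.cov x0
        exact ⟨s, hs, fun x hx => h x (by linarith [A.R_le])⟩
      hH := A.hh
      hb := A.hb
      hl0 := fun j => by have := A.ll_spec (A.z j); omega
      hr0 := fun j => by have := A.lr_spec (A.z j + (C.k + 1) * c.α); omega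
      memL := fun j y hy => (A.ll_spec (A.z j)).2.2 y (hz hy)
      memR := fun j y hy => (A.lr_spec (A.z j + (C.k + 1) * c.α)).2.2 _ (by
        rw [add_sub_add_right_eq_sub]; exact hz hy)
      isν := fun j y hy E hE => C.isν _ y (A.near0 (hz hy)) E (A.W_sub hE)
      ν_le := fun j y hy E hE => C.ν_le _ y (A.near0 (hz hy)) E (A.W_sub hE)
      ν_ge := fun j y hy E hE => C.ν_ge _ y (A.near0 (hz hy)) E (A.W_sub hE)
      G_le := fun j y hy E hE => by
        have h1 := Gn_close hnon hRet hrr (hz hy) hE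
        have h2 := nrm_le_add (A.Gn j y E) (C.G (A.par j) y E)
        have h3 := C.G_le _ y (A.near0 (hz hy)) E (A.W_sub hE)
        have h4 := A.eh_le
        have h5 := A.num.δ_le
        exact h2.trans (by linarith)
      C11_le := fun j y hy E hE => (C.C11_le _ y (A.near0 (hz hy)) E (A.W_sub hE)).trans (by
        have := abs_nonneg (C.ν (A.par j) y E).v0
        nlinarith) }
  exact ⟨N.core, by constructor <;> rfl⟩

end keep

end Ref
end Core

namespace Core
open Ctx

variable {c : Ctx}

namespace Ref

/-- A resonance between the two new centres. -/
structure Res {C : Core c} (A : C.Ref) where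
  a : Bool
  n : ℕ
  m0 : ℤ
  Ret : ℕ
  R : ℝ
  rr : ℝ
  D : ℝ
  hn : C.Ret < n
  hres : |A.z a + n * c.α - m0 - A.z (!a)| ≤ rr
  hsame : ∀ t m : ℤ, t ≠ 0 → |t| ≤ Ret → D < |t * c.α - m|
  hR : R + rr ≤ A.R
  hD : 2 * R + A.rh + rr ≤ D
  hRet : A.h + C.H1 + C.k + n ≤ Ret
  R_nonneg : 0 ≤ R

namespace Res

variable {C : Core c} {A : C.Ref} (M : A.Res)

/-- Length of the middle segment. -/
def m2 : ℕ := M.n - C.k - 1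

lemma n_eq : M.n = C.k + 1 + M.m2 := by
  have := M.hn; have := C.hk_le; unfold m2; omega

lemma h_le_m2 : C.h ≤ M.m2 := by
  have := M.hn; have := C.hk_le; unfold m2; omega

lemma rr_nonneg : 0 ≤ M.rr := (abs_nonneg _).trans M.hres

lemma nearb {y : ℝ} (hy : |y - A.z M.a| ≤ M.R) : |y + M.n * c.α - M.m0 - A.z (!M.a)| ≤ A.R := by
  have e : y + M.n * c.α - M.m0 - A.z (!M.a) =
    (y - A.z M.a) + (A.z M.a + M.n * c.α - M.m0 - A.z (!M.a)) := by ring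
  rw [e]
  have := abs_add_le (y - A.z M.a) (A.z M.a + M.n * c.α - M.m0 - A.z (!M.a))
  linarith [M.hres, M.hR]

lemma neara {y : ℝ} (hy : |y - A.z M.a| ≤ M.R) : |y - A.z M.a| ≤ A.R := by
  linarith [M.hR, M.rr_nonneg]

lemma not_visit {y : ℝ} (hy : |y - A.z M.a| ≤ M.R) {i : ℤ} (hi : i ≠ 0) (hin : i ≠ M.n)
    (h1 : |i| ≤ M.Ret) (h2 : |i - M.n| ≤ M.Ret) : y + i * c.α ∉ balls A.z A.rh := by
  rintro ⟨j, m, h⟩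
  have hD := M.hD
  have h0 := M.R_nonneg
  have hrr := M.rr_nonneg
  by_cases hj : j = M.a
  · subst hj
    have := M.hsame i m hi h1
    have e : i * c.α - m = (y + i * c.α - m - A.z M.a) - (y - A.z M.a) := by ring
    rw [e] at this
    have := abs_sub (y + i * c.α - m - A.z M.a) (y - A.z M.a)
    linarith
  · have hj' : j = !M.a := by revert hj; cases j <;> cases M.a <;> simp
    subst hj'
    have := M.hsame (i - M.n) (m - M.m0) (by omega) h2
    have e : (i - M.n : ℤ) * c.α - (m - M.m0 : ℤ) = (y + i * c.α - m - A.z (!M.a)) -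
      ((y - A.z M.a) + (A.z M.a + M.n * c.α - M.m0 - A.z (!M.a))) := by push_cast; ring
    rw [e] at this
    have h3 := abs_sub (y + i * c.α - m - A.z (!M.a))
      ((y - A.z M.a) + (A.z M.a + M.n * c.α - M.m0 - A.z (!M.a)))
    have h4 := abs_add_le (y - A.z M.a) (A.z M.a + M.n * c.α - M.m0 - A.z (!M.a))
    linarith [M.hres]

variable {y E : ℝ}

lemma memEb (hy : |y - A.z M.a| ≤ M.R) : y + M.n * c.α ∈ C.E1 :=
  A.memE (j := !M.a) (m := M.m0) (M.nearb hy)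

lemma memSb (hy : |y - A.z M.a| ≤ M.R) : y + M.n * c.α + (C.k + 1) * c.α ∈ C.S1 :=
  A.memS (j := !M.a) (m := M.m0) (M.nearb hy)

lemma memEa (hy : |y - A.z M.a| ≤ M.R) : y ∈ C.E1 :=
  A.memE (j := M.a) (m := 0) (by simpa using M.neara hy)

lemma memSa (hy : |y - A.z M.a| ≤ M.R) : y + (C.k + 1) * c.α ∈ C.S1 :=
  A.memS (j := M.a) (m := 0) (by simpa using M.neara hy)

/-- Length of the left reference segment. -/
def l : ℕ := A.ll (A.z M.a)
/-- Length of the right reference segment. -/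
def q : ℕ := A.lr (A.z (!M.a) + (C.k + 1) * c.α)

lemma l_mem : A.h ≤ M.l ∧ M.l < A.h + C.H1 := by have := A.ll_spec (A.z M.a); exact ⟨this.1, this.2.1⟩

lemma q_mem : A.h ≤ M.q ∧ M.q < A.h + C.H1 := by
  have := A.lr_spec (A.z (!M.a) + (C.k + 1) * c.α); exact ⟨this.1, this.2.1⟩

lemma memL (hy : |y - A.z M.a| ≤ M.R) : y - M.l * c.α ∈ C.S1 :=
  (A.ll_spec (A.z M.a)).2.2 y (M.neara hy)

lemma memR (hy : |y - A.z M.a| ≤ M.R) :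
    y + M.n * c.α + (C.k + 1) * c.α + M.q * c.α ∈ C.E1 := by
  have := (A.lr_spec (A.z (!M.a) + (C.k + 1) * c.α)).2.2 (y + M.n * c.α - M.m0 + (C.k + 1) * c.α)
    (by rw [add_sub_add_right_eq_sub]; exact M.nearb hy)
  rw [← C.E1_int _ M.m0] at this
  convert this using 1
  unfold q; ring

lemma stepL (hy : |y - A.z M.a| ≤ M.R) (hE : E ∈ A.W) :
    C.Step A.ρ A.B A.η E (y - M.l * c.α) M.l := by
  refine A.step hE ⟨M.memL hy, by rw [sub_add_cancel]; exact M.memEa hy, fun t h1 h2 => ?_⟩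
  have h3 := M.l_mem; have h4 := M.hRet; have h5 := M.hn
  have := M.not_visit hy (i := t - M.l) (by omega) (by omega) (by rw [abs_le]; omega)
    (by rw [abs_le]; omega)
  convert this using 2; push_cast; ring

lemma stepM (hy : |y - A.z M.a| ≤ M.R) (hE : E ∈ A.W) :
    C.Step A.ρ A.B A.η E (y + (C.k + 1) * c.α) M.m2 := by
  have h3 := M.n_eq; have h4 := M.hRet
  refine A.step hE ⟨M.memSa hy, ?_, fun t h1 h2 => ?_⟩
  · convert M.memEb hy using 1; rw [M.n_eq]; push_cast; ring
  have := M.not_visit hy (i := C.k + 1 + t) (by omega) (by omega) (by rw [abs_le]; omega)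
    (by rw [abs_le]; omega)
  convert this using 2; push_cast; ring

lemma stepR (hy : |y - A.z M.a| ≤ M.R) (hE : E ∈ A.W) :
    C.Step A.ρ A.B A.η E (y + M.n * c.α + (C.k + 1) * c.α) M.q := by
  have h3 := M.q_mem; have h4 := M.hRet
  refine A.step hE ⟨M.memSb hy, M.memR hy, fun t h1 h2 => ?_⟩
  have := M.not_visit hy (i := M.n + (C.k + 1 + t)) (by omega) (by omega) (by rw [abs_le]; omega)
    (by rw [abs_le]; omega)
  convert this using 2; push_cast; ring

/-- Left direction. -/
def gL (y E : ℝ) : Jet := c.gaL y E M.l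
/-- Right direction. -/
def bR (y E : ℝ) : Jet := c.beR (y + M.n * c.α + (C.k + 1) * c.α) E M.q
/-- Middle matrix. -/
def X (y E : ℝ) : JM := c.Mj (y + (C.k + 1) * c.α) E M.m2
/-- First normalising factor. -/
def νa (y E : ℝ) : Jet := C.ν (A.par M.a) y E
/-- Second normalising factor. -/
def νb (y E : ℝ) : Jet := C.ν (A.par (!M.a)) (y + M.n * c.α - M.m0) E
/-- First coupling function. -/
def f (y E : ℝ) : Jet := M.νa y E * gf (M.X y E).Be (c.blk y E C.k) (M.gL y E)
/-- Second coupling function. -/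
def g (y E : ℝ) : Jet := M.νb y E * gf (M.bR y E) (c.blk (y + M.n * c.α) E C.k) (M.X y E).Ga
/-- Weight at the first visit. -/
def wa (y E : ℝ) : Jet := M.νa y E * w2 (c.blk y E C.k) (M.gL y E)
/-- Weight at the second visit. -/
def wb (y E : ℝ) : Jet := M.νb y E * w2 (c.blk (y + M.n * c.α) E C.k) (M.X y E).Ga
/-- Dual weight at the second visit. -/
def zb (y E : ℝ) : Jet := M.νb y E * z2 (M.bR y E) (c.blk (y + M.n * c.α) E C.k)
/-- Contraction of the middle segment. -/
def u (y E : ℝ) : Jet := (M.X y E).U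
/-- Interaction term. -/
def cc (y E : ℝ) : Jet := M.u y E ^ 2 * (M.zb y E * M.wa y E)
/-- Corner entry of the second block. -/
def d (y E : ℝ) : Jet := M.νb y E * c.blk (y + M.n * c.α) E C.k 1 1

lemma hyb (hy : |y - A.z M.a| ≤ M.R) :
    |y + M.n * c.α - M.m0 - C.ctr (A.par (!M.a))| ≤ C.rD := A.near' (M.nearb hy)

lemma hya (hy : |y - A.z M.a| ≤ M.R) : |y - C.ctr (A.par M.a)| ≤ C.rD := A.near0 (M.neara hy)

lemma gf_id (y E : ℝ) : M.g y E * M.d y E - M.zb y E * M.wb y E = M.νb y E ^ 2 := by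
  have := gf_mul_e11 (C := c.blk (y + M.n * c.α) E C.k) (c.det_Mj _ _ _) (M.bR y E) (M.X y E).Ga
  unfold g d zb wb
  linear_combination M.νb y E ^ 2 * this

lemma nrm_gL (hy : |y - A.z M.a| ≤ M.R) (hE : E ∈ A.W) : nrm (M.gL y E) ≤ 2 :=
  (M.stepL hy hE).good.hGa.trans A.num.B'_le

lemma nrm_bR (hy : |y - A.z M.a| ≤ M.R) (hE : E ∈ A.W) : nrm (M.bR y E) ≤ 2 :=
  (M.stepR hy hE).good.hBe.trans A.num.B'_le

lemma nrm_Xg (hy : |y - A.z M.a| ≤ M.R) (hE : E ∈ A.W) : nrm (M.X y E).Ga ≤ 2 :=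
  (M.stepM hy hE).good.hGa.trans A.num.B'_le

lemma nrm_u (hy : |y - A.z M.a| ≤ M.R) (hE : E ∈ A.W) : nrm (M.u y E) ≤ A.ρ ^ M.m2 :=
  (M.stepM hy hE).good.hU

lemma nrm_νa (hy : |y - A.z M.a| ≤ M.R) (hE : E ∈ A.W) : nrm (M.νa y E) ≤ C.νb :=
  C.ν_le _ _ (M.hya hy) E (A.W_sub hE)

lemma nrm_νb (hy : |y - A.z M.a| ≤ M.R) (hE : E ∈ A.W) : nrm (M.νb y E) ≤ C.νb :=
  C.ν_le _ _ (M.hyb hy) E (A.W_sub hE)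

lemma nrm_wa (hy : |y - A.z M.a| ≤ M.R) (hE : E ∈ A.W) :
    nrm (M.wa y E) ≤ C.νb * (3 * C.Q) :=
  nrm_mul_le_of_le (M.nrm_νa hy hE) (nrm_w2_le (C.Q10 _ E (A.W_sub hE)) (C.Q11 _ E (A.W_sub hE))
    (M.nrm_gL hy hE))

lemma nrm_wb (hy : |y - A.z M.a| ≤ M.R) (hE : E ∈ A.W) :
    nrm (M.wb y E) ≤ C.νb * (3 * C.Q) :=
  nrm_mul_le_of_le (M.nrm_νb hy hE) (nrm_w2_le (C.Q10 _ E (A.W_sub hE)) (C.Q11 _ E (A.W_sub hE))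
    (M.nrm_Xg hy hE))

lemma nrm_zb (hy : |y - A.z M.a| ≤ M.R) (hE : E ∈ A.W) :
    nrm (M.zb y E) ≤ C.νb * (3 * C.Q) :=
  nrm_mul_le_of_le (M.nrm_νb hy hE) (nrm_z2_le (C.Q01 _ E (A.W_sub hE)) (C.Q11 _ E (A.W_sub hE))
    (M.nrm_bR hy hE))

lemma nrm_cc (hy : |y - A.z M.a| ≤ M.R) (hE : E ∈ A.W) :
    nrm (M.cc y E) ≤ (A.ρ ^ M.m2) ^ 2 * (C.νb * (3 * C.Q)) ^ 2 := by
  have h := M.nrm_u hy hE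
  have h2 := nrm_mul_le_of_le (nrm_mul_le_of_le h h)
    (nrm_mul_le_of_le (M.nrm_zb hy hE) (M.nrm_wa hy hE))
  rw [cc, pow_two (M.u y E)]
  refine h2.trans_eq ?_
  ring

lemma blk_int' (y E : ℝ) : c.blk (y + M.n * c.α - M.m0) E C.k = c.blk (y + M.n * c.α) E C.k := by
  have := c.blk_int (y + M.n * c.α) E (-M.m0) C.k
  rwa [Int.cast_neg, ← sub_eq_add_neg] at this

lemma abs_d_le (hy : |y - A.z M.a| ≤ M.R) (hE : E ∈ A.W) :
    |(M.d y E).v0| ≤ C.K * (M.νb y E).v0 ^ 2 := by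
  have := C.C11_le _ _ (M.hyb hy) E (A.W_sub hE)
  rw [M.blk_int'] at this
  rw [d, mul_v0, abs_mul, ← sq_abs (M.νb y E).v0]
  have h2 := mul_le_mul_of_nonneg_left this (abs_nonneg (M.νb y E).v0)
  refine h2.trans_eq ?_
  unfold νb; ring

lemma νlow_le (hy : |y - A.z M.a| ≤ M.R) (hE : E ∈ A.W) : C.νlow ≤ |(M.νb y E).v0| :=
  C.ν_ge _ _ (M.hyb hy) E (A.W_sub hE)

lemma νlow_le' (hy : |y - A.z M.a| ≤ M.R) (hE : E ∈ A.W) : C.νlow ≤ |(M.νa y E).v0| :=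
  C.ν_ge _ _ (M.hya hy) E (A.W_sub hE)

lemma u_ge (hy : |y - A.z M.a| ≤ M.R) (hE : E ∈ A.W) :
    (c.b ^ (10 * M.m2))⁻¹ ≤ |(M.u y E).v0| := by
  have h1 := (abs_v0_le _).trans (c.nrm_Mj (C.hW E (A.W_sub hE)) (y + (C.k + 1) * c.α) M.m2 0 0)
  have h2 := (M.stepM hy hE).good.ne
  rw [u, U, inv_v0, abs_inv]
  exact inv_anti₀ (abs_pos.mpr h2) h1

lemma f_close (hy : |y - A.z M.a| ≤ M.R) (hE : E ∈ A.W) :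
    nrm (M.f y E - C.G (A.par M.a) y E) ≤ A.eh := by
  have hL := M.stepL hy hE
  have hM := M.stepM hy hE
  have h1 := hL.toNearL (A.h_le.trans M.l_mem.1)
  rw [sub_add_cancel] at h1
  have := C.approx_near (j := A.par M.a) (y := y) (m := 0) (by simpa using M.hya hy) (A.W_sub hE) h1
    (hM.toNearR M.h_le_m2) (hL.good.hGa.trans A.num.B'_le)
  simp only [Int.cast_zero, sub_zero] at this
  exact this

lemma wa_close (hy : |y - A.z M.a| ≤ M.R) (hE : E ∈ A.W) :
    |(M.wa y E).v0 - C.w (A.par M.a) y E| ≤ A.eh := by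
  have hL := M.stepL hy hE
  have h1 := hL.toNearL (A.h_le.trans M.l_mem.1)
  rw [sub_add_cancel] at h1
  have := C.approxw_near (j := A.par M.a) (y := y) (m := 0) (by simpa using M.hya hy) (A.W_sub hE) h1
  simp only [Int.cast_zero, sub_zero] at this
  exact this

lemma nearL_mid (hy : |y - A.z M.a| ≤ M.R) (hE : E ∈ A.W) :
    C.NearL (y + M.n * c.α) E A.η (M.X y E).Ga := by
  have h := (M.stepM hy hE).toNearL M.h_le_m2
  have e : y + (C.k + 1) * c.α + M.m2 * c.α = y + M.n * c.α := by
    rw [M.n_eq]; push_cast; ring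
  rwa [e] at h

lemma g_close (hy : |y - A.z M.a| ≤ M.R) (hE : E ∈ A.W) :
    nrm (M.g y E - C.G (A.par (!M.a)) (y + M.n * c.α - M.m0) E) ≤ A.eh :=
  C.approx_near (j := A.par (!M.a)) (y := y + M.n * c.α) (m := M.m0) (M.hyb hy) (A.W_sub hE)
    (M.nearL_mid hy hE) ((M.stepR hy hE).toNearR (A.h_le.trans M.q_mem.1)) (M.nrm_Xg hy hE)

lemma wb_close (hy : |y - A.z M.a| ≤ M.R) (hE : E ∈ A.W) :
    |(M.wb y E).v0 - C.w (A.par (!M.a)) (y + M.n * c.α - M.m0) E| ≤ A.eh :=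
  C.approxw_near (j := A.par (!M.a)) (y := y + M.n * c.α) (m := M.m0) (M.hyb hy) (A.W_sub hE)
    (M.nearL_mid hy hE)

lemma isAt_X (y E : ℝ) (i j : Fin 2) : IsAt (fun y E => M.X y E i j) y E :=
  (c.isAt_Mj _ E M.m2 i j).shift _

lemma isAt_u (hy : |y - A.z M.a| ≤ M.R) (hE : E ∈ A.W) : IsAt M.u y E :=
  (M.isAt_X y E 0 0).inv (M.stepM hy hE).good.ne

lemma isAt_gL (hy : |y - A.z M.a| ≤ M.R) (hE : E ∈ A.W) : IsAt M.gL y E :=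
  c.isAt_gaL (M.stepL hy hE).good.ne

lemma isAt_bR (hy : |y - A.z M.a| ≤ M.R) (hE : E ∈ A.W) : IsAt M.bR y E := by
  have h := (c.isAt_beR (M.stepR hy hE).good.ne)
  rw [add_assoc] at h
  have h2 := h.shift
  unfold bR
  simpa only [← add_assoc] using h2

lemma isAt_νa (hy : |y - A.z M.a| ≤ M.R) (hE : E ∈ A.W) : IsAt M.νa y E :=
  C.isν _ _ (M.hya hy) E (A.W_sub hE)

lemma isAt_νb (hy : |y - A.z M.a| ≤ M.R) (hE : E ∈ A.W) : IsAt M.νb y E := by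
  have := C.isν _ _ (M.hyb hy) E (A.W_sub hE)
  have e : ∀ y, y + M.n * c.α - M.m0 = y + (M.n * c.α - M.m0) := fun y => by ring
  unfold νb
  simp only [e] at this ⊢
  exact this.shift _

lemma isAt_f (hy : |y - A.z M.a| ≤ M.R) (hE : E ∈ A.W) : IsAt M.f y E :=
  (M.isAt_νa hy hE).mul (c.isAt_gf ((M.isAt_X y E 0 1).mul (M.isAt_u hy hE)) (M.isAt_gL hy hE))

lemma isAt_g (hy : |y - A.z M.a| ≤ M.R) (hE : E ∈ A.W) : IsAt M.g y E := by
  have h := fun i j => (c.isAt_Mj (y + M.n * c.α) E (C.k + 1) i j).shift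
  have hγ := (M.isAt_X y E 1 0).mul (M.isAt_u hy hE)
  have hβ := M.isAt_bR hy hE
  have := (((h 0 0).add ((h 0 1).mul hγ)).add (hβ.mul (h 1 0))).add ((hβ.mul hγ).mul (h 1 1))
  exact (M.isAt_νb hy hE).mul this

/-- The merged normalising factor. -/
def νm (s y E : ℝ) : Jet := cst s * (M.νa y E * M.νb y E * M.u y E)

lemma blk_eq (y E : ℝ) : c.blk y E (C.k + M.n) =
    c.blk (y + M.n * c.α) E C.k * M.X y E * c.blk y E C.k := by
  unfold blk
  have e : y + ((M.m2 + (C.k + 1) : ℕ) : ℝ) * c.α = y + M.n * c.α := by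
    rw [M.n_eq]; push_cast; ring
  have h1 := c.Mj_add y E (C.k + 1) (M.m2 + (C.k + 1))
  rw [c.Mj_add y E M.m2 (C.k + 1), e, ← mul_assoc] at h1
  rw [show C.k + M.n + 1 = C.k + 1 + (M.m2 + (C.k + 1)) by have := M.n_eq; omega, h1]
  unfold X
  push_cast
  rfl

/-- The merged coupling function. -/
def Gm (s y E : ℝ) : Jet := cst s * (M.f y E * M.g y E + M.cc y E)

/-- The merged energy weight. -/
def wm (s y E : ℝ) : ℝ := s * ((M.wb y E).v0 * (M.f y E).v0 +
  (M.u y E).v0 ^ 2 * (M.d y E).v0 * (M.wa y E).v0)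

lemma Gm_eq (s : ℝ) (hy : |y - A.z M.a| ≤ M.R) (hE : E ∈ A.W) : M.νm s y E *
    gf (c.beR (y + ((C.k + M.n : ℕ) + 1) * c.α) E M.q) (c.blk y E (C.k + M.n)) (c.gaL y E M.l) =
    M.Gm s y E := by
  have hX := (M.stepM hy hE).good.ne
  have e : y + ((C.k + M.n : ℕ) + 1) * c.α = y + M.n * c.α + (C.k + 1) * c.α := by push_cast; ring
  rw [M.blk_eq, gf_join (X := M.X y E) (c.det_Mj _ _ _) hX, e]
  have h2 := mul_U (X := M.X y E) hX
  unfold νm Gm cc f g zb wa gL bR u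
  linear_combination (cst s * M.νa y E * M.νb y E * (gf (M.X y E).Be (c.blk y E C.k) (c.gaL y E M.l) *
    gf (c.beR (y + M.n * c.α + (C.k + 1) * c.α) E M.q) (c.blk (y + M.n * c.α) E C.k) (M.X y E).Ga +
    (M.X y E).U ^ 2 * z2 (c.beR (y + M.n * c.α + (C.k + 1) * c.α) E M.q)
      (c.blk (y + M.n * c.α) E C.k) * w2 (c.blk y E C.k) (c.gaL y E M.l))) * h2

lemma wm_eq (s : ℝ) (hy : |y - A.z M.a| ≤ M.R) (hE : E ∈ A.W) :
    (M.νm s y E * w2 (c.blk y E (C.k + M.n)) (c.gaL y E M.l)).v0 = M.wm s y E := by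
  have hX := (M.stepM hy hE).good.ne
  have h2 := mul_U (X := M.X y E) hX
  have : M.νm s y E * w2 (c.blk y E (C.k + M.n)) (c.gaL y E M.l) =
      cst s * (M.wb y E * M.f y E + M.u y E ^ 2 * M.d y E * M.wa y E) := by
    rw [M.blk_eq, w2_join (X := M.X y E) (c.det_Mj _ _ _) hX]
    unfold νm f wb wa d gL u
    linear_combination (cst s * M.νa y E * M.νb y E * (w2 (c.blk (y + M.n * c.α) E C.k) (M.X y E).Ga *
      gf (M.X y E).Be (c.blk y E C.k) (c.gaL y E M.l) + (M.X y E).U ^ 2 *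
      c.blk (y + M.n * c.α) E C.k 1 1 * w2 (c.blk y E C.k) (c.gaL y E M.l))) * h2
  rw [this]
  simp only [wm, mul_v0, add_v0, pow_two, cst]

/-- The merged coupling function is smooth. -/
lemma isAt_Gm (s : ℝ) (hy : |y - A.z M.a| ≤ M.R) (hE : E ∈ A.W) : IsAt (M.Gm s) y E := by
  have hu := M.isAt_u hy hE
  have hγ := (M.isAt_X y E 1 0).mul hu
  have hβ := M.isAt_bR hy hE
  have h := fun i j => (c.isAt_Mj (y + M.n * c.α) E (C.k + 1) i j).shift
  have hz : IsAt M.zb y E := (M.isAt_νb hy hE).mul ((h 0 1).add (hβ.mul (h 1 1)))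
  have hw : IsAt M.wa y E := (M.isAt_νa hy hE).mul ((c.isAt_Mj y E (C.k + 1) 1 0).add
    ((c.isAt_Mj y E (C.k + 1) 1 1).mul (M.isAt_gL hy hE)))
  have h2 := (hu.mul hu).mul (hz.mul hw)
  have h3 : IsAt M.cc y E := by
    unfold cc; simpa only [pow_two] using h2
  exact (((M.isAt_f hy hE).mul (M.isAt_g hy hE)).add h3).cst_mul s

lemma isAt_νm (s : ℝ) (hy : |y - A.z M.a| ≤ M.R) (hE : E ∈ A.W) : IsAt (M.νm s) y E :=
  (((M.isAt_νa hy hE).mul (M.isAt_νb hy hE)).mul (M.isAt_u hy hE)).cst_mul s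

/-- Refinement with a resonance: the two blocks are merged. -/
theorem merge {s : ℝ} (hs : |s| = 1) {x r rD K : ℝ} (hx : |x - A.z M.a| + rD ≤ M.R)
    (hr : |x - A.z M.a| + A.rh + M.rr ≤ r) (hrD : r ≤ rD) (hD : 2 * rD ≤ M.D)
    (hK1 : (2 * C.K) ^ 2 + (C.νb * (3 * C.Q)) ^ 2 ≤ K)
    (hK2 : c.b ^ (10 * (C.k + M.n + 1)) ≤ K * (C.νlow ^ 2 * (c.b ^ (10 * M.m2))⁻¹)) :
    ∃ C' : Core c, C'.Spec A.W (fun _ => x) r rD (C.k + M.n) A.h M.Ret C.H1 A.ρ A.B K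
      (C.νb ^ 2) (C.νlow ^ 2 * (c.b ^ (10 * M.m2))⁻¹) C'.G C'.w ∧
      (∀ j y E, |y - x| ≤ rD → E ∈ A.W → C'.G j y E = M.Gm s y E) ∧
      (∀ j y E, |y - x| ≤ rD → E ∈ A.W → C'.w j y E = M.wm s y E) ∧
      (∀ j, C'.G j = C'.G true) ∧ ∀ j, C'.w j = C'.w true := by
  have hz : ∀ {y}, |y - x| ≤ rD → |y - A.z M.a| ≤ M.R := fun {y} hy => by
    have := abs_sub_le y x (A.z M.a)
    linarith
  have hb := c.one_le_b
  have hb0 : 0 < c.b := by linarith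
  have hρ1 : A.ρ ^ M.m2 ≤ 1 := pow_le_one₀ A.ρ_pos.le (by
    have := one_le_pow₀ hb (n := 6); have := A.hρ; have := A.ρ_pos; nlinarith)
  have hρ0 : 0 ≤ A.ρ ^ M.m2 := pow_nonneg A.ρ_pos.le _
  have hr0 : 0 ≤ r := by
    have := abs_nonneg (x - A.z M.a); have := A.rh_pos; have := M.rr_nonneg; linarith
  have hνl : 0 < C.νlow ^ 2 * (c.b ^ (10 * M.m2))⁻¹ := by have := C.νlow_pos; positivity
  have hK0 : 0 < K := by
    by_contra h
    push Not at h
    have h1 : 0 < c.b ^ (10 * (C.k + M.n + 1)) := by positivity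
    nlinarith
  have hwn : ∀ {y : ℝ} {m : ℤ}, |y - m - x| ≤ rD → |(y - m) - A.z M.a| ≤ M.R := fun h => hz h
  have ecast : ∀ y : ℝ, y + ((C.k + M.n : ℕ) + 1) * c.α = y + M.n * c.α + (C.k + 1) * c.α :=
    fun y => by push_cast; ring
  have hνge : ∀ y, |y - x| ≤ rD → ∀ E ∈ A.W,
      C.νlow ^ 2 * (c.b ^ (10 * M.m2))⁻¹ ≤ |(M.νm s y E).v0| := fun y hy E hE => by
    have h1 := M.νlow_le (hz hy) hE
    have h2 := M.νlow_le' (hz hy) hE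
    have h3 := M.u_ge (hz hy) hE
    have h4 := C.νlow_pos
    rw [νm]
    simp only [mul_v0, cst, abs_mul, hs, one_mul]
    rw [pow_two]
    gcongr
  let N : C.Nxt :=
    { W := A.W
      ctr := fun _ => x
      r := r
      rD := rD
      k := C.k + M.n
      h := A.h
      Ret := M.Ret
      H := C.H1
      ρ := A.ρ
      B := A.B
      K := K
      νb := C.νb ^ 2
      νlow := C.νlow ^ 2 * (c.b ^ (10 * M.m2))⁻¹
      ν := fun _ => M.νm s
      l0 := fun _ => M.l
      r0 := fun _ => M.q
      hW := fun E hE => C.hW E (A.W_sub hE)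
      r_nonneg := hr0
      r_le := hrD
      ρ_pos := A.ρ_pos
      ρ_le := A.hρ
      B_nonneg := A.B_nonneg
      B_le := A.num.B'_le
      K_pos := hK0
      νlow_pos := hνl
      νb_pos := by have := C.νb_pos; positivity
      good := fun E hE y n h => (A.step hE ⟨h.1, h.2.1, fun t h1 h2 ht => by
        obtain ⟨j, m, h3⟩ := ht
        have hrr := M.rr_nonneg
        have hrh := A.rh_pos
        by_cases hj : j = M.a
        · subst hj
          refine h.2.2 t (by push_cast; omega) h2 ⟨true, m, ?_⟩
          have := abs_sub_le (y + t * c.α - m) (A.z M.a) x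
          rw [abs_sub_comm (A.z M.a)] at this
          linarith
        · have hj' : j = !M.a := by revert hj; cases j <;> cases M.a <;> simp
          subst hj'
          refine h.2.2 (t - M.n) (by push_cast; omega) (by omega) ⟨true, m - M.m0, ?_⟩
          have e : y + (t - M.n : ℤ) * c.α - (m - M.m0 : ℤ) - x =
            (y + t * c.α - m - A.z (!M.a)) - (A.z M.a + M.n * c.α - M.m0 - A.z (!M.a))
              - (x - A.z M.a) := by push_cast; ring
          rw [e]
          have h4 := abs_sub ((y + t * c.α - m - A.z (!M.a)) -
            (A.z M.a + M.n * c.α - M.m0 - A.z (!M.a))) (x - A.z M.a)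
          have h5 := abs_sub (y + t * c.α - m - A.z (!M.a))
            (A.z M.a + M.n * c.α - M.m0 - A.z (!M.a))
          linarith [M.hres]⟩).good
      nearE := fun j y m h => by
        have := M.memEa (hwn h)
        rwa [← C.E1_int _ m, sub_add_cancel] at this
      nearS := fun j y m h => by
        have := M.memSb (hwn h)
        rw [← C.S1_int _ m] at this
        convert this using 1
        push_cast; ring
      ret := fun j j' t m ht h => by
        have := M.hsame t m ht h
        rw [show x + t * c.α - m - x = t * c.α - m by ring]
        linarith
      hk_le := by have := M.hRet; omega
      cov := fun x0 => by
        obtain ⟨s, hs, h⟩ := A.cov x0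
        refine ⟨s, hs, fun y hy => h y ?_⟩
        have := abs_nonneg (x - A.z M.a); have := M.hR; have := M.rr_nonneg
        linarith [A.R_le]
      hH := A.hh
      hb := A.hb
      hl0 := fun j => by have := M.l_mem; have := M.hRet; omega
      hr0 := fun j => by have := M.q_mem; have := M.hRet; omega
      memL := fun j y hy => M.memL (hz hy)
      memR := fun j y hy => by rw [ecast]; exact M.memR (hz hy)
      isν := fun j y hy E hE => M.isAt_νm s (hz hy) hE
      ν_le := fun j y hy E hE => by
        have h1 := nrm_mul_le_of_le (nrm_mul_le_of_le (M.nrm_νa (hz hy) hE)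
          (M.nrm_νb (hz hy) hE)) ((M.nrm_u (hz hy) hE).trans hρ1)
        rw [νm, nrm_cst_mul, hs, one_mul]
        refine h1.trans_eq ?_
        ring
      ν_ge := fun j => hνge
      G_le := fun j y hy E hE => by
        rw [M.Gm_eq s (hz hy) hE, Gm, nrm_cst_mul, hs, one_mul]
        have hG : ∀ {F F' : Jet}, nrm (F - F') ≤ A.eh → nrm F' ≤ C.K → nrm F ≤ 2 * C.K :=
          fun {F F'} h1 h2 => by
            have := nrm_le_add F F'
            have := A.eh_le; have := A.num.δ_le; have := C.K_pos
            linarith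
        have hf := hG (M.f_close (hz hy) hE) (C.G_le _ _ (M.hya (hz hy)) E (A.W_sub hE))
        have hg := hG (M.g_close (hz hy) hE) (C.G_le _ _ (M.hyb (hz hy)) E (A.W_sub hE))
        have h3 := (M.nrm_cc (hz hy) hE).trans (mul_le_of_le_one_left (sq_nonneg _)
          (pow_le_one₀ hρ0 hρ1 (n := 2)))
        refine ((nrm_add_le _ _).trans (add_le_add (nrm_mul_le_of_le hf hg) h3)).trans ?_
        linarith
      C11_le := fun j y hy E hE => by
        have h1 := (abs_v0_le _).trans (c.nrm_blk (y := y) (C.hW E (A.W_sub hE)) (C.k + M.n) 1 1)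
        exact (h1.trans hK2).trans (mul_le_mul_of_nonneg_left (hνge y hy E hE) hK0.le) }
  exact ⟨N.core, by constructor <;> rfl, fun j y E hy hE => M.Gm_eq s (hz hy) hE,
    fun j y E hy hE => M.wm_eq s (hz hy) hE, fun _ => rfl, fun _ => rfl⟩

end Res
end Ref
end Core

/-- A lower bound for the derivative gives a lower bound for the increment. -/
lemma slope_ge {f f' : ℝ → ℝ} {p q m : ℝ} (hpq : p ≤ q)
    (h : ∀ x ∈ Set.Icc p q, HasDerivAt f (f' x) x) (hm : ∀ x ∈ Set.Icc p q, m ≤ f' x) :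
    m * (q - p) ≤ f q - f p := by
  refine (convex_Icc p q).mul_sub_le_image_sub_of_le_deriv
    (fun x hx => (h x hx).continuousAt.continuousWithinAt)
    (fun x hx => (h x (interior_subset hx)).differentiableAt.differentiableWithinAt)
    (fun x hx => ?_) p ⟨le_rfl, hpq⟩ q ⟨hpq, le_rfl⟩ hpq
  rw [(h x (interior_subset hx)).deriv]
  exact hm x (interior_subset hx)

/-- An upper bound for the derivative gives a Lipschitz bound. -/
lemma lip_le {f f' : ℝ → ℝ} {z R M : ℝ} (h : ∀ x, |x - z| ≤ R → HasDerivAt f (f' x) x)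
    (hM : ∀ x, |x - z| ≤ R → |f' x| ≤ M) {p q : ℝ} (hp : |p - z| ≤ R) (hq : |q - z| ≤ R) :
    |f q - f p| ≤ M * |q - p| := by
  have hc : Convex ℝ {x : ℝ | |x - z| ≤ R} := by
    have := convex_closedBall z R
    simpa [Metric.closedBall, Real.dist_eq] using this
  exact hc.norm_image_sub_le_of_norm_hasDerivWithin_le (f := f) (f' := f')
    (fun x hx => (h x hx).hasDerivWithinAt) (fun x hx => hM x hx) hp hq

/-- Two-sided growth of a function with positive slope. -/
lemma slope_abs {f f' : ℝ → ℝ} {z R m : ℝ} (h : ∀ x, |x - z| ≤ R → HasDerivAt f (f' x) x)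
    (hm : ∀ x, |x - z| ≤ R → m ≤ f' x) {p q : ℝ} (hp : |p - z| ≤ R) (hq : |q - z| ≤ R) :
    m * |q - p| ≤ |f q - f p| := by
  wlog hpq : p ≤ q generalizing p q
  · have := this hq hp (le_of_not_ge hpq)
    rwa [abs_sub_comm, abs_sub_comm (f q)]
  have hin : ∀ x ∈ Set.Icc p q, |x - z| ≤ R := fun x hx => by
    rw [abs_le] at *; constructor <;> linarith [hx.1, hx.2]
  have := slope_ge hpq (fun x hx => h x (hin x hx)) (fun x hx => hm x (hin x hx))
  rw [abs_of_nonneg (by linarith : 0 ≤ q - p)]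
  exact this.trans (le_abs_self _)

/-- Existence of a zero near an approximate zero. -/
lemma exists_zero {f f' : ℝ → ℝ} {z R m : ℝ} (hm0 : 0 < m)
    (h : ∀ x, |x - z| ≤ R → HasDerivAt f (f' x) x)
    (hm : ∀ x, |x - z| ≤ R → m ≤ f' x) {ε : ℝ} (hf : |f z| ≤ m * ε) (hε : ε ≤ R) :
    ∃ x, |x - z| ≤ ε ∧ f x = 0 := by
  have hε0 : 0 ≤ ε := by
    by_contra hcon
    have := (abs_nonneg _).trans hf
    nlinarith
  have hin : ∀ x ∈ Set.Icc (z - ε) (z + ε), |x - z| ≤ R := fun x hx => by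
    rw [abs_le]; constructor <;> linarith [hx.1, hx.2]
  have h1 := slope_ge (p := z - ε) (q := z) (f := f) (f' := f') (m := m) (by linarith)
    (fun x hx => h x (hin x ⟨hx.1, by linarith [hx.2]⟩))
    (fun x hx => hm x (hin x ⟨hx.1, by linarith [hx.2]⟩))
  have h2 := slope_ge (p := z) (q := z + ε) (f := f) (f' := f') (m := m) (by linarith)
    (fun x hx => h x (hin x ⟨by linarith [hx.1], hx.2⟩))
    (fun x hx => hm x (hin x ⟨by linarith [hx.1], hx.2⟩))
  rw [abs_le] at hf
  have hc : ContinuousOn f (Set.Icc (z - ε) (z + ε)) := fun x hx =>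
    (h x (hin x hx)).continuousAt.continuousWithinAt
  obtain ⟨x, hx, hx0⟩ := intermediate_value_Icc (by linarith) hc
    (show (0 : ℝ) ∈ Set.Icc _ _ from ⟨by nlinarith, by nlinarith⟩)
  exact ⟨x, by rw [abs_le]; constructor <;> linarith [hx.1, hx.2], hx0⟩

/-- Quadratic lower bound for a uniformly convex function. -/
lemma quad_ge {f f' f2 : ℝ → ℝ} {z R m : ℝ} (h : ∀ x, |x - z| ≤ R → HasDerivAt f (f' x) x)
    (h2 : ∀ x, |x - z| ≤ R → HasDerivAt f' (2 * f2 x) x) (hm : ∀ x, |x - z| ≤ R → m ≤ f2 x)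
    {p q : ℝ} (hp : |p - z| ≤ R) (hq : |q - z| ≤ R) :
    f p + f' p * (q - p) + m * (q - p) ^ 2 ≤ f q := by
  set F : ℝ → ℝ := fun x => f x - f' p * x - m * (x - p) ^ 2
  have hF : ∀ x, |x - z| ≤ R → HasDerivAt F (f' x - f' p - 2 * m * (x - p)) x := fun x hx => by
    have h3 := ((h x hx).sub ((hasDerivAt_id x).const_mul (f' p))).sub
      ((((hasDerivAt_id x).sub_const p).pow 2).const_mul m)
    refine h3.congr_deriv ?_
    simp; ring
  have hsub : ∀ {x y}, |x - z| ≤ R → |y - z| ≤ R → ∀ t ∈ Set.Icc x y, |t - z| ≤ R := by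
    intro x y hx hy t ht
    rw [abs_le] at *; constructor <;> linarith [ht.1, ht.2]
  have key : ∀ {x y}, |x - z| ≤ R → |y - z| ≤ R → x ≤ y → 2 * m * (y - x) ≤ f' y - f' x :=
    fun hx hy hxy => slope_ge hxy (fun t ht => h2 t (hsub hx hy t ht))
      (fun t ht => by linarith [hm t (hsub hx hy t ht)])
  rcases le_total p q with hpq | hpq
  · have := slope_ge (f := F) (m := 0) hpq (fun t ht => hF t (hsub hp hq t ht))
      (fun t ht => by linarith [key hp (hsub hp hq t ht) ht.1])
    simp only [F] at this
    nlinarith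
  · have := slope_ge (f := fun x => -F x) (m := 0) hpq (fun t ht => (hF t (hsub hq hp t ht)).neg)
      (fun t ht => by linarith [key (hsub hq hp t ht) hp ht.2])
    simp only [F] at this
    nlinarith

/-- Away from a point with a negative value, a convex function with a larger value has a
definite slope. -/
lemma convex_slope {f f' f2 : ℝ → ℝ} {z R d : ℝ} (h : ∀ x, |x - z| ≤ R → HasDerivAt f (f' x) x)
    (h2 : ∀ x, |x - z| ≤ R → HasDerivAt f' (2 * f2 x) x) (hm : ∀ x, |x - z| ≤ R → 0 ≤ f2 x)
    (hR0 : 0 ≤ R) (hR : R ≤ 1) (hd0 : 0 < d) {σ x : ℝ} (hσ : |σ| = 1) (hx : |x - z| ≤ R)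
    (hσx : 0 ≤ σ * (x - z)) (hd : d ≤ f x - f z) : d ≤ σ * f' x := by
  have h3 := quad_ge (q := z) h h2 hm hx (by simpa using hR0)
  have hx1 : |x - z| ≤ 1 := hx.trans hR
  rcases eq_or_eq_neg_of_abs_eq hσ with rfl | rfl
  · rw [one_mul] at hσx
    rw [abs_of_nonneg hσx] at hx1
    have h0 : 0 ≤ f' x := by
      by_contra hcon
      nlinarith [mul_nonneg hσx (by linarith : 0 ≤ -f' x)]
    nlinarith [mul_nonneg h0 (by linarith : 0 ≤ 1 - (x - z))]
  · have hσx' : x - z ≤ 0 := by linarith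
    rw [abs_of_nonpos hσx'] at hx1
    have h0 : f' x ≤ 0 := by
      by_contra hcon
      nlinarith [mul_nonneg (by linarith : 0 ≤ -(x - z)) (by linarith : 0 ≤ f' x)]
    nlinarith [mul_nonneg (by linarith : 0 ≤ -f' x) (by linarith : 0 ≤ 1 + (x - z))]

namespace Core
open Ctx

variable {c : Ctx}

/-- Numerical data of one refinement step. -/
structure StepData (C : Core c) (δ ε : ℝ) (h : ℕ) (ρ B η : ℝ) : Prop where
  num : C.StepNum δ ρ B η
  eh_le : C.e + 6 * C.Q * C.νb * η ≤ ε
  hh : C.H1 + 2 ≤ h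
  hb : 2 ≤ c.b
  hρ : ρ * c.b ^ 6 ≤ 1
  cov : c.Cov C.S1 C.E1 (C.rD / 2) C.H1

/-- A core with two transversal critical points. -/
structure StI (C : Core c) (E0 κ : ℝ) (sx sE : Bool → ℝ) : Prop where
  win : ∀ E, |E - E0| ≤ κ ^ 2 → E ∈ C.W
  κ_pos : 0 < κ
  κ_le : κ ≤ 1 / 1000
  K_le : C.K * κ ≤ 1
  rD_ge : κ ≤ C.rD
  r_le : 2 * C.r ≤ C.rD
  sx_abs : ∀ j, |sx j| = 1
  sE_abs : ∀ j, |sE j| = 1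
  sgn_t : sx true * sE true = 1
  sgn_f : sx false * sE false = -1
  zero : ∀ j, (C.G j (C.ctr j) E0).v0 = 0
  dx : ∀ j y E, |y - C.ctr j| ≤ C.rD → |E - E0| ≤ κ ^ 2 → κ ≤ sx j * (C.G j y E).dx
  dE : ∀ j y E, |y - C.ctr j| ≤ C.rD → |E - E0| ≤ κ ^ 2 → κ ≤ sE j * (C.G j y E).dE
  w : ∀ j y E, |y - C.ctr j| ≤ C.rD → |E - E0| ≤ κ ^ 2 → κ ≤ sE j * C.w j y E

/-- A core with a single quadratic critical point. -/
structure StII (C : Core c) (E0 κ s : ℝ) : Prop where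
  win : ∀ E, |E - E0| ≤ κ ^ 2 → E ∈ C.W
  κ_pos : 0 < κ
  κ_le : κ ≤ 1 / 1000
  K_le : C.K * κ ≤ 1
  rD_ge : κ ≤ C.rD
  rD_le : C.rD ≤ 1
  r_le : 2 * C.r ≤ C.rD
  s_abs : |s| = 1
  ctr_eq : ∀ j, C.ctr j = C.ctr true
  G_eq : ∀ j, C.G j = C.G true
  w_eq : ∀ j, C.w j = C.w true
  crit : (C.G true (C.ctr true) E0).dx = 0
  bot : ∀ y, |y - C.ctr true| ≤ C.rD → C.rD / 4 ≤ |y - C.ctr true| → κ ≤ (C.G true y E0).v0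
  dxx : ∀ y E, |y - C.ctr true| ≤ C.rD → |E - E0| ≤ κ ^ 2 → κ ≤ (C.G true y E).dxx
  dE : ∀ y E, |y - C.ctr true| ≤ C.rD → |E - E0| ≤ κ ^ 2 → |(C.G true y E).v0| ≤ κ →
    κ ≤ s * (C.G true y E).dE
  w : ∀ y E, |y - C.ctr true| ≤ C.rD → |E - E0| ≤ κ ^ 2 → |(C.G true y E).v0| ≤ κ →
    κ ≤ s * C.w true y E

/-- Two transversal critical points of a core at a finer scale. -/
structure PreI (C : Core c) (E1 ξ wl : ℝ) (z : Bool → ℝ) (par : Bool → Bool)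
    (sx sE : Bool → ℝ) : Prop where
  win : ∀ E, |E - E1| ≤ ξ → E ∈ C.W
  ξ_pos : 0 < ξ
  ξ_le : ξ ≤ 1 / 1000
  wl_pos : 0 < wl
  K_le : C.K * ξ ≤ 1
  near : ∀ j, |z j - C.ctr (par j)| + ξ ≤ C.rD
  half : ξ ≤ C.rD / 2
  sx_abs : ∀ j, |sx j| = 1
  sE_abs : ∀ j, |sE j| = 1
  sgn_t : sx true * sE true = 1
  sgn_f : sx false * sE false = -1
  zero : ∀ j, (C.G (par j) (z j) E1).v0 = 0
  dx : ∀ j y E, |y - z j| ≤ ξ → |E - E1| ≤ ξ → ξ ≤ sx j * (C.G (par j) y E).dx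
  dE : ∀ j y E, |y - z j| ≤ ξ → |E - E1| ≤ ξ → ξ ≤ sE j * (C.G (par j) y E).dE
  w : ∀ j y E, |y - z j| ≤ ξ → |E - E1| ≤ ξ → wl ≤ sE j * C.w (par j) y E
  cov : ∀ i y (m : ℤ) E, |y - m - C.ctr i| ≤ C.r → |E - E1| ≤ ξ ^ 100 →
    |(C.G i (y - m) E).v0| < ξ ^ 100 →
    ∃ j, ∃ m' : ℤ, |y - m' - z j| ≤ ξ ∧
      (C.G (par j) (y - m') E).v0 = (C.G i (y - m) E).v0

/-- A quadratic critical point of a core at a finer scale. -/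
structure PreII (C : Core c) (E1 κ y wl s z : ℝ) (j0 : Bool) : Prop where
  win : ∀ E, |E - E1| ≤ y ^ 3 → E ∈ C.W
  κ_pos : 0 < κ
  κ_le : κ ≤ 1 / 1000
  y_pos : 0 < y
  y_le : y ≤ κ ^ 10
  wl_pos : 0 < wl
  K_le : C.K * κ ≤ 1
  near : |z - C.ctr j0| + y / κ ^ 3 ≤ C.rD
  half : y / κ ^ 3 ≤ C.rD / 2
  s_abs : |s| = 1
  crit : (C.G j0 z E1).dx = 0
  bot : -y ^ 2 ≤ (C.G j0 z E1).v0
  dxx : ∀ x E, |x - z| ≤ y / κ ^ 3 → |E - E1| ≤ y ^ 3 → κ ≤ (C.G j0 x E).dxx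
  dE : ∀ x E, |x - z| ≤ y / κ ^ 3 → |E - E1| ≤ y ^ 3 → |(C.G j0 x E).v0| ≤ κ →
    κ ≤ s * (C.G j0 x E).dE
  w : ∀ x E, |x - z| ≤ y / κ ^ 3 → |E - E1| ≤ y ^ 3 → |(C.G j0 x E).v0| ≤ κ →
    wl ≤ s * C.w j0 x E
  cov : ∀ i x (m : ℤ) E, |x - m - C.ctr i| ≤ C.r → |E - E1| ≤ y ^ 3 →
    |(C.G i (x - m) E).v0| < y ^ 2 →
    ∃ m' : ℤ, |x - m' - z| ≤ y / κ ^ 3 ∧ |(C.G j0 (x - m') E).v0| < y ^ 2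

variable {C : Core c}

/-- Lipschitz dependence of the coupling function on the energy. -/
lemma lipE (j : Bool) {x E1 ω : ℝ} (hx : |x - C.ctr j| ≤ C.rD)
    (hω : ∀ E, |E - E1| ≤ ω → E ∈ C.W) {E E' : ℝ} (hE : |E - E1| ≤ ω) (hE' : |E' - E1| ≤ ω) :
    |(C.G j x E').v0 - (C.G j x E).v0| ≤ C.K * |E' - E| :=
  lip_le (f := fun E => (C.G j x E).v0) (f' := fun E => (C.G j x E).dE)
    (fun e he => (C.isG j x hx e (hω e he)).hdE)
    (fun e he => (abs_dE_le _).trans (C.G_le j x hx e (hω e he))) hE hE'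

/-- Lipschitz dependence of the coupling function on the phase. -/
lemma lipX (j : Bool) {E z R : ℝ} (hE : E ∈ C.W) (hz : |z - C.ctr j| + R ≤ C.rD) {x x' : ℝ}
    (hx : |x - z| ≤ R) (hx' : |x' - z| ≤ R) :
    |(C.G j x' E).v0 - (C.G j x E).v0| ≤ C.K * |x' - x| := by
  have h : ∀ t, |t - z| ≤ R → |t - C.ctr j| ≤ C.rD := fun t ht =>
    (abs_sub_le t z (C.ctr j)).trans (by linarith)
  exact lip_le (f := fun x => (C.G j x E).v0) (f' := fun x => (C.G j x E).dx)
    (fun e he => (C.isG j e (h e he) E hE).hdx)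
    (fun e he => (abs_dx_le _).trans (C.G_le j e (h e he) E hE)) hx hx'

lemma pow_le_of_small {x : ℝ} (h0 : 0 < x) (h1 : x ≤ 1 / 1000) {m n : ℕ} (hmn : m < n) :
    1000 * x ^ n ≤ x ^ m := by
  have h2 : x ^ n ≤ x ^ (m + 1) := pow_le_pow_of_le_one h0.le (by linarith) hmn
  have h3 : 0 < x ^ m := by positivity
  rw [pow_succ] at h2
  nlinarith

lemma abs_sgn_mul {s t : ℝ} (hs : |s| = 1) : |s * t| = |t| := by rw [abs_mul, hs, one_mul]

/-- A core with two transversal critical points, seen at a finer scale. -/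
lemma StI.zoom {E0 κ ξ : ℝ} {sx sE : Bool → ℝ} (h : C.StI E0 κ sx sE) (hξ : 0 < ξ)
    (hξκ : ξ ≤ κ ^ 10) : C.PreI E0 ξ κ C.ctr id sx sE := by
  have hκ := h.κ_pos
  have hκ1 := h.κ_le
  have h10 : 1000 * κ ^ 10 ≤ κ ^ 2 := pow_le_of_small hκ hκ1 (by norm_num)
  have h2 : 1000 * κ ^ 2 ≤ κ := by simpa using pow_le_of_small hκ hκ1 (show 1 < 2 by norm_num)
  have hξ2 : ξ ≤ κ ^ 2 := by nlinarith [sq_nonneg κ]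
  have hξ1 : ξ ≤ 1 / 1000 := by nlinarith
  have h100 : 1000 * ξ ^ 100 ≤ ξ ^ 2 := pow_le_of_small hξ hξ1 (by norm_num)
  have hs2 : 1000 * ξ ^ 2 ≤ ξ := by simpa using pow_le_of_small hξ hξ1 (show 1 < 2 by norm_num)
  have hrD := h.rD_ge
  have hp : 0 < ξ ^ 100 := by positivity
  refine ⟨fun E hE => h.win E (hE.trans hξ2), hξ, hξ1, hκ, ?_, fun j => ?_, by nlinarith, h.sx_abs,
    h.sE_abs, h.sgn_t, h.sgn_f, h.zero, fun j y E hy hE => ?_, fun j y E hy hE => ?_,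
    fun j y E hy hE => ?_, fun i y m E hy hE hG => ?_⟩
  · nlinarith [h.K_le, C.K_pos]
  · simp; nlinarith
  · exact le_trans (by nlinarith) (h.dx j y E (hy.trans (by nlinarith)) (hE.trans hξ2))
  · exact le_trans (by nlinarith) (h.dE j y E (hy.trans (by nlinarith)) (hE.trans hξ2))
  · exact h.w j y E (hy.trans (by nlinarith)) (hE.trans hξ2)
  · refine ⟨i, m, ?_, rfl⟩
    have hE2 : |E - E0| ≤ κ ^ 2 := hE.trans (by nlinarith)
    have hrp : 0 ≤ C.rD := by linarith
    have h1 := lipE i (x := C.ctr i) (by simpa using hrp) h.win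
      (E := E0) (E' := E) (by simp; positivity) hE2
    rw [h.zero, sub_zero] at h1
    have h3 := slope_abs (f := fun x => sx i * (C.G i x E).v0)
      (f' := fun x => sx i * (C.G i x E).dx) (z := C.ctr i) (R := C.rD) (m := κ)
      (fun x hx => ((C.isG i x hx E (h.win E hE2)).hdx).const_mul _)
      (fun x hx => h.dx i x E hx hE2) (p := C.ctr i) (q := y - m) (by simpa using hrp)
      (hy.trans C.r_le)
    rw [← mul_sub, abs_sgn_mul (h.sx_abs i)] at h3
    have h4 := abs_sub (C.G i (y - m) E).v0 (C.G i (C.ctr i) E).v0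
    have h5 : C.K * |E - E0| ≤ C.K * ξ ^ 100 := by gcongr; exact C.K_pos.le
    have h6 : κ * |y - m - C.ctr i| ≤ ξ ^ 100 + C.K * ξ ^ 100 := by linarith
    have h7 : κ * (κ * |y - m - C.ctr i|) ≤ 2 * ξ ^ 100 := by
      have := mul_le_mul_of_nonneg_left h6 hκ.le
      have h8 := mul_le_mul_of_nonneg_right h.K_le hp.le
      nlinarith
    have h9 : κ ^ 2 * |y - m - C.ctr i| ≤ κ ^ 2 * ξ := by
      have : ξ * ξ ≤ κ ^ 2 * ξ := by gcongr
      nlinarith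
    exact le_of_mul_le_mul_left h9 (by positivity)

end Core

namespace Core
open Ctx

variable {c : Ctx} {C : Core c}

/-- A single quadratic critical point whose critical value is not too low, at a finer scale. -/
lemma StII.zoom_single {E0 κ s y : ℝ} (h : C.StII E0 κ s) (hy : 0 < y) (hyκ : y ≤ κ ^ 10)
    (hbot : -y ^ 2 ≤ (C.G true (C.ctr true) E0).v0) :
    C.PreII E0 κ y κ s (C.ctr true) true := by
  have hκ := h.κ_pos
  have hκ1 := h.κ_le
  have h2 : 1000 * κ ^ 2 ≤ κ := by simpa using pow_le_of_small hκ hκ1 (show 1 < 2 by norm_num)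
  have h10 : 1000 * κ ^ 10 ≤ κ ^ 2 := pow_le_of_small hκ hκ1 (by norm_num)
  have h10' : 1000 * κ ^ 10 ≤ κ ^ 5 := pow_le_of_small hκ hκ1 (by norm_num)
  have hy1 : y ≤ 1 / 1000 := by nlinarith
  have h3 : 1000 * y ^ 3 ≤ y := by simpa using pow_le_of_small hy hy1 (show 1 < 3 by norm_num)
  have hR : y / κ ^ 3 ≤ κ / 1000 := by
    rw [div_le_iff₀ (by positivity)]
    nlinarith [pow_pos hκ 5, pow_pos hκ 2, pow_pos hκ 4]
  have hrD := h.rD_ge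
  have hwin : ∀ E, |E - E0| ≤ y ^ 3 → |E - E0| ≤ κ ^ 2 := fun E hE => hE.trans (by nlinarith)
  have hrp : 0 ≤ C.rD := by linarith
  refine ⟨fun E hE => h.win E (hwin E hE), hκ, hκ1, hy, hyκ, hκ, h.K_le, by simp; linarith,
    by linarith, h.s_abs, h.crit, hbot, fun x E hx hE => h.dxx x E (hx.trans (by linarith)) (hwin E hE),
    fun x E hx hE => h.dE x E (hx.trans (by linarith)) (hwin E hE),
    fun x E hx hE => h.w x E (hx.trans (by linarith)) (hwin E hE),
    fun i x m E hx hE hG => ⟨m, ?_, by rwa [h.G_eq i] at hG⟩⟩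
  rw [h.ctr_eq i] at hx
  rw [h.G_eq i] at hG
  have hx' : |x - m - C.ctr true| ≤ C.rD := hx.trans C.r_le
  have h00 : |E0 - E0| ≤ κ ^ 2 := by simp; positivity
  have h4 := quad_ge (f := fun x => (C.G true x E0).v0) (f' := fun x => (C.G true x E0).dx)
    (f2 := fun x => (C.G true x E0).dxx) (z := C.ctr true) (R := C.rD) (m := κ)
    (fun x hx => (C.isG true x hx E0 (h.win E0 h00)).hdx)
    (fun x hx => (C.isG true x hx E0 (h.win E0 h00)).hdxx)
    (fun x hx => h.dxx x E0 hx h00) (p := C.ctr true) (q := x - m) (by simpa using hrp) hx'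
  rw [h.crit] at h4
  have h5 := lipE true hx' h.win h00 (hwin E hE)
  have h6 : C.K * |E - E0| ≤ C.K * y ^ 3 := by gcongr; exact C.K_pos.le
  rw [abs_lt] at hG
  rw [abs_le] at h5
  have h7 : κ * (κ * (x - m - C.ctr true) ^ 2) ≤ κ * (2 * y ^ 2 + C.K * y ^ 3) := by
    gcongr; linarith
  have h8 := mul_le_mul_of_nonneg_right h.K_le (pow_pos hy 3).le
  have h9 : κ ^ 2 * (x - m - C.ctr true) ^ 2 ≤ y ^ 2 := by nlinarith [pow_pos hy 2, pow_pos hy 3]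
  rw [le_div_iff₀ (by positivity)]
  have h10 : κ * |x - m - C.ctr true| ≤ y := by
    refine abs_le_of_sq_le_sq' ?_ hy.le |>.2
    rw [mul_pow, sq_abs]; exact h9
  have h11 : κ ^ 2 ≤ 1 := by nlinarith
  have h12 : 0 ≤ κ * |x - m - C.ctr true| := by positivity
  calc _ = (κ * |x - m - C.ctr true|) * κ ^ 2 := by ring
    _ ≤ (κ * |x - m - C.ctr true|) * 1 := by gcongr
    _ ≤ y := by linarith

/-- A quadratic critical point with negative critical value splits into two transversal ones. -/
lemma StII.zoom_pair {E0 E1 κ s y : ℝ} (h : C.StII E0 κ s) (hy : 0 < y) (hyκ : y ≤ κ ^ 10)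
    (hE1 : |E1 - E0| ≤ κ ^ 4) (hbot : (C.G true (C.ctr true) E1).v0 ≤ -y ^ 2) :
    ∃ z sx, C.PreI E1 (y ^ 4) κ z (fun _ => true) sx (fun _ => s) := by
  have hκ := h.κ_pos
  have hκ1 := h.κ_le
  have h2 : 1000 * κ ^ 2 ≤ κ := by simpa using pow_le_of_small hκ hκ1 (show 1 < 2 by norm_num)
  have h4 : 1000 * κ ^ 4 ≤ κ ^ 2 := pow_le_of_small hκ hκ1 (by norm_num)
  have h10 : 1000 * κ ^ 10 ≤ κ ^ 2 := pow_le_of_small hκ hκ1 (by norm_num)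
  have hy1 : y ≤ 1 / 1000 := by nlinarith
  have hy4 : 1000 * y ^ 4 ≤ y ^ 3 := pow_le_of_small hy hy1 (by norm_num)
  have hy3 : 1000 * y ^ 3 ≤ y ^ 2 := pow_le_of_small hy hy1 (by norm_num)
  have hy2 : 1000 * y ^ 2 ≤ y := by simpa using pow_le_of_small hy hy1 (show 1 < 2 by norm_num)
  have hrD := h.rD_ge
  have hrD1 := h.rD_le
  have hrp : 0 ≤ C.rD := by linarith
  have hK0 := C.K_pos
  have hp4 : 0 < y ^ 4 := by positivity
  have hp3 : 0 < y ^ 3 := by positivity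
  have hp2 : 0 < y ^ 2 := by positivity
  have hyκ' : y ≤ κ := by linarith
  have hKy : C.K * y ≤ 1 / 1000 := by nlinarith [h.K_le]
  have hKξ : C.K * y ^ 4 ≤ y ^ 3 / 1000 := by
    have := mul_le_mul_of_nonneg_right hKy hp3.le
    calc C.K * y ^ 4 = C.K * y * y ^ 3 := by ring
      _ ≤ _ := by linarith
  set ctr := C.ctr true with hctr
  have hwin : ∀ E, |E - E1| ≤ y ^ 4 → |E - E0| ≤ κ ^ 2 := fun E hE =>
    (abs_sub_le E E1 E0).trans (by nlinarith)
  have h11 : |E1 - E1| ≤ y ^ 4 := by simpa using hp4.le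
  have hC0 : ∀ E, |E - E1| ≤ y ^ 4 → (C.G true ctr E).v0 ≤ -(y ^ 2 * (9 / 10)) := fun E hE => by
    have h5 := lipE true (x := ctr) (by rw [← hctr]; simpa using hrp) h.win (hwin E1 h11) (hwin E hE)
    have h6 : C.K * |E - E1| ≤ C.K * y ^ 4 := by gcongr
    rw [abs_le] at h5
    linarith
  have hd := fun E (hE : |E - E1| ≤ y ^ 4) => fun x (hx : |x - ctr| ≤ C.rD) =>
    C.isG true x hx E (h.win E (hwin E hE))
  have slope : ∀ σ : ℝ, |σ| = 1 → ∀ E, |E - E1| ≤ y ^ 4 → ∀ x, |x - ctr| ≤ C.rD →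
      0 ≤ σ * (x - ctr) → -(y ^ 2 / 10) ≤ (C.G true x E).v0 →
      y ^ 2 / 2 ≤ σ * (C.G true x E).dx := by
    intro σ hσ E hE x hx hσx hG
    refine convex_slope (f := fun x => (C.G true x E).v0) (f' := fun x => (C.G true x E).dx)
      (f2 := fun x => (C.G true x E).dxx) (fun x hx => (hd E hE x hx).hdx)
      (fun x hx => (hd E hE x hx).hdxx)
      (fun x hx => hκ.le.trans (h.dxx x E hx (hwin E hE))) hrp hrD1 (by positivity) hσ hx hσx ?_
    linarith [hC0 E hE]
  have side : ∀ σ : ℝ, |σ| = 1 → ∃ z, |z - ctr| ≤ C.rD / 4 ∧ 0 ≤ σ * (z - ctr) ∧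
      (C.G true z E1).v0 = 0 := by
    intro σ hσ
    have hσ2 : σ * σ = 1 := by rw [← abs_mul_abs_self, hσ]; norm_num
    have hq : |ctr + σ * (C.rD / 4) - ctr| = C.rD / 4 := by
      rw [add_sub_cancel_left, abs_sgn_mul hσ, abs_of_nonneg (by linarith)]
    have hb := h.bot (ctr + σ * (C.rD / 4)) (by rw [hq]; linarith) hq.ge
    have h00 : |E0 - E0| ≤ κ ^ 2 := by simp; positivity
    have h5 := lipE true (x := ctr + σ * (C.rD / 4)) (by rw [hq]; linarith) h.win h00 (hwin E1 h11)
    have h6 : C.K * |E1 - E0| ≤ C.K * κ ^ 4 := by gcongr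
    have h7 : C.K * κ ^ 4 ≤ κ ^ 3 := by
      have := mul_le_mul_of_nonneg_right h.K_le (pow_pos hκ 3).le
      calc C.K * κ ^ 4 = C.K * κ * κ ^ 3 := by ring
        _ ≤ _ := by linarith
    have h8 : κ ^ 3 ≤ κ / 1000 := by
      have : 1000 * κ ^ 3 ≤ κ := by simpa using pow_le_of_small hκ hκ1 (show 1 < 3 by norm_num)
      linarith
    rw [abs_le] at h5
    have hc : ContinuousOn (fun t => (C.G true (ctr + σ * t) E1).v0) (Set.Icc 0 (C.rD / 4)) := by
      intro t ht
      have h9 : |ctr + σ * t - ctr| ≤ C.rD := by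
        rw [add_sub_cancel_left, abs_sgn_mul hσ, abs_of_nonneg ht.1]; linarith [ht.2]
      have h10 := (hd E1 h11 _ h9).hdx.continuousAt
      exact (ContinuousAt.comp (f := fun t => ctr + σ * t) (g := fun x => (C.G true x E1).v0) h10
        (by fun_prop)).continuousWithinAt
    obtain ⟨t, ht, ht0⟩ := intermediate_value_Icc (by linarith) hc
      (show (0 : ℝ) ∈ Set.Icc _ _ from ⟨by simp; linarith [hC0 E1 h11, sq_nonneg y], by linarith⟩)
    refine ⟨ctr + σ * t, ?_, ?_, ht0⟩
    · rw [add_sub_cancel_left, abs_sgn_mul hσ, abs_of_nonneg ht.1]; exact ht.2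
    · rw [add_sub_cancel_left, ← mul_assoc, hσ2, one_mul]; exact ht.1
  have hs0 : ∀ j : Bool, |(if j then s else -s : ℝ)| = 1 := fun j => by
    cases j <;> simp [h.s_abs]
  choose z hz1 hz2 hz3 using fun j : Bool => side (if j then s else -s) (hs0 j)
  have hss : s * s = 1 := by rw [← abs_mul_abs_self, h.s_abs]; norm_num
  have hzR : ∀ j x, |x - z j| ≤ y ^ 4 → |x - ctr| ≤ C.rD := fun j x hx =>
    (abs_sub_le x (z j) ctr).trans (by linarith [hz1 j])
  have hval : ∀ j x E, |x - z j| ≤ y ^ 4 → |E - E1| ≤ y ^ 4 →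
      |(C.G true x E).v0| ≤ y ^ 3 / 500 := fun j x E hx hE => by
    have h5 := lipE true (hzR j x hx) h.win (hwin E1 h11) (hwin E hE)
    have h6 := lipX true (z := z j) (R := y ^ 4) (h.win E1 (hwin E1 h11))
      (by rw [← hctr]; linarith [hz1 j]) (x := z j) (by simpa using hp4.le) hx
    rw [hz3, sub_zero] at h6
    have h7 : C.K * |E - E1| ≤ C.K * y ^ 4 := by gcongr
    have h8 : C.K * |x - z j| ≤ C.K * y ^ 4 := by gcongr
    rw [abs_le] at *
    constructor <;> linarith
  have hpos : ∀ j x, |x - z j| ≤ y ^ 4 → 0 ≤ (if j then s else -s : ℝ) * (x - ctr) := by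
    intro j x hx
    by_contra hcon
    push Not at hcon
    have h5 : |z j - ctr| ≤ y ^ 4 := by
      rw [← abs_sgn_mul (hs0 j), abs_of_nonneg (hz2 j)]
      have := abs_sgn_mul (t := x - z j) (hs0 j)
      have h6 := neg_abs_le ((if j then s else -s : ℝ) * (x - z j))
      have h7 : (if j then s else -s : ℝ) * (x - ctr) = (if j then s else -s : ℝ) * (x - z j) +
        (if j then s else -s : ℝ) * (z j - ctr) := by ring
      linarith
    have h6 := hval j ctr E1 (by rwa [abs_sub_comm]) h11
    have h7 := hC0 E1 h11
    rw [abs_le] at h6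
    linarith
  refine ⟨z, fun j => if j then s else -s, fun E hE => h.win E (hwin E hE), hp4, by linarith, hκ, ?_,
    fun j => ?_, by linarith, hs0, fun _ => h.s_abs, by simpa using hss, by simp [hss], hz3,
    fun j x E hx hE => ?_, fun j x E hx hE => ?_, fun j x E hx hE => ?_,
    fun i x m E hx hE hG => ?_⟩
  · linarith
  · linarith [hz1 j]
  · have h5 := hval j x E hx hE
    rw [abs_le] at h5
    exact le_trans (by linarith) (slope _ (hs0 j) E hE x (hzR j x hx) (hpos j x hx) (by linarith))
  · exact le_trans (by linarith) (h.dE x E (hzR j x hx) (hwin E hE)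
      ((hval j x E hx hE).trans (by linarith)))
  · exact h.w x E (hzR j x hx) (hwin E hE) ((hval j x E hx hE).trans (by linarith))
  · rw [h.ctr_eq i] at hx
    rw [h.G_eq i] at hG
    have hp100 : 0 < (y ^ 4) ^ 100 := by positivity
    have hy1' : y ^ 4 ≤ 1 / 1000 := by linarith
    have h100 : 1000 * (y ^ 4) ^ 100 ≤ (y ^ 4) ^ 2 := pow_le_of_small hp4 hy1' (by norm_num)
    have h22 : 1000 * (y ^ 4) ^ 2 ≤ y ^ 4 := by
      simpa using pow_le_of_small hp4 hy1' (show 1 < 2 by norm_num)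
    have hE4 : |E - E1| ≤ y ^ 4 := hE.trans (by linarith)
    have hx' : |x - m - ctr| ≤ C.rD := hx.trans C.r_le
    obtain ⟨j, hj⟩ : ∃ j : Bool, 0 ≤ (if j then s else -s : ℝ) * (x - m - ctr) := by
      rcases le_total 0 (s * (x - m - ctr)) with h5 | h5
      · exact ⟨true, by simpa using h5⟩
      · exact ⟨false, by simp; linarith⟩
    refine ⟨j, m, ?_, by rw [h.G_eq i]⟩
    set σ : ℝ := if j then s else -s with hσ
    have hσ1 : |σ| = 1 := hs0 j
    have hσ2 : σ * σ = 1 := by rw [← abs_mul_abs_self, hσ1]; norm_num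
    have h5 := lipE true hx' h.win (hwin E1 h11) (hwin E hE4)
    have h7 : C.K * |E - E1| ≤ C.K * (y ^ 4) ^ 100 := by gcongr
    have h8 : C.K * (y ^ 4) ^ 100 ≤ C.K * y ^ 4 := by gcongr; linarith
    have hG2 : |(C.G true (x - m) E1).v0| ≤ (y ^ 4) ^ 100 + C.K * (y ^ 4) ^ 100 := by
      rw [abs_lt] at hG
      rw [abs_le] at h5 ⊢
      constructor <;> linarith
    have hG3 := abs_le.mp hG2
    have hsx := slope σ hσ1 E1 h11 (x - m) hx' hj (by linarith)
    have hsz := slope σ hσ1 E1 h11 (z j) ((hz1 j).trans (by linarith)) (hz2 j)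
      (by rw [hz3]; linarith)
    have hc := fun p q (hp : |p - ctr| ≤ C.rD) (hq : |q - ctr| ≤ C.rD) =>
      quad_ge (f := fun x => (C.G true x E1).v0) (f' := fun x => (C.G true x E1).dx)
      (f2 := fun x => (C.G true x E1).dxx) (z := ctr) (m := 0) (fun x hx => (hd E1 h11 x hx).hdx)
      (fun x hx => (hd E1 h11 x hx).hdxx)
      (fun x hx => hκ.le.trans (h.dxx x E1 hx (hwin E1 h11))) hp hq
    have hc1 := hc (z j) (x - m) ((hz1 j).trans (by linarith)) hx'
    have hc2 := hc (x - m) (z j) hx' ((hz1 j).trans (by linarith))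
    simp only [hz3, zero_mul, add_zero, zero_add] at hc1 hc2
    have h9 : y ^ 2 / 2 * |x - m - z j| ≤ (y ^ 4) ^ 100 + C.K * (y ^ 4) ^ 100 := by
      have e1 : (C.G true (z j) E1).dx * (x - m - z j) =
        σ * (C.G true (z j) E1).dx * (σ * (x - m - z j))   := by
          linear_combination -(C.G true (z j) E1).dx * (x - m - z j) * hσ2
      have e2 : (C.G true (x - m) E1).dx * (z j - (x - m)) =
        σ * (C.G true (x - m) E1).dx * -(σ * (x - m - z j))   := by
          linear_combination (C.G true (x - m) E1).dx * (x - m - z j) * hσ2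
      rw [e1] at hc1
      rw [e2] at hc2
      rw [← abs_sgn_mul hσ1]
      rcases le_total 0 (σ * (x - m - z j)) with h10 | h10
      · rw [abs_of_nonneg h10]
        have := mul_le_mul_of_nonneg_right hsz h10
        linarith
      · rw [abs_of_nonpos h10]
        have := mul_le_mul_of_nonneg_right hsx (by linarith : 0 ≤ -(σ * (x - m - z j)))
        linarith
    have h10 : (y ^ 4) ^ 100 + C.K * (y ^ 4) ^ 100 ≤ y ^ 2 / 2 * y ^ 4 := by
      have e3 : (y ^ 4) ^ 100 ≤ (y ^ 4) ^ 3 := pow_le_pow_of_le_one hp4.le (by linarith) (by norm_num)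
      have e4 : C.K * (y ^ 4) ^ 100 ≤ C.K * (y ^ 4) ^ 3 := by gcongr
      have e5 : C.K * (y ^ 4) ^ 3 ≤ y ^ 3 / 1000 * (y ^ 4) ^ 2 := by
        calc C.K * (y ^ 4) ^ 3 = C.K * y ^ 4 * (y ^ 4) ^ 2 := by ring
          _ ≤ _ := by gcongr
      have e6 : y ^ 3 * (y ^ 4) ^ 2 ≤ y ^ 2 * y ^ 4 := by
        calc y ^ 3 * (y ^ 4) ^ 2 = y ^ 11 := by ring
          _ ≤ y ^ 6 := pow_le_pow_of_le_one hy.le (by linarith) (by norm_num)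
          _ = _ := by ring
      have e7 : (y ^ 4) ^ 3 ≤ y ^ 2 * y ^ 4 / 1000 := by
        have : 1000 * y ^ 12 ≤ y ^ 6 := pow_le_of_small hy hy1 (by norm_num)
        calc (y ^ 4) ^ 3 = y ^ 12 := by ring
          _ ≤ y ^ 6 / 1000 := by linarith
          _ = _ := by ring
      have e8 : 0 < y ^ 2 * y ^ 4 := by positivity
      linarith
    exact le_of_mul_le_mul_left (h9.trans h10) (by positivity)

end Core

namespace Core
open Ctx

variable {c : Ctx}

/-- Numerical parameters of a core. -/
structure Params (C : Core c) (k h Ret H : ℕ) (ρ B K νb νlow : ℝ) : Prop where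
  k_eq : C.k = k
  h_eq : C.h = h
  Ret_eq : C.Ret = Ret
  H_eq : C.H = H
  ρ_eq : C.ρ = ρ
  B_eq : C.B = B
  K_eq : C.K = K
  νb_eq : C.νb = νb
  νlow_eq : C.νlow = νlow
  Q_eq : C.Q = c.b ^ (10 * (k + 1))
  e_eq : C.e = 12 * νb * c.b ^ (10 * (k + 1)) * (c.b ^ 4)⁻¹ ^ h

lemma Spec.params {C : Core c} {W : Set ℝ} {ctr : Bool → ℝ} {r rD : ℝ} {k h Ret H : ℕ}
    {ρ B K νb νlow : ℝ} {G : Bool → ℝ → ℝ → Jet} {w : Bool → ℝ → ℝ → ℝ}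
    (hC : C.Spec W ctr r rD k h Ret H ρ B K νb νlow G w) :
    C.Params k h Ret H ρ B K νb νlow :=
  ⟨hC.k_eq, hC.h_eq, hC.Ret_eq, hC.H_eq, hC.ρ_eq, hC.B_eq, hC.K_eq, hC.νb_eq, hC.νlow_eq,
    hC.Q_eq, hC.e_eq⟩

variable {C : Core c}

lemma PreII.catches {E1 κ y wl s z : ℝ} {j0 : Bool} (h : C.PreII E1 κ y wl s z j0) {E : ℝ}
    (hE : |E - E1| ≤ y ^ 3) : C.Catches E (y ^ 2) (balls (fun _ => z) (2 * y / κ)) := by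
  intro i x m hx hG
  have hκ := h.κ_pos
  have hy := h.y_pos
  have hκ1 := h.κ_le
  obtain ⟨m', h1, h2⟩ := h.cov i x m E hx hE hG
  refine ⟨true, m', ?_⟩
  have hnear : ∀ t, |t - z| ≤ y / κ ^ 3 → |t - C.ctr j0| ≤ C.rD := fun t ht =>
    (abs_sub_le t z (C.ctr j0)).trans (by linarith [h.near])
  have hE1 : E1 ∈ C.W := h.win E1 (by simp; positivity)
  have h3 := lipE j0 (hnear _ h1) h.win (E := E) (E' := E1) hE (by simp; positivity)
  have h4 := quad_ge (f := fun x => (C.G j0 x E1).v0) (f' := fun x => (C.G j0 x E1).dx)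
    (f2 := fun x => (C.G j0 x E1).dxx) (z := z) (R := y / κ ^ 3) (m := κ) (p := z)
    (q := x - m') (fun x hx => (C.isG j0 x (hnear x hx) E1 hE1).hdx)
    (fun x hx => (C.isG j0 x (hnear x hx) E1 hE1).hdxx)
    (fun x hx => h.dxx x E1 hx (by simp; positivity)) (by simp; positivity) h1
  simp only [h.crit, zero_mul, add_zero] at h4
  have hyκ : y ≤ κ := h.y_le.trans (pow_le_of_le_one hκ.le (by linarith) (by norm_num))
  have h5 : C.K * |E1 - E| ≤ y ^ 2 := by
    rw [abs_sub_comm]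
    calc C.K * |E - E1| ≤ C.K * y ^ 3 := by gcongr; exact C.K_pos.le
      _ = (C.K * y) * y ^ 2 := by ring
      _ ≤ (C.K * κ) * y ^ 2 := by gcongr; exact C.K_pos.le
      _ ≤ 1 * y ^ 2 := by gcongr; exact h.K_le
      _ = y ^ 2 := one_mul _
  have h6 : κ * (x - m' - z) ^ 2 ≤ 3 * y ^ 2 := by
    have := h.bot
    have := (abs_le.1 h3).2
    have := (abs_lt.1 h2).2
    linarith
  rw [le_div_iff₀ hκ]
  refine (pow_le_pow_iff_left₀ (by positivity) (by positivity) two_ne_zero).1 ?_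
  rw [mul_pow, sq_abs]
  have : κ * (κ * (x - m' - z) ^ 2) ≤ 1 * (3 * y ^ 2) := by
    gcongr; linarith
  nlinarith [sq_nonneg y]

set_option maxHeartbeats 1000000 in
/-- Refinement at a quadratic critical point. -/
theorem PreII.keep {E1 κ y wl s z : ℝ} {j0 : Bool} (hP : C.PreII E1 κ y wl s z j0)
    {ε ρ B η κ' : ℝ} {h Ret : ℕ} (hD : C.StepData (y ^ 2) ε h ρ B η) (hε : ε ≤ y ^ 3)
    (hεw : ε ≤ wl / 2) (hnon : ∀ t m : ℤ, t ≠ 0 → |t| ≤ Ret → 2 * (y / κ ^ 3) < |t * c.α - m|)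
    (hRet : h + C.H1 + C.k ≤ Ret) (hκ' : 0 < κ') (hκy : κ' ≤ y ^ 3) (hκw : κ' ≤ wl / 2)
    (hκK : 2 * C.K * κ' ≤ 1) :
    ∃ C' : Core c, C'.Params C.k h Ret C.H1 ρ B (2 * C.K) C.νb C.νlow ∧ C'.StII E1 κ' s := by
  have hκ := hP.κ_pos
  have hy := hP.y_pos
  have hκ1 := hP.κ_le
  have hyκ : y ≤ κ ^ 4 := hP.y_le.trans (pow_le_pow_of_le_one hκ.le (by linarith) (by norm_num))
  have hκ4 : 1000 * κ ^ 4 ≤ κ ^ 3 := pow_le_of_small hκ hκ1 (by norm_num)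
  have hκ3 : 1000 * κ ^ 3 ≤ κ ^ 2 := pow_le_of_small hκ hκ1 (by norm_num)
  have hκ2 : 1000 * κ ^ 2 ≤ κ := by simpa using pow_le_of_small hκ hκ1 (show 1 < 2 by norm_num)
  have hy1 : y ≤ 1 / 1000 := by linarith
  have hy3 : 1000 * y ^ 3 ≤ y ^ 2 := pow_le_of_small hy hy1 (by norm_num)
  have hy2 : 1000 * y ^ 2 ≤ y := by simpa using pow_le_of_small hy hy1 (show 1 < 2 by norm_num)
  have hyp3 : 0 < y ^ 3 := by positivity
  set R := y / κ ^ 3 with hR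
  have hyR : y = R * κ ^ 3 := by rw [hR]; field_simp
  have hRp : 0 < R := by positivity
  have hR1 : R ≤ κ := by
    rw [hR, div_le_iff₀ (by positivity)]; exact hyκ.trans_eq (by ring)
  have hrh : 1000 * (2 * y / κ) ≤ R / 500 := by
    have : 2 * y / κ = 2 * R * κ ^ 2 := by rw [hyR]; field_simp
    rw [this]
    have h1 : R * κ ^ 2 ≤ R * (1 / 1000 * (1 / 1000)) := by
      gcongr; linarith
    linarith
  have hrhp : 0 < 2 * y / κ := by positivity
  let A : C.Ref :=
    { W := {E | |E - E1| ≤ y ^ 3}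
      z := fun _ => z
      par := fun _ => j0
      rh := 2 * y / κ
      R := R
      h := h
      δ := y ^ 2
      ρ := ρ
      B := B
      η := η
      W_sub := hP.win
      num := hD.num
      near := fun _ => hP.near
      R_le := hP.half
      rh_pos := hrhp
      rh_le := by linarith
      catches := fun E hE => hP.catches hE
      cov := hD.cov
      hh := hD.hh
      hb := hD.hb
      hρ := hD.hρ }
  have hnon' : A.NonRes Ret (2 * R) := fun j j' t m ht h => by
    have := hnon t m ht h
    have e : A.z j + t * c.α - m - A.z j' = t * c.α - m := by simp only [A]; ring
    rw [e]; linarith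
  have hRet' : A.h + C.H1 + C.k ≤ Ret := hRet
  have hrr : A.R + A.rh ≤ 2 * R := by simp only [A]; linarith
  have heh : A.eh ≤ ε := hD.eh_le
  have hcl : ∀ {x E}, |x - z| ≤ R → |E - E1| ≤ y ^ 3 →
      nrm (A.Gn true x E - C.G j0 x E) ≤ ε := fun {x E} hx hE =>
    (Ref.Gn_close (A := A) (j := true) hnon' hRet' hrr hx hE).trans heh
  have hw : ∀ {x E}, |x - z| ≤ R → |E - E1| ≤ y ^ 3 →
      |A.wn true x E - C.w j0 x E| ≤ ε := fun {x E} hx hE =>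
    (Ref.wn_close (A := A) (j := true) hnon' hRet' hrr hx hE).trans heh
  have hat : ∀ {x E}, |x - z| ≤ R → |E - E1| ≤ y ^ 3 → IsAt (A.Gn true) x E := fun hx hE =>
    Ref.isAt_Gn (A := A) (j := true) hnon' hRet' hrr hx hE
  have hEE : |E1 - E1| ≤ y ^ 3 := by simp; positivity
  have hzz : |z - z| ≤ R := by simp; positivity
  have hdxx : ∀ x E, |x - z| ≤ R → |E - E1| ≤ y ^ 3 → κ / 2 ≤ (A.Gn true x E).dxx :=
    fun x E hx hE => by
      have h1 := (abs_dxx_le _).trans (hcl hx hE)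
      rw [sub_dxx] at h1
      have := (abs_le.1 h1).1
      have := hP.dxx x E hx hE
      linarith
  obtain ⟨x0, hx0, hx0'⟩ := exists_zero (f := fun x => (A.Gn true x E1).dx)
    (f' := fun x => 2 * (A.Gn true x E1).dxx) (z := z) (R := R) hκ
    (fun x hx => (hat hx hEE).hdxx) (fun x hx => by linarith [hdxx x E1 hx hEE])
    (ε := 2 * y / κ) (by
      have h1 := (abs_dx_le _).trans (hcl hzz hEE)
      rw [sub_dx, hP.crit, sub_zero] at h1
      have : κ * (2 * y / κ) = 2 * y := by field_simp
      rw [this]; linarith) (by linarith)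
  obtain ⟨C', hC⟩ := A.keep (rD := R / 2) hnon' hRet' hrr (by simp only [A]; linarith)
    (by simp only [A]; linarith) (by simp only [A]; linarith) (fun _ => x0) (fun _ => hx0)
  refine ⟨C', hC.params, ?_⟩
  have hz : ∀ {x}, |x - x0| ≤ R / 2 → |x - z| ≤ R := fun {x} hx => by
    have := abs_sub_le x x0 z
    linarith
  have hκ'2 : κ' ^ 2 ≤ y ^ 3 := by
    have h1 : κ' ≤ 1 := by linarith
    nlinarith
  have hG : C'.G = A.Gn := hC.G_eq
  have hw' : C'.w = A.wn := hC.w_eq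
  have hW : C'.W = {E | |E - E1| ≤ y ^ 3} := hC.W_eq
  have hctr : C'.ctr = fun _ => x0 := hC.ctr_eq
  have hrD : C'.rD = R / 2 := hC.rD_eq
  have hr : C'.r = 2 * (2 * y / κ) := hC.r_eq
  have hval : ∀ {x E}, |x - z| ≤ R → |E - E1| ≤ y ^ 3 → |(A.Gn true x E).v0| ≤ κ' →
      |(C.G j0 x E).v0| ≤ κ := fun {x E} hx hE hv => by
    have h1 := (abs_v0_le _).trans (hcl hx hE)
    rw [sub_v0, abs_sub_comm] at h1
    have := abs_sub_abs_le_abs_sub (C.G j0 x E).v0 (A.Gn true x E).v0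
    linarith
  have hss : s = 1 ∨ s = -1 := eq_or_eq_neg_of_abs_eq hP.s_abs
  have hsl : ∀ {p q : ℝ}, |p - q| ≤ ε → s * q - ε ≤ s * p := fun {p q} h => by
    have h1 := abs_le.1 h
    rcases hss with rfl | rfl <;> linarith
  refine ⟨fun E hE => by rw [hW]; exact hE.trans hκ'2, hκ', by linarith, by rw [hC.K_eq]; exact hκK,
    by rw [hrD]; nlinarith, by rw [hrD]; linarith, by rw [hr, hrD]; linarith, hP.s_abs,
    fun j => by rw [hctr], fun j => by rw [hG]; rfl, fun j => by rw [hw']; rfl,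
    by rw [hG, hctr]; exact hx0', fun x hx hx' => ?_, fun x E hx hE => ?_, fun x E hx hE hv => ?_,
    fun x E hx hE hv => ?_⟩
  · rw [hctr, hrD] at hx hx'
    have hxz := hz hx
    rw [hG]
    have hE1 : E1 ∈ C.W := hP.win E1 hEE
    have hnear : ∀ t, |t - z| ≤ R → |t - C.ctr j0| ≤ C.rD := fun t ht =>
      (abs_sub_le t z (C.ctr j0)).trans (by linarith [hP.near])
    have h4 := quad_ge (f := fun x => (C.G j0 x E1).v0) (f' := fun x => (C.G j0 x E1).dx)
      (f2 := fun x => (C.G j0 x E1).dxx) (z := z) (R := R) (m := κ) (p := z)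
      (q := x) (fun x hx => (C.isG j0 x (hnear x hx) E1 hE1).hdx)
      (fun x hx => (C.isG j0 x (hnear x hx) E1 hE1).hdxx)
      (fun x hx => hP.dxx x E1 hx hEE) hzz hxz
    simp only [hP.crit, zero_mul, add_zero] at h4
    have h5 : R / 16 ≤ |x - z| := by
      have := abs_sub_le x z x0
      rw [abs_sub_comm z x0] at this
      linarith
    have h6 : (R / 16) ^ 2 ≤ (x - z) ^ 2 := by
      rw [← sq_abs (x - z)]; gcongr
    have h7 : 3 * y ^ 2 ≤ κ * (x - z) ^ 2 := by
      have h8 : 3 * y ^ 2 = 3 * R ^ 2 * (κ ^ 5) * κ := by rw [hyR]; ring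
      have h9 : κ ^ 5 ≤ κ ^ 2 := pow_le_pow_of_le_one hκ.le (by linarith) (by norm_num)
      have h10 : R ^ 2 * κ ^ 5 ≤ R ^ 2 * (1 / 1000 * (1 / 1000)) := by
        gcongr; nlinarith
      have h11 : 3 * R ^ 2 * κ ^ 5 ≤ (x - z) ^ 2 := by nlinarith
      rw [h8, mul_comm κ]; gcongr
    have h1 := (abs_v0_le _).trans (hcl hxz hEE)
    rw [sub_v0] at h1
    have := (abs_le.1 h1).1
    have := hP.bot
    linarith
  · rw [hctr, hrD] at hx
    rw [hG]
    have := hdxx x E (hz hx) (hE.trans hκ'2)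
    linarith
  · rw [hctr, hrD] at hx
    rw [hG] at hv ⊢
    have hE' := hE.trans hκ'2
    have h1 := hP.dE x E (hz hx) hE' (hval (hz hx) hE' hv)
    have h2 := (abs_dE_le _).trans (hcl (hz hx) hE')
    rw [sub_dE] at h2
    have := hsl h2
    linarith
  · rw [hctr, hrD] at hx
    rw [hG] at hv
    rw [hw']
    have hE' := hE.trans hκ'2
    have h1 := hP.w x E (hz hx) hE' (hval (hz hx) hE' hv)
    have := hsl (hw (hz hx) hE')
    linarith

end Core

namespace Core
open Ctx

variable {c : Ctx} {C : Core c}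

namespace PreI

variable {E1 ξ wl : ℝ} {z : Bool → ℝ} {par : Bool → Bool} {sx sE : Bool → ℝ}

lemma pow_step (h : C.PreI E1 ξ wl z par sx sE) {m n : ℕ} (hmn : m < n) :
    1000 * ξ ^ n ≤ ξ ^ m := pow_le_of_small h.ξ_pos h.ξ_le hmn

lemma nearD (h : C.PreI E1 ξ wl z par sx sE) {j : Bool} {x : ℝ} (hx : |x - z j| ≤ ξ) :
    |x - C.ctr (par j)| ≤ C.rD :=
  (abs_sub_le x (z j) (C.ctr (par j))).trans (by linarith [h.near j])

lemma memW (h : C.PreI E1 ξ wl z par sx sE) : E1 ∈ C.W := h.win E1 (by simpa using h.ξ_pos.le)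

lemma slope (h : C.PreI E1 ξ wl z par sx sE) {j : Bool} {x E : ℝ} (hx : |x - z j| ≤ ξ)
    (hE : |E - E1| ≤ ξ) :
    ξ * |x - z j| ≤ |(C.G (par j) x E).v0| + C.K * |E - E1| := by
  have hξ := h.ξ_pos
  have hE1 : |E1 - E1| ≤ ξ := by simpa using hξ.le
  have h3 := slope_abs (f := fun x => sx j * (C.G (par j) x E1).v0)
    (f' := fun x => sx j * (C.G (par j) x E1).dx) (z := z j) (R := ξ) (m := ξ)
    (fun x hx => ((C.isG _ x (h.nearD hx) E1 h.memW).hdx).const_mul _)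
    (fun x hx => h.dx j x E1 hx hE1) (p := z j) (q := x) (by simpa using hξ.le) hx
  rw [← mul_sub, abs_sgn_mul (h.sx_abs j), h.zero, sub_zero] at h3
  have h1 := lipE (par j) (h.nearD hx) h.win hE hE1
  rw [abs_sub_comm E1] at h1
  have := abs_sub_abs_le_abs_sub (C.G (par j) x E1).v0 (C.G (par j) x E).v0
  linarith

lemma catches (h : C.PreI E1 ξ wl z par sx sE) {E : ℝ} (hE : |E - E1| ≤ ξ ^ 103) :
    C.Catches E (ξ ^ 100) (balls z (ξ ^ 98)) := by
  intro i x m hx hG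
  have hξ := h.ξ_pos
  have h103 : 0 < ξ ^ 103 := by positivity
  have h1 := h.pow_step (show 100 < 103 by norm_num)
  have h2 := h.pow_step (show 1 < 103 by norm_num)
  have h99 := h.pow_step (show 98 < 99 by norm_num)
  have h102 := h.pow_step (show 100 < 102 by norm_num)
  rw [pow_one] at h2
  obtain ⟨j, m', h3, h4⟩ := h.cov i x m E hx (by linarith) hG
  rw [← h4] at hG
  refine ⟨j, m', ?_⟩
  have h5 := h.slope h3 (by linarith : |E - E1| ≤ ξ)
  have h6 : C.K * |E - E1| ≤ ξ ^ 102 := by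
    calc C.K * |E - E1| ≤ C.K * ξ ^ 103 := by gcongr; exact C.K_pos.le
      _ = (C.K * ξ) * ξ ^ 102 := by ring
      _ ≤ 1 * ξ ^ 102 := by gcongr; exact h.K_le
      _ = ξ ^ 102 := one_mul _
  have h7 : ξ * |x - m' - z j| ≤ ξ * ξ ^ 98 := by
    have : ξ * ξ ^ 98 = ξ ^ 99 := by ring
    have := h.pow_step (show 99 < 100 by norm_num)
    have : 0 < ξ ^ 102 := by positivity
    linarith
  exact le_of_mul_le_mul_left h7 hξ

/-- The refinement around the critical points at the given radius. -/
def ref (hP : C.PreI E1 ξ wl z par sx sE) {ε ρ B η R : ℝ} {h : ℕ}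
    (hD : C.StepData (ξ ^ 100) ε h ρ B η) (hR : R ≤ ξ) (hR' : ξ ^ 98 ≤ R) : C.Ref where
  W := {E | |E - E1| ≤ ξ ^ 103}
  z := z
  par := par
  rh := ξ ^ 98
  R := R
  h := h
  δ := ξ ^ 100
  ρ := ρ
  B := B
  η := η
  W_sub := fun E hE => hP.win E (by
    have := hP.pow_step (show 1 < 103 by norm_num)
    have : 0 < ξ ^ 103 := pow_pos hP.ξ_pos _
    have : |E - E1| ≤ ξ ^ 103 := hE
    linarith)
  num := hD.num
  near := fun j => by linarith [hP.near j]
  R_le := by linarith [hP.half]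
  rh_pos := pow_pos hP.ξ_pos _
  rh_le := hR'
  catches := fun E hE => hP.catches hE
  cov := hD.cov
  hh := hD.hh
  hb := hD.hb
  hρ := hD.hρ

end PreI

lemma sgn_mul_ge {s p q ε : ℝ} (hs : |s| = 1) (h : |p - q| ≤ ε) : s * q - ε ≤ s * p := by
  have h1 := abs_le.1 h
  rcases eq_or_eq_neg_of_abs_eq hs with rfl | rfl <;> linarith

set_option maxHeartbeats 1000000 in
/-- Refinement at non-resonant transversal critical points. -/
theorem PreI.keep {E1 ξ wl : ℝ} {z : Bool → ℝ} {par : Bool → Bool} {sx sE : Bool → ℝ}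
    (hP : C.PreI E1 ξ wl z par sx sE)
    {ε ρ B η κ' : ℝ} {h Ret : ℕ} (hD : C.StepData (ξ ^ 100) ε h ρ B η) (hε : ε ≤ ξ ^ 100)
    (hεw : ε ≤ wl / 2)
    (hnon : ∀ j j' (t m : ℤ), t ≠ 0 → |t| ≤ Ret → ξ ^ 95 < |z j + t * c.α - m - z j'|)
    (hRet : h + C.H1 + C.k ≤ Ret) (hκ' : 0 < κ') (hκy : κ' ≤ ξ ^ 100) (hκw : κ' ≤ wl / 2)
    (hκK : 2 * C.K * κ' ≤ 1) :
    ∃ C' : Core c, C'.Params C.k h Ret C.H1 ρ B (2 * C.K) C.νb C.νlow ∧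
      C'.StI E1 κ' sx sE := by
  have hξ := hP.ξ_pos
  have hξ1 := hP.ξ_le
  have h95 := hP.pow_step (show 95 < 96 by norm_num)
  have h96 := hP.pow_step (show 96 < 98 by norm_num)
  have h1 := hP.pow_step (show 1 < 96 by norm_num)
  have h100 := hP.pow_step (show 99 < 100 by norm_num)
  have h99 := hP.pow_step (show 98 < 99 by norm_num)
  have h103 := hP.pow_step (show 1 < 103 by norm_num)
  rw [pow_one] at h1 h103
  have p98 : 0 < ξ ^ 98 := by positivity
  have p100 : 0 < ξ ^ 100 := by positivity
  have p103 : 0 < ξ ^ 103 := by positivity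
  have hRξ : 2 * ξ ^ 96 ≤ ξ := by linarith
  set A : C.Ref := hP.ref (R := 2 * ξ ^ 96) hD hRξ (by linarith) with hA
  have eR : A.R = 2 * ξ ^ 96 := rfl
  have erh : A.rh = ξ ^ 98 := rfl
  have hnon' : A.NonRes Ret (ξ ^ 95) := hnon
  have hRet' : A.h + C.H1 + C.k ≤ Ret := hRet
  have hrr : A.R + A.rh ≤ ξ ^ 95 := by rw [eR, erh]; linarith
  have heh : A.eh ≤ ε := hD.eh_le
  have hcl : ∀ {j x E}, |x - z j| ≤ 2 * ξ ^ 96 → |E - E1| ≤ ξ ^ 103 →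
      nrm (A.Gn j x E - C.G (par j) x E) ≤ ε := fun {j x E} hx hE =>
    (Ref.Gn_close (A := A) (j := j) hnon' hRet' hrr hx hE).trans heh
  have hw : ∀ {j x E}, |x - z j| ≤ 2 * ξ ^ 96 → |E - E1| ≤ ξ ^ 103 →
      |A.wn j x E - C.w (par j) x E| ≤ ε := fun {j x E} hx hE =>
    (Ref.wn_close (A := A) (j := j) hnon' hRet' hrr hx hE).trans heh
  have hat : ∀ {j x E}, |x - z j| ≤ 2 * ξ ^ 96 → |E - E1| ≤ ξ ^ 103 → IsAt (A.Gn j) x E :=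
    fun {j x E} hx hE => Ref.isAt_Gn (A := A) (j := j) hnon' hRet' hrr hx hE
  have hEE : |E1 - E1| ≤ ξ ^ 103 := by simpa using p103.le
  have hdx : ∀ j x E, |x - z j| ≤ 2 * ξ ^ 96 → |E - E1| ≤ ξ ^ 103 →
      ξ / 2 ≤ sx j * (A.Gn j x E).dx := fun j x E hx hE => by
    have h2 := (abs_dx_le _).trans (hcl hx hE)
    rw [sub_dx] at h2
    have := sgn_mul_ge (hP.sx_abs j) h2
    have := hP.dx j x E (by linarith) (by linarith)
    linarith [hP.pow_step (show 1 < 100 by norm_num), pow_one ξ]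
  have hex : ∀ j, ∃ x0, |x0 - z j| ≤ ξ ^ 98 ∧ sx j * (A.Gn j x0 E1).v0 = 0 := fun j => by
    have hzz : |z j - z j| ≤ 2 * ξ ^ 96 := by simp; positivity
    refine exists_zero (f := fun x => sx j * (A.Gn j x E1).v0)
      (f' := fun x => sx j * (A.Gn j x E1).dx) (z := z j) (R := 2 * ξ ^ 96) (m := ξ / 2)
      (by linarith) (fun x hx => (hat hx hEE).hdx.const_mul _) (fun x hx => hdx j x E1 hx hEE)
      ?_ (by linarith)
    have h2 := (abs_v0_le _).trans (hcl hzz hEE)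
    rw [sub_v0, hP.zero, sub_zero] at h2
    rw [abs_sgn_mul (hP.sx_abs j)]
    have : ξ / 2 * ξ ^ 98 = ξ ^ 99 / 2 := by ring
    linarith
  choose x0 hx0 hx0' using hex
  obtain ⟨C', hC⟩ := A.keep (rD := ξ ^ 96) hnon' hRet' hrr (by rw [eR, erh]; linarith)
    (by rw [erh]; linarith) (by rw [erh]; linarith) x0 hx0
  refine ⟨C', hC.params, ?_⟩
  have hz : ∀ {j x}, |x - x0 j| ≤ ξ ^ 96 → |x - z j| ≤ 2 * ξ ^ 96 := fun {j x} hx => by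
    have := abs_sub_le x (x0 j) (z j)
    linarith [hx0 j]
  have hκ'2 : κ' ^ 2 ≤ ξ ^ 103 := by
    have h2 : κ' ^ 2 ≤ (ξ ^ 100) ^ 2 := by gcongr
    rw [← pow_mul] at h2
    linarith [hP.pow_step (show 103 < 100 * 2 by norm_num)]
  have hG : C'.G = A.Gn := hC.G_eq
  have hw' : C'.w = A.wn := hC.w_eq
  have hW : C'.W = {E | |E - E1| ≤ ξ ^ 103} := hC.W_eq
  have hctr : C'.ctr = x0 := hC.ctr_eq
  have hrD : C'.rD = ξ ^ 96 := hC.rD_eq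
  have hr : C'.r = 2 * ξ ^ 98 := hC.r_eq
  have h2 := hP.pow_step (show 1 < 100 by norm_num)
  rw [pow_one] at h2
  refine ⟨fun E hE => by rw [hW]; exact hE.trans hκ'2, hκ', by linarith,
    by rw [hC.K_eq]; exact hκK, by rw [hrD]; linarith, by rw [hr, hrD]; linarith, hP.sx_abs,
    hP.sE_abs, hP.sgn_t, hP.sgn_f, fun j => ?_, fun j x E hx hE => ?_, fun j x E hx hE => ?_,
    fun j x E hx hE => ?_⟩
  · rw [hG, hctr]
    have := abs_sgn_mul (t := (A.Gn j (x0 j) E1).v0) (hP.sx_abs j)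
    rw [hx0', abs_zero] at this
    exact abs_eq_zero.1 this.symm
  · rw [hctr, hrD] at hx
    rw [hG]
    have := hdx j x E (hz hx) (hE.trans hκ'2)
    linarith
  · rw [hctr, hrD] at hx
    rw [hG]
    have h3 := (abs_dE_le _).trans (hcl (hz hx) (hE.trans hκ'2))
    rw [sub_dE] at h3
    have := sgn_mul_ge (hP.sE_abs j) h3
    have := hP.dE j x E ((hz hx).trans hRξ) (by linarith)
    linarith
  · rw [hctr, hrD] at hx
    rw [hw']
    have := sgn_mul_ge (hP.sE_abs j) (hw (hz hx) (hE.trans hκ'2))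
    have := hP.w j x E ((hz hx).trans hRξ) (by linarith)
    linarith

end Core

/-- Two transversal functions whose zeros move in opposite directions with the energy. -/
structure Pair (f g : ℝ → ℝ → Jet) (z E1 R ω m M sa sb ta tb : ℝ) : Prop where
  atf : ∀ y E, |y - z| ≤ R → |E - E1| ≤ ω → IsAt f y E
  atg : ∀ y E, |y - z| ≤ R → |E - E1| ≤ ω → IsAt g y E
  m_pos : 0 < m
  M_pos : 0 < M
  R_nonneg : 0 ≤ R
  ω_nonneg : 0 ≤ ω
  sa_abs : |sa| = 1
  sb_abs : |sb| = 1
  ta_abs : |ta| = 1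
  tb_abs : |tb| = 1
  sgn : sa * sb = -(ta * tb)
  fx : ∀ y E, |y - z| ≤ R → |E - E1| ≤ ω → m ≤ sa * (f y E).dx
  gx : ∀ y E, |y - z| ≤ R → |E - E1| ≤ ω → m ≤ sb * (g y E).dx
  fE : ∀ y E, |y - z| ≤ R → |E - E1| ≤ ω → m ≤ ta * (f y E).dE
  gE : ∀ y E, |y - z| ≤ R → |E - E1| ≤ ω → m ≤ tb * (g y E).dE
  f_le : ∀ y E, |y - z| ≤ R → |E - E1| ≤ ω → nrm (f y E) ≤ M
  g_le : ∀ y E, |y - z| ≤ R → |E - E1| ≤ ω → nrm (g y E) ≤ M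

namespace Pair

variable {f g : ℝ → ℝ → Jet} {z E1 R ω m M sa sb ta tb : ℝ}

lemma zz (h : Pair f g z E1 R ω m M sa sb ta tb) : |z - z| ≤ R := by simpa using h.R_nonneg

lemma EE (h : Pair f g z E1 R ω m M sa sb ta tb) : |E1 - E1| ≤ ω := by simpa using h.ω_nonneg

/-- The roles of the two functions may be exchanged. -/
lemma symm (h : Pair f g z E1 R ω m M sa sb ta tb) : Pair g f z E1 R ω m M sb sa tb ta :=
  ⟨h.atg, h.atf, h.m_pos, h.M_pos, h.R_nonneg, h.ω_nonneg, h.sb_abs, h.sa_abs, h.tb_abs, h.ta_abs,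
    by linarith [h.sgn, mul_comm sa sb, mul_comm ta tb], h.gx, h.fx, h.gE, h.fE, h.g_le, h.f_le⟩

lemma mono_f (h : Pair f g z E1 R ω m M sa sb ta tb) {p q E : ℝ} (hp : |p - z| ≤ R)
    (hq : |q - z| ≤ R) (hE : |E - E1| ≤ ω) (hpq : p ≤ q) :
    m * (q - p) ≤ sa * (f q E).v0 - sa * (f p E).v0 :=
  have hin : ∀ x ∈ Set.Icc p q, |x - z| ≤ R := fun x hx => by
    rw [abs_le] at *; constructor <;> linarith [hx.1, hx.2]
  slope_ge (f := fun x => sa * (f x E).v0) (f' := fun x => sa * (f x E).dx) hpq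
    (fun x hx => (h.atf x E (hin x hx) hE).hdx.const_mul _) (fun x hx => h.fx x E (hin x hx) hE)

lemma mono_g (h : Pair f g z E1 R ω m M sa sb ta tb) {p q E : ℝ} (hp : |p - z| ≤ R)
    (hq : |q - z| ≤ R) (hE : |E - E1| ≤ ω) (hpq : p ≤ q) :
    m * (q - p) ≤ sb * (g q E).v0 - sb * (g p E).v0 := h.symm.mono_f hp hq hE hpq

lemma monoE_f (h : Pair f g z E1 R ω m M sa sb ta tb) {y E E' : ℝ} (hy : |y - z| ≤ R)
    (hE : |E - E1| ≤ ω) (hE' : |E' - E1| ≤ ω) (hEE : E ≤ E') :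
    m * (E' - E) ≤ ta * (f y E').v0 - ta * (f y E).v0 :=
  have hin : ∀ x ∈ Set.Icc E E', |x - E1| ≤ ω := fun x hx => by
    rw [abs_le] at *; constructor <;> linarith [hx.1, hx.2]
  slope_ge (f := fun e => ta * (f y e).v0) (f' := fun e => ta * (f y e).dE) hEE
    (fun x hx => (h.atf y x hy (hin x hx)).hdE.const_mul _) (fun x hx => h.fE y x hy (hin x hx))

lemma monoE_g (h : Pair f g z E1 R ω m M sa sb ta tb) {y E E' : ℝ} (hy : |y - z| ≤ R)
    (hE : |E - E1| ≤ ω) (hE' : |E' - E1| ≤ ω) (hEE : E ≤ E') :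
    m * (E' - E) ≤ tb * (g y E').v0 - tb * (g y E).v0 := h.symm.monoE_f hy hE hE' hEE

lemma lipE_f (h : Pair f g z E1 R ω m M sa sb ta tb) {y E E' : ℝ} (hy : |y - z| ≤ R)
    (hE : |E - E1| ≤ ω) (hE' : |E' - E1| ≤ ω) :
    |(f y E').v0 - (f y E).v0| ≤ M * |E' - E| :=
  lip_le (f := fun e => (f y e).v0) (f' := fun e => (f y e).dE)
    (fun e he => (h.atf y e hy he).hdE) (fun e he => (abs_dE_le _).trans (h.f_le y e hy he)) hE hE'

lemma lipE_g (h : Pair f g z E1 R ω m M sa sb ta tb) {y E E' : ℝ} (hy : |y - z| ≤ R)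
    (hE : |E - E1| ≤ ω) (hE' : |E' - E1| ≤ ω) :
    |(g y E').v0 - (g y E).v0| ≤ M * |E' - E| := h.symm.lipE_f hy hE hE'

lemma lipX_f (h : Pair f g z E1 R ω m M sa sb ta tb) {p q E : ℝ} (hp : |p - z| ≤ R)
    (hq : |q - z| ≤ R) (hE : |E - E1| ≤ ω) :
    |(f q E).v0 - (f p E).v0| ≤ M * |q - p| :=
  lip_le (f := fun e => (f e E).v0) (f' := fun e => (f e E).dx)
    (fun e he => (h.atf e E he hE).hdx) (fun e he => (abs_dx_le _).trans (h.f_le e E he hE)) hp hq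

lemma lipX_g (h : Pair f g z E1 R ω m M sa sb ta tb) {p q E : ℝ} (hp : |p - z| ≤ R)
    (hq : |q - z| ≤ R) (hE : |E - E1| ≤ ω) :
    |(g q E).v0 - (g p E).v0| ≤ M * |q - p| := h.symm.lipX_f hp hq hE

lemma exists_zero_f (h : Pair f g z E1 R ω m M sa sb ta tb) {E ε : ℝ} (hE : |E - E1| ≤ ω)
    (hf : |(f z E).v0| ≤ m * ε) (hε : ε ≤ R) : ∃ y, |y - z| ≤ ε ∧ (f y E).v0 = 0 := by
  obtain ⟨y, h1, h2⟩ := exists_zero (f := fun x => sa * (f x E).v0)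
    (f' := fun x => sa * (f x E).dx) (z := z) (R := R) (m := m) h.m_pos
    (fun x hx => (h.atf x E hx hE).hdx.const_mul _) (fun x hx => h.fx x E hx hE) (ε := ε)
    (by rwa [Core.abs_sgn_mul h.sa_abs]) hε
  refine ⟨y, h1, ?_⟩
  have h3 := Core.abs_sgn_mul (t := (f y E).v0) h.sa_abs
  rw [h2, abs_zero] at h3
  exact abs_eq_zero.1 h3.symm

/-- Two such functions vanish simultaneously at some point of the box. -/
theorem crossing (h : Pair f g z E1 R ω m M sa sb ta tb) {ε ω' : ℝ} (hω' : ω' ≤ ω)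
    (hf : |(f z E1).v0| ≤ ε) (hg : |(g z E1).v0| ≤ ε) (hε : ε < m * ω')
    (hR : ε + M * ω' ≤ m * R) :
    ∃ y E, |E - E1| ≤ ω' ∧ |y - z| ≤ R ∧ (f y E).v0 = 0 ∧ (g y E).v0 = 0 := by
  have hm := h.m_pos
  have hM := h.M_pos
  have hε0 : 0 ≤ ε := (abs_nonneg _).trans hf
  have hω0 : 0 < ω' := by
    by_contra hc
    nlinarith
  have hz : ∀ E, |E - E1| ≤ ω' → ∃ y, |y - z| ≤ R ∧ (f y E).v0 = 0 := fun E hE => by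
    refine h.exists_zero_f (hE.trans hω') ?_ le_rfl
    have h1 := h.lipE_f h.zz h.EE (hE.trans hω')
    have h2 : M * |E - E1| ≤ M * ω' := by gcongr
    have := abs_sub_abs_le_abs_sub (f z E).v0 (f z E1).v0
    linarith
  choose! Y hY hfY using hz
  have hcont : ContinuousOn (fun E => (g (Y E) E).v0) (Set.Icc (E1 - ω') (E1 + ω')) := by
    have hin : ∀ E ∈ Set.Icc (E1 - ω') (E1 + ω'), |E - E1| ≤ ω' := fun E hE => by
      rw [abs_le]; constructor <;> linarith [hE.1, hE.2]
    have hlip : LipschitzOnWith (Real.toNNReal (M + M * (M / m))) (fun E => (g (Y E) E).v0)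
        (Set.Icc (E1 - ω') (E1 + ω')) := by
      refine LipschitzOnWith.of_dist_le_mul fun E hE E' hE' => ?_
      rw [Real.dist_eq, Real.dist_eq, Real.coe_toNNReal _ (by positivity)]
      have e := hin E hE
      have e' := hin E' hE'
      have h1 := h.lipE_f (hY E' e') (e.trans hω') (e'.trans hω')
      rw [hfY E' e', zero_sub, abs_neg] at h1
      have h2 : m * |Y E - Y E'| ≤ M * |E - E'| := by
        rw [abs_sub_comm E]
        rcases le_total (Y E) (Y E') with hl | hl
        · have := h.mono_f (hY E e) (hY E' e') (e.trans hω') hl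
          rw [hfY E e, mul_zero, sub_zero] at this
          have h3 := le_abs_self (sa * (f (Y E') E).v0)
          rw [Core.abs_sgn_mul h.sa_abs] at h3
          rw [abs_of_nonpos (by linarith)]; linarith
        · have := h.mono_f (hY E' e') (hY E e) (e.trans hω') hl
          rw [hfY E e, mul_zero, zero_sub] at this
          have h3 := neg_le_abs (sa * (f (Y E') E).v0)
          rw [Core.abs_sgn_mul h.sa_abs] at h3
          rw [abs_of_nonneg (by linarith)]; linarith
      have h4 := h.lipX_g (hY E' e') (hY E e) (e'.trans hω')
      have h5 := h.lipE_g (hY E e) (e'.trans hω') (e.trans hω')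
      have h6 : |Y E - Y E'| ≤ M / m * |E - E'| := by
        rw [div_mul_eq_mul_div, le_div_iff₀ hm]; linarith
      have h7 : M * |Y E - Y E'| ≤ M * (M / m * |E - E'|) := by gcongr
      have := abs_sub_le (g (Y E) E).v0 (g (Y E) E').v0 (g (Y E') E').v0
      linarith
    exact hlip.continuousOn
  have e1 : |E1 + ω' - E1| ≤ ω' := by rw [add_sub_cancel_left, abs_of_pos hω0]
  have e2 : |E1 - ω' - E1| ≤ ω' := by rw [sub_sub_cancel_left, abs_neg, abs_of_pos hω0]
  have key : ∀ E, |E - E1| ≤ ω' → ∀ σ, |σ| = 1 → 0 < σ * (ta * (f z E).v0) →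
      0 < σ * (tb * (g z E).v0) → 0 < σ * (tb * (g (Y E) E).v0) := by
    intro E hE σ hσ h1 h2
    have h3 := h.sgn
    have mf : ∀ p q, _ := fun p q => h.mono_f (p := p) (q := q) (E := E)
    have mg : ∀ p q, _ := fun p q => h.mono_g (p := p) (q := q) (E := E)
    have hE' := hE.trans hω'
    have h5 := hfY E hE
    rcases le_total (Y E) z with hl | hl
    · have h6 := mf _ _ (hY E hE) h.zz hE' hl
      have h7 := mg _ _ (hY E hE) h.zz hE' hl
      rw [h5] at h6
      have h8 : 0 ≤ m * (z - Y E) := mul_nonneg hm.le (by linarith)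
      rcases eq_or_eq_neg_of_abs_eq hσ with rfl | rfl <;>
      rcases eq_or_eq_neg_of_abs_eq h.sa_abs with rfl | rfl <;>
      rcases eq_or_eq_neg_of_abs_eq h.sb_abs with rfl | rfl <;>
      rcases eq_or_eq_neg_of_abs_eq h.ta_abs with rfl | rfl <;>
      rcases eq_or_eq_neg_of_abs_eq h.tb_abs with rfl | rfl <;>
      linarith
    · have h6 := mf _ _ h.zz (hY E hE) hE' hl
      have h7 := mg _ _ h.zz (hY E hE) hE' hl
      rw [h5] at h6
      have h8 : 0 ≤ m * (Y E - z) := mul_nonneg hm.le (by linarith)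
      rcases eq_or_eq_neg_of_abs_eq hσ with rfl | rfl <;>
      rcases eq_or_eq_neg_of_abs_eq h.sa_abs with rfl | rfl <;>
      rcases eq_or_eq_neg_of_abs_eq h.sb_abs with rfl | rfl <;>
      rcases eq_or_eq_neg_of_abs_eq h.ta_abs with rfl | rfl <;>
      rcases eq_or_eq_neg_of_abs_eq h.tb_abs with rfl | rfl <;>
      linarith
  have hle : E1 - ω' ≤ E1 + ω' := by linarith
  have h3 := neg_le_abs (ta * (f z E1).v0)
  have h4 := neg_le_abs (tb * (g z E1).v0)
  have h5 := le_abs_self (ta * (f z E1).v0)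
  have h6 := le_abs_self (tb * (g z E1).v0)
  rw [Core.abs_sgn_mul h.ta_abs] at h3 h5
  rw [Core.abs_sgn_mul h.tb_abs] at h4 h6
  have up : 0 < 1 * (tb * (g (Y (E1 + ω')) (E1 + ω')).v0) := by
    have h1 := h.monoE_f h.zz h.EE (e1.trans hω') (by linarith)
    have h2 := h.monoE_g h.zz h.EE (e1.trans hω') (by linarith)
    rw [add_sub_cancel_left] at h1 h2
    exact key _ e1 1 (by simp) (by linarith) (by linarith)
  have dn : 0 < -1 * (tb * (g (Y (E1 - ω')) (E1 - ω')).v0) := by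
    have h1 := h.monoE_f h.zz (e2.trans hω') h.EE (by linarith)
    have h2 := h.monoE_g h.zz (e2.trans hω') h.EE (by linarith)
    rw [sub_sub_cancel] at h1 h2
    exact key _ e2 (-1) (by simp) (by linarith) (by linarith)
  have hivt : ∃ E ∈ Set.Icc (E1 - ω') (E1 + ω'), (g (Y E) E).v0 = 0 := by
    rcases eq_or_eq_neg_of_abs_eq h.tb_abs with rfl | rfl
    · exact intermediate_value_Icc hle hcont ⟨by linarith, by linarith⟩
    · exact intermediate_value_Icc' hle hcont ⟨by linarith, by linarith⟩
  obtain ⟨E, hE, hgE⟩ := hivt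
  have hE' : |E - E1| ≤ ω' := by rw [abs_le]; constructor <;> linarith [hE.1, hE.2]
  exact ⟨Y E, E, hE', hY E hE', hfY E hE', hgE⟩

end Pair

/-- A transversal pair together with a small interaction term. -/
structure PairC (f g cc : ℝ → ℝ → Jet) (u wa wb zb d nu : ℝ → ℝ → ℝ)
    (z E1 R ω m M sa sb ta tb K τ N0 c0 wl : ℝ) : Prop extends
    Pair f g z E1 R ω m M sa sb ta tb where
  ccv : ∀ y E, |y - z| ≤ R → |E - E1| ≤ ω → (cc y E).v0 = u y E ^ 2 * (zb y E * wa y E)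
  cc_le : ∀ y E, |y - z| ≤ R → |E - E1| ≤ ω → nrm (cc y E) ≤ N0
  c0_le : ∀ y E, |y - z| ≤ R → |E - E1| ≤ ω → c0 ≤ |(cc y E).v0|
  c0_pos : 0 < c0
  sq_le : 8 * N0 ^ 2 ≤ m ^ 2 * c0
  N0_le : N0 ≤ m ^ 2 / 4
  id : ∀ y E, |y - z| ≤ R → |E - E1| ≤ ω →
    (g y E).v0 * d y E - zb y E * wb y E = nu y E ^ 2
  d_le : ∀ y E, |y - z| ≤ R → |E - E1| ≤ ω → |d y E| ≤ K * nu y E ^ 2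
  nu_ne : ∀ y E, |y - z| ≤ R → |E - E1| ≤ ω → nu y E ≠ 0
  wl_pos : 0 < wl
  wa_ge : ∀ y E, |y - z| ≤ R → |E - E1| ≤ ω → wl ≤ ta * wa y E
  wb_ge : ∀ y E, |y - z| ≤ R → |E - E1| ≤ ω → wl ≤ tb * wb y E
  fs : ∀ y E, |y - z| ≤ R → |E - E1| ≤ ω → |(f y E).v0| ≤ τ
  gs : ∀ y E, |y - z| ≤ R → |E - E1| ≤ ω → |(g y E).v0| ≤ τ
  K_pos : 0 < K
  Kτ : 8 * K * τ ≤ 1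
  τ_le : τ ≤ 1
  Mτ : 8 * M * τ ≤ m ^ 2
  m_le : m ≤ 1
  N0_1 : N0 ≤ 1

namespace PairC

variable {f g cc : ℝ → ℝ → Jet} {u wa wb zb d nu : ℝ → ℝ → ℝ}
  {z E1 R ω m M sa sb ta tb K τ N0 c0 wl : ℝ}

/-- The combined coupling function. -/
abbrev P (_ : PairC f g cc u wa wb zb d nu z E1 R ω m M sa sb ta tb K τ N0 c0 wl) (y E : ℝ) : Jet :=
  cst (sa * sb) * (f y E * g y E + cc y E)

/-- The combined weight. -/
abbrev W (_ : PairC f g cc u wa wb zb d nu z E1 R ω m M sa sb ta tb K τ N0 c0 wl) (y E : ℝ) : ℝ :=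
  sa * sb * (wb y E * (f y E).v0 + u y E ^ 2 * d y E * wa y E)

variable (h : PairC f g cc u wa wb zb d nu z E1 R ω m M sa sb ta tb K τ N0 c0 wl)
variable {y E : ℝ}

include h

lemma σ_abs : |sa * sb| = 1 := by rw [abs_mul, h.sa_abs, h.sb_abs, one_mul]

lemma gd_le (hy : |y - z| ≤ R) (hE : |E - E1| ≤ ω) :
    |(g y E).v0 * d y E| ≤ nu y E ^ 2 / 8 := by
  rw [abs_mul]
  have h1 := h.d_le y E hy hE
  have h2 := h.gs y E hy hE
  have h3 : 0 ≤ τ := (abs_nonneg _).trans h2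
  have h4 : |(g y E).v0| * |d y E| ≤ τ * (K * nu y E ^ 2) :=
    mul_le_mul h2 h1 (abs_nonneg _) h3
  have h5 := mul_le_mul_of_nonneg_right h.Kτ (sq_nonneg (nu y E))
  linarith

lemma zbwb_le (hy : |y - z| ≤ R) (hE : |E - E1| ≤ ω) :
    zb y E * wb y E ≤ -(7 / 8 * nu y E ^ 2) := by
  have h1 := (abs_le.1 (h.gd_le hy hE)).2
  have := h.id y E hy hE
  linarith

lemma cc_sgn (hy : |y - z| ≤ R) (hE : |E - E1| ≤ ω) :
    sa * sb * (cc y E).v0 = |(cc y E).v0| := by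
  have h1 := h.zbwb_le hy hE
  have h2 : 0 < nu y E ^ 2 := by have := h.nu_ne y E hy hE; positivity
  have h3 := h.wa_ge y E hy hE
  have h4 := h.wb_ge y E hy hE
  have h5 := h.wl_pos
  have h6 : 0 < -(tb * zb y E) := by
    by_contra hc
    have h7 : 0 ≤ (tb * zb y E) * (tb * wb y E) := mul_nonneg (by linarith) (by linarith)
    have h8 : (tb * zb y E) * (tb * wb y E) = zb y E * wb y E := by
      rcases eq_or_eq_neg_of_abs_eq h.tb_abs with rfl | rfl <;> ring
    linarith
  have h7 : sa * sb * (cc y E).v0 = u y E ^ 2 * (-(tb * zb y E) * (ta * wa y E)) := by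
    rw [h.ccv y E hy hE, h.sgn]; ring
  have h8 : 0 ≤ sa * sb * (cc y E).v0 := by
    rw [h7]
    have : 0 < ta * wa y E := by linarith
    positivity
  rw [← abs_of_nonneg h8, abs_mul, h.σ_abs, one_mul]

lemma P_v0 (hy : |y - z| ≤ R) (hE : |E - E1| ≤ ω) :
    (h.P y E).v0 = (sa * (f y E).v0) * (sb * (g y E).v0) + |(cc y E).v0| := by
  rw [← h.cc_sgn hy hE, P, cst_mul]
  simp only [add_v0, mul_v0]; ring

lemma dxx_ge (hy : |y - z| ≤ R) (hE : |E - E1| ≤ ω) : m ^ 2 / 4 ≤ (h.P y E).dxx := by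
  have e : (h.P y E).dxx = (sa * (f y E).dx) * (sb * (g y E).dx) + (sa * sb) *
    ((f y E).v0 * (g y E).dxx) + (sa * sb) * ((f y E).dxx * (g y E).v0)
      + (sa * sb) * (cc y E).dxx := by
    rw [P, cst_mul]
    simp only [add_dxx, mul_dxx]; ring
  have h1 := mul_le_mul (h.fx y E hy hE) (h.gx y E hy hE) h.m_pos.le
    (h.m_pos.le.trans (h.fx y E hy hE))
  have h2 : |(sa * sb) * ((f y E).v0 * (g y E).dxx)| ≤ M * τ := by
    rw [Core.abs_sgn_mul h.σ_abs, abs_mul, mul_comm]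
    exact mul_le_mul ((abs_dxx_le _).trans (h.g_le y E hy hE)) (h.fs y E hy hE) (abs_nonneg _)
      h.M_pos.le
  have h3 : |(sa * sb) * ((f y E).dxx * (g y E).v0)| ≤ M * τ := by
    rw [Core.abs_sgn_mul h.σ_abs, abs_mul]
    exact mul_le_mul ((abs_dxx_le _).trans (h.f_le y E hy hE)) (h.gs y E hy hE) (abs_nonneg _)
      h.M_pos.le
  have h4 : |(sa * sb) * (cc y E).dxx| ≤ N0 := by
    rw [Core.abs_sgn_mul h.σ_abs]
    exact (abs_dxx_le _).trans (h.cc_le y E hy hE)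
  have := h.N0_le
  have := h.Mτ
  rw [e]
  rw [← pow_two] at h1
  have : 8 * (M * τ) ≤ m ^ 2 := by linarith
  linarith [(abs_le.1 h2).1, (abs_le.1 h3).1, (abs_le.1 h4).1, sq_nonneg m]

lemma dx_small {ε0 : ℝ} (hf : |(f z E1).v0| ≤ ε0) (hg : |(g z E1).v0| ≤ ε0) :
    |(h.P z E1).dx| ≤ 2 * M * ε0 + N0 := by
  have e : (h.P z E1).dx = (sa * sb) *
    ((f z E1).v0 * (g z E1).dx + (f z E1).dx * (g z E1).v0 + (cc z E1).dx) := by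
    rw [P, cst_mul]
    simp only [add_dx, mul_dx]
  rw [e, Core.abs_sgn_mul h.σ_abs]
  have h0 : 0 ≤ ε0 := (abs_nonneg _).trans hf
  have h2 : |(f z E1).v0 * (g z E1).dx| ≤ M * ε0 := by
    rw [abs_mul, mul_comm]
    exact mul_le_mul ((abs_dx_le _).trans (h.g_le z E1 h.zz h.EE)) hf (abs_nonneg _)
      h.M_pos.le
  have h3 : |(f z E1).dx * (g z E1).v0| ≤ M * ε0 := by
    rw [abs_mul]
    exact mul_le_mul ((abs_dx_le _).trans (h.f_le z E1 h.zz h.EE)) hg (abs_nonneg _)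
      h.M_pos.le
  have h4 := (abs_dx_le _).trans (h.cc_le z E1 h.zz h.EE)
  have h5 := abs_add_le ((f z E1).v0 * (g z E1).dx + (f z E1).dx * (g z E1).v0) (cc z E1).dx
  have h6 := abs_add_le ((f z E1).v0 * (g z E1).dx) ((f z E1).dx * (g z E1).v0)
  linarith

lemma exists_crit (hat : ∀ y, |y - z| ≤ R → IsAt h.P y E1) {ε0 r0 : ℝ}
    (hf : |(f z E1).v0| ≤ ε0) (hg : |(g z E1).v0| ≤ ε0)
    (hr : 2 * M * ε0 + N0 ≤ m ^ 2 / 2 * r0) (hr0 : r0 ≤ R) :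
    ∃ x, |x - z| ≤ r0 ∧ (h.P x E1).dx = 0 :=
  exists_zero (f := fun x => (h.P x E1).dx) (f' := fun x => 2 * (h.P x E1).dxx) (z := z) (R := R)
    (m := m ^ 2 / 2) (by have := h.m_pos; positivity) (fun x hx => (hat x hx).hdxx)
    (fun x hx => by linarith [h.dxx_ge hx h.EE]) ((h.dx_small hf hg).trans hr) hr0

/-- Lower bound for the combined coupling function away from the crossing. -/
lemma P_ge_far {ε0 D : ℝ} (hf : |(f z E1).v0| ≤ ε0) (hg : |(g z E1).v0| ≤ ε0)
    (hy : |y - z| ≤ R) (hD : D + ε0 ≤ m * |y - z|) (hD0 : 0 ≤ D) : D ^ 2 ≤ (h.P y E1).v0 := by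
  rw [h.P_v0 hy h.EE]
  have h1 := abs_nonneg (cc y E1).v0
  rw [← Core.abs_sgn_mul h.sa_abs] at hf
  rw [← Core.abs_sgn_mul h.sb_abs] at hg
  have h2 := abs_le.1 hf
  have h3 := abs_le.1 hg
  rcases le_total z y with hl | hl
  · have h4 := h.mono_f h.zz hy h.EE hl
    have h5 := h.mono_g h.zz hy h.EE hl
    rw [abs_of_nonneg (by linarith)] at hD
    have : D * D ≤ (sa * (f y E1).v0) * (sb * (g y E1).v0) :=
      mul_le_mul (by linarith) (by linarith) hD0 (by linarith)
    nlinarith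
  · have h4 := h.mono_f hy h.zz h.EE hl
    have h5 := h.mono_g hy h.zz h.EE hl
    rw [abs_of_nonpos (by linarith)] at hD
    have : D * D ≤ (-(sa * (f y E1).v0)) * (-(sb * (g y E1).v0)) :=
      mul_le_mul (by linarith) (by linarith) hD0 (by linarith)
    nlinarith

/-- At an exact crossing the combined coupling function is bounded below. -/
lemma P_ge_crossing {y0 : ℝ} (hy0 : |y0 - z| ≤ R) (hE : |E - E1| ≤ ω) (hf : (f y0 E).v0 = 0)
    (hg : (g y0 E).v0 = 0) (hy : |y - z| ≤ R) : c0 ≤ (h.P y E).v0 := by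
  rw [h.P_v0 hy hE]
  have h1 := h.c0_le y E hy hE
  have hm := h.m_pos
  rcases le_total y0 y with hl | hl
  · have h4 := h.mono_f hy0 hy hE hl
    have h5 := h.mono_g hy0 hy hE hl
    rw [hf] at h4
    rw [hg] at h5
    have : 0 ≤ m * (y - y0) := mul_nonneg hm.le (by linarith)
    have : 0 ≤ (sa * (f y E).v0) * (sb * (g y E).v0) := mul_nonneg (by linarith) (by linarith)
    linarith
  · have h4 := h.mono_f hy hy0 hE hl
    have h5 := h.mono_g hy hy0 hE hl
    rw [hf] at h4
    rw [hg] at h5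
    have : 0 ≤ m * (y0 - y) := mul_nonneg hm.le (by linarith)
    have : 0 ≤ (-(sa * (f y E).v0)) * (-(sb * (g y E).v0)) := mul_nonneg (by linarith) (by linarith)
    linarith

/-- Near the zeros of the combined function both factors have a common definite sign. -/
lemma sign_of_small {κ : ℝ} (hκ : κ ≤ c0 / 2) (hy : |y - z| ≤ R) (hE : |E - E1| ≤ ω)
    (hP : |(h.P y E).v0| ≤ κ) :
    ∃ θ : ℝ, |θ| = 1 ∧ θ * (ta * (f y E).v0) = |(f y E).v0| ∧
      θ * (tb * (g y E).v0) = |(g y E).v0| ∧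
      |(cc y E).v0| / 2 ≤ |(f y E).v0| * |(g y E).v0| := by
  rw [h.P_v0 hy hE] at hP
  have h1 := h.c0_le y E hy hE
  have h2 := h.c0_pos
  have h3 := (abs_le.1 hP).2
  have h4 : (sa * (f y E).v0) * (sb * (g y E).v0) =
      -((ta * (f y E).v0) * (tb * (g y E).v0)) := by
    linear_combination ((f y E).v0 * (g y E).v0) * h.sgn
  rw [h4] at h3
  have h5 : |(ta * (f y E).v0) * (tb * (g y E).v0)| = |(f y E).v0| * |(g y E).v0| := by
    rw [abs_mul, Core.abs_sgn_mul h.ta_abs, Core.abs_sgn_mul h.tb_abs]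
  have h6 : 0 < (ta * (f y E).v0) * (tb * (g y E).v0) := by linarith
  rw [abs_of_pos h6] at h5
  have e1 := Core.abs_sgn_mul (t := (f y E).v0) h.ta_abs
  have e2 := Core.abs_sgn_mul (t := (g y E).v0) h.tb_abs
  rcases mul_pos_iff.1 h6 with ⟨ha, hb⟩ | ⟨ha, hb⟩
  · refine ⟨1, by simp, ?_, ?_, by linarith⟩
    · rw [one_mul, ← e1, abs_of_pos ha]
    · rw [one_mul, ← e2, abs_of_pos hb]
  · refine ⟨-1, by simp, ?_, ?_, by linarith⟩
    · rw [← e1, abs_of_neg ha]; ring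
    · rw [← e2, abs_of_neg hb]; ring

/-- Energy slope of the combined function near its zeros. -/
lemma dE_ge {θ κ : ℝ} (hκ : κ ≤ m * c0 / 4) (hy : |y - z| ≤ R)
    (hE : |E - E1| ≤ ω) (h1 : θ * (ta * (f y E).v0) = |(f y E).v0|)
    (hθ : |θ| = 1) (h2 : θ * (tb * (g y E).v0) = |(g y E).v0|)
    (h3 : |(cc y E).v0| / 2 ≤ |(f y E).v0| * |(g y E).v0|) : κ ≤ -θ * (h.P y E).dE := by
  set F := |(f y E).v0|
  set Γ := |(g y E).v0|
  have e : -θ * (h.P y E).dE = (θ * (ta * (f y E).v0)) * (tb * (g y E).dE)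
      + (ta * (f y E).dE) * (θ * (tb * (g y E).v0)) + (-θ * (sa * sb)) * (cc y E).dE := by
    rw [P, cst_mul]
    simp only [add_dE, mul_dE]
    linear_combination (-θ * ((f y E).v0 * (g y E).dE + (f y E).dE * (g y E).v0)) * h.sgn
  have hs : |-θ * (sa * sb)| = 1 := by rw [abs_mul, abs_neg, hθ, h.σ_abs, one_mul]
  have h4 : |(-θ * (sa * sb)) * (cc y E).dE| ≤ N0 := by
    rw [Core.abs_sgn_mul hs]
    exact (abs_dE_le _).trans (h.cc_le y E hy hE)
  have hF : 0 ≤ F := abs_nonneg _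
  have hΓ : 0 ≤ Γ := abs_nonneg _
  have hF1 : F ≤ 1 := (h.fs y E hy hE).trans h.τ_le
  have hΓ1 : Γ ≤ 1 := (h.gs y E hy hE).trans h.τ_le
  have hm := h.m_pos
  have hc := h.c0_le y E hy hE
  have hc0 := h.c0_pos
  have hN : 2 * N0 ≤ m * (F + Γ) := by
    refine (abs_le_of_sq_le_sq' ?_ (by positivity)).2
    have h8 := h.sq_le
    have h9 : c0 / 2 ≤ F * Γ := by linarith
    have h10 : m ^ 2 * (c0 / 2) ≤ m ^ 2 * (F * Γ) := by gcongr
    have h11 : 4 * (m ^ 2 * (F * Γ)) ≤ m ^ 2 * (F + Γ) ^ 2 := by nlinarith [sq_nonneg (m * (F - Γ))]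
    nlinarith
  rw [e, h1, h2]
  have h5 := mul_le_mul_of_nonneg_left (h.gE y E hy hE) hF
  have h6 := mul_le_mul_of_nonneg_right (h.fE y E hy hE) hΓ
  have h7 : m * (c0 / 2) ≤ m * (F + Γ) := by
    gcongr
    nlinarith
  linarith [(abs_le.1 h4).1]

/-- Size of the combined weight near the zeros of the combined function. -/
lemma W_ge {θ κ : ℝ} (hκ : κ ≤ wl * c0 / 8) (hy : |y - z| ≤ R)
    (hE : |E - E1| ≤ ω) (h1 : θ * (ta * (f y E).v0) = |(f y E).v0|)
    (hθ : |θ| = 1)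
    (h3 : |(cc y E).v0| / 2 ≤ |(f y E).v0| * |(g y E).v0|) : κ ≤ -θ * h.W y E := by
  set F := |(f y E).v0|
  set Γ := |(g y E).v0|
  have e : -θ * h.W y E = (θ * (ta * (f y E).v0)) * (tb * wb y E)
      + (-θ * (sa * sb)) * (u y E ^ 2 * d y E * wa y E) := by
    rw [W]
    linear_combination (-θ * (wb y E * (f y E).v0)) * h.sgn
  have hs : |-θ * (sa * sb)| = 1 := by rw [abs_mul, abs_neg, hθ, h.σ_abs, one_mul]
  have hF : 0 ≤ F := abs_nonneg _
  have hΓ : 0 ≤ Γ := abs_nonneg _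
  have hΓτ : Γ ≤ τ := h.gs y E hy hE
  have hΓ1 : Γ ≤ 1 := hΓτ.trans h.τ_le
  have hc := h.c0_le y E hy hE
  have hc0 := h.c0_pos
  have hwl := h.wl_pos
  have hb := h.wb_ge y E hy hE
  have hu := sq_nonneg (u y E)
  have hn := sq_nonneg (nu y E)
  have hwb : |wb y E| = tb * wb y E := by
    rw [← Core.abs_sgn_mul h.tb_abs, abs_of_pos (by linarith)]
  have hΓp : 0 < Γ := by
    rcases hΓ.eq_or_lt with h0 | h0
    · rw [← h0] at h3; linarith
    · exact h0
  have hz : 7 / 8 * nu y E ^ 2 ≤ |zb y E| * |wb y E| := by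
    rw [← abs_mul]
    have := neg_le_abs (zb y E * wb y E)
    linarith [h.zbwb_le hy hE]
  have hcc : |(cc y E).v0| = u y E ^ 2 * (|zb y E| * |wa y E|) := by
    rw [h.ccv y E hy hE, abs_mul, abs_mul, abs_of_nonneg hu]
  have hA : 0 ≤ u y E ^ 2 * |wa y E| := by positivity
  have hd : |u y E ^ 2 * d y E * wa y E| ≤ (u y E ^ 2 * |wa y E|) * (K * nu y E ^ 2) := by
    rw [abs_mul, abs_mul, abs_of_nonneg hu]
    have := mul_le_mul_of_nonneg_left (h.d_le y E hy hE) hA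
    linarith
  have hK := h.K_pos
  have hkey : Γ * ((u y E ^ 2 * |wa y E|) * (K * nu y E ^ 2)) ≤ Γ * (F * |wb y E| / 2) := by
    have a1 : Γ * K ≤ 1 / 8 := by
      have := mul_le_mul_of_nonneg_right hΓτ hK.le
      linarith [h.Kτ]
    have a2 : (Γ * K) * ((u y E ^ 2 * |wa y E|) * nu y E ^ 2) ≤
        1 / 8 * ((u y E ^ 2 * |wa y E|) * nu y E ^ 2) := by gcongr
    have a3 := mul_le_mul_of_nonneg_left hz hA
    have a4 := mul_le_mul_of_nonneg_right h3 (abs_nonneg (wb y E))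
    rw [hcc] at a4
    have a5 : 0 ≤ (u y E ^ 2 * |wa y E|) * nu y E ^ 2 := by positivity
    linarith
  have hkey2 := le_of_mul_le_mul_left hkey hΓp
  have h8 : |(-θ * (sa * sb)) * (u y E ^ 2 * d y E * wa y E)| ≤ F * |wb y E| / 2 := by
    rw [Core.abs_sgn_mul hs]; exact hd.trans hkey2
  have h9 : c0 / 2 ≤ F := by nlinarith
  have h10 : (c0 / 2) * wl ≤ F * |wb y E| := mul_le_mul h9 (by linarith) hwl.le hF
  rw [e, h1, ← hwb]
  nlinarith [(abs_le.1 h8).1]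

/-- Energy slope and weight of the combined function have a common constant sign near its zeros. -/
theorem exists_sign {κ : ℝ} (hκ0 : 0 < κ) (hκ1 : κ ≤ m * c0 / 8) (hκ2 : κ ≤ wl * c0 / 8)
    (hκω : κ ^ 2 ≤ ω) (hκM : 8 * M * κ ^ 2 ≤ c0) :
    ∃ s : ℝ, |s| = 1 ∧ ∀ y E, |y - z| ≤ R → |E - E1| ≤ κ ^ 2 → |(h.P y E).v0| ≤ κ →
      κ ≤ s * (h.P y E).dE ∧ κ ≤ s * h.W y E := by
  have hc0 := h.c0_pos
  have hm := h.m_pos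
  have hm1 := h.m_le
  have hκc : κ ≤ c0 / 2 := by nlinarith
  by_cases hex : ∃ y E, |y - z| ≤ R ∧ |E - E1| ≤ κ ^ 2 ∧ |(h.P y E).v0| ≤ κ
  swap
  · exact ⟨1, by simp, fun y E hy hE hP => (hex ⟨y, E, hy, hE, hP⟩).elim⟩
  obtain ⟨y0, E0, hy0, hE0, hP0⟩ := hex
  obtain ⟨θ, t1, t2, t3, t4⟩ := h.sign_of_small hκc hy0 (hE0.trans hκω) hP0
  refine ⟨-θ, by rwa [abs_neg], fun y E hy hE hP => ?_⟩
  obtain ⟨θ', q1, q2, q3, q4⟩ := h.sign_of_small hκc hy (hE.trans hκω) hP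
  suffices hθ : θ' = θ by
    rw [← hθ]
    exact ⟨h.dE_ge (by nlinarith) hy (hE.trans hκω) q2 q1 q3 q4,
      h.W_ge hκ2 hy (hE.trans hκω) q2 q1 q4⟩
  have hEE : |E - E0| ≤ 2 * κ ^ 2 := by
    have := abs_sub_le E E1 E0
    rw [abs_sub_comm E1] at this
    linarith
  have hM := h.M_pos
  have hML : M * |E - E0| ≤ c0 / 4 := by
    have : M * |E - E0| ≤ M * (2 * κ ^ 2) := by gcongr
    linarith
  have hcc := h.c0_le y0 E0 hy0 (hE0.trans hκω)
  have f1 := (h.fs y0 E0 hy0 (hE0.trans hκω)).trans h.τ_le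
  have g1 := (h.gs y0 E0 hy0 (hE0.trans hκω)).trans h.τ_le
  have fp : c0 / 2 ≤ |(f y0 E0).v0| := by
    have := mul_le_mul_of_nonneg_left g1 (abs_nonneg (f y0 E0).v0)
    linarith
  have gp : c0 / 2 ≤ |(g y0 E0).v0| := by
    have := mul_le_mul_of_nonneg_right f1 (abs_nonneg (g y0 E0).v0)
    linarith
  have fl := abs_le.1 ((h.lipE_f hy0 (hE0.trans hκω) (hE.trans hκω)).trans hML)
  have gl := abs_le.1 ((h.lipE_g hy0 (hE0.trans hκω) (hE.trans hκω)).trans hML)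
  rw [← t2] at fp
  rw [← t3] at gp
  have fe : 0 < θ * (ta * (f y0 E).v0) := by
    rcases eq_or_eq_neg_of_abs_eq t1 with rfl | rfl <;>
    rcases eq_or_eq_neg_of_abs_eq h.ta_abs with rfl | rfl <;> linarith [fl.1, fl.2]
  have ge : 0 < θ * (tb * (g y0 E).v0) := by
    rcases eq_or_eq_neg_of_abs_eq t1 with rfl | rfl <;>
    rcases eq_or_eq_neg_of_abs_eq h.tb_abs with rfl | rfl <;> linarith [gl.1, gl.2]
  have hcc' := h.c0_le y E hy (hE.trans hκω)
  have fy : 0 < θ' * (ta * (f y E).v0) := by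
    rw [q2]
    rcases (abs_nonneg (f y E).v0).eq_or_lt with h0 | h0
    · rw [← h0] at q4; linarith
    · exact h0
  have gy : 0 < θ' * (tb * (g y E).v0) := by
    rw [q3]
    rcases (abs_nonneg (g y E).v0).eq_or_lt with h0 | h0
    · rw [← h0] at q4; linarith
    · exact h0
  have hsgn := h.sgn
  have sa1 := h.sa_abs
  have sb1 := h.sb_abs
  have ta1 := h.ta_abs
  have tb1 := h.tb_abs
  rcases le_total y0 y with hl | hl
  · have h4 := h.mono_f hy0 hy (hE.trans hκω) hl
    have h5 := h.mono_g hy0 hy (hE.trans hκω) hl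
    have h6 : 0 ≤ m * (y - y0) := mul_nonneg hm.le (by linarith)
    clear t4 q4 q2 q3 t2 t3
    rcases eq_or_eq_neg_of_abs_eq q1 with rfl | rfl <;>
    rcases eq_or_eq_neg_of_abs_eq t1 with rfl | rfl <;>
    rcases eq_or_eq_neg_of_abs_eq sa1 with rfl | rfl <;>
    rcases eq_or_eq_neg_of_abs_eq sb1 with rfl | rfl <;>
    rcases eq_or_eq_neg_of_abs_eq ta1 with rfl | rfl <;>
    rcases eq_or_eq_neg_of_abs_eq tb1 with rfl | rfl <;>
    first | rfl | (exfalso; linarith)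
  · have h4 := h.mono_f hy hy0 (hE.trans hκω) hl
    have h5 := h.mono_g hy hy0 (hE.trans hκω) hl
    have h6 : 0 ≤ m * (y0 - y) := mul_nonneg hm.le (by linarith)
    clear t4 q4 q2 q3 t2 t3
    rcases eq_or_eq_neg_of_abs_eq q1 with rfl | rfl <;>
    rcases eq_or_eq_neg_of_abs_eq t1 with rfl | rfl <;>
    rcases eq_or_eq_neg_of_abs_eq sa1 with rfl | rfl <;>
    rcases eq_or_eq_neg_of_abs_eq sb1 with rfl | rfl <;>
    rcases eq_or_eq_neg_of_abs_eq ta1 with rfl | rfl <;>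
    rcases eq_or_eq_neg_of_abs_eq tb1 with rfl | rfl <;>
    first | rfl | (exfalso; linarith)

end PairC

namespace Core
open Ctx

variable {c : Ctx} {C : Core c} {E1 ξ wl : ℝ} {z : Bool → ℝ} {par : Bool → Bool}
  {sx sE : Bool → ℝ}

lemma PreI.v0_le (hP : C.PreI E1 ξ wl z par sx sE) {j : Bool} {x E : ℝ} (hx : |x - z j| ≤ ξ)
    (hE : |E - E1| ≤ ξ) : |(C.G (par j) x E).v0| ≤ C.K * (|x - z j| + |E - E1|) := by
  have hξ := hP.ξ_pos
  have h1 := lipE (par j) (hP.nearD hx) hP.win (E := E1) (E' := E) (by simpa using hξ.le) hE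
  have h2 := lipX (par j) hP.memW (hP.near j) (x := z j) (x' := x) (by simpa using hξ.le) hx
  rw [hP.zero, sub_zero] at h2
  have h3 := abs_sub_abs_le_abs_sub (C.G (par j) x E).v0 (C.G (par j) x E1).v0
  linarith

lemma PreI.sgn_bool (hP : C.PreI E1 ξ wl z par sx sE) (a : Bool) :
    sx a * sx (!a) = -(sE a * sE (!a)) := by
  have h1 := hP.sgn_t
  have h2 := hP.sgn_f
  have h3 := hP.sE_abs true
  have h4 := hP.sE_abs false
  cases a <;> simp only [Bool.not_true, Bool.not_false] <;>
  rcases eq_or_eq_neg_of_abs_eq h3 with h3 | h3 <;>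
  rcases eq_or_eq_neg_of_abs_eq h4 with h4 | h4 <;> rw [h3] at h1 ⊢ <;> rw [h4] at h2 ⊢ <;>
  · have h5 : sx true = 1 ∨ sx true = -1 := by
      first | (left; linarith) | (right; linarith)
    have h6 : sx false = 1 ∨ sx false = -1 := by
      first | (left; linarith) | (right; linarith)
    rcases h5 with h5 | h5 <;> rcases h6 with h6 | h6 <;> rw [h5] at h1 ⊢ <;>
      rw [h6] at h2 ⊢ <;> linarith

section

variable {ε ρ B η R : ℝ} {h : ℕ}

set_option maxHeartbeats 2000000 in
theorem PreI.pairC (hP : C.PreI E1 ξ wl z par sx sE)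
    (hD : StepData C (ξ ^ 100) ε h ρ B η) (hR : R ≤ ξ) (hR' : ξ ^ 98 ≤ R)
    (hε : ε ≤ ξ ^ 100) (hεw : ε ≤ wl / 2)
    (M : (hP.ref hD hR hR').Res) (hMR : M.R = 2 * ξ ^ 80) (hrr : M.rr ≤ ξ ^ 95) {N0 c0 : ℝ}
    (hN0 : (ρ ^ M.m2) ^ 2 * (C.νb * (3 * C.Q)) ^ 2 ≤ N0) (hc0 : 0 < c0)
    (hc : c0 * (4 * (C.νb * (3 * C.Q))) ≤ (c.b ^ (10 * M.m2))⁻¹ ^ 2 * (C.νlow ^ 2 * wl))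
    (hNc : 8 * N0 ^ 2 ≤ (ξ / 2) ^ 2 * c0) (hN1 : N0 ≤ ξ ^ 200) :
    PairC M.f M.g M.cc (fun y E => (M.u y E).v0) (fun y E => (M.wa y E).v0)
      (fun y E => (M.wb y E).v0) (fun y E => (M.zb y E).v0) (fun y E => (M.d y E).v0)
      (fun y E => (M.νb y E).v0) (z M.a) E1 (2 * ξ ^ 80) (ξ ^ 103) (ξ / 2) (2 / ξ)
      (sx M.a) (sx (!M.a)) (sE M.a) (sE (!M.a)) C.K (ξ ^ 78) N0 c0 (wl / 2) := by
  have hξ := hP.ξ_pos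
  have hξ1 := hP.ξ_le
  have q1 := hP.pow_step (show 1 < 80 by norm_num)
  have q2 := hP.pow_step (show 80 < 95 by norm_num)
  have q3 := hP.pow_step (show 80 < 103 by norm_num)
  have q4 := hP.pow_step (show 1 < 100 by norm_num)
  have q5 := hP.pow_step (show 78 < 79 by norm_num)
  have q6 := hP.pow_step (show 78 < 100 by norm_num)
  rw [pow_one] at q1 q4
  have p80 : 0 < ξ ^ 80 := by positivity
  have p100 : 0 < ξ ^ 100 := by positivity
  have p103 : 0 < ξ ^ 103 := by positivity
  have p79 : 0 < ξ ^ 79 := by positivity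
  have hKp := C.K_pos
  have eh : (hP.ref hD hR hR').eh ≤ ε := hD.eh_le
  have hy' : ∀ {y}, |y - z M.a| ≤ 2 * ξ ^ 80 → |y - (hP.ref hD hR hR').z M.a| ≤ M.R :=
    fun h => by rw [hMR]; exact h
  have ha : ∀ {y}, |y - z M.a| ≤ 2 * ξ ^ 80 → |y - z M.a| ≤ ξ := fun h => by linarith
  have hb3 : ∀ {y}, |y - z M.a| ≤ 2 * ξ ^ 80 →
      |y + M.n * c.α - M.m0 - z (!M.a)| ≤ 3 * ξ ^ 80 := fun {y} h => by
    have e : y + M.n * c.α - M.m0 - z (!M.a) =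
      (y - z M.a) + (z M.a + M.n * c.α - M.m0 - z (!M.a)) := by ring
    have h1 := abs_add_le (y - z M.a) (z M.a + M.n * c.α - M.m0 - z (!M.a))
    have h2 : |z M.a + M.n * c.α - M.m0 - z (!M.a)| ≤ M.rr := M.hres
    rw [e]; linarith
  have hb : ∀ {y}, |y - z M.a| ≤ 2 * ξ ^ 80 → |y + M.n * c.α - M.m0 - z (!M.a)| ≤ ξ :=
    fun h => (hb3 h).trans (by linarith)
  have hE1 : ∀ {E}, |E - E1| ≤ ξ ^ 103 → |E - E1| ≤ ξ := fun h => by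
    linarith
  have hW : ∀ {E}, |E - E1| ≤ ξ ^ 103 → E ∈ (hP.ref hD hR hR').W := fun h => h
  have hf : ∀ {y E}, |y - z M.a| ≤ 2 * ξ ^ 80 → |E - E1| ≤ ξ ^ 103 →
      nrm (M.f y E - C.G (par M.a) y E) ≤ ε := fun h1 h2 =>
    (M.f_close (hy' h1) (hW h2)).trans eh
  have hg : ∀ {y E}, |y - z M.a| ≤ 2 * ξ ^ 80 → |E - E1| ≤ ξ ^ 103 →
      nrm (M.g y E - C.G (par (!M.a)) (y + M.n * c.α - M.m0) E) ≤ ε := fun h1 h2 =>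
    (M.g_close (hy' h1) (hW h2)).trans eh
  have hKξ : C.K ≤ 1 / ξ := by rw [le_div_iff₀ hξ]; exact hP.K_le
  have hKε : C.K + ε ≤ 2 / ξ := by
    have : 2 / ξ = 1 / ξ + 1 / ξ := by ring
    have : 1 ≤ 1 / ξ := by rw [le_div_iff₀ hξ]; linarith
    linarith
  have hKpow : ∀ t, t ≤ 3 * ξ ^ 80 + ξ ^ 103 → C.K * t + ε ≤ ξ ^ 78 := fun t ht => by
    have h1 : C.K * t ≤ C.K * (4 * ξ ^ 80) := by gcongr; linarith
    have h2 : C.K * (4 * ξ ^ 80) = (C.K * ξ) * (4 * ξ ^ 79) := by ring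
    have h3 : (C.K * ξ) * (4 * ξ ^ 79) ≤ 1 * (4 * ξ ^ 79) := by gcongr; exact hP.K_le
    linarith
  have hv : ∀ {F F' : Jet} {t : ℝ}, nrm (F - F') ≤ ε → |F'.v0| ≤ C.K * t →
      t ≤ 3 * ξ ^ 80 + ξ ^ 103 → |F.v0| ≤ ξ ^ 78 := fun {F F' t} h1 h2 h3 => by
    have h4 := (abs_v0_le _).trans h1
    rw [sub_v0] at h4
    have := abs_sub_abs_le_abs_sub F.v0 F'.v0
    linarith [hKpow t h3]
  have hwb : ∀ y E, |y - z M.a| ≤ 2 * ξ ^ 80 → |E - E1| ≤ ξ ^ 103 →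
      wl / 2 ≤ sE (!M.a) * (M.wb y E).v0 := fun y E h1 h2 => by
    have h3 : |(M.wb y E).v0 - C.w (par (!M.a)) (y + M.n * c.α - M.m0) E| ≤ ε :=
      (M.wb_close (hy' h1) (hW h2)).trans eh
    have h3 := sgn_mul_ge (hP.sE_abs (!M.a)) h3
    have := hP.w (!M.a) _ E (hb h1) (hE1 h2)
    linarith
  have hwa : ∀ y E, |y - z M.a| ≤ 2 * ξ ^ 80 → |E - E1| ≤ ξ ^ 103 →
      wl / 2 ≤ sE M.a * (M.wa y E).v0 := fun y E h1 h2 => by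
    have h3 : |(M.wa y E).v0 - C.w (par M.a) y E| ≤ ε :=
      (M.wa_close (hy' h1) (hW h2)).trans eh
    have h3 := sgn_mul_ge (hP.sE_abs M.a) h3
    have := hP.w M.a _ E (ha h1) (hE1 h2)
    linarith
  have hK8 : 8 * C.K * ξ ^ 78 ≤ 1 := by
    have h2 : 8 * C.K * ξ ^ 78 = (C.K * ξ) * (8 * ξ ^ 77) := by ring
    have h3 : (C.K * ξ) * (8 * ξ ^ 77) ≤ 1 * (8 * ξ ^ 77) := by gcongr; exact hP.K_le
    have := hP.pow_step (show 0 < 77 by norm_num)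
    rw [pow_zero] at this
    linarith
  have hwl := hP.wl_pos
  have hcc : ∀ y E, |y - z M.a| ≤ 2 * ξ ^ 80 → |E - E1| ≤ ξ ^ 103 →
      (M.cc y E).v0 = (M.u y E).v0 ^ 2 * ((M.zb y E).v0 * (M.wa y E).v0) := fun y E h1 h2 => by
    rw [Ref.Res.cc, pow_two]; simp only [mul_v0]; ring
  have hid : ∀ y E, (M.g y E).v0 * (M.d y E).v0 - (M.zb y E).v0 * (M.wb y E).v0
      = (M.νb y E).v0 ^ 2 := fun y E => by
    have := congrArg Jet.v0 (M.gf_id y E)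
    rw [pow_two] at this
    simp only [sub_v0, mul_v0] at this
    rw [pow_two]; exact this
  have hνl := C.νlow_pos
  have hνb := C.νb_pos
  have hQ := C.Q_pos
  have hgs : ∀ y E, |y - z M.a| ≤ 2 * ξ ^ 80 → |E - E1| ≤ ξ ^ 103 → |(M.g y E).v0| ≤ ξ ^ 78 :=
    fun y E h1 h2 => hv (hg h1 h2) (hP.v0_le (hb h1) (hE1 h2)) (by linarith [hb3 h1])
  refine {
    atf := fun y E h1 h2 => M.isAt_f (hy' h1) (hW h2)
    atg := fun y E h1 h2 => M.isAt_g (hy' h1) (hW h2)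
    m_pos := by positivity
    M_pos := by positivity
    R_nonneg := by positivity
    ω_nonneg := p103.le
    sa_abs := hP.sx_abs _
    sb_abs := hP.sx_abs _
    ta_abs := hP.sE_abs _
    tb_abs := hP.sE_abs _
    sgn := hP.sgn_bool _
    fx := fun y E h1 h2 => ?_
    gx := fun y E h1 h2 => ?_
    fE := fun y E h1 h2 => ?_
    gE := fun y E h1 h2 => ?_
    f_le := fun y E h1 h2 => ?_
    g_le := fun y E h1 h2 => ?_
    ccv := hcc
    cc_le := fun y E h1 h2 => (M.nrm_cc (hy' h1) (hW h2)).trans hN0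
    c0_le := fun y E h1 h2 => ?_
    c0_pos := hc0
    sq_le := hNc
    N0_le := ?_
    id := fun y E h1 h2 => hid y E
    d_le := fun y E h1 h2 => M.abs_d_le (hy' h1) (hW h2)
    nu_ne := fun y E h1 h2 h3 => ?_
    wl_pos := by linarith
    wa_ge := hwa
    wb_ge := hwb
    fs := fun y E h1 h2 => ?_
    gs := hgs
    K_pos := hKp
    Kτ := hK8
    τ_le := ?_
    Mτ := ?_
    m_le := by linarith
    N0_1 := ?_ }
  · have h3 := (abs_dx_le _).trans (hf h1 h2)
    rw [sub_dx] at h3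
    have := sgn_mul_ge (hP.sx_abs M.a) h3
    linarith [hP.dx M.a y E (ha h1) (hE1 h2)]
  · have h3 := (abs_dx_le _).trans (hg h1 h2)
    rw [sub_dx] at h3
    have := sgn_mul_ge (hP.sx_abs (!M.a)) h3
    linarith [hP.dx (!M.a) _ E (hb h1) (hE1 h2)]
  · have h3 := (abs_dE_le _).trans (hf h1 h2)
    rw [sub_dE] at h3
    have := sgn_mul_ge (hP.sE_abs M.a) h3
    linarith [hP.dE M.a y E (ha h1) (hE1 h2)]
  · have h3 := (abs_dE_le _).trans (hg h1 h2)
    rw [sub_dE] at h3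
    have := sgn_mul_ge (hP.sE_abs (!M.a)) h3
    linarith [hP.dE (!M.a) _ E (hb h1) (hE1 h2)]
  · have := nrm_le_add (M.f y E) (C.G (par M.a) y E)
    linarith [hf h1 h2, C.G_le _ y (hP.nearD (ha h1)) E (hP.win E (hE1 h2))]
  · have := nrm_le_add (M.g y E) (C.G (par (!M.a)) (y + M.n * c.α - M.m0) E)
    linarith [hg h1 h2, C.G_le _ _ (hP.nearD (hb h1)) E (hP.win E (hE1 h2))]
  · rw [hcc y E h1 h2, abs_mul, abs_mul, abs_pow]
    have hu := M.u_ge (hy' h1) (hW h2)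
    have hU : 0 < (c.b ^ (10 * M.m2))⁻¹ := by have := c.one_le_b; positivity
    have hwa' : wl / 2 ≤ |(M.wa y E).v0| := by
      rw [← abs_sgn_mul (hP.sE_abs M.a)]
      exact (hwa y E h1 h2).trans (le_abs_self _)
    have hwbn := (abs_v0_le _).trans (M.nrm_wb (hy' h1) (hW h2))
    have hνn := M.νlow_le (hy' h1) (hW h2)
    have hν2 : C.νlow ^ 2 ≤ (M.νb y E).v0 ^ 2 := by
      rw [← sq_abs (M.νb y E).v0]; gcongr
    have hgd : |(M.g y E).v0 * (M.d y E).v0| ≤ (M.νb y E).v0 ^ 2 / 8 := by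
      rw [abs_mul]
      have h4 := mul_le_mul (hgs y E h1 h2) (M.abs_d_le (hy' h1) (hW h2)) (abs_nonneg _)
        (by positivity)
      have h5 := mul_le_mul_of_nonneg_right hK8 (sq_nonneg (M.νb y E).v0)
      linarith
    have hzw : C.νlow ^ 2 / 2 ≤ |(M.zb y E).v0| * |(M.wb y E).v0| := by
      rw [← abs_mul]
      have := hid y E
      have := (abs_le.1 hgd).2
      have := neg_abs_le ((M.zb y E).v0 * (M.wb y E).v0)
      linarith [sq_nonneg (M.νb y E).v0]
    have hz2 : C.νlow ^ 2 / 2 ≤ |(M.zb y E).v0| * (C.νb * (3 * C.Q)) :=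
      hzw.trans (mul_le_mul_of_nonneg_left hwbn (abs_nonneg _))
    have hNn : 0 < C.νb * (3 * C.Q) := by positivity
    refine le_of_mul_le_mul_right ?_ (show 0 < 4 * (C.νb * (3 * C.Q)) by positivity)
    refine hc.trans ?_
    have h6 : (c.b ^ (10 * M.m2))⁻¹ ^ 2 ≤ |(M.u y E).v0| ^ 2 := by gcongr
    have h7 : C.νlow ^ 2 / 2 * (wl / 2) ≤
      (|(M.zb y E).v0| * (C.νb * (3 * C.Q))) * |(M.wa y E).v0| := by gcongr
    have h8 : (c.b ^ (10 * M.m2))⁻¹ ^ 2 * (C.νlow ^ 2 / 2 * (wl / 2)) ≤ |(M.u y E).v0| ^ 2 *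
      ((|(M.zb y E).v0| * (C.νb * (3 * C.Q))) * |(M.wa y E).v0|) := by gcongr
    linarith
  · have := hP.pow_step (show 2 < 200 by norm_num)
    have : 0 < ξ ^ 2 := by positivity
    linarith
  · have := M.νlow_le (hy' h1) (hW h2)
    have h3 : (M.νb y E).v0 = 0 := h3
    rw [h3, abs_zero] at this
    linarith
  · exact hv (hf h1 h2) (hP.v0_le (ha h1) (hE1 h2)) (by linarith)
  · have := hP.pow_step (show 0 < 78 by norm_num)
    have : 0 < ξ ^ 78 := by positivity
    linarith [pow_zero ξ]
  · have h1 : 8 * (2 / ξ) * ξ ^ 78 = 16 * ξ ^ 77 := by field_simp; ring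
    rw [h1]
    have := hP.pow_step (show 2 < 77 by norm_num)
    have : 0 < ξ ^ 77 := by positivity
    linarith
  · have := hP.pow_step (show 0 < 200 by norm_num)
    have : 0 < ξ ^ 200 := by positivity
    linarith [pow_zero ξ]

end

variable {ε ρ B η : ℝ} {h : ℕ}

set_option maxHeartbeats 2000000 in
/-- Refinement at resonant transversal critical points. -/
theorem PreI.merge (hP : C.PreI E1 ξ wl z par sx sE)
    (hD : StepData C (ξ ^ 100) ε h ρ B η) (hε : ε ≤ ξ ^ 100) (hεw : ε ≤ wl / 2)
    {a : Bool} {n Ret : ℕ} {m0 : ℤ} (hn : C.Ret < n)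
    (hres : |z a + n * c.α - m0 - z (!a)| ≤ ξ ^ 95)
    (hsame : ∀ t m : ℤ, t ≠ 0 → |t| ≤ Ret → 6 * ξ ^ 80 < |t * c.α - m|)
    (hRet : h + C.H1 + C.k + n ≤ Ret) {N0 c0 K' κ' : ℝ}
    (hN0 : (ρ ^ (n - C.k - 1)) ^ 2 * (C.νb * (3 * C.Q)) ^ 2 ≤ N0) (hc0 : 0 < c0)
    (hc : c0 * (4 * (C.νb * (3 * C.Q))) ≤
      (c.b ^ (10 * (n - C.k - 1)))⁻¹ ^ 2 * (C.νlow ^ 2 * wl))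
    (hNc : 8 * N0 ^ 2 ≤ (ξ / 2) ^ 2 * c0) (hN1 : N0 ≤ ξ ^ 200)
    (hK1 : (2 * C.K) ^ 2 + (C.νb * (3 * C.Q)) ^ 2 ≤ K')
    (hK2 : c.b ^ (10 * (C.k + n + 1)) ≤ K' * (C.νlow ^ 2 * (c.b ^ (10 * (n - C.k - 1)))⁻¹))
    (hκ0 : 0 < κ') (hκξ : κ' ≤ ξ ^ 200) (hκ1 : κ' ≤ ξ / 2 * c0 / 8)
    (hκ2 : κ' ≤ wl / 2 * c0 / 8) (hκK : K' * κ' ≤ 1) :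
    ∃ C' : Core c, C'.Params (C.k + n) h Ret C.H1 ρ B K' (C.νb ^ 2)
        (C.νlow ^ 2 * (c.b ^ (10 * (n - C.k - 1)))⁻¹) ∧ (∃ s, C'.StII E1 κ' s) ∧
      (z a + n * c.α - m0 - z (!a) = 0 → ε ≤ ξ ^ 105 → ∃ E3 ∈ C'.W, |E3 - E1| ≤ ξ ^ 103 ∧
        ∀ j y, |y - C'.ctr j| ≤ C'.rD → c0 ≤ |(C'.G j y E3).v0|) := by
  have hξ := hP.ξ_pos
  have hξ1 := hP.ξ_le
  have q1 := hP.pow_step (show 1 < 80 by norm_num)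
  have q2 := hP.pow_step (show 80 < 95 by norm_num)
  have q3 := hP.pow_step (show 80 < 98 by norm_num)
  have q4 := hP.pow_step (show 80 < 89 by norm_num)
  have q5 := hP.pow_step (show 85 < 89 by norm_num)
  have q6 := hP.pow_step (show 80 < 85 by norm_num)
  have q7 := hP.pow_step (show 85 < 95 by norm_num)
  have q8 := hP.pow_step (show 85 < 98 by norm_num)
  have q9 := hP.pow_step (show 0 < 80 by norm_num)
  have q10 := hP.pow_step (show 80 < 200 by norm_num)
  rw [pow_one] at q1
  rw [pow_zero] at q9
  have p80 : 0 < ξ ^ 80 := by positivity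
  have p85 : 0 < ξ ^ 85 := by positivity
  have p89 : 0 < ξ ^ 89 := by positivity
  have p95 : 0 < ξ ^ 95 := by positivity
  have p98 : 0 < ξ ^ 98 := by positivity
  have p103 : 0 < ξ ^ 103 := by positivity
  have p200 : 0 < ξ ^ 200 := by positivity
  have hR : 3 * ξ ^ 80 ≤ ξ := by linarith
  have hR' : ξ ^ 98 ≤ 3 * ξ ^ 80 := by linarith
  have eh : (hP.ref hD hR hR').eh ≤ ε := hD.eh_le
  let M : (hP.ref hD hR hR').Res :=
    { a := a
      n := n
      m0 := m0
      Ret := Ret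
      R := 2 * ξ ^ 80
      rr := ξ ^ 95
      D := 6 * ξ ^ 80
      hn := hn
      hres := hres
      hsame := hsame
      hR := show 2 * ξ ^ 80 + ξ ^ 95 ≤ 3 * ξ ^ 80 by linarith
      hD := show 2 * (2 * ξ ^ 80) + ξ ^ 98 + ξ ^ 95 ≤ 6 * ξ ^ 80 by linarith
      hRet := hRet
      R_nonneg := by positivity }
  have hC := hP.pairC hD hR hR' hε hεw M rfl le_rfl hN0 hc0 hc hNc hN1
  have hW : ∀ {E}, |E - E1| ≤ ξ ^ 103 → E ∈ (hP.ref hD hR hR').W := fun h => h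
  have hEE : |E1 - E1| ≤ ξ ^ 103 := by simpa using p103.le
  have hzz : ∀ j, |z j - z j| ≤ ξ := fun j => by simpa using hξ.le
  have hyz : |z a - (hP.ref hD hR hR').z M.a| ≤ M.R := by
    change |z a - z a| ≤ 2 * ξ ^ 80
    simpa using p80.le
  have hf0 : |(M.f (z a) E1).v0| ≤ ε := by
    have h1 := (abs_v0_le _).trans ((M.f_close hyz (hW hEE)).trans eh)
    have h2 : (C.G ((hP.ref hD hR hR').par M.a) (z a) E1).v0 = 0 := hP.zero a
    rwa [sub_v0, h2, sub_zero] at h1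
  have hg0 : |(M.g (z a) E1).v0| ≤ ε + C.K * |z a + n * c.α - m0 - z (!a)| := by
    have h1 : |(M.g (z a) E1 - C.G (par (!a)) (z a + n * c.α - m0) E1).v0| ≤ ε :=
      (abs_v0_le _).trans ((M.g_close hyz (hW hEE)).trans eh)
    have h2 := hP.v0_le (j := !a) (x := z a + n * c.α - m0) (E := E1) (hres.trans (by linarith))
      (by simpa using hξ.le)
    rw [sub_self, abs_zero, add_zero] at h2
    rw [sub_v0] at h1
    have := abs_sub_abs_le_abs_sub (M.g (z a) E1).v0 (C.G (par (!a)) (z a + n * c.α - m0) E1).v0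
    linarith
  have q93 := hP.pow_step (show 93 < 94 by norm_num)
  have q100 := hP.pow_step (show 93 < 100 by norm_num)
  have p94 : 0 < ξ ^ 94 := by positivity
  have p93 : 0 < ξ ^ 93 := by positivity
  have hf1 : |(M.f (z a) E1).v0| ≤ ξ ^ 93 := by linarith
  have hg1 : |(M.g (z a) E1).v0| ≤ ξ ^ 93 := by
    have h1 : C.K * |z a + n * c.α - m0 - z (!a)| ≤ C.K * ξ ^ 95 := by
      gcongr; exact C.K_pos.le
    have h2 : C.K * ξ ^ 95 = (C.K * ξ) * ξ ^ 94 := by ring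
    have h3 : (C.K * ξ) * ξ ^ 94 ≤ 1 * ξ ^ 94 := by gcongr; exact hP.K_le
    linarith
  have hPat : ∀ y E, |y - z a| ≤ 2 * ξ ^ 80 → |E - E1| ≤ ξ ^ 103 → IsAt hC.P y E :=
    fun y E h1 h2 => M.isAt_Gm _ h1 (hW h2)
  obtain ⟨x, hx, hxc⟩ := hC.exists_crit (fun y hy => hPat y E1 hy hEE) hf1 hg1 (r0 := ξ ^ 89) (by
    have e1 : 2 * (2 / ξ) * ξ ^ 93 = 4 * ξ ^ 92 := by field_simp; ring
    have e2 : (ξ / 2) ^ 2 / 2 * ξ ^ 89 = ξ ^ 91 / 8 := by ring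
    rw [e1, e2]
    have := hP.pow_step (show 91 < 92 by norm_num)
    have := hP.pow_step (show 91 < 200 by norm_num)
    have : 0 < ξ ^ 91 := by positivity
    linarith) (by linarith)
  have hx : |x - z a| ≤ ξ ^ 89 := hx
  have hσ : |sx a * sx (!a)| = 1 := hC.σ_abs
  obtain ⟨s, hs, hsg⟩ := hC.exists_sign hκ0 hκ1 hκ2 (by
    have h1 : κ' ^ 2 ≤ (ξ ^ 200) ^ 2 := by gcongr
    rw [← pow_mul] at h1
    have := hP.pow_step (show 103 < 200 * 2 by norm_num)
    linarith) (by
    have h1 : 8 * (2 / ξ) * κ' ^ 2 = (16 / ξ * κ') * κ' := by ring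
    have h2 : 16 / ξ * κ' ≤ 1 := by
      rw [div_mul_eq_mul_div, div_le_iff₀ hξ]
      have := hP.pow_step (show 1 < 200 by norm_num)
      rw [pow_one] at this
      linarith
    have h3 : (16 / ξ * κ') * κ' ≤ 1 * κ' := by gcongr
    have h4 : ξ / 2 * c0 / 8 ≤ 1 * c0 := by
      have : ξ * c0 ≤ 1 * c0 := by gcongr; linarith
      linarith
    linarith)
  obtain ⟨C', hS, hG, hw, hGe, hwe⟩ := M.merge hσ (x := x) (r := ξ ^ 85) (rD := ξ ^ 80) (K := K')
    (show |x - z a| + ξ ^ 80 ≤ 2 * ξ ^ 80 by linarith)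
    (show |x - z a| + ξ ^ 98 + ξ ^ 95 ≤ ξ ^ 85 by linarith) (by linarith)
    (show 2 * ξ ^ 80 ≤ 6 * ξ ^ 80 by linarith) hK1 hK2
  have hctr : C'.ctr = fun _ => x := hS.ctr_eq
  have hrD : C'.rD = ξ ^ 80 := hS.rD_eq
  have hr : C'.r = ξ ^ 85 := hS.r_eq
  have hCW : C'.W = {E | |E - E1| ≤ ξ ^ 103} := hS.W_eq
  have hGP : ∀ j y E, |y - x| ≤ ξ ^ 80 → |E - E1| ≤ ξ ^ 103 → C'.G j y E = hC.P y E :=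
    fun j y E h1 h2 => hG j y E h1 (hW h2)
  have hwW : ∀ j y E, |y - x| ≤ ξ ^ 80 → |E - E1| ≤ ξ ^ 103 → C'.w j y E = hC.W y E :=
    fun j y E h1 h2 => hw j y E h1 (hW h2)
  have hz : ∀ {y}, |y - x| ≤ ξ ^ 80 → |y - z a| ≤ 2 * ξ ^ 80 := fun {y} h => by
    have := abs_sub_le y x (z a)
    linarith
  have hκE : ∀ {E}, |E - E1| ≤ κ' ^ 2 → |E - E1| ≤ ξ ^ 103 := fun {E} h => by
    have h1 : κ' ^ 2 ≤ (ξ ^ 200) ^ 2 := by gcongr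
    rw [← pow_mul] at h1
    have := hP.pow_step (show 103 < 200 * 2 by norm_num)
    have : 0 < ξ ^ (200 * 2) := by positivity
    linarith
  have hxx : |x - x| ≤ ξ ^ 80 := by simpa using p80.le
  refine ⟨C', hS.params, ⟨s, ?_⟩, fun h0 hε5 => ?_⟩
  · refine ⟨fun E hE => by rw [hCW]; exact hκE hE, hκ0, by linarith, (by rw [hS.K_eq]; exact hκK), by rw [hrD]; linarith,
      by rw [hrD]; linarith, by rw [hr, hrD]; linarith, hs, fun j => by rw [hctr], hGe, hwe, ?_,
      fun y h1 h2 => ?_, fun y E h1 h2 => ?_, fun y E h1 h2 h3 => ?_, fun y E h1 h2 h3 => ?_⟩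
    · rw [hctr, hGP _ _ _ hxx hEE]; exact hxc
    all_goals rw [hctr, hrD] at h1
    · rw [hctr, hrD] at h2
      rw [hGP _ _ _ h1 hEE]
      have h3 := hC.P_ge_far hf1 hg1 (hz h1) (D := ξ ^ 82) (by
        have h4 := abs_sub_le y (z a) x
        rw [abs_sub_comm (z a)] at h4
        have h5 : ξ / 2 * (ξ ^ 80 / 8) ≤ ξ / 2 * |y - z a| := by
          gcongr; linarith
        have e : ξ / 2 * (ξ ^ 80 / 8) = ξ ^ 81 / 16 := by ring
        have := hP.pow_step (show 81 < 82 by norm_num)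
        have := hP.pow_step (show 81 < 93 by norm_num)
        have : 0 < ξ ^ 81 := by positivity
        change ξ ^ 82 + ξ ^ 93 ≤ ξ / 2 * |y - z a|
        linarith) (by positivity)
      rw [← pow_mul] at h3
      have h4 := hP.pow_step (show 82 * 2 < 200 by norm_num)
      have h5 : 0 < ξ ^ 200 := by positivity
      have h6 : κ' ≤ ξ ^ (82 * 2) := by linarith
      exact h6.trans h3
    · rw [hGP _ _ _ h1 (hκE h2)]
      have h3 := hC.dxx_ge (hz h1) (hκE h2)
      have e : (ξ / 2) ^ 2 / 4 = ξ ^ 2 / 16 := by ring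
      have := hP.pow_step (show 2 < 200 by norm_num)
      have : 0 < ξ ^ 2 := by positivity
      linarith
    · rw [hGP _ _ _ h1 (hκE h2)] at h3 ⊢
      exact (hsg y E (hz h1) h2 h3).1
    · rw [hGP _ _ _ h1 (hκE h2)] at h3
      rw [hwW _ _ _ h1 (hκE h2)]
      exact (hsg y E (hz h1) h2 h3).2
  · rw [h0, abs_zero, mul_zero, add_zero] at hg0
    have r1 := hP.pow_step (show 104 < 105 by norm_num)
    have r2 := hP.pow_step (show 81 < 102 by norm_num)
    have r3 := hP.pow_step (show 81 < 105 by norm_num)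
    have p104 : 0 < ξ ^ 104 := by positivity
    have p81 : 0 < ξ ^ 81 := by positivity
    have e1 : ξ / 2 * ξ ^ 103 = ξ ^ 104 / 2 := by ring
    have e2 : 2 / ξ * ξ ^ 103 = 2 * ξ ^ 102 := by field_simp
    have e3 : ξ / 2 * (2 * ξ ^ 80) = ξ ^ 81 := by ring
    obtain ⟨y, E3, hE3, hy, h1, h2⟩ := hC.crossing le_rfl hf0 hg0 (by rw [e1]; linarith)
      (by rw [e2, e3]; linarith)
    refine ⟨E3, by rw [hCW]; exact hE3, hE3, fun j y' hy' => ?_⟩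
    rw [hctr, hrD] at hy'
    rw [hGP j y' E3 hy' hE3]
    exact (hC.P_ge_crossing hy hE3 h1 h2 (hz hy')).trans (le_abs_self _)

end Core

namespace Ctx

variable (c : Ctx)

/-- Real powers of the base. -/
def p (x : ℝ) : ℝ := c.b ^ x

variable {c}

lemma p_pos (x : ℝ) : 0 < c.p x := Real.rpow_pos_of_pos (by linarith [c.hb]) x

lemma p_add (x y : ℝ) : c.p (x + y) = c.p x * c.p y := Real.rpow_add (by linarith [c.hb]) x y

lemma p_neg (x : ℝ) : c.p (-x) = (c.p x)⁻¹ := Real.rpow_neg (by linarith [c.hb]) x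

lemma p_nat (n : ℕ) : c.b ^ n = c.p n := (Real.rpow_natCast c.b n).symm

lemma p_pow (x : ℝ) (n : ℕ) : c.p x ^ n = c.p (n * x) := by
  rw [p, p, ← Real.rpow_natCast, ← Real.rpow_mul (by linarith [c.hb]), mul_comm]

lemma p_le {x y : ℝ} (h : x ≤ y) : c.p x ≤ c.p y :=
  Real.rpow_le_rpow_of_exponent_le (by linarith [c.hb]) h

lemma p_lt {x y : ℝ} (h : x < y) : c.p x < c.p y :=
  Real.rpow_lt_rpow_of_exponent_lt c.hb h

lemma p_zero : c.p 0 = 1 := Real.rpow_zero _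

lemma num_le (hb : 2 ≤ c.b) {r : ℝ} (n : ℕ) (h : r ≤ 2 ^ n) : r ≤ c.p n := by
  rw [← p_nat]
  exact h.trans (by gcongr)

lemma num_mul_le (hb : 2 ≤ c.b) {r x y : ℝ} (n : ℕ) (h : r ≤ 2 ^ n) (hxy : n + x ≤ y) :
    r * c.p x ≤ c.p y := by
  calc r * c.p x ≤ c.p n * c.p x := by
        gcongr
        · exact (p_pos _).le
        · exact num_le hb n h
    _ = c.p (n + x) := (p_add _ _).symm
    _ ≤ c.p y := p_le hxy

lemma p_div (x y : ℝ) : c.p x / c.p y = c.p (x - y) := by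
  rw [sub_eq_add_neg, p_add, p_neg, div_eq_mul_inv]

end Ctx

namespace Core
open Ctx

variable {c : Ctx}

/-- The numerical size of a core at scale `P`. -/
structure Sized (C : Core c) (P : ℕ) : Prop where
  k_le : C.k ≤ 2 * P
  h_eq : C.h = P ^ 7
  Ret_eq : C.Ret = P ^ 8
  H_le : C.H ≤ P
  ρ_eq : C.ρ = c.p (-(6 + 1 / P))
  B_le : C.B ≤ 2 - 1 / P
  K_ge : 1 ≤ C.K
  K_le : C.K ≤ c.p (200 * P)
  νlow_ge : c.p (-(100 * P)) ≤ C.νlow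
  νb_le : C.νb ≤ 1
  Q_le : C.Q ≤ c.p (30 * P)
  e_le : C.e ≤ c.p (-(P : ℝ) ^ 6)

variable {C : Core c} {P P' : ℕ}

lemma pow_gap {x : ℝ} (hx : 1000 ≤ x) {i j : ℕ} (hij : i < j) : 1000 * x ^ i ≤ x ^ j := by
  have h2 : x ^ (i + 1) ≤ x ^ j := pow_le_pow_right₀ (by linarith) hij
  rw [pow_succ] at h2
  have h3 : 0 < x ^ i := by positivity
  nlinarith

lemma rate_pow (P l : ℕ) : c.p (-(6 + 1 / P)) ^ l = c.p (-(6 + 1 / P) * l) := by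
  rw [p_pow, mul_comm]

/-- Refinement data from numerical size. -/
lemma Sized.stepData (hS : C.Sized P) (hb : 2 ≤ c.b) (hP : 1000 ≤ P) (hP' : P ^ 10 ≤ P')
    (hr : 2 * C.r ≤ C.rD) {δ : ℝ} (hδ : c.p (-(P : ℝ) ^ 5) ≤ δ) (hδ1 : δ ≤ 1) :
    C.StepData δ (2 * c.p (-(P : ℝ) ^ 6)) (P' ^ 7) (c.p (-(6 + 1 / P'))) (2 - 1 / P')
      (c.p (-(10 * (P : ℝ) ^ 7))) := by
  have hx : (1000 : ℝ) ≤ P := by exact_mod_cast hP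
  have hx' : (P : ℝ) ^ 10 ≤ P' := by exact_mod_cast hP'
  have hP0 : (0 : ℝ) < P := by linarith
  have p1 : 0 < (P : ℝ) ^ 1 := by positivity
  have p5 : 0 < (P : ℝ) ^ 5 := by positivity
  have p6 : 0 < (P : ℝ) ^ 6 := by positivity
  have g01 := pow_gap hx (show 0 < 1 by norm_num)
  have g15 := pow_gap hx (show 1 < 5 by norm_num)
  have g56 := pow_gap hx (show 5 < 6 by norm_num)
  have g67 := pow_gap hx (show 6 < 7 by norm_num)
  have g110 := pow_gap hx (show 1 < 10 by norm_num)
  rw [pow_zero] at g01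
  rw [pow_one] at g01 g15 p1 g110
  have hP'0 : (0 : ℝ) < P' := by linarith
  have hinv : (1 : ℝ) / P' ≤ 1 / (1000 * P) := by
    apply one_div_le_one_div_of_le <;> linarith
  have hinv2 : (1 : ℝ) / (1000 * P) = 1 / P / 1000 := by field_simp
  have hinvP : 0 < (1 : ℝ) / P := by positivity
  have hinv1 : (1 : ℝ) / P ≤ 1 := by rw [div_le_one hP0]; linarith
  have hinv0 : 0 < (1 : ℝ) / P' := by positivity
  have hδ0 : 0 < δ := (p_pos _).trans_le hδ
  have hg : 96 * C.νb * C.K ^ 2 / δ ^ 3 ≤ c.p (7 + 400 * P + 3 * (P : ℝ) ^ 5) := by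
    rw [div_le_iff₀ (by positivity)]
    calc 96 * C.νb * C.K ^ 2 ≤ c.p (7 : ℕ) * 1 * c.p (200 * P) ^ 2 := by
          have := C.νb_pos
          have := C.K_pos
          gcongr
          · exact (mul_pos (p_pos _) one_pos).le
          · exact (p_pos _).le
          · exact num_le hb 7 (by norm_num)
          · exact hS.νb_le
          · exact hS.K_le
      _ = c.p (7 + 400 * P + 3 * (P : ℝ) ^ 5) * c.p (-(P : ℝ) ^ 5) ^ 3 := by
          rw [p_pow, p_pow, mul_one, ← p_add, ← p_add]
          congr 1
          push_cast
          ring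
      _ ≤ c.p (7 + 400 * P + 3 * (P : ℝ) ^ 5) * δ ^ 3 := by
          have := p_pos (c := c) (-(P : ℝ) ^ 5)
          gcongr
          exact (p_pos _).le
  have hg0 : 0 ≤ 96 * C.νb * C.K ^ 2 / δ ^ 3 := by
    have := C.νb_pos
    positivity
  have hη : c.p (-(10 * (P : ℝ) ^ 7)) ≤ 1 / P / 1000 := by
    have h1 : c.p (-(10 * (P : ℝ) ^ 7)) ≤ c.p (-((2 * P : ℕ) : ℝ)) := p_le (by push_cast; linarith)
    refine h1.trans ?_
    rw [p_neg, ← p_nat, ← hinv2, one_div]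
    apply inv_anti₀ (by positivity)
    have h2 : ((2 : ℝ) ^ 2) ^ P ≤ c.b ^ (2 * P) := by rw [pow_mul]; gcongr
    have h3 : (P : ℝ) ≤ 2 ^ P := by exact_mod_cast P.lt_two_pow_self.le
    have h4 : (2 : ℝ) ^ 10 ≤ 2 ^ P := pow_le_pow_right₀ (by norm_num) (by omega)
    calc 1000 * (P : ℝ) ≤ 2 ^ P * 2 ^ P := by gcongr; linarith
      _ = ((2 : ℝ) ^ 2) ^ P := by rw [← mul_pow]; norm_num
      _ ≤ _ := h2
  have heh : C.e + 6 * C.Q * C.νb * c.p (-(10 * (P : ℝ) ^ 7)) ≤ 2 * c.p (-(P : ℝ) ^ 6) := by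
    have h1 : 6 * C.Q * C.νb * c.p (-(10 * (P : ℝ) ^ 7)) ≤ c.p (-(P : ℝ) ^ 6) := by
      calc 6 * C.Q * C.νb * c.p (-(10 * (P : ℝ) ^ 7))
          ≤ 6 * c.p (30 * P) * 1 * c.p (-(10 * (P : ℝ) ^ 7)) := by
            have := C.Q_pos
            have := C.νb_pos
            have := p_pos (c := c) (30 * P)
            gcongr
            · exact (p_pos _).le
            · exact hS.Q_le
            · exact hS.νb_le
        _ = 6 * c.p (30 * P + -(10 * (P : ℝ) ^ 7)) := by rw [p_add]; ring
        _ ≤ _ := num_mul_le hb 3 (by norm_num) (by push_cast; linarith)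
    linarith [hS.e_le]
  have hk : (C.k : ℝ) ≤ 2 * P := by exact_mod_cast hS.k_le
  refine ⟨⟨hδ0, hδ1.trans hS.K_ge, ?_, heh.trans ?_, fun l hl => ?_, ?_, by linarith, ?_⟩, heh, ?_,
    hb, ?_, ?_⟩
  · rw [hS.ρ_eq, rate_pow, hS.h_eq]
    calc 3 * C.Q * c.p (-(6 + 1 / P) * (2 * P ^ 7 : ℕ)) * (96 * C.νb * C.K ^ 2 / δ ^ 3)
        ≤ 3 * c.p (30 * P) * c.p (-(12 * (P : ℝ) ^ 7)) *
          c.p (7 + 400 * P + 3 * (P : ℝ) ^ 5) := by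
          have := C.Q_pos
          have := p_pos (c := c) (30 * P)
          have := p_pos (c := c) (-(12 * (P : ℝ) ^ 7))
          gcongr
          · exact (p_pos _).le
          · exact hS.Q_le
          · apply p_le
            push_cast
            have : 0 < 1 / (P : ℝ) * (P : ℝ) ^ 7 := by positivity
            linarith
      _ = 3 * c.p (30 * P + -(12 * (P : ℝ) ^ 7) + (7 + 400 * P + 3 * (P : ℝ) ^ 5)) := by
          rw [p_add (30 * P + -(12 * (P : ℝ) ^ 7)), p_add (30 * P : ℝ)]; ring
      _ ≤ _ := num_mul_le hb 2 (by norm_num) (by push_cast; linarith)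
  · have : 8 * c.p (-(P : ℝ) ^ 6) ≤ c.p (-(P : ℝ) ^ 5) :=
      num_mul_le hb 3 (by norm_num) (by push_cast; linarith)
    linarith
  · rw [hS.h_eq] at hl
    have hl' : (P : ℝ) ^ 7 ≤ l := by exact_mod_cast hl
    rw [hS.ρ_eq, rate_pow, rate_pow]
    calc c.p (-(6 + 1 / P) * l) * (96 * C.νb * C.K ^ 2 / δ ^ 3)
        ≤ c.p (-(6 + 1 / P) * l) * c.p (7 + 400 * P + 3 * (P : ℝ) ^ 5) := by
          gcongr
          exact (p_pos _).le
      _ = c.p (-(6 + 1 / P) * l + (7 + 400 * P + 3 * (P : ℝ) ^ 5)) := (p_add _ _).symm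
      _ ≤ _ := by
        apply p_le
        push_cast
        have h1 : 1 / (P : ℝ) * (P : ℝ) ^ 7 = (P : ℝ) ^ 6 := by field_simp
        have h2 : 1 / (P : ℝ) * (P : ℝ) ^ 7 ≤ 1 / P * l := by gcongr
        have h3 : 1 / (P' : ℝ) * l ≤ 1 / P / 1000 * l := by
          apply mul_le_mul_of_nonneg_right _ (by positivity)
          linarith
        have h4 : 1 / (P' : ℝ) * (C.k + 1) ≤ 1 * (C.k + 1) := by
          gcongr
          linarith
        have e1 : -(6 + 1 / (P' : ℝ)) * (l + C.k + 1)
          = -6 * l - 1 / (P' : ℝ) * l - 6 * (C.k + 1) - 1 / (P' : ℝ) * (C.k + 1) := by ring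
        have e2 : -(6 + 1 / (P : ℝ)) * l = -6 * l - 1 / P * l := by ring
        have e3 : 1 / (P : ℝ) / 1000 * l = 1 / P * l / 1000 := by ring
        rw [e1, e2]
        linarith
  · linarith [hS.B_le]
  · rw [hS.ρ_eq]
    exact p_le (by linarith)
  · have h1 : P ^ 7 * 1000 ≤ P' ^ 7 := by
      calc P ^ 7 * 1000 ≤ P ^ 7 * P := by gcongr
        _ = P ^ 8 := by ring
        _ ≤ P ^ 10 := Nat.pow_le_pow_right (by omega) (by norm_num)
        _ ≤ P' := hP'
        _ ≤ P' ^ 7 := Nat.le_self_pow (by norm_num) _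
    have h2 : P ≤ P ^ 7 := Nat.le_self_pow (by norm_num) _
    have h3 := hS.k_le
    have h4 := hS.H_le
    have h5 := hS.h_eq
    unfold H1
    omega
  · rw [p_nat, ← p_add]
    exact (p_le (by push_cast; linarith)).trans_eq p_zero
  · have h1 : P ^ 7 * 1000 ≤ P ^ 8 := by
      calc P ^ 7 * 1000 ≤ P ^ 7 * P := by gcongr
        _ = P ^ 8 := by ring
    have h2 : P ≤ P ^ 7 := Nat.le_self_pow (by norm_num) _
    have h3 := hS.k_le
    have h4 := hS.H_le
    have h5 := hS.h_eq
    have h6 := hS.Ret_eq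
    exact C.cover1 hr (by omega)

/-- The parameters of a refined core fit its scale. -/
lemma Params.sized {k H : ℕ} {K νb νlow : ℝ}
    (h : C.Params k (P ^ 7) (P ^ 8) H (c.p (-(6 + 1 / P))) (2 - 1 / P) K νb νlow)
    (hb : 2 ≤ c.b) (hP : 1000 ≤ P) (hk : k ≤ 2 * P) (hH : H ≤ P) (hK1 : 1 ≤ K)
    (hK : K ≤ c.p (200 * P)) (hνb : νb ≤ 1) (hν : c.p (-(100 * P)) ≤ νlow) : C.Sized P := by
  have hx : (1000 : ℝ) ≤ P := by exact_mod_cast hP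
  have hk' : (k : ℝ) ≤ 2 * P := by exact_mod_cast hk
  have p6 : 0 < (P : ℝ) ^ 6 := by positivity
  have g67 := pow_gap hx (show 6 < 7 by norm_num)
  have g17 := pow_gap hx (show 1 < 7 by norm_num)
  rw [pow_one] at g17
  have hQ : c.b ^ (10 * (k + 1)) ≤ c.p (30 * P) := by
    rw [p_nat]
    exact p_le (by push_cast; linarith)
  refine ⟨by rwa [h.k_eq], h.h_eq, h.Ret_eq, by rwa [h.H_eq], h.ρ_eq, h.B_eq.le,
    by rwa [h.K_eq], by rwa [h.K_eq], by rwa [h.νlow_eq], by rwa [h.νb_eq], by rwa [h.Q_eq], ?_⟩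
  rw [h.e_eq]
  have h0 : 0 < νb := by rw [← h.νb_eq]; exact C.νb_pos
  calc 12 * νb * c.b ^ (10 * (k + 1)) * (c.b ^ 4)⁻¹ ^ P ^ 7
      ≤ 12 * 1 * c.p (30 * P) * c.p (-(4 * (P : ℝ) ^ 7)) := by
        have e : (c.b ^ 4)⁻¹ ^ P ^ 7 = c.p (-(4 * (P : ℝ) ^ 7)) := by
          rw [inv_pow, p_nat, p_pow, ← p_neg]
          congr 1
          push_cast
          ring
        rw [e]
        have := p_pos (c := c) (-(4 * (P : ℝ) ^ 7))
        gcongr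
    _ = 12 * c.p (30 * P + -(4 * (P : ℝ) ^ 7)) := by rw [p_add]; ring
    _ ≤ _ := num_mul_le hb 4 (by norm_num) (by push_cast; linarith)

lemma Sized.H1_le (hS : C.Sized P) (hP : 1000 ≤ P) (hP' : P ^ 10 ≤ P') : C.H1 ≤ P' := by
  have h1 : P ^ 7 * 1000 ≤ P ^ 10 := by
    calc P ^ 7 * 1000 ≤ P ^ 7 * P := by gcongr
      _ = P ^ 8 := by ring
      _ ≤ P ^ 10 := Nat.pow_le_pow_right (by omega) (by norm_num)
  have h2 : P ≤ P ^ 7 := Nat.le_self_pow (by norm_num) _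
  have h3 := hS.k_le
  have h4 := hS.H_le
  have h5 := hS.h_eq
  unfold H1
  omega

lemma ret_le {a b d n : ℕ} (hP : 1000 ≤ P) (ha : a ≤ P) (hb : b ≤ 2 * P) (hn : n ≤ P)
    (hd : d = P ^ 7 + a + b + n) : d ≤ P ^ 8 := by
  have h1 : P ^ 7 * 1000 ≤ P ^ 8 := by
    calc P ^ 7 * 1000 ≤ P ^ 7 * P := by gcongr
      _ = P ^ 8 := by ring
  have h2 : P ≤ P ^ 7 := Nat.le_self_pow (by norm_num) _
  omega

lemma Sized.keep {C' : Core c} (hS : C.Sized P) (hb : 2 ≤ c.b) (hP : 1000 ≤ P)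
    (hP' : P ^ 10 ≤ P') (h : C'.Params C.k (P' ^ 7) (P' ^ 8) C.H1 (c.p (-(6 + 1 / P')))
      (2 - 1 / P') (2 * C.K) C.νb C.νlow) : C'.Sized P' := by
  have h1 : P ≤ P ^ 10 := Nat.le_self_pow (by norm_num) _
  have h2 : 2 * P ≤ P' := by
    calc 2 * P ≤ P * P := by gcongr; omega
      _ = P ^ 2 := by ring
      _ ≤ P ^ 10 := Nat.pow_le_pow_right (by omega) (by norm_num)
      _ ≤ P' := hP'
  have h3 : (2 * P : ℝ) ≤ P' := by exact_mod_cast h2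
  have hx : (1000 : ℝ) ≤ P := by exact_mod_cast hP
  have h4 := hS.k_le
  have h5 := hS.K_ge
  refine h.sized hb (by omega) (by omega) (hS.H1_le hP hP') (by linarith) ?_ hS.νb_le
    ((p_le (by linarith)).trans hS.νlow_ge)
  calc 2 * C.K ≤ 2 * c.p (200 * P) := by gcongr; exact hS.K_le
    _ ≤ _ := num_mul_le hb 1 (by norm_num) (by push_cast; linarith)

lemma Sized.merge {C' : Core c} {n : ℕ} (hS : C.Sized P) (hb : 2 ≤ c.b) (hP : 1000 ≤ P)
    (hP' : P ^ 10 ≤ P') (hn : n ≤ P') (h : C'.Params (C.k + n) (P' ^ 7) (P' ^ 8) C.H1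
      (c.p (-(6 + 1 / P'))) (2 - 1 / P') (c.p (200 * P')) (C.νb ^ 2)
      (C.νlow ^ 2 * (c.b ^ (10 * (n - C.k - 1)))⁻¹)) : C'.Sized P' := by
  have h1 : P ≤ P ^ 10 := Nat.le_self_pow (by norm_num) _
  have h2 : 1000 * P ≤ P' := by
    calc 1000 * P ≤ P * P := by gcongr
      _ = P ^ 2 := by ring
      _ ≤ P ^ 10 := Nat.pow_le_pow_right (by omega) (by norm_num)
      _ ≤ P' := hP'
  have h3 : (1000 * P : ℝ) ≤ P' := by exact_mod_cast h2
  have hx : (1000 : ℝ) ≤ P := by exact_mod_cast hP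
  have h4 := hS.k_le
  have h5 : ((n - C.k - 1 : ℕ) : ℝ) ≤ P' := by exact_mod_cast (by omega : n - C.k - 1 ≤ P')
  refine h.sized hb (by omega) (by omega) (hS.H1_le hP hP') ?_ le_rfl ?_ ?_
  · rw [← p_zero (c := c)]
    exact p_le (by linarith)
  · have := C.νb_pos
    have := hS.νb_le
    exact pow_le_one₀ (by linarith) (by linarith)
  · calc c.p (-(100 * P')) ≤ c.p (-(200 * P) + -(10 * P')) := p_le (by linarith)
      _ = c.p (-(100 * P)) ^ 2 * (c.p (10 * P'))⁻¹ := by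
        rw [p_add, p_pow, ← p_neg]
        congr 2
        push_cast
        ring
      _ ≤ _ := by
        have := p_pos (c := c) (-(100 * P))
        have h6 := C.νlow_pos
        have : 0 < c.b ^ (10 * (n - C.k - 1)) := pow_pos (by linarith) _
        gcongr
        · exact (inv_pos.2 (p_pos _)).le
        · exact hS.νlow_ge
        · rw [p_nat]
          exact p_le (by push_cast; linarith)

end Core

namespace Core
open Ctx

variable {c : Ctx} {C : Core c} {P P' : ℕ} {E1 ξ wl : ℝ} {z : Bool → ℝ} {par : Bool → Bool}
  {sx sE : Bool → ℝ}

/-- Powers of a scale parameter dominate each other. -/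
lemma scale_gaps (hP : 1000 ≤ P) (hP' : P ^ 10 ≤ P') :
    1000 ≤ (P : ℝ) ∧ 1000 * (P : ℝ) ≤ (P : ℝ) ^ 2 ∧ 1000 * (P : ℝ) ^ 2 ≤ (P : ℝ) ^ 3 ∧
      1000 * (P : ℝ) ^ 3 ≤ (P : ℝ) ^ 4 ∧ 1000 * (P : ℝ) ^ 4 ≤ (P : ℝ) ^ 5 ∧
      1000 * (P : ℝ) ^ 5 ≤ (P : ℝ) ^ 6 ∧ 1000 * (P : ℝ) ^ 6 ≤ (P : ℝ) ^ 8 ∧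
      1000 * (P : ℝ) ^ 8 ≤ P' := by
  have hx : (1000 : ℝ) ≤ P := by exact_mod_cast hP
  have h1 := pow_gap hx (show 1 < 2 by norm_num)
  rw [pow_one] at h1
  have h2 : (P : ℝ) ^ 10 ≤ P' := by exact_mod_cast hP'
  exact ⟨hx, h1, pow_gap hx (by norm_num), pow_gap hx (by norm_num), pow_gap hx (by norm_num),
    pow_gap hx (by norm_num), pow_gap hx (by norm_num), (pow_gap hx (by norm_num)).trans h2⟩

lemma mul_p_le_half (hb : 2 ≤ c.b) {w r x : ℝ} (hw : c.p (-(200 * P)) ≤ w) (h1 : r * 2 ≤ 2 ^ 2)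
    (h2 : 2 + x ≤ -(200 * P)) : r * c.p x ≤ w / 2 := by
  have : r * 2 * c.p x ≤ c.p (-(200 * P)) := num_mul_le hb 2 h1 (by push_cast; exact h2)
  linarith

lemma Sized.two_K_mul_p_le (hS : C.Sized P) (hb : 2 ≤ c.b) {Q : ℝ} (h : 200 * P + 1 ≤ 200 * Q) :
    2 * C.K * c.p (-(200 * Q)) ≤ 1 := by
  calc 2 * C.K * c.p (-(200 * Q)) ≤ 2 * c.p (200 * P) * c.p (-(200 * Q)) := by
        have := p_pos (c := c) (-(200 * Q))
        gcongr
        exact hS.K_le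
    _ = 2 * c.p (200 * P + -(200 * Q)) := by rw [p_add]; ring
    _ ≤ c.p 0 := num_mul_le hb 1 (by norm_num) (by push_cast; linarith)
    _ = 1 := p_zero

lemma Sized.ret_le_pow (hS : C.Sized P) (hP : 1000 ≤ P) (hP' : P ^ 10 ≤ P') :
    P' ^ 7 + C.H1 + C.k ≤ P' ^ 8 := by
  have h : P ≤ P' := (Nat.le_self_pow (by norm_num) _).trans hP'
  exact ret_le (n := 0) (hP.trans h) (hS.H1_le hP hP') (hS.k_le.trans (by omega)) (by omega)
    (by omega)

lemma p_neg_mul_le_pow {x ξ : ℝ} (h : c.p (-x) ≤ ξ) (i : ℕ) : c.p (-(i * x)) ≤ ξ ^ i := by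
  have := pow_le_pow_left₀ (p_pos (c := c) (-x)).le h i
  rwa [p_pow, mul_neg] at this

/-- Passing to the next scale at nonresonant transversal critical points. -/
lemma Sized.keepI (hS : C.Sized P) (hb : 2 ≤ c.b) (hP0 : 1000 ≤ P) (hP' : P ^ 10 ≤ P')
    (hr : 2 * C.r ≤ C.rD) (hP : C.PreI E1 ξ wl z par sx sE) (hξ : c.p (-(P : ℝ) ^ 4) ≤ ξ)
    (hwl : c.p (-(200 * P)) ≤ wl)
    (hnon : ∀ j j' (t m : ℤ), t ≠ 0 → |t| ≤ (P' ^ 8 : ℕ) → ξ ^ 95 < |z j + t * c.α - m - z j'|) :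
    ∃ C' : Core c, C'.Sized P' ∧ C'.StI E1 (c.p (-(200 * P'))) sx sE := by
  obtain ⟨hx, g2, g3, g4, g5, g6, g8, gP⟩ := scale_gaps hP0 hP'
  have hξ0 := hP.ξ_pos
  have hξ1 := hP.ξ_le
  have h100 : c.p (-(100 * (P : ℝ) ^ 4)) ≤ ξ ^ 100 := by simpa using p_neg_mul_le_pow hξ 100
  have hD := hS.stepData hb hP0 hP' hr (δ := ξ ^ 100) ((p_le (by linarith)).trans h100)
    (pow_le_one₀ hξ0.le (by linarith))
  have hwl2 := fun {r x} => mul_p_le_half (r := r) (x := x) hb hwl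
  obtain ⟨C', h1, h2⟩ := hP.keep hD
    ((num_mul_le hb 1 (by norm_num) (by push_cast; linarith)).trans h100)
    (hwl2 (by norm_num) (by linarith)) hnon
    (hS.ret_le_pow hP0 hP')
    (p_pos (-(200 * P'))) ((p_le (by linarith)).trans h100)
    (by simpa using hwl2 (r := 1) (x := -(200 * P')) (by norm_num) (by linarith))
    (hS.two_K_mul_p_le hb (by linarith))
  exact ⟨C', hS.keep hb hP0 hP' h1, h2⟩

/-- Passing to the next scale at a quadratic critical point. -/
lemma Sized.keepII {κ y s z : ℝ} {j0 : Bool} (hS : C.Sized P) (hb : 2 ≤ c.b) (hP0 : 1000 ≤ P)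
    (hP' : P ^ 10 ≤ P') (hr : 2 * C.r ≤ C.rD) (hP : C.PreII E1 κ y wl s z j0)
    (hy : c.p (-(P : ℝ) ^ 3) ≤ y) (hwl : c.p (-(200 * P)) ≤ wl)
    (hnon : ∀ t m : ℤ, t ≠ 0 → |t| ≤ (P' ^ 8 : ℕ) → 2 * (y / κ ^ 3) < |t * c.α - m|) :
    ∃ C' : Core c, C'.Sized P' ∧ C'.StII E1 (c.p (-(200 * P'))) s := by
  obtain ⟨hx, g2, g3, g4, g5, g6, g8, gP⟩ := scale_gaps hP0 hP'
  have hy0 := hP.y_pos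
  have hy1 : y ≤ 1 := hP.y_le.trans
    (pow_le_one₀ hP.κ_pos.le (hP.κ_le.trans (by norm_num)))
  have h3 : c.p (-(3 * (P : ℝ) ^ 3)) ≤ y ^ 3 := by simpa using p_neg_mul_le_pow hy 3
  have h2 : c.p (-(3 * (P : ℝ) ^ 3)) ≤ y ^ 2 := h3.trans
    (pow_le_pow_of_le_one hy0.le hy1 (by norm_num))
  have hD := hS.stepData hb hP0 hP' hr (δ := y ^ 2) ((p_le (by linarith)).trans h2)
    (pow_le_one₀ hy0.le hy1)
  have hwl2 := fun {r x} => mul_p_le_half (r := r) (x := x) hb hwl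
  obtain ⟨C', h1, h2⟩ := hP.keep hD
    ((num_mul_le hb 1 (by norm_num) (by push_cast; linarith)).trans h3)
    (hwl2 (by norm_num) (by linarith)) hnon
    (hS.ret_le_pow hP0 hP')
    (p_pos (-(200 * P'))) ((p_le (by linarith)).trans h3)
    (by simpa using hwl2 (r := 1) (x := -(200 * P')) (by norm_num) (by linarith))
    (hS.two_K_mul_p_le hb (by linarith))
  exact ⟨C', hS.keep hb hP0 hP' h1, h2⟩

/-- Passing to the next scale at resonant transversal critical points. -/
lemma Sized.mergeI (hS : C.Sized P) (hb : 2 ≤ c.b) (hP0 : 1000 ≤ P) (hP' : P ^ 10 ≤ P')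
    (hr : 2 * C.r ≤ C.rD) (hP : C.PreI E1 ξ wl z par sx sE) (hξ : c.p (-(P : ℝ) ^ 4) ≤ ξ)
    (hwl : c.p (-(200 * P)) ≤ wl) {a : Bool} {n : ℕ} {m0 : ℤ} (hn : C.Ret < n) (hnP : n ≤ P')
    (hres : |z a + n * c.α - m0 - z (!a)| ≤ ξ ^ 95)
    (hsame : ∀ t m : ℤ, t ≠ 0 → |t| ≤ (P' ^ 8 : ℕ) → 6 * ξ ^ 80 < |t * c.α - m|) :
    ∃ C' : Core c, C'.Sized P' ∧ (∃ s, C'.StII E1 (c.p (-(200 * P'))) s) ∧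
      (z a + n * c.α - m0 - z (!a) = 0 → ∃ E3 ∈ C'.W, |E3 - E1| ≤ ξ ^ 103 ∧
        ∀ j y, |y - C'.ctr j| ≤ C'.rD → c.p (-(P' : ℝ) ^ 5) ≤ |(C'.G j y E3).v0|) := by
  obtain ⟨hx, g2, g3, g4, g5, g6, g8, gP⟩ := scale_gaps hP0 hP'
  have hξ0 := hP.ξ_pos
  have hξ1 := hP.ξ_le
  have hpow : ∀ i : ℕ, c.p (-(i * (P : ℝ) ^ 4)) ≤ ξ ^ i := p_neg_mul_le_pow hξ
  have h100 : c.p (-(100 * (P : ℝ) ^ 4)) ≤ ξ ^ 100 := by simpa using hpow 100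
  have h105 : c.p (-(105 * (P : ℝ) ^ 4)) ≤ ξ ^ 105 := by simpa using hpow 105
  have h200 : c.p (-(200 * (P : ℝ) ^ 4)) ≤ ξ ^ 200 := by simpa using hpow 200
  have h2 : c.p (-(2 * (P : ℝ) ^ 4)) ≤ ξ ^ 2 := by simpa using hpow 2
  have hD := hS.stepData hb hP0 hP' hr (δ := ξ ^ 100) ((p_le (by linarith)).trans h100)
    (pow_le_one₀ hξ0.le (by linarith))
  have hwl2 := fun {r x} => mul_p_le_half (r := r) (x := x) hb hwl
  have hPP' : 1000 * P ≤ P' := by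
    calc 1000 * P ≤ P * P := by gcongr
      _ = P ^ 2 := by ring
      _ ≤ P ^ 10 := Nat.pow_le_pow_right (by omega) (by norm_num)
      _ ≤ P' := hP'
  have hk := hS.k_le
  have hkn : C.k + 1 ≤ n := by
    have h1 := C.hk_le
    have h2 := hS.h_eq
    have : 0 < P ^ 7 := by positivity
    omega
  set m := n - C.k - 1 with hm
  have hmP : (m : ℝ) ≤ P' := by exact_mod_cast (by omega : m ≤ P')
  have hmn : (m : ℝ) = n - C.k - 1 := by
    have : n = m + C.k + 1 := by omega
    rw [this]
    push_cast
    ring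
  have hn' : (P : ℝ) ^ 8 < n := by
    rw [hS.Ret_eq] at hn
    exact_mod_cast hn
  have hnP' : (n : ℝ) ≤ P' := by exact_mod_cast hnP
  have hk' : (C.k : ℝ) ≤ 2 * P := by exact_mod_cast hk
  have hm8 : (P : ℝ) ^ 8 ≤ m + 2 * P + 1 := by rw [hmn]; linarith
  have hνb := C.νb_pos
  have hνQ : C.νb * (3 * C.Q) ≤ 3 * c.p (30 * P) := by
    calc C.νb * (3 * C.Q) ≤ 1 * (3 * c.p (30 * P)) := by
          have := C.Q_pos
          gcongr
          · exact hS.νb_le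
          · exact hS.Q_le
      _ = _ := one_mul _
  have hνQ0 : 0 ≤ C.νb * (3 * C.Q) := by
    have := C.Q_pos
    positivity
  have hνQ2 : (C.νb * (3 * C.Q)) ^ 2 ≤ 9 * c.p (60 * P) := by
    calc (C.νb * (3 * C.Q)) ^ 2 ≤ (3 * c.p (30 * P)) ^ 2 := by gcongr
      _ = 9 * c.p (60 * P) := by
        rw [mul_pow, p_pow]
        norm_num
        ring_nf
  have hνlow : c.p (-(200 * P)) ≤ C.νlow ^ 2 := by
    calc c.p (-(200 * P)) = c.p (-(100 * P)) ^ 2 := by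
          rw [p_pow]; congr 1; push_cast; ring
      _ ≤ _ := by
          have := p_pos (c := c) (-(100 * P))
          gcongr
          exact hS.νlow_ge
  have hP'5 : (P' : ℝ) * 1000 ≤ (P' : ℝ) ^ 5 := by
    have h1 : (1000 : ℝ) ≤ P' := by linarith
    have := pow_gap h1 (show 1 < 5 by norm_num)
    rw [pow_one] at this
    linarith
  obtain ⟨C', h1, h3, h4⟩ := hP.merge hD
    (N0 := c.p (-(12 * m) + 60 * P + 4)) (c0 := c.p (-(20 * m + 500 * P)))
    (K' := c.p (200 * P')) (κ' := c.p (-(200 * P')))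
    ((num_mul_le hb 1 (by norm_num) (by push_cast; linarith)).trans h100)
    (hwl2 (by norm_num) (by linarith)) hn hres hsame
    (ret_le (d := P' ^ 7 + C.H1 + C.k + n) (P := P')
      (hP0.trans (by omega)) (hS.H1_le hP0 hP')
      (hS.k_le.trans (by omega)) hnP (by omega))
    (by
      rw [rate_pow, p_pow]
      calc c.p ((2 : ℕ) * (-(6 + 1 / P') * m)) * (C.νb * (3 * C.Q)) ^ 2
          ≤ c.p (-(12 * m)) * (9 * c.p (60 * P)) := by
            gcongr
            · exact (p_pos _).le
            · apply p_le
              push_cast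
              have : 0 ≤ 1 / (P' : ℝ) * m := by positivity
              linarith
        _ = 9 * c.p (-(12 * m) + 60 * P) := by rw [p_add]; ring
        _ ≤ _ := num_mul_le hb 4 (by norm_num) (by push_cast; linarith))
    (p_pos _)
    (by
      calc c.p (-(20 * m + 500 * P)) * (4 * (C.νb * (3 * C.Q)))
          ≤ c.p (-(20 * m + 500 * P)) * (4 * (3 * c.p (30 * P))) := by
            gcongr
            exact (p_pos _).le
        _ = 12 * c.p (-(20 * m + 500 * P) + 30 * P) := by rw [p_add]; ring
        _ ≤ c.p (-(20 * m) + (-(200 * P) + -(200 * P))) :=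
            num_mul_le hb 4 (by norm_num) (by push_cast; linarith)
        _ = c.p (-(10 * m)) ^ 2 * (c.p (-(200 * P)) * c.p (-(200 * P))) := by
            rw [p_add, p_add, p_pow]; congr 2; push_cast; ring
        _ ≤ _ := by
            rw [p_nat, ← p_neg]
            push_cast
            have := p_pos (c := c) (-(200 * P))
            have := p_pos (c := c) (-(10 * m))
            gcongr)
    (by
      have e1 : c.p (-(12 * m) + 60 * P + 4) ^ 2 = c.p (-(24 * m) + 120 * P + 8) := by
        rw [p_pow]; congr 1; push_cast; ring
      have e2 : 32 * c.p (-(24 * m) + 120 * P + 8) ≤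
          c.p (-(2 * (P : ℝ) ^ 4) + -(20 * m + 500 * P)) :=
        num_mul_le hb 5 (by norm_num) (by push_cast; linarith)
      rw [p_add (-(2 * (P : ℝ) ^ 4))] at e2
      have e3 : c.p (-(2 * (P : ℝ) ^ 4)) * c.p (-(20 * m + 500 * P)) ≤
          ξ ^ 2 * c.p (-(20 * m + 500 * P)) := by
        gcongr
        exact (p_pos _).le
      have e4 : (ξ / 2) ^ 2 * c.p (-(20 * m + 500 * P)) =
          ξ ^ 2 * c.p (-(20 * m + 500 * P)) / 4 := by ring
      rw [e1, e4]
      linarith)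
    ((p_le (by linarith)).trans h200)
    (by
      have e1 : (2 * C.K) ^ 2 ≤ 4 * c.p (400 * P) := by
        calc (2 * C.K) ^ 2 ≤ (2 * c.p (200 * P)) ^ 2 := by
              have := C.K_pos
              gcongr
              exact hS.K_le
          _ = 4 * c.p (400 * P) := by
            rw [mul_pow, p_pow]
            norm_num
            ring_nf
      have e2 : c.p (60 * P) ≤ c.p (400 * P) := p_le (by linarith)
      have e3 : 13 * c.p (400 * P) ≤ c.p (200 * P') :=
        num_mul_le hb 4 (by norm_num) (by push_cast; linarith)
      linarith)
    (by
      calc c.b ^ (10 * (C.k + n + 1)) ≤ c.p (200 * P' + (-(200 * P) + -(10 * m))) := by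
            rw [p_nat]
            exact p_le (by push_cast; linarith)
        _ ≤ _ := by
            rw [p_nat, ← p_neg, p_add, p_add]
            push_cast
            have := p_pos (c := c) (200 * P')
            have := p_pos (c := c) (-(10 * m))
            gcongr)
    (p_pos _) ((p_le (by linarith)).trans h200)
    (by
      have e1 : 16 * c.p (-(200 * P')) ≤ c.p (-(P : ℝ) ^ 4 + -(20 * m + 500 * P)) :=
        num_mul_le hb 4 (by norm_num) (by push_cast; linarith)
      rw [p_add (-(P : ℝ) ^ 4)] at e1
      have e3 : c.p (-(P : ℝ) ^ 4) * c.p (-(20 * m + 500 * P)) ≤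
          ξ * c.p (-(20 * m + 500 * P)) := by
        gcongr
        exact (p_pos _).le
      linarith)
    (by
      have e1 : 16 * c.p (-(200 * P')) ≤ c.p (-(200 * P) + -(20 * m + 500 * P)) :=
        num_mul_le hb 4 (by norm_num) (by push_cast; linarith)
      rw [p_add (-(200 * (P : ℝ)))] at e1
      have e3 : c.p (-(200 * P)) * c.p (-(20 * m + 500 * P)) ≤
          wl * c.p (-(20 * m + 500 * P)) := by
        gcongr
        exact (p_pos _).le
      linarith)
    (by rw [← p_add, add_neg_cancel, p_zero])
  refine ⟨C', hS.merge hb hP0 hP' hnP h1, h3, fun h0 => ?_⟩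
  obtain ⟨E3, h5, h6, h7⟩ := h4 h0
    ((num_mul_le hb 1 (by norm_num) (by push_cast; linarith)).trans h105)
  exact ⟨E3, h5, h6, fun j y hy => (p_le (by linarith)).trans (h7 j y hy)⟩

end Core

/-- Separation of returns at scale `P`. -/
def Ctx.Sep (c : Ctx) (P : ℕ) : Prop :=
  ∀ t m : ℤ, t ≠ 0 → |t| ≤ (P ^ 640 : ℕ) → c.p (-(P : ℝ) ^ 2) < |t * c.α - m|

namespace Core
open Ctx

variable {c : Ctx} {C : Core c} {P P' : ℕ} {E1 ξ wl : ℝ} {z : Bool → ℝ} {par : Bool → Bool}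
  {sx sE : Bool → ℝ}

/-- A core of size `P` with controlled critical points. -/
structure Staged (C : Core c) (P : ℕ) (E0 : ℝ) : Prop where
  sized : C.Sized P
  crit : (∃ sx sE, C.StI E0 (c.p (-(200 * P))) sx sE) ∨ ∃ s, C.StII E0 (c.p (-(200 * P))) s

/-- Resonant returns are longer than the return time of the core. -/
lemma PreI.ret_lt (hP : C.PreI E1 ξ wl z par sx sE) {a b : Bool} {t m : ℤ} (ht : t ≠ 0)
    (hres : |z a + t * c.α - m - z b| ≤ ξ) : (C.Ret : ℤ) < |t| := by
  by_contra! hle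
  have h1 := C.ret (par a) (par b) t m ht hle
  have h2 := hP.near a
  have h3 := hP.near b
  have h4 : |C.ctr (par a) + t * c.α - m - C.ctr (par b)| ≤
      |z a - C.ctr (par a)| + |z a + t * c.α - m - z b| + |z b - C.ctr (par b)| := by
    have e : C.ctr (par a) + t * c.α - m - C.ctr (par b) =
      -(z a - C.ctr (par a)) + (z a + t * c.α - m - z b) + (z b - C.ctr (par b)) := by ring
    rw [e]
    refine (abs_add_le _ _).trans ?_
    have := abs_add_le (-(z a - C.ctr (par a))) (z a + t * c.α - m - z b)
    rw [abs_neg] at this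
    linarith
  linarith [hP.ξ_pos]

/-- A resonance can be oriented forward. -/
lemma PreI.orient (hP : C.PreI E1 ξ wl z par sx sE) {N : ℕ} {ε : ℝ} (hε : ε ≤ ξ)
    (hsame : ∀ t m : ℤ, t ≠ 0 → |t| ≤ N → ε < |t * c.α - m|) {j j' : Bool} {t m : ℤ} (ht : t ≠ 0)
    (htN : |t| ≤ N) (hres : |z j + t * c.α - m - z j'| ≤ ε) :
    ∃ (a : Bool) (n : ℕ) (m0 : ℤ), C.Ret < n ∧ n ≤ N ∧
      |z a + n * c.α - m0 - z (!a)| ≤ ε := by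
  have hR := hP.ret_lt ht (hres.trans hε)
  have hne : j' = !j := by
    by_contra hj
    have hj : j' = j := by cases j <;> cases j' <;> simp_all
    subst hj
    have := hsame t m ht htN
    have e : z j' + t * c.α - m - z j' = t * c.α - m := by ring
    rw [e] at hres
    linarith
  subst hne
  rcases lt_or_gt_of_ne ht with h | h
  · rw [abs_of_neg h] at hR htN
    obtain ⟨n, hn⟩ := Int.eq_ofNat_of_zero_le (show 0 ≤ -t by omega)
    have hn' : (n : ℝ) = -t := by exact_mod_cast hn.symm
    refine ⟨!j, n, -m, by omega, by omega, ?_⟩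
    rw [abs_sub_comm] at hres
    convert hres using 2
    rw [hn', Bool.not_not]
    push_cast
    ring
  · rw [abs_of_pos h] at hR htN
    obtain ⟨n, hn⟩ := Int.eq_ofNat_of_zero_le h.le
    have hn' : (n : ℝ) = t := by exact_mod_cast hn.symm
    exact ⟨j, n, m, by omega, by omega, by rwa [hn']⟩

/-- One inductive step at transversal critical points. -/
lemma Sized.next (hS : C.Sized P) (hb : 2 ≤ c.b) (hP0 : 1000 ≤ P) (hsep : c.Sep P)
    (hr : 2 * C.r ≤ C.rD) (hP : C.PreI E1 (c.p (-(40 * (P : ℝ) ^ 2))) wl z par sx sE)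
    (hwl : c.p (-(200 * P)) ≤ wl) : ∃ P' ≥ P ^ 10, ∃ C' : Core c, C'.Staged P' E1 := by
  obtain ⟨hx, g2, g3, g4, -, -, -, -⟩ := scale_gaps hP0 (le_refl (P ^ 10))
  have hξ : c.p (-(P : ℝ) ^ 4) ≤ c.p (-(40 * (P : ℝ) ^ 2)) := p_le (by linarith)
  have h95 : c.p (-(40 * (P : ℝ) ^ 2)) ^ 95 ≤ c.p (-(P : ℝ) ^ 2) := by
    rw [p_pow]
    exact p_le (by push_cast; linarith)
  have h80 : 6 * c.p (-(40 * (P : ℝ) ^ 2)) ^ 80 ≤ c.p (-(P : ℝ) ^ 2) := by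
    rw [p_pow]
    exact num_mul_le hb 3 (by norm_num) (by push_cast; linarith)
  have e80 : (P ^ 10) ^ 8 = P ^ 80 := by rw [← pow_mul]
  have h640 : P ^ 80 ≤ P ^ 640 := Nat.pow_le_pow_right (by omega) (by norm_num)
  by_cases hres : ∀ j j' (t m : ℤ), t ≠ 0 → |t| ≤ ((P ^ 10) ^ 8 : ℕ) →
      c.p (-(40 * (P : ℝ) ^ 2)) ^ 95 < |z j + t * c.α - m - z j'|
  · obtain ⟨C', h1, h2⟩ := hS.keepI hb hP0 le_rfl hr hP hξ hwl hres
    exact ⟨P ^ 10, le_rfl, C', h1, Or.inl ⟨_, _, h2⟩⟩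
  · push Not at hres
    obtain ⟨j, j', t, m, ht, htN, hle⟩ := hres
    have hξ1 : c.p (-(40 * (P : ℝ) ^ 2)) ^ 95 ≤ c.p (-(40 * (P : ℝ) ^ 2)) :=
      pow_le_of_le_one (p_pos _).le (hP.ξ_le.trans (by norm_num)) (by norm_num)
    obtain ⟨a, n, m0, hn, hnN, hz⟩ := hP.orient hξ1 (fun t m ht h => h95.trans_lt
      (hsep t m ht (h.trans (by rw [e80]; exact_mod_cast h640)))) ht htN hle
    have h80' : P ^ 10 ≤ P ^ 80 := Nat.pow_le_pow_right (by omega) (by norm_num)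
    have e640 : (P ^ 80) ^ 8 = P ^ 640 := by rw [← pow_mul]
    obtain ⟨C', h1, h2, -⟩ := hS.mergeI hb hP0 h80' hr hP hξ hwl hn (by rwa [e80] at hnN) hz
      (fun t m ht h => h80.trans_lt (hsep t m ht (by rwa [e640] at h)))
    exact ⟨P ^ 80, h80', C', h1, Or.inr h2⟩

/-- The zoomed transversal critical points at the standard scale. -/
lemma StI.zoom_std {E0 : ℝ} (h : C.StI E0 (c.p (-(200 * P))) sx sE) (hP0 : 1000 ≤ P) :
    C.PreI E0 (c.p (-(40 * (P : ℝ) ^ 2))) (c.p (-(200 * P))) C.ctr id sx sE := by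
  obtain ⟨hx, g2, -⟩ := scale_gaps hP0 (le_refl (P ^ 10))
  refine h.zoom (p_pos _) ?_
  rw [p_pow]
  exact p_le (by push_cast; linarith)

/-- The split quadratic critical point at the standard scale. -/
lemma StII.zoom_std {E0 s : ℝ} (h : C.StII E0 (c.p (-(200 * P))) s) (hP0 : 1000 ≤ P)
    (hE1 : |E1 - E0| ≤ c.p (-(200 * P)) ^ 4)
    (hbot : (C.G true (C.ctr true) E1).v0 ≤ -c.p (-(10 * (P : ℝ) ^ 2)) ^ 2) :
    ∃ z sx, C.PreI E1 (c.p (-(40 * (P : ℝ) ^ 2))) (c.p (-(200 * P))) z (fun _ => true) sx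
      (fun _ => s) := by
  obtain ⟨hx, g2, -⟩ := scale_gaps hP0 (le_refl (P ^ 10))
  have e : c.p (-(10 * (P : ℝ) ^ 2)) ^ 4 = c.p (-(40 * (P : ℝ) ^ 2)) := by
    rw [p_pow]; congr 1; push_cast; ring
  rw [← e]
  refine h.zoom_pair (p_pos _) ?_ hE1 hbot
  rw [p_pow]
  exact p_le (by push_cast; linarith)

/-- One inductive step. -/
lemma Staged.next {E0 : ℝ} (h : C.Staged P E0) (hb : 2 ≤ c.b) (hP0 : 1000 ≤ P)
    (hsep : c.Sep P) : ∃ P' ≥ P ^ 10, ∃ C' : Core c, C'.Staged P' E0 := by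
  rcases h.crit with ⟨sx, sE, h1⟩ | ⟨s, h1⟩
  · exact h.sized.next hb hP0 hsep h1.r_le (h1.zoom_std hP0) le_rfl
  · rcases le_total (C.G true (C.ctr true) E0).v0 (-c.p (-(10 * (P : ℝ) ^ 2)) ^ 2) with hm | hm
    · obtain ⟨z, sx, hP⟩ := h1.zoom_std hP0 (E1 := E0)
        (by rw [sub_self, abs_zero]; exact (pow_pos (p_pos _) 4).le) hm
      exact h.sized.next hb hP0 hsep h1.r_le hP le_rfl
    · obtain ⟨hx, g2, g3, -⟩ := scale_gaps hP0 (le_refl (P ^ 10))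
      have hP := h1.zoom_single (y := c.p (-(10 * (P : ℝ) ^ 2))) (p_pos _)
        (by rw [p_pow]; exact p_le (by push_cast; linarith)) hm
      obtain ⟨C', h2, h3⟩ := h.sized.keepII hb hP0 le_rfl h1.r_le hP (p_le (by linarith)) le_rfl
        (fun t m ht htN => by
          refine lt_of_le_of_lt ?_ (hsep t m ht (htN.trans ?_))
          · rw [p_pow, p_div]
            exact num_mul_le hb 1 (by norm_num) (by push_cast; linarith)
          · rw [← pow_mul]
            exact_mod_cast Nat.pow_le_pow_right (by omega) (by norm_num))
      exact ⟨P ^ 10, le_rfl, C', h2, Or.inr ⟨s, h3⟩⟩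

/-- Arbitrarily fine staged cores. -/
theorem Staged.exists_fine {E0 : ℝ} (h : C.Staged P E0) (hb : 2 ≤ c.b) (hP0 : 1000 ≤ P)
    (hsep : ∀ P' ≥ P, c.Sep P') (N : ℕ) :
    ∃ P' ≥ P, N ≤ P' ∧ ∃ C' : Core c, C'.Staged P' E0 := by
  induction N with
  | zero => exact ⟨P, le_rfl, Nat.zero_le _, C, h⟩
  | succ N ih =>
    obtain ⟨P1, h1, h2, C1, h3⟩ := ih
    obtain ⟨P2, h4, C2, h5⟩ := h3.next hb (by omega) (hsep P1 h1)
    have h6 : P1 < P1 ^ 10 := lt_self_pow₀ (by omega) (by norm_num)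
    exact ⟨P2, by omega, by omega, C2, h5⟩

/-- If the coupling functions do not vanish then the cocycle is uniformly hyperbolic. -/
theorem Sized.uh_of_gap (hS : C.Sized P) (hb : 2 ≤ c.b) (hP0 : 1000 ≤ P)
    (hr : 2 * C.r ≤ C.rD) (hrD : 0 < C.rD) {E δ : ℝ} (hE : E ∈ C.W) (hδ : c.p (-(P : ℝ) ^ 5) ≤ δ) (hδ1 : δ ≤ 1)
    (hgap : ∀ j y, |y - C.ctr j| ≤ C.r → δ ≤ |(C.G j y E).v0|) :
    IsUH c.α (schCocycle c.lam c.v (c.lam * E)) := by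
  have hD := hS.stepData hb hP0 le_rfl hr hδ hδ1
  have hJ : C.Catches E δ ∅ := fun j y m hy hG => absurd hG (not_lt.2 (hgap j _ hy))
  exact uh_of_good (S := C.S1) (Eo := C.E1) (k := C.k) hb (C.hW E hE) (p_pos _).le hD.hρ
    (fun x n hx => (C.step hD.num hE hJ n x hx).good) (half_pos hrD).le hD.cov

/-- Passing to exact zeros at a nearby energy and to a smaller scale. -/
lemma PreI.shrink (hP : C.PreI E1 ξ wl z par sx sE) {ξ' E2 : ℝ} {z2 : Bool → ℝ} (hξ0 : 0 < ξ')
    (hξ' : ξ' ≤ ξ ^ 10) (hE : |E2 - E1| ≤ ξ ^ 101) (hz : ∀ j, |z2 j - z j| ≤ ξ / 2)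
    (h0 : ∀ j, (C.G (par j) (z2 j) E2).v0 = 0) : C.PreI E2 ξ' wl z2 par sx sE := by
  have hξ := hP.ξ_pos
  have hξ1 := hP.ξ_le
  have s1 := hP.pow_step (show 1 < 10 by norm_num)
  have s2 := hP.pow_step (show 1 < 101 by norm_num)
  have s3 := hP.pow_step (show 1 < 100 by norm_num)
  have s4 := hP.pow_step (show 100 < 101 by norm_num)
  rw [pow_one] at s1 s2 s3
  have q10 : 0 < ξ ^ 10 := by positivity
  have q100 : 0 < ξ ^ 100 := by positivity
  have q101 : 0 < ξ ^ 101 := by positivity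
  have q' : 0 < ξ' ^ 100 := by positivity
  have hle : ξ' ≤ ξ := by linarith
  have hsm : 1000 * ξ' ^ 100 ≤ ξ' ^ 2 := pow_le_of_small hξ0 (by linarith) (by norm_num)
  have hx2 : ∀ (j : Bool) y, |y - z2 j| ≤ ξ' → |y - z j| ≤ ξ := fun j y hy =>
    (abs_sub_le y (z2 j) (z j)).trans (by linarith [hz j])
  have hE' : ∀ E, |E - E2| ≤ ξ' → |E - E1| ≤ ξ := fun E h =>
    (abs_sub_le E E2 E1).trans (by linarith)
  have hEE : |E2 - E2| ≤ ξ' := by simpa using hξ0.le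
  refine ⟨fun E h => hP.win E (hE' E h), hξ0, by linarith, hP.wl_pos, ?_, fun j => ?_, ?_,
    hP.sx_abs, hP.sE_abs, hP.sgn_t, hP.sgn_f, h0,
    fun j y E hy h => hle.trans (hP.dx j y E (hx2 j y hy) (hE' E h)),
    fun j y E hy h => hle.trans (hP.dE j y E (hx2 j y hy) (hE' E h)),
    fun j y E hy h => hP.w j y E (hx2 j y hy) (hE' E h), fun i y m E hy h hG => ?_⟩
  · exact (mul_le_mul_of_nonneg_left hle C.K_pos.le).trans hP.K_le
  · have := hP.near j
    have := abs_sub_le (z2 j) (z j) (C.ctr (par j))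
    linarith [hz j]
  · linarith [hP.half]
  · have h100 : ξ' ^ 100 ≤ (ξ ^ 10) ^ 100 := by gcongr
    have e1000 : (ξ ^ 10) ^ 100 = ξ ^ 1000 := by ring
    have s5 := hP.pow_step (show 100 < 1000 by norm_num)
    rw [e1000] at h100
    have hEs : |E - E2| ≤ ξ' := by nlinarith
    have hEl : |E - E1| ≤ ξ ^ 100 := (abs_sub_le E E2 E1).trans (by linarith)
    obtain ⟨j, m', h1, h2⟩ := hP.cov i y m E hy hEl (hG.trans_le (by linarith))
    refine ⟨j, m', ?_, h2⟩
    rw [← h2] at hG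
    have h3 := slope_abs (f := fun x => sx j * (C.G (par j) x E).v0)
      (f' := fun x => sx j * (C.G (par j) x E).dx) (z := z j) (R := ξ) (m := ξ)
      (fun x hx => ((C.isG _ x (hP.nearD hx) E (hP.win E (hE' E hEs))).hdx).const_mul _)
      (fun x hx => hP.dx j x E hx (hE' E hEs)) (p := z2 j) (q := y - m')
      ((hz j).trans (by linarith)) h1
    rw [← mul_sub, abs_sgn_mul (hP.sx_abs j)] at h3
    have h4 := lipE (par j) (hP.nearD ((hz j).trans (by linarith) : |z2 j - z j| ≤ ξ)) hP.win
      (hE' E2 hEE) (hE' E hEs)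
    rw [h0, sub_zero] at h4
    have h5 := abs_sub (C.G (par j) (y - m') E).v0 (C.G (par j) (z2 j) E).v0
    have h6 : C.K * |E - E2| ≤ C.K * ξ' ^ 100 := by gcongr; exact C.K_pos.le
    have h7 : ξ * |y - m' - z2 j| ≤ ξ' ^ 100 + C.K * ξ' ^ 100 := by linarith
    have h8 := mul_le_mul_of_nonneg_left h7 hξ.le
    have h9 := mul_le_mul_of_nonneg_right hP.K_le q'.le
    have h10 : ξ ^ 2 * |y - m' - z2 j| ≤ ξ ^ 2 * ξ' := by
      have : ξ' * ξ' ≤ ξ ^ 2 * ξ' := by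
        have : ξ ^ 10 ≤ ξ ^ 2 := pow_le_pow_of_le_one hξ.le (by linarith) (by norm_num)
        gcongr
        linarith
      nlinarith
    exact le_of_mul_le_mul_left h10 (by positivity)

/-- Approximately resonant critical points become exactly resonant at a nearby energy. -/
lemma PreI.exact (hP : C.PreI E1 ξ wl z par sx sE) {n : ℕ} {m0 : ℤ}
    (hres : |z true + n * c.α - m0 - z false| ≤ ξ ^ 110) :
    ∃ (E2 : ℝ) (z2 : Bool → ℝ), |E2 - E1| ≤ ξ ^ 101 ∧ (∀ j, |z2 j - z j| ≤ ξ / 2) ∧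
      (∀ j, (C.G (par j) (z2 j) E2).v0 = 0) ∧ z2 true + n * c.α - m0 - z2 false = 0 := by
  have hξ := hP.ξ_pos
  have hξ1 := hP.ξ_le
  have hK := C.K_pos
  set d : ℝ := n * c.α - m0 with hd
  have hres' : |z true + d - z false| ≤ ξ ^ 110 := by rw [hd]; convert hres using 2; ring
  have q110 : 0 < ξ ^ 110 := by positivity
  have q109 : 0 < ξ ^ 109 := by positivity
  have q101 : 0 < ξ ^ 101 := by positivity
  have s1 := hP.pow_step (show 1 < 110 by norm_num)
  have s2 := hP.pow_step (show 1 < 101 by norm_num)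
  have s3 := hP.pow_step (show 102 < 109 by norm_num)
  have s4 := hP.pow_step (show 2 < 100 by norm_num)
  have s5 := hP.pow_step (show 2 < 109 by norm_num)
  rw [pow_one] at s1 s2
  have hf : ∀ y, |y - z true| ≤ ξ / 4 → |y - z true| ≤ ξ := fun y h => h.trans (by linarith)
  have hg : ∀ y, |y - z true| ≤ ξ / 4 → |y + d - z false| ≤ ξ / 2 := fun y h => by
    have e : y + d - z false = (y - z true) + (z true + d - z false) := by ring
    rw [e]
    exact (abs_add_le _ _).trans (by linarith)
  have hg' : ∀ y, |y - z true| ≤ ξ / 4 → |y + d - z false| ≤ ξ := fun y h =>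
    (hg y h).trans (by linarith)
  have hsx := hP.sx_abs
  have hpair : Pair (C.G (par true)) (fun y => C.G (par false) (y + d)) (z true) E1 (ξ / 4) ξ ξ C.K
      (sx true) (sx false) (sE true) (sE false) :=
    { atf := fun y E hy hE => C.isG _ y (hP.nearD (hf y hy)) E (hP.win E hE)
      atg := fun y E hy hE =>
        (C.isG _ (y + d) (hP.nearD (hg' y hy)) E (hP.win E hE)).shift d
      m_pos := hξ
      M_pos := hK
      R_nonneg := by linarith
      ω_nonneg := hξ.le
      sa_abs := hP.sx_abs _
      sb_abs := hP.sx_abs _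
      ta_abs := hP.sE_abs _
      tb_abs := hP.sE_abs _
      sgn := by
        have h1 : sx true * sE true * (sx false * sE false) = -1 := by
          rw [hP.sgn_t, hP.sgn_f]; norm_num
        have h2 : (sE true * sE false) ^ 2 = 1 := by
          rw [← sq_abs, abs_mul, hP.sE_abs, hP.sE_abs]; norm_num
        linear_combination (sE true * sE false) * h1 - sx true * sx false * h2
      fx := fun y E hy hE => hP.dx _ y E (hf y hy) hE
      gx := fun y E hy hE => hP.dx _ _ E (hg' y hy) hE
      fE := fun y E hy hE => hP.dE _ y E (hf y hy) hE
      gE := fun y E hy hE => hP.dE _ _ E (hg' y hy) hE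
      f_le := fun y E hy hE => C.G_le _ _ (hP.nearD (hf y hy)) E (hP.win E hE)
      g_le := fun y E hy hE => C.G_le _ _ (hP.nearD (hg' y hy)) E (hP.win E hE) }
  have hE1 : |E1 - E1| ≤ ξ := by simpa using hξ.le
  have hzz : |z true - z true| ≤ ξ / 4 := by simp; linarith
  have h1 := lipX (par false) hP.memW (z := z false) (R := ξ) (x := z false) (x' := z true + d)
    (hP.near false) (by simpa using hξ.le) (hg' _ hzz)
  rw [hP.zero, sub_zero] at h1
  have hKξ : C.K * ξ ^ 110 ≤ ξ ^ 109 := by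
    calc C.K * ξ ^ 110 = (C.K * ξ) * ξ ^ 109 := by ring
      _ ≤ 1 * ξ ^ 109 := by gcongr; exact hP.K_le
      _ = ξ ^ 109 := one_mul _
  have hKξ' : C.K * ξ ^ 101 ≤ ξ ^ 100 := by
    calc C.K * ξ ^ 101 = (C.K * ξ) * ξ ^ 100 := by ring
      _ ≤ 1 * ξ ^ 100 := by gcongr; exact hP.K_le
      _ = ξ ^ 100 := one_mul _
  obtain ⟨y, E2, h2, h3, h4, h5⟩ := hpair.crossing (ε := ξ ^ 109) (ω' := ξ ^ 101) (by linarith)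
    (by rw [hP.zero]; simpa using q109.le)
    (h1.trans ((mul_le_mul_of_nonneg_left hres' hK.le).trans hKξ))
    (by
      have : ξ * ξ ^ 101 = ξ ^ 102 := by ring
      have : 0 < ξ ^ 102 := by positivity
      linarith)
    (by
      have : ξ * (ξ / 4) = ξ ^ 2 / 4 := by ring
      have : 0 < ξ ^ 2 := by positivity
      linarith)
  refine ⟨E2, fun j => if j then y else y + d, h2, fun j => ?_, fun j => ?_, ?_⟩
  · cases j
    · simpa using hg y h3
    · simp only [if_true]; linarith
  · cases j
    · simpa using h5
    · simpa using h4
  · simp [hd]; ring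

end Core

namespace Ctx

variable {c : Ctx}

/-- Orbits of a Diophantine rotation are quantitatively dense. -/
lemma exists_return (c : Ctx) {N : ℕ} (hN : 0 < N) (x : ℝ) :
    ∃ (n : ℕ) (m : ℤ), 0 < n ∧ (n : ℝ) ≤ ((N : ℝ) ^ c.T / c.γ + 1) * N ∧
      |x + n * c.α - m| ≤ 1 / N := by
  obtain ⟨k, hk0, hkN, hk⟩ := Real.exists_nat_abs_mul_sub_round_le c.α hN
  set d : ℝ := k * c.α - round (k * c.α) with hd
  have hγ := c.hγ
  have hN0 : (0 : ℝ) < N := by exact_mod_cast hN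
  have hkN' : (k : ℝ) ≤ N := by exact_mod_cast hkN
  have h1 : c.γ ≤ |d| * (N : ℝ) ^ c.T := by
    refine (c.dc (round (k * c.α)) k (by omega)).trans ?_
    rw [hd]
    push_cast
    rw [abs_of_nonneg (Nat.cast_nonneg k : (0 : ℝ) ≤ k)]
    gcongr
  have hNT : 0 < (N : ℝ) ^ c.T := by positivity
  have he : 0 < |d| := by
    by_contra hcon
    have : |d| = 0 := le_antisymm (not_lt.1 hcon) (abs_nonneg _)
    rw [this, zero_mul] at h1
    linarith
  obtain ⟨σ, hσ, hdσ⟩ : ∃ σ : ℤ, σ * σ = 1 ∧ d = σ * |d| := by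
    rcases le_total 0 d with h | h
    · exact ⟨1, by norm_num, by rw [abs_of_nonneg h]; simp⟩
    · exact ⟨-1, by norm_num, by rw [abs_of_nonpos h]; simp⟩
  have hσ' : (σ : ℝ) * σ = 1 := by exact_mod_cast hσ
  have hσ1 : |(σ : ℝ)| = 1 := by
    have := abs_mul (σ : ℝ) σ
    rw [hσ', abs_one] at this
    nlinarith [abs_nonneg (σ : ℝ)]
  set t : ℝ := Int.fract (-(σ : ℝ) * x) with ht
  have ht0 : 0 ≤ t := Int.fract_nonneg _
  have ht1 : t < 1 := Int.fract_lt_one _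
  have hF : -(σ : ℝ) * x = ⌊-(σ : ℝ) * x⌋ + t := (Int.floor_add_fract _).symm
  set F : ℤ := ⌊-(σ : ℝ) * x⌋
  set i : ℕ := ⌊t / |d|⌋₊ with hi
  have hi1 : (i : ℝ) ≤ t / |d| := Nat.floor_le (by positivity)
  have hi2 : t / |d| < i + 1 := Nat.lt_floor_add_one _
  rw [le_div_iff₀ he] at hi1
  rw [div_lt_iff₀ he] at hi2
  refine ⟨(i + 1) * k, (i + 1) * round (k * c.α) - σ * F, by positivity, ?_, ?_⟩
  · have h2 : (i : ℝ) ≤ (N : ℝ) ^ c.T / c.γ := by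
      rw [le_div_iff₀ hγ]
      calc (i : ℝ) * c.γ ≤ i * (|d| * (N : ℝ) ^ c.T) := by gcongr
        _ = (i * |d|) * (N : ℝ) ^ c.T := by ring
        _ ≤ 1 * (N : ℝ) ^ c.T := by gcongr; linarith
        _ = _ := one_mul _
    push_cast
    gcongr
  · have e : x + (((i + 1) * k : ℕ) : ℝ) * c.α - (((i + 1) * round (k * c.α) - σ * F : ℤ) : ℝ) =
        σ * ((i + 1) * |d| - t) := by
      push_cast
      have e1 : (k : ℝ) * c.α = d + round (k * c.α) := by rw [hd]; ring
      linear_combination (-(σ : ℝ)) * hF + (i + 1 : ℝ) * e1 + (i + 1 : ℝ) * hdσ - x * hσ'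
    rw [e, abs_mul, hσ1, one_mul, abs_le]
    have h3 : (1 : ℝ) / (N + 1) ≤ 1 / N := by gcongr; linarith
    constructor <;> nlinarith

/-- Scales that are large relative to the arithmetic of the frequency. -/
structure Large (c : Ctx) (P : ℕ) : Prop where
  le : 1000 * (c.T + 1) ≤ P
  γ : c.p (-P) ≤ c.γ

lemma Large.mono {P P' : ℕ} (h : c.Large P) (hP : P ≤ P') : c.Large P' :=
  ⟨h.le.trans hP, (p_le (by have : (P : ℝ) ≤ P' := by exact_mod_cast hP
                            linarith)).trans h.γ⟩

lemma nat_le_p (hb : 2 ≤ c.b) (P : ℕ) : (P : ℝ) ≤ c.p P :=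
  num_le hb P (by exact_mod_cast (Nat.lt_two_pow_self (n := P)).le)

/-- Lower bound for the distance of long returns. -/
lemma Large.far {P : ℕ} (h : c.Large P) {t m : ℤ} (ht : t ≠ 0) {x : ℝ} (htx : (|t| : ℤ) ≤ c.p x) :
    c.p (-P - c.T * x) ≤ |t * c.α - m| := by
  have h1 := c.dc m t ht
  have hp := p_pos (c := c) (c.T * x)
  have h2 : |(t : ℝ)| ^ c.T ≤ c.p (c.T * x) := by
    rw [← p_pow]
    have : |(t : ℝ)| ≤ c.p x := by exact_mod_cast htx
    gcongr
  have h3 : c.p (-P) ≤ |t * c.α - m| * c.p (c.T * x) :=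
    h.γ.trans (h1.trans (by gcongr))
  rw [sub_eq_add_neg, p_add, p_neg (c.T * x), ← div_eq_mul_inv, div_le_iff₀ hp]
  exact h3

lemma Large.sep {P : ℕ} (h : c.Large P) (hb : 2 ≤ c.b) : c.Sep P := by
  intro t m ht htP
  have hT : (1000 : ℝ) * (c.T + 1) ≤ P := by exact_mod_cast h.le
  have hT0 : (0 : ℝ) ≤ c.T := Nat.cast_nonneg _
  have h1 : ((|t| : ℤ) : ℝ) ≤ c.p (640 * P) := by
    calc ((|t| : ℤ) : ℝ) ≤ (((P : ℕ) ^ 640 : ℕ) : ℝ) := by exact_mod_cast htP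
      _ = (P : ℝ) ^ 640 := by rw [Nat.cast_pow]
      _ ≤ c.p P ^ 640 := by gcongr; exact nat_le_p hb P
      _ = c.p (640 * P) := by rw [p_pow]; norm_cast
  refine lt_of_lt_of_le (p_lt ?_) (h.far ht h1)
  nlinarith

end Ctx

namespace Core
open Ctx

variable {c : Ctx} {C : Core c} {P : ℕ} {E1 wl : ℝ} {z : Bool → ℝ} {par : Bool → Bool}
  {sx sE : Bool → ℝ}

/-- Return times up to which critical points become resonant. -/
lemma Large.return_le (hL : c.Large P) (hb : 2 ≤ c.b) (x : ℝ) :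
    ∃ (n : ℕ) (m : ℤ), 0 < n ∧ (n : ℝ) ≤ c.p (5 * (P : ℝ) ^ 3) ∧
      |x + n * c.α - m| ≤ c.p (-(40 * (P : ℝ) ^ 2)) ^ 110 := by
  have hT : (1000 : ℝ) * (c.T + 1) ≤ P := by exact_mod_cast hL.le
  have hT0 : (0 : ℝ) ≤ c.T := Nat.cast_nonneg _
  have hx : (1000 : ℝ) ≤ P := by linarith
  have g1 := pow_gap hx (show 1 < 2 by norm_num)
  have g2 := pow_gap hx (show 2 < 3 by norm_num)
  rw [pow_one] at g1
  set u : ℝ := 4400 * (P : ℝ) ^ 2 with hu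
  have hup := p_pos (c := c) u
  have hu1 : 1 ≤ c.p u := by
    rw [← p_zero (c := c)]; exact p_le (by rw [hu]; positivity)
  set N : ℕ := ⌈c.p u⌉₊ with hN
  have hN1 : c.p u ≤ N := Nat.le_ceil _
  have hN2 : (N : ℝ) ≤ c.p (u + 1) := by
    have h1 : (N : ℝ) < c.p u + 1 := Nat.ceil_lt_add_one hup.le
    have h2 : 2 * c.p u ≤ c.p (u + 1) := num_mul_le hb 1 (by norm_num) (by push_cast; linarith)
    linarith
  have hN0 : 0 < N := Nat.ceil_pos.2 hup
  obtain ⟨n, m, h0, h1, h2⟩ := c.exists_return hN0 x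
  refine ⟨n, m, h0, h1.trans ?_, h2.trans ?_⟩
  · have hγ := c.hγ
    have h3 : (N : ℝ) ^ c.T / c.γ ≤ c.p (c.T * (u + 1) + P) := by
      rw [p_add, ← p_pow, div_le_iff₀ hγ]
      have h4 : 1 ≤ c.p P * c.γ := by
        have := mul_le_mul_of_nonneg_left hL.γ (p_pos (c := c) P).le
        rwa [← p_add, add_neg_cancel, p_zero] at this
      calc (N : ℝ) ^ c.T ≤ c.p (u + 1) ^ c.T * 1 := by rw [mul_one]; gcongr
        _ ≤ c.p (u + 1) ^ c.T * (c.p P * c.γ) := by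
            gcongr
            exact pow_nonneg (p_pos _).le _
        _ = _ := by ring
    have h5 : 1 ≤ c.p (c.T * (u + 1) + P) := by
      have hu0 : 0 ≤ u := by rw [hu]; positivity
      exact (p_zero (c := c)).symm.le.trans (p_le (by positivity))
    calc ((N : ℝ) ^ c.T / c.γ + 1) * N ≤ (2 * c.p (c.T * (u + 1) + P)) * c.p (u + 1) := by
          gcongr
          linarith
      _ = 2 * c.p (c.T * (u + 1) + P + (u + 1)) := by rw [p_add (c.T * (u + 1) + P)]; ring
      _ ≤ _ := num_mul_le hb 1 (by norm_num) (by
          have h6 : (P : ℝ) ^ 3 = P * (P : ℝ) ^ 2 := by ring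
          have h7 : (c.T + 1) * (4400 * (P : ℝ) ^ 2) ≤ (P / 1000) * (4400 * (P : ℝ) ^ 2) := by
            gcongr; linarith
          push_cast
          nlinarith)
  · have e : c.p (-(40 * (P : ℝ) ^ 2)) ^ 110 = 1 / c.p u := by
      rw [p_pow, one_div, ← p_neg]; congr 1; rw [hu]; push_cast; ring
    rw [e]
    gcongr

/-- Near transversal critical points there are uniformly hyperbolic energies. -/
theorem Sized.uh_near (hS : C.Sized P) (hb : 2 ≤ c.b) (hL : c.Large P) (hr : 2 * C.r ≤ C.rD)
    (hP : C.PreI E1 (c.p (-(40 * (P : ℝ) ^ 2))) wl z par sx sE) (hwl : c.p (-(200 * P)) ≤ wl) :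
    ∃ E, |E - E1| ≤ c.p (-(P : ℝ) ^ 2) ∧ IsUH c.α (schCocycle c.lam c.v (c.lam * E)) := by
  have hP0 : 1000 ≤ P := by have := hL.le; omega
  have hT : (1000 : ℝ) * (c.T + 1) ≤ P := by exact_mod_cast hL.le
  have hT0 : (0 : ℝ) ≤ c.T := Nat.cast_nonneg _
  obtain ⟨hx, g2, g3, g4, -⟩ := scale_gaps hP0 (le_refl (P ^ 10))
  obtain ⟨n, m0, hn0, hnle, hnres⟩ := Large.return_le hL hb (z true - z false)
  have hres : |z true + n * c.α - m0 - z false| ≤ c.p (-(40 * (P : ℝ) ^ 2)) ^ 110 := by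
    convert hnres using 2; ring
  have hxi0 := hP.ξ_pos
  have hxi1 := hP.ξ_le
  have hRet : C.Ret < n := by
    have h1 := hP.ret_lt (a := true) (b := false) (t := n) (m := m0) (by omega) (by
      push_cast
      exact hres.trans (pow_le_of_le_one hxi0.le (by linarith) (by norm_num)))
    rw [abs_of_pos (by omega)] at h1
    exact_mod_cast h1
  obtain ⟨E2, z2, hE2, hz2, h0, hex⟩ := hP.exact hres
  set xi : ℝ := c.p (-(P : ℝ) ^ 4) with hxi
  have hQ := hP.shrink (ξ' := xi) (p_pos _)
    (by rw [hxi, p_pow]; exact p_le (by push_cast; linarith)) hE2 hz2 h0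
  have hP10 : ((P ^ 10 : ℕ) : ℝ) ≤ c.p (10 * P) := by
    calc ((P ^ 10 : ℕ) : ℝ) = (P : ℝ) ^ 10 := by push_cast; ring
      _ ≤ c.p P ^ 10 := by gcongr; exact nat_le_p hb P
      _ = c.p (10 * P) := by rw [p_pow]; norm_cast
  have hP' : ((n + P ^ 10 : ℕ) : ℝ) ≤ c.p (6 * (P : ℝ) ^ 3) := by
    have h1 : 2 * c.p (5 * (P : ℝ) ^ 3) ≤ c.p (6 * (P : ℝ) ^ 3) :=
      num_mul_le hb 1 (by norm_num) (by push_cast; linarith)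
    have h2 : c.p (10 * P) ≤ c.p (5 * (P : ℝ) ^ 3) := p_le (by linarith)
    push_cast at hP10 ⊢
    linarith
  obtain ⟨C', hS', ⟨s, hC'⟩, hE3⟩ := hS.mergeI hb hP0 (P' := n + P ^ 10) (by omega) hr hQ le_rfl
    hwl hRet (by omega) (a := true) (m0 := m0)
    (by rw [Bool.not_true, hex, abs_zero]; exact (pow_pos (p_pos _) _).le)
    (fun t m ht htP => by
      have h1 : ((|t| : ℤ) : ℝ) ≤ c.p (48 * (P : ℝ) ^ 3) := by
        calc ((|t| : ℤ) : ℝ) ≤ (((n + P ^ 10 : ℕ) ^ 8 : ℕ) : ℝ) := by exact_mod_cast htP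
          _ = ((n + P ^ 10 : ℕ) : ℝ) ^ 8 := by push_cast; ring
          _ ≤ c.p (6 * (P : ℝ) ^ 3) ^ 8 := by gcongr
          _ = c.p (48 * (P : ℝ) ^ 3) := by rw [p_pow]; congr 1; push_cast; ring
      refine lt_of_lt_of_le ?_ (hL.far ht h1)
      rw [hxi, p_pow]
      have h2 : (c.T : ℝ) * (48 * (P : ℝ) ^ 3) ≤ (P / 1000) * (48 * (P : ℝ) ^ 3) := by
        gcongr; linarith
      have h3 : (P / 1000) * (48 * (P : ℝ) ^ 3) = 48 / 1000 * (P : ℝ) ^ 4 := by ring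
      refine lt_of_le_of_lt (num_mul_le hb 3 (by norm_num) le_rfl) (p_lt ?_)
      push_cast
      linarith)
  obtain ⟨E3, hW, hE3, hgap⟩ := hE3 (by simpa using hex)
  refine ⟨E3, ?_, ?_⟩
  · have q1 : c.p (-(40 * (P : ℝ) ^ 2)) ^ 101 ≤ c.p (-(40 * (P : ℝ) ^ 2)) :=
      pow_le_of_le_one hxi0.le (by linarith) (by norm_num)
    have q2 : xi ^ 103 ≤ c.p (-(40 * (P : ℝ) ^ 2)) := by
      rw [hxi, p_pow]; exact p_le (by push_cast; linarith)
    have q3 : 2 * c.p (-(40 * (P : ℝ) ^ 2)) ≤ c.p (-(P : ℝ) ^ 2) :=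
      num_mul_le hb 1 (by norm_num) (by push_cast; linarith)
    exact (abs_sub_le E3 E2 E1).trans (by linarith)
  · have hrD := hC'.κ_pos.trans_le hC'.rD_ge
    refine hS'.uh_of_gap hb (hP0.trans ?_) hC'.r_le hrD hW le_rfl
      ?_ fun j y hy => hgap j y (hy.trans C'.r_le)
    · have : P ≤ P ^ 10 := Nat.le_self_pow (by norm_num) P
      omega
    · rw [← p_zero (c := c)]
      exact p_le (by simp only [Left.neg_nonpos_iff]; positivity)

/-- Near the energy of a staged core there are uniformly hyperbolic energies. -/
theorem Staged.exists_uh {E0 : ℝ} (h : C.Staged P E0) (hb : 2 ≤ c.b) (hL : c.Large P) :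
    ∃ E, |E - E0| ≤ c.p (-P) ∧ IsUH c.α (schCocycle c.lam c.v (c.lam * E)) := by
  have hP0 : 1000 ≤ P := by have := hL.le; omega
  obtain ⟨hx, g2, g3, g4, g5, -⟩ := scale_gaps hP0 (le_refl (P ^ 10))
  have q0 : c.p (-(P : ℝ) ^ 2) ≤ c.p (-P) := p_le (by linarith)
  rcases h.crit with ⟨sx, sE, h1⟩ | ⟨s, h1⟩
  · obtain ⟨E, hE, hU⟩ := h.sized.uh_near hb hL h1.r_le (h1.zoom_std hP0) le_rfl
    exact ⟨E, hE.trans q0, hU⟩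
  set y : ℝ := c.p (-(10 * (P : ℝ) ^ 2)) with hy
  set κ : ℝ := c.p (-(200 * (P : ℝ))) with hκ
  have hy0 : 0 < y := p_pos _
  have hκ0 : 0 < κ := p_pos _
  have hκ1 := h1.κ_le
  have hrD := h1.κ_pos.trans_le h1.rD_ge
  have hE0 : |E0 - E0| ≤ κ ^ 2 := by simp; positivity
  have hcc : |C.ctr true - C.ctr true| ≤ C.rD := by simpa using hrD.le
  rcases le_or_gt (C.G true (C.ctr true) E0).v0 (-y ^ 2) with hm | hm
  · obtain ⟨z, sx, hP⟩ := h1.zoom_std hP0 (E1 := E0)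
      (by rw [sub_self, abs_zero]; positivity) hm
    obtain ⟨E, hE, hU⟩ := h.sized.uh_near hb hL h1.r_le hP le_rfl
    exact ⟨E, hE.trans q0, hU⟩
  rcases le_or_gt (y ^ 2) (C.G true (C.ctr true) E0).v0 with hm' | hm'
  · refine ⟨E0, by simpa using (p_pos _).le, ?_⟩
    refine h.sized.uh_of_gap hb hP0 h1.r_le hrD (h1.win E0 hE0) (δ := y ^ 2) ?_ ?_ ?_
    · rw [hy, p_pow]; exact p_le (by push_cast; linarith)
    · rw [hy, p_pow]
      exact (p_le (by push_cast; nlinarith)).trans_eq p_zero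
    · intro j x hx'
      rw [h1.G_eq j]
      rw [h1.ctr_eq j] at hx'
      have h2 := quad_ge (f := fun x => (C.G true x E0).v0) (f' := fun x => (C.G true x E0).dx)
        (f2 := fun x => (C.G true x E0).dxx) (z := C.ctr true) (R := C.rD) (m := κ)
        (fun x hx => (C.isG _ x hx E0 (h1.win E0 hE0)).hdx)
        (fun x hx => (C.isG _ x hx E0 (h1.win E0 hE0)).hdxx)
        (fun x hx => h1.dxx x E0 hx hE0) (p := C.ctr true) (q := x) hcc (hx'.trans C.r_le)
      rw [h1.crit, zero_mul, add_zero] at h2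
      have h3 : 0 ≤ κ * (x - C.ctr true) ^ 2 := by positivity
      exact le_trans (by linarith) (le_abs_self _)
  · set ω : ℝ := 3 * y ^ 2 / κ with hω
    have hω0 : 0 < ω := by positivity
    have hωκ : ω ≤ κ ^ 4 := by
      rw [hω, hy, hκ, p_pow, p_pow, mul_div_assoc, p_div]
      exact num_mul_le hb 2 (by norm_num) (by push_cast; linarith)
    have hκ4 : 1000 * κ ^ 4 ≤ κ ^ 2 := pow_le_of_small hκ0 hκ1 (by norm_num)
    have hκ2 : 1000 * κ ^ 2 ≤ κ := by simpa using pow_le_of_small hκ0 hκ1 (show 1 < 2 by norm_num)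
    have hs2 : s * s = 1 := by rw [← abs_mul_abs_self, h1.s_abs]; norm_num
    have hsub : ∀ t, E0 - s * t - E0 = -(s * t) := fun t => by ring
    have hball : ∀ t ∈ Set.Icc 0 ω, |E0 - s * t - E0| ≤ κ ^ 4 := fun t ht => by
      rw [hsub, abs_neg, abs_mul, h1.s_abs, one_mul, abs_of_nonneg ht.1]
      exact ht.2.trans hωκ
    have hball2 : ∀ t ∈ Set.Icc 0 ω, |E0 - s * t - E0| ≤ κ ^ 2 := fun t ht =>
      (hball t ht).trans (by linarith)
    have hy2 : y ^ 2 ≤ κ ^ 2 := by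
      have : y ≤ κ := p_le (by linarith)
      gcongr
    have hsl := slope_ge (f := fun t => -(C.G true (C.ctr true) (E0 - s * t)).v0)
      (f' := fun t => s * (C.G true (C.ctr true) (E0 - s * t)).dE) (p := 0) (q := ω) (m := κ)
      hω0.le
      (fun t ht => by
        have h2 := (C.isG true (C.ctr true) hcc _ (h1.win _ (hball2 t ht))).hdE
        have h3 := ((hasDerivAt_id t).const_mul s).const_sub E0
        have h4 := (HasDerivAt.comp (h₂ := fun E => (C.G true (C.ctr true) E).v0) t h2 h3).neg
        exact h4.congr_deriv (by simp; ring))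
      (fun t ht => by
        refine h1.dE _ _ hcc (hball2 t ht) ?_
        have h5 := lipE true hcc h1.win hE0 (hball2 t ht)
        have h6 : C.K * |E0 - s * t - E0| ≤ C.K * κ ^ 4 := by
          have := hball t ht
          have := C.K_pos
          gcongr
        have h7 : C.K * κ ^ 4 ≤ κ ^ 3 := by
          calc C.K * κ ^ 4 = (C.K * κ) * κ ^ 3 := by ring
            _ ≤ 1 * κ ^ 3 := by gcongr; exact h1.K_le
            _ = _ := one_mul _
        have h8 : 1000 * κ ^ 3 ≤ κ ^ 2 := pow_le_of_small hκ0 hκ1 (by norm_num)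
        have h9 := abs_sub_abs_le_abs_sub (C.G true (C.ctr true) (E0 - s * t)).v0
          (C.G true (C.ctr true) E0).v0
        have h10 : |(C.G true (C.ctr true) E0).v0| ≤ y ^ 2 := abs_le.2 ⟨by linarith, hm'.le⟩
        have h11 : 0 < κ ^ 3 := by positivity
        have h12 : 0 < κ ^ 2 := by positivity
        linarith)
    have hωe : κ * (ω - 0) = 3 * y ^ 2 := by rw [hω]; field_simp; ring
    rw [hωe] at hsl
    simp only [mul_zero, sub_zero] at hsl
    have hb1 := hball ω ⟨hω0.le, le_rfl⟩
    obtain ⟨z, sx, hP⟩ := h1.zoom_std hP0 (E1 := E0 - s * ω) hb1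
      (by
        have : 0 < y ^ 2 := by positivity
        linarith)
    obtain ⟨E, hE, hU⟩ := h.sized.uh_near hb hL h1.r_le hP le_rfl
    refine ⟨E, ?_, hU⟩
    have q1 : κ ^ 4 ≤ c.p (-P - 1) := by rw [hκ, p_pow]; exact p_le (by push_cast; linarith)
    have q2 : c.p (-(P : ℝ) ^ 2) ≤ c.p (-P - 1) := p_le (by linarith)
    have q3 : 2 * c.p (-P - 1) ≤ c.p (-P) := num_mul_le hb 1 (by norm_num) (by push_cast; linarith)
    exact (abs_sub_le E (E0 - s * ω) E0).trans (by linarith)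

end Core

/-- A periodic function which increases on `[a, m]` and decreases on `[m, a + 1]`, with
quantitatively nondegenerate extrema. -/
structure Uni (f f1 f2 : ℝ → ℝ) (κ a m : ℝ) : Prop where
  hf : ∀ x, HasDerivAt f (f1 x) x
  hf1 : ∀ x, HasDerivAt f1 (f2 x) x
  per : ∀ x, f (x + 1) = f x
  per1 : ∀ x, f1 (x + 1) = f1 x
  per2 : ∀ x, f2 (x + 1) = f2 x
  κ_pos : 0 < κ
  κ_le : κ ≤ 1 / 1000
  am : a + κ ≤ m
  ma : m + κ ≤ a + 1
  up : ∀ x ∈ Set.Icc a m, 0 ≤ f1 x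
  down : ∀ x ∈ Set.Icc m (a + 1), f1 x ≤ 0
  cva : ∀ x, |x - a| ≤ κ → 2 * κ ≤ f2 x
  cvm : ∀ x, |x - m| ≤ κ → f2 x ≤ -(2 * κ)
  slope : ∀ d, 0 < d → d ≤ 1 → ∀ x, f a + d ≤ f x → f x ≤ f m - d → κ * d ≤ |f1 x|

namespace Uni

variable {f f1 f2 : ℝ → ℝ} {κ a m : ℝ}

lemma flip (h : Uni f f1 f2 κ a m) :
    Uni (fun x => -f x) (fun x => -f1 x) (fun x => -f2 x) κ m (a + 1) where
  hf x := (h.hf x).neg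
  hf1 x := (h.hf1 x).neg
  per x := by rw [h.per]
  per1 x := by rw [h.per1]
  per2 x := by rw [h.per2]
  κ_pos := h.κ_pos
  κ_le := h.κ_le
  am := h.ma
  ma := by linarith [h.am]
  up x hx := by linarith [h.down x hx]
  down x hx := by
    have := h.up (x - 1) ⟨by linarith [hx.1], by linarith [hx.2]⟩
    rw [← h.per1, sub_add_cancel] at this
    linarith
  cva x hx := by linarith [h.cvm x hx]
  cvm x hx := by
    have := h.cva (x - 1) (by convert hx using 2; ring)
    rw [← h.per2, sub_add_cancel] at this
    linarith
  slope d hd hd1 x h1 h2 := by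
    rw [abs_neg]
    rw [h.per] at h2
    exact h.slope d hd hd1 x (by linarith) (by linarith)

lemma mono (h : Uni f f1 f2 κ a m) {p q : ℝ} (hp : a ≤ p) (hpq : p ≤ q) (hq : q ≤ m) :
    f p ≤ f q := by
  have := slope_ge (m := 0) hpq (fun x _ => h.hf x)
    (fun x hx => h.up x ⟨hp.trans hx.1, hx.2.trans hq⟩)
  linarith

lemma anti (h : Uni f f1 f2 κ a m) {p q : ℝ} (hp : m ≤ p) (hpq : p ≤ q) (hq : q ≤ a + 1) :
    f q ≤ f p := by
  have := h.flip.mono hp hpq hq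
  linarith

/-- Every point is equivalent to one in the fundamental domain. -/
lemma rep (a x : ℝ) : ∃ n : ℤ, a ≤ x - n ∧ x - n ≤ a + 1 :=
  ⟨⌊x - a⌋, by linarith [Int.floor_le (x - a)], by linarith [Int.lt_floor_add_one (x - a)]⟩

lemma crit (h : Uni f f1 f2 κ a m) : f1 a = 0 := by
  have h1 := h.up a ⟨le_rfl, by linarith [h.am, h.κ_pos]⟩
  have h2 := h.down (a + 1) ⟨by linarith [h.ma, h.κ_pos], le_rfl⟩
  rw [h.per1] at h2
  exact le_antisymm h2 h1

lemma quad (h : Uni f f1 f2 κ a m) {x : ℝ} (hx : |x - a| ≤ κ) : f a + κ * (x - a) ^ 2 ≤ f x := by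
  have := quad_ge (f := f) (f' := f1) (f2 := fun x => f2 x / 2) (z := a) (R := κ) (m := κ)
    (p := a) (q := x) (fun x _ => h.hf x)
    (fun x _ => (h.hf1 x).congr_deriv (by ring)) (fun x hx => by linarith [h.cva x hx])
    (by simpa using h.κ_pos.le) hx
  simpa [h.crit] using this

/-- Away from the minimum the values are separated from the minimal one. -/
lemma gap (h : Uni f f1 f2 κ a m) (x : ℝ) : ∃ n : ℤ, |x - n - a| ≤ κ ∨ f a + κ ^ 3 ≤ f x := by
  obtain ⟨n, h1, h2⟩ := rep a x
  have hκ := h.κ_pos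
  have hq1 := h.quad (x := a + κ) (by simp [abs_of_pos hκ])
  have hq2 := h.quad (x := a - κ) (by simp [abs_of_pos hκ])
  have e : f x = f (x - n) := by rw [← Ctx.per_int h.per (x - n) n, sub_add_cancel]
  rcases le_total (x - n) (a + κ) with h3 | h3
  · exact ⟨n, Or.inl (abs_le.2 ⟨by linarith, by linarith⟩)⟩
  rcases le_total (a + 1 - κ) (x - n) with h4 | h4
  · exact ⟨n + 1, Or.inl (by push_cast; exact abs_le.2 ⟨by linarith, by linarith⟩)⟩
  refine ⟨n, Or.inr ?_⟩
  rw [e]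
  rcases le_total (x - n) m with h5 | h5
  · have := h.mono (by linarith) h3 h5
    nlinarith
  · have := h.anti h5 h4 (by linarith)
    rw [show a + 1 - κ = (a - κ) + 1 by ring, h.per] at this
    nlinarith

/-- Slope lower bound near the minimum. -/
lemma near_slope (hf : ∀ x, HasDerivAt f (f1 x) x) (hf1 : ∀ x, HasDerivAt f1 (f2 x) x)
    (hκ : 0 ≤ κ) (hκ1 : κ ≤ 1) (hcv : ∀ x, |x - a| ≤ κ → 0 ≤ f2 x) {d x : ℝ} (hd : 0 < d)
    (hx : |x - a| ≤ κ) (hdx : f a + d ≤ f x) : d ≤ |f1 x| := by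
  have key : ∀ σ : ℝ, |σ| = 1 → 0 ≤ σ * (x - a) → d ≤ |f1 x| := fun σ hσ h0 => by
    have := convex_slope (f := f) (f' := f1) (f2 := fun x => f2 x / 2) (z := a) (R := κ) (d := d)
      (fun x _ => hf x) (fun x _ => (hf1 x).congr_deriv (by ring))
      (fun x hx => by linarith [hcv x hx]) hκ hκ1 hd hσ hx h0 (by linarith)
    refine this.trans ((le_abs_self _).trans ?_)
    rw [abs_mul, hσ, one_mul]
  rcases le_total 0 (x - a) with h0 | h0
  · exact key 1 (by simp) (by linarith)
  · exact key (-1) (by simp) (by linarith)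

/-- Construction from qualitative information. -/
lemma of_sign (hf : ∀ x, HasDerivAt f (f1 x) x) (hf1 : ∀ x, HasDerivAt f1 (f2 x) x)
    (hc : Continuous f2) (per : ∀ x, f (x + 1) = f x) (per1 : ∀ x, f1 (x + 1) = f1 x)
    (per2 : ∀ x, f2 (x + 1) = f2 x) (am : a < m) (ma : m < a + 1)
    (up : ∀ x ∈ Set.Ioo a m, 0 < f1 x) (down : ∀ x ∈ Set.Ioo m (a + 1), f1 x < 0)
    (ha : f2 a ≠ 0) (hm : f2 m ≠ 0) (ca : f1 a = 0) (cm : f1 m = 0) :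
    ∃ κ, Uni f f1 f2 κ a m := by
  have hc1 : Continuous f1 := continuous_iff_continuousAt.2 fun x => (hf1 x).continuousAt
  have near : ∀ (g : ℝ → ℝ), Continuous g → ∀ z, 0 < g z →
      ∃ ε > 0, ∀ x, |x - z| ≤ ε → g z / 2 ≤ g x := by
    intro g hg z hz
    obtain ⟨ε, h1, h2⟩ := Metric.continuous_iff.1 hg z (g z / 2) (by linarith)
    refine ⟨ε / 2, by linarith, fun x hx => ?_⟩
    have := h2 x (by rw [Real.dist_eq]; linarith)
    rw [Real.dist_eq] at this
    linarith [(abs_lt.1 this).1]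
  have pos_a : 0 < f2 a := by
    by_contra hcon
    have h0 : 0 < -f2 a := by
      rcases lt_or_eq_of_le (not_lt.1 hcon) with h | h
      · linarith
      · exact absurd h ha
    obtain ⟨ε, h1, h2⟩ := near (fun x => -f2 x) hc.neg a h0
    set q := min (a + ε) ((a + m) / 2) with hq
    have q1 : q ≤ a + ε := min_le_left _ _
    have q2 : q ≤ (a + m) / 2 := min_le_right _ _
    have q3 : a < q := lt_min (by linarith) (by linarith)
    have := slope_ge (f := fun x => -f1 x) (m := 0) q3.le (fun x _ => (hf1 x).neg)
      (fun x hx => by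
        have := h2 x (abs_le.2 ⟨by linarith [hx.1], by linarith [hx.2]⟩)
        linarith)
    have h3 := up q ⟨q3, by linarith⟩
    linarith
  have neg_m : f2 m < 0 := by
    by_contra hcon
    have h0 : 0 < f2 m := lt_of_le_of_ne (not_lt.1 hcon) (Ne.symm hm)
    obtain ⟨ε, h1, h2⟩ := near f2 hc m h0
    set q := min (m + ε) ((a + 1 + m) / 2) with hq
    have q1 : q ≤ m + ε := min_le_left _ _
    have q2 : q ≤ (a + 1 + m) / 2 := min_le_right _ _
    have q3 : m < q := lt_min (by linarith) (by linarith)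
    have := slope_ge (f := f1) (m := 0) q3.le (fun x _ => hf1 x)
      (fun x hx => by
        have := h2 x (abs_le.2 ⟨by linarith [hx.1], by linarith [hx.2]⟩)
        linarith)
    have h3 := down q ⟨q3, by linarith⟩
    linarith
  obtain ⟨ε1, e1, h1⟩ := near f2 hc a pos_a
  obtain ⟨ε2, e2, h2⟩ := near (fun x => -f2 x) hc.neg m (by linarith)
  set ε := min (min ε1 ε2) (1 / 1000) with hε
  have ε0 : 0 < ε := by positivity
  have εε1 : ε ≤ ε1 := (min_le_left _ _).trans (min_le_left _ _)
  have εε2 : ε ≤ ε2 := (min_le_left _ _).trans (min_le_right _ _)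
  have ε3 : ε ≤ 1 / 1000 := min_le_right _ _
  set Kc : Set ℝ := Set.Icc a (a + 1) ∩ {x | ε ≤ |x - a| ∧ ε ≤ |x - m| ∧ ε ≤ |x - (a + 1)|}
  have hcomp : IsCompact Kc := by
    refine isCompact_Icc.inter_right ?_
    have hcl : ∀ t : ℝ, IsClosed {x : ℝ | ε ≤ |x - t|} := fun t =>
      isClosed_le continuous_const (by fun_prop)
    exact (hcl a).inter ((hcl m).inter (hcl (a + 1)))
  have hne : ∀ x ∈ Kc, 0 < |f1 x| := by
    rintro x ⟨hx, h3, h4, h5⟩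
    have h6 : x ≠ a := by rintro rfl; simp at h3; linarith
    have h7 : x ≠ m := by rintro rfl; simp at h4; linarith
    have h8 : x ≠ a + 1 := by rintro rfl; simp at h5; linarith
    rw [abs_pos]
    rcases lt_or_gt_of_ne h7 with h | h
    · exact (up x ⟨lt_of_le_of_ne hx.1 (Ne.symm h6), h⟩).ne'
    · exact (down x ⟨h, lt_of_le_of_ne hx.2 h8⟩).ne
  obtain ⟨c0, hc0, hlow⟩ : ∃ c0 > 0, ∀ x ∈ Kc, c0 ≤ |f1 x| := by
    rcases Kc.eq_empty_or_nonempty with h | h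
    · exact ⟨1, one_pos, by simp [h]⟩
    · obtain ⟨x, hx, hmin⟩ := hcomp.exists_isMinOn h hc1.abs.continuousOn
      exact ⟨_, hne x hx, fun y hy => hmin hy⟩
  set κ := min (min ε c0) (min (min (f2 a / 4) (-f2 m / 4)) (min (m - a) (a + 1 - m))) with hκ
  have k1 : κ ≤ ε := (min_le_left _ _).trans (min_le_left _ _)
  have k2 : κ ≤ c0 := (min_le_left _ _).trans (min_le_right _ _)
  have k3 : κ ≤ f2 a / 4 := (min_le_right _ _).trans ((min_le_left _ _).trans (min_le_left _ _))
  have k4 : κ ≤ -f2 m / 4 := (min_le_right _ _).trans ((min_le_left _ _).trans (min_le_right _ _))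
  have k5 : κ ≤ m - a := (min_le_right _ _).trans ((min_le_right _ _).trans (min_le_left _ _))
  have k6 : κ ≤ a + 1 - m := (min_le_right _ _).trans ((min_le_right _ _).trans (min_le_right _ _))
  have k0 : 0 < κ := lt_min (lt_min ε0 hc0)
    (lt_min (lt_min (by linarith) (by linarith)) (lt_min (by linarith) (by linarith)))
  refine ⟨κ, hf, hf1, per, per1, per2, k0, k1.trans ε3, by linarith, by linarith, ?_, ?_, ?_, ?_, ?_⟩
  · rintro x ⟨h3, h4⟩
    rcases eq_or_lt_of_le h3 with rfl | h3
    · exact ca.ge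
    rcases eq_or_lt_of_le h4 with rfl | h4
    · exact cm.ge
    · exact (up x ⟨h3, h4⟩).le
  · rintro x ⟨h3, h4⟩
    rcases eq_or_lt_of_le h3 with rfl | h3
    · exact cm.le
    rcases eq_or_lt_of_le h4 with rfl | h4
    · rw [per1, ca]
    · exact (down x ⟨h3, h4⟩).le
  · intro x hx
    linarith [h1 x (by linarith)]
  · intro x hx
    have := h2 x (by linarith)
    linarith
  · intro d hd hd1 x h3 h4
    obtain ⟨n, h5, h6⟩ := rep a x
    rw [← sub_add_cancel x (n : ℝ), Ctx.per_int per] at h3 h4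
    rw [← sub_add_cancel x (n : ℝ), Ctx.per_int per1]
    set y := x - n
    have hκd : κ * d ≤ d := by nlinarith
    by_cases hya : |y - a| ≤ ε
    · exact hκd.trans (near_slope hf hf1 ε0.le (by linarith)
        (fun x hx => by linarith [h1 x (by linarith)]) hd hya h3)
    by_cases hym : |y - m| ≤ ε
    · have := near_slope (f := fun x => -f x) (f1 := fun x => -f1 x) (f2 := fun x => -f2 x)
        (fun x => (hf x).neg) (fun x => (hf1 x).neg) ε0.le (by linarith)
        (fun x hx => by have := h2 x (by linarith); linarith) hd hym
        (by linarith)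
      rw [abs_neg] at this
      exact hκd.trans this
    by_cases hya' : |y - (a + 1)| ≤ ε
    · refine hκd.trans (near_slope (a := a + 1) hf hf1 ε0.le (by linarith)
        (fun x hx => ?_) hd hya' (by rwa [per]))
      rw [← sub_add_cancel x 1, per2]
      have := h1 (x - 1) (by rw [show x - 1 - a = x - (a + 1) by ring]; linarith)
      linarith
    push Not at hya hym hya'
    have := hlow y ⟨⟨h5, h6⟩, hya.le, hym.le, hya'.le⟩
    nlinarith

end Uni

/-- A function satisfying condition (V) is quantitatively unimodal. -/
lemma ConditionV.uni {v : ℝ → ℝ} (hper : Function.Periodic v 1) (hV : ConditionV v) :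
    ∃ κ a m, 0 ≤ a ∧ a < 1 ∧ Uni v (deriv v) (iteratedDeriv 2 v) κ a m := by
  obtain ⟨hC, z1, z2, hz1, hz2, hne, hcrit, hmin, hmax, hd1, hd2⟩ := hV
  have e2 : iteratedDeriv 2 v = deriv (deriv v) := by
    rw [iteratedDeriv_succ, iteratedDeriv_one]
  have hf : ∀ x, HasDerivAt v (deriv v x) x := fun x =>
    (hC.differentiable (by norm_num) x).hasDerivAt
  have hC1 : ContDiff ℝ 1 (deriv v) :=
    (contDiff_succ_iff_deriv.1 (show ContDiff ℝ (1 + 1) v by norm_num; exact hC)).2.2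
  have hf1 : ∀ x, HasDerivAt (deriv v) (iteratedDeriv 2 v x) x := fun x => by
    rw [e2]; exact (hC1.differentiable (by norm_num) x).hasDerivAt
  have hc : Continuous (iteratedDeriv 2 v) := by
    rw [e2]
    exact hC1.continuous_deriv le_rfl
  have hc1 : Continuous (deriv v) := hC1.continuous
  have perd : ∀ g : ℝ → ℝ, (∀ x, g (x + 1) = g x) → ∀ x, deriv g (x + 1) = deriv g x := by
    intro g hg x
    rw [← deriv_comp_add_const]
    simp only [hg]
  have per1 := perd v hper
  have per2 : ∀ x, iteratedDeriv 2 v (x + 1) = iteratedDeriv 2 v x := by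
    rw [e2]; exact perd _ per1
  have c1 : deriv v z1 = 0 := (hcrit z1 hz1).2 (Or.inl rfl)
  have c2 : deriv v z2 = 0 := (hcrit z2 hz2).2 (Or.inr rfl)
  have sign : ∀ p q : ℝ, p < q → v p ≤ v q → (∀ x ∈ Set.Ioo p q, deriv v x ≠ 0) →
      ∀ x ∈ Set.Ioo p q, 0 < deriv v x := by
    intro p q hpq hle hnz x hx
    obtain ⟨y, hy, hslope⟩ := exists_deriv_eq_slope v hpq hC.continuous.continuousOn
      (hC.differentiable (by norm_num)).differentiableOn
    have hy0 : 0 ≤ deriv v y := by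
      rw [hslope]; exact div_nonneg (by linarith) (by linarith)
    by_contra hcon
    obtain ⟨w, hw, hw0⟩ := isPreconnected_Ioo.intermediate_value hx hy hc1.continuousOn
      (show (0 : ℝ) ∈ Set.Icc _ _ from ⟨not_lt.1 hcon, hy0⟩)
    exact hnz w hw hw0
  have sign' : ∀ p q : ℝ, p < q → v q ≤ v p → (∀ x ∈ Set.Ioo p q, deriv v x ≠ 0) →
      ∀ x ∈ Set.Ioo p q, deriv v x < 0 := by
    intro p q hpq hle hnz x hx
    obtain ⟨y, hy, hslope⟩ := exists_deriv_eq_slope v hpq hC.continuous.continuousOn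
      (hC.differentiable (by norm_num)).differentiableOn
    have hy0 : deriv v y ≤ 0 := by
      rw [hslope]; exact div_nonpos_of_nonpos_of_nonneg (by linarith) (by linarith)
    by_contra hcon
    obtain ⟨w, hw, hw0⟩ := isPreconnected_Ioo.intermediate_value hy hx hc1.continuousOn
      (show (0 : ℝ) ∈ Set.Icc _ _ from ⟨hy0, not_lt.1 hcon⟩)
    exact hnz w hw hw0
  have nz : ∀ x, 0 ≤ x → x < 1 → x ≠ z1 → x ≠ z2 → deriv v x ≠ 0 := fun x h0 h1 h2 h3 h4 =>
    ((hcrit x ⟨h0, h1⟩).1 h4).elim h2 h3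
  have nz' : ∀ x, 1 ≤ x → x < 2 → x ≠ z1 + 1 → x ≠ z2 + 1 → deriv v x ≠ 0 := by
    intro x h0 h1 h2 h3
    rw [← sub_add_cancel x 1, per1]
    exact nz _ (by linarith) (by linarith) (fun h => h2 (by linarith)) (fun h => h3 (by linarith))
  obtain ⟨h10, h11⟩ := hz1
  obtain ⟨h20, h21⟩ := hz2
  have nzz : ∀ x, 0 ≤ x → x < 2 → x ≠ z1 → x ≠ z2 → x ≠ z1 + 1 → x ≠ z2 + 1 →
      deriv v x ≠ 0 := by
    intro x h0 h1 h2 h3 h4 h5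
    rcases lt_or_ge x 1 with h | h
    · exact nz x h0 h h2 h3
    · exact nz' x h h1 h4 h5
  obtain ⟨m, hm1, hm2, hm3, hm4, hm5, hm6⟩ : ∃ m, z1 < m ∧ m < z1 + 1 ∧ v m = v z2 ∧
      deriv v m = 0 ∧ iteratedDeriv 2 v m ≠ 0 ∧ (m = z2 ∨ m = z2 + 1) := by
    rcases lt_or_gt_of_ne hne with h | h
    · exact ⟨z2, h, by linarith, rfl, c2, hd2, Or.inl rfl⟩
    · exact ⟨z2 + 1, by linarith, by linarith, hper z2, by rw [per1, c2], by rwa [per2],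
        Or.inr rfl⟩
  have hnz : ∀ x ∈ Set.Ioo z1 (z1 + 1), x ≠ m → deriv v x ≠ 0 := by
    intro x hx hxm
    refine nzz x (by linarith [hx.1]) (by linarith [hx.2]) hx.1.ne' ?_ hx.2.ne ?_
    · rintro rfl
      rcases hm6 with h | h
      · exact hxm h.symm
      · linarith [hx.1]
    · rintro rfl
      rcases hm6 with h | h
      · linarith [hx.2]
      · exact hxm h.symm
  obtain ⟨κ, hκ⟩ := Uni.of_sign (f := v) hf hf1 hc hper per1 per2 hm1 hm2
    (sign _ _ hm1 (hmin m) fun x hx => hnz x ⟨hx.1, hx.2.trans hm2⟩ hx.2.ne)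
    (sign' _ _ hm2 (by rw [hm3]; exact hmax _) fun x hx => hnz x ⟨hm1.trans hx.1, hx.2⟩ hx.1.ne')
    hd1 hm5 c1 hm4
  exact ⟨κ, z1, m, h10, h11, hκ⟩

namespace Ctx

variable (c : Ctx)

/-- The critical set of the initial core is the whole circle. -/
lemma mem_unit_ball (x : ℝ) : ∃ m : ℤ, |x - m - 0| ≤ 1 :=
  ⟨⌊x⌋, abs_le.2 ⟨by linarith [Int.floor_le x], by linarith [Int.lt_floor_add_one x]⟩⟩

lemma adm_univ {S Eo : Set ℝ} {x : ℝ} {n : ℕ}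
    (h : c.Adm S Eo {y | ∃ _ : Bool, ∃ m : ℤ, |y - m - 0| ≤ 1} 0 x n) : n = 0 := by
  by_contra hn
  exact h.2.2 0 (by simp) (by exact_mod_cast Nat.pos_of_ne_zero hn) ⟨true, mem_unit_ball _⟩

lemma nrm_scaled_aJ {σ K : ℝ} (hσ : |σ| = 1)
    (hK : ∀ x E, |E| ≤ c.Emax → |E - c.v x| + |c.v1 x| + |c.v2 x / 2| + 1 ≤ K) {x E : ℝ}
    (hE : |E| ≤ c.Emax) : nrm (cst (σ / c.lam) * c.aJ x E) ≤ K := by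
  have hl := c.hlam
  refine le_trans (le_of_eq ?_) (hK x E hE)
  have hl0 := hl.ne'
  have h1 : ∀ t : ℝ, |σ / c.lam * (c.lam * t)| = |t| := fun t => by
    rw [show σ / c.lam * (c.lam * t) = σ * t by field_simp, abs_mul, hσ, one_mul]
  have h2 : |σ / c.lam * c.lam| = 1 := by rw [div_mul_cancel₀ _ hl0, hσ]
  rw [cst_mul]
  simp only [nrm, aJ, mul_neg, abs_neg]
  rw [h1, h1, h2, mul_div_assoc, h1]

/-- The initial core: every point is critical and the coupling function is `±(E - v)`. -/
def base (σ K : ℝ) (hσ : |σ| = 1)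
    (hK : ∀ x E, |E| ≤ c.Emax → |E - c.v x| + |c.v1 x| + |c.v2 x / 2| + 1 ≤ K) (hK0 : 0 < K) :
    Core c where
  W := {E | |E| ≤ c.Emax}
  S := Set.univ
  Eo := Set.univ
  ctr _ := 0
  r := 1
  rD := 4
  k := 0
  h := 0
  Ret := 0
  H := 1
  ρ := (c.b ^ 7)⁻¹
  B := 0
  K := K
  νb := 1 / c.lam
  νlow := 1 / c.lam
  Q := 1
  e := 0
  ν _ _ _ := cst (σ / c.lam)
  G _ y E := cst (σ / c.lam) * c.aJ y E
  w _ _ _ := σ / c.lam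
  hW _ h := h
  S_int _ _ := by simp
  Eo_int _ _ := by simp
  r_le := by norm_num
  ρ_pos := by have := c.hb; positivity
  ρ_le := inv_le_one_of_one_le₀ (one_le_pow₀ c.hb.le)
  B_nonneg := le_rfl
  B_le := by norm_num
  K_pos := hK0
  Q_pos := one_pos
  νlow_pos := one_div_pos.2 c.hlam
  νb_pos := one_div_pos.2 c.hlam
  e_nonneg := le_rfl
  good E _ x n h := by
    obtain rfl := c.adm_univ h
    have e : (1 : Jet)⁻¹ = 1 := (eq_inv_of_mul_eq_one (one_mul 1)).symm
    refine ⟨?_, ?_, ?_, ?_⟩ <;> simp [Mj, U, Be, Ga, e]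
  nearE := by simp
  nearS := by simp
  ret j j' t m h0 h1 := by
    exfalso
    simp at h1
    exact h0 h1
  hk_le := le_rfl
  cover x0 := ⟨0, one_pos, by simp⟩
  approx j y m hy E hE l hl r' hr' h1 h2 := by
    obtain rfl := c.adm_univ h1
    obtain rfl := c.adm_univ h2
    have e : c.aJ (y - m) E = c.aJ y E := by
      obtain ⟨x, rfl⟩ : ∃ x, y = x + m := ⟨y - m, by ring⟩
      simp [aJ, per_int c.per, per_int c.per1, per_int c.per2]
    simp [gf, beR, gaL, blk, Mj, Be, Ga, TJ, e]
  approxw j y m hy E hE l hl h1 := by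
    obtain rfl := c.adm_univ h1
    simp [w2, gaL, blk, Mj, Ga, TJ, cst]
  isG j y _ E _ := (c.isAt_aJ y E).cst_mul _
  isν j y _ E _ := IsAt.const _ rfl rfl rfl
  ν_le j y _ E _ := by simp [nrm, cst, abs_div, hσ, abs_of_pos c.hlam]
  ν_ge j y _ E _ := by simp [cst, abs_div, hσ, abs_of_pos c.hlam]
  G_le j y _ E hE := c.nrm_scaled_aJ hσ hK hE
  Q01 y E _ := by simp [blk, Mj_one, TJ]
  Q10 y E _ := by simp [blk, Mj_one, TJ]
  Q11 y E _ := by simp [blk, Mj_one, TJ]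
  C11_le j y _ E _ := by
    have e : c.blk y E 0 1 1 = 0 := by simp [blk, Mj_one, TJ]
    rw [e, zero_v0, abs_zero]
    exact mul_nonneg hK0.le (abs_nonneg _)

end Ctx

namespace Ctx
open Core

variable {c : Ctx} {σ K : ℝ} {hσ : |σ| = 1}
  {hK : ∀ x E, |E| ≤ c.Emax → |E - c.v x| + |c.v1 x| + |c.v2 x / 2| + 1 ≤ K} {hK0 : 0 < K} {P : ℕ}

/-- The coupling is a large power of the bounds on the potential. -/
structure Strong (c : Ctx) (K : ℝ) : Prop where
  hb : 2 ≤ c.b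
  one_le : 1 ≤ K
  lam_eq : K * c.lam = c.b ^ 10
  large : 10 ^ 6 * K ^ 4 ≤ c.p (1 / 40000)

lemma Strong.inv_lam (h : c.Strong K) : 1 / c.lam = K * c.p (-10) := by
  have h1 := c.hlam.ne'
  have h2 := h.one_le
  have e : c.b ^ 10 = c.p 10 := by rw [p_nat]; norm_num
  rw [p_neg, ← e, ← h.lam_eq]
  field_simp

lemma Strong.small (h : c.Strong K) {r x y : ℝ} (hr : r ≤ 10 ^ 6 * K ^ 4)
    (hxy : 1 / 40000 + x ≤ y) : r * c.p x ≤ c.p y := by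
  calc r * c.p x ≤ c.p (1 / 40000) * c.p x := by
        have := p_pos (c := c) x
        gcongr
        exact hr.trans h.large
    _ = c.p (1 / 40000 + x) := (p_add _ _).symm
    _ ≤ c.p y := p_le hxy

lemma Strong.K_pow (h : c.Strong K) {n : ℕ} (hn : n ≤ 4) {r : ℝ} (hr : r ≤ 10 ^ 6) :
    r * K ^ n ≤ 10 ^ 6 * K ^ 4 := by
  have h0 : 0 < K := by linarith [h.one_le]
  have := pow_le_pow_right₀ h.one_le hn
  have h1 : 0 < K ^ n := by positivity
  nlinarith

lemma exponent_bounds (hP : 1000 ≤ P) : 0 < 1 / (P : ℝ) ∧ 1 / (P : ℝ) ≤ 1 / 1000 := by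
  have hx : (1000 : ℝ) ≤ P := by exact_mod_cast hP
  exact ⟨by positivity, one_div_le_one_div_of_le (by norm_num) hx⟩

/-- Refinement data of the initial core. -/
lemma Strong.stepData (h : c.Strong K) (hP : 1000 ≤ P) {δ : ℝ} (hδ : c.p (-(1 / 10)) ≤ δ)
    (hδ1 : δ ≤ 1) :
    (c.base σ K hσ hK hK0).StepData δ (c.p (-18)) (P ^ 7) (c.p (-(6 + 1 / P))) (2 - 1 / P)
      (c.p (-9)) := by
  obtain ⟨hP1, hP2⟩ := exponent_bounds hP
  have hδ0 : 0 < δ := (p_pos _).trans_le hδ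
  have hl := h.inv_lam
  have hb7 : (c.b ^ 7)⁻¹ = c.p (-7) := by rw [p_nat, ← p_neg]; norm_num
  have hg : 96 * (1 / c.lam) * K ^ 2 / δ ^ 3 ≤ c.p (-19 / 2) := by
    have h3 : c.p (-(3 / 10)) ≤ δ ^ 3 := by
      calc c.p (-(3 / 10)) = c.p (-(1 / 10)) ^ 3 := by rw [p_pow]; congr 1; norm_num
        _ ≤ δ ^ 3 := by
          have := p_pos (c := c) (-(1 / 10))
          gcongr
    rw [hl, div_le_iff₀ (by positivity)]
    calc 96 * (K * c.p (-10)) * K ^ 2 = 96 * K ^ 3 * c.p (-10) := by ring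
      _ ≤ c.p (-(98 / 10)) := h.small (h.K_pow (by norm_num) (by norm_num)) (by norm_num)
      _ = c.p (-19 / 2) * c.p (-(3 / 10)) := by rw [← p_add]; norm_num
      _ ≤ _ := by
        have := p_pos (c := c) (-19 / 2)
        gcongr
  have h9 : c.p (-9) ≤ 1 := (p_le (by norm_num)).trans_eq p_zero
  have h6 : 6 * (1 / c.lam) * c.p (-9) ≤ c.p (-18) := by
    rw [hl]
    calc 6 * (K * c.p (-10)) * c.p (-9) = 6 * K ^ 1 * (c.p (-10) * c.p (-9)) := by ring
      _ = 6 * K ^ 1 * c.p (-19) := by rw [← p_add]; norm_num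
      _ ≤ _ := h.small (h.K_pow (by norm_num) (by norm_num)) (by norm_num)
  have hρ : c.p (-7) ≤ c.p (-(6 + 1 / P)) := p_le (by linarith)
  refine ⟨⟨hδ0, hδ1.trans h.one_le, ?_, ?_, ?_, ?_, by linarith, ?_⟩, ?_, ?_, h.hb, ?_, ?_⟩
  · simp only [base, mul_zero, pow_zero, mul_one]
    have h0 : c.p (-19 / 2) * 3 ≤ c.p (-9) := by
      have := h.small (r := 3) (x := -19 / 2) (y := -9)
        (by simpa using h.K_pow (n := 0) (r := 3) (by norm_num) (by norm_num)) (by norm_num)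
      linarith
    linarith
  · simp only [base, mul_one, zero_add]
    have : 4 * c.p (-18) ≤ c.p (-(1 / 10)) := num_mul_le h.hb 2 (by norm_num) (by norm_num)
    linarith
  · intro l _
    simp only [base, add_zero, hb7]
    rw [pow_succ]
    have h0 := p_pos (c := c) (-7)
    have h1 : c.p (-19 / 2) ≤ c.p (-(6 + 1 / P)) := p_le (by linarith)
    have h2 := hg.trans h1
    exact mul_le_mul (pow_le_pow_left₀ h0.le hρ l) h2
      (by have := c.hlam; have := h.one_le; positivity) (pow_nonneg (p_pos _).le l)
  · simp only [base]
    linarith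
  · simp only [base, hb7]
    exact hρ
  · simp only [base, mul_one, zero_add]
    exact h6
  · simp only [H1, base]
    have : P ≤ P ^ 7 := Nat.le_self_pow (by norm_num) P
    omega
  · rw [p_nat, ← p_add]
    refine (p_le ?_).trans_eq p_zero
    push_cast
    linarith
  · exact fun x0 => ⟨0, by simp [H1], fun x _ =>
      ⟨⟨trivial, fun t h1 h2 => by simp only [base] at h1 h2; omega⟩,
        ⟨trivial, fun t h1 h2 => by simp only [base] at h1 h2; omega⟩⟩⟩

variable {E1 : ℝ}

lemma Strong.num (h : c.Strong K) {n : ℕ} (hn : n ≤ 4) {r x y : ℝ} (hr : r ≤ 10 ^ 6)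
    (hxy : 1 / 40000 + x ≤ y) : r * K ^ n * c.p x ≤ c.p y :=
  h.small (h.K_pow hn hr) hxy

lemma Strong.K_one (h : c.Strong K) {r x : ℝ} (hr : r ≤ 10 ^ 6) (hx : 1 / 40000 + x ≤ 0) :
    r * K * c.p x ≤ 1 := by
  simpa using (h.num (n := 1) (by norm_num) hr hx).trans_eq p_zero

lemma Strong.le_wl (h : c.Strong K) {x : ℝ} (hx : x ≤ -11) : c.p x ≤ 1 / c.lam / 2 := by
  rw [h.inv_lam]
  have h1 : 2 * c.p x ≤ c.p (-10) := num_mul_le h.hb 1 (by norm_num) (by push_cast; linarith)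
  have h2 := p_pos (c := c) (-10)
  nlinarith [h.one_le]

lemma Strong.νb_le (h : c.Strong K) : 1 / c.lam ≤ c.p (-9) := by
  rw [h.inv_lam]
  have := h.num (n := 1) (r := 1) (x := -10) (y := -9) (by norm_num) (by norm_num) (by norm_num)
  linarith

lemma Strong.K_le (h : c.Strong K) {r x : ℝ} (hr : r ≤ 10 ^ 6) (hx : 1 ≤ x) : r * K ≤ c.p x := by
  have := h.num (n := 1) (r := r) (x := 0) (y := x) (by norm_num) hr (by linarith)
  rwa [pow_one, p_zero, mul_one] at this

lemma base_ret (hP : 1000 ≤ P) : P ^ 7 + (c.base σ K hσ hK hK0).H1 + (c.base σ K hσ hK hK0).k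
    ≤ P ^ 8 := by
  have h1 : P ^ 7 * 1000 ≤ P ^ 8 := by
    calc P ^ 7 * 1000 ≤ P ^ 7 * P := by gcongr
      _ = P ^ 8 := by ring
  have h2 : P ≤ P ^ 7 := Nat.le_self_pow (by norm_num) _
  simp only [H1, base]
  omega

lemma Strong.sized (h : c.Strong K) (hP : 1000 ≤ P) {C : Core c}
    (hC : C.Params 0 (P ^ 7) (P ^ 8) (c.base σ K hσ hK hK0).H1 (c.p (-(6 + 1 / P))) (2 - 1 / P)
      (2 * K) (1 / c.lam) (1 / c.lam)) : C.Sized P := by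
  have hx : (1000 : ℝ) ≤ P := by exact_mod_cast hP
  refine hC.sized h.hb hP (by omega) (by simp only [H1, base]; omega) (by linarith [h.one_le])
    (h.K_le (by norm_num) (by linarith))
    (h.νb_le.trans ((p_le (by norm_num)).trans_eq p_zero)) ?_
  rw [h.inv_lam]
  have h1 := p_pos (c := c) (-10)
  have h2 : c.p (-(100 * P)) ≤ c.p (-10) := p_le (by linarith)
  nlinarith [h.one_le]

/-- The first core near an extremum of the potential. -/
lemma Strong.keepII (h : c.Strong K) (hP : 1000 ≤ P) {κ s z : ℝ} {j0 : Bool} (hκ : 1 ≤ K * κ)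
    (hpre : (c.base σ K hσ hK hK0).PreII E1 κ (c.p (-(1 / 4000))) (1 / c.lam) s z j0)
    (hfar : ∀ t m : ℤ, t ≠ 0 → |t| ≤ (P ^ 8 : ℕ) → c.p (-(1 / 5000)) < |t * c.α - m|) :
    ∃ C : Core c, C.Staged P E1 := by
  have hx : (1000 : ℝ) ≤ P := by exact_mod_cast hP
  have hy3 : c.p (-(1 / 4000)) ^ 3 = c.p (-(3 / 4000)) := by rw [p_pow]; congr 1; norm_num
  have hy2 : c.p (-(1 / 4000)) ^ 2 = c.p (-(1 / 2000)) := by rw [p_pow]; congr 1; norm_num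
  have hD := h.stepData (hσ := hσ) (hK := hK) (hK0 := hK0) hP (δ := c.p (-(1 / 4000)) ^ 2)
    (by rw [hy2]; exact p_le (by norm_num))
    (by rw [hy2]; exact (p_le (by norm_num)).trans_eq p_zero)
  have hnon : 2 * (c.p (-(1 / 4000)) / κ ^ 3) ≤ c.p (-(1 / 5000)) := by
    have hκ0 := hpre.κ_pos
    have h3 : 1 / κ ^ 3 ≤ K ^ 3 := by
      rw [div_le_iff₀ (by positivity), ← mul_pow]
      exact one_le_pow₀ hκ
    have h4 := p_pos (c := c) (-(1 / 4000))
    calc 2 * (c.p (-(1 / 4000)) / κ ^ 3) = 2 * (1 / κ ^ 3) * c.p (-(1 / 4000)) := by ring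
      _ ≤ 2 * K ^ 3 * c.p (-(1 / 4000)) := by gcongr
      _ ≤ _ := h.num (by norm_num) (by norm_num) (by norm_num)
  obtain ⟨C, h1, h2⟩ := hpre.keep hD (by rw [hy3]; exact p_le (by norm_num))
    (h.le_wl (by norm_num)) (Ret := P ^ 8) (κ' := c.p (-(200 * P)))
    (fun t m h0 h1 => lt_of_le_of_lt hnon (hfar t m h0 h1)) (base_ret hP) (p_pos _)
    (by rw [hy3]; exact p_le (by linarith)) (h.le_wl (by linarith))
    (h.K_one (by norm_num) (by linarith))
  exact ⟨C, h.sized hP h1, Or.inr ⟨s, h2⟩⟩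

set_option maxHeartbeats 1000000 in
/-- The first core at transversal critical points. -/
lemma Strong.keepI (h : c.Strong K) (hP : 1000 ≤ P) {z : Bool → ℝ} {par : Bool → Bool}
    {sx sE : Bool → ℝ}
    (hpre : (c.base σ K hσ hK hK0).PreI E1 (c.p (-(1 / 1000))) (1 / c.lam) z par sx sE)
    (hfar : ∀ t m : ℤ, t ≠ 0 → |t| ≤ (P ^ 64 : ℕ) → c.p (-(1 / 5000)) < |t * c.α - m|) :
    ∃ P' ≥ P, ∃ C : Core c, C.Staged P' E1 := by
  have hx : (1000 : ℝ) ≤ P := by exact_mod_cast hP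
  have hξ : ∀ i : ℕ, c.p (-(1 / 1000)) ^ i = c.p (-(i / 1000)) := fun i => by
    rw [p_pow]; congr 1; ring
  have hD : ∀ P' ≥ P, (c.base σ K hσ hK hK0).StepData (c.p (-(1 / 1000)) ^ 100) (c.p (-18))
      (P' ^ 7) (c.p (-(6 + 1 / P'))) (2 - 1 / P') (c.p (-9)) := fun P' hP' =>
    h.stepData (hP.trans hP') (by rw [hξ]; exact p_le (by norm_num))
      (by rw [hξ]; exact (p_le (by norm_num)).trans_eq p_zero)
  have hε : c.p (-18) ≤ c.p (-(1 / 1000)) ^ 100 := by rw [hξ]; exact p_le (by norm_num)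
  by_cases hres : ∀ j j' (t m : ℤ), t ≠ 0 → |t| ≤ (P ^ 8 : ℕ) →
      c.p (-(1 / 1000)) ^ 95 < |z j + t * c.α - m - z j'|
  · obtain ⟨C, h1, h2⟩ := hpre.keep (hD P le_rfl) hε (h.le_wl (by norm_num)) hres (base_ret hP)
      (p_pos (-(200 * P))) (by rw [hξ]; exact p_le (by push_cast; linarith))
      (h.le_wl (by linarith)) (h.K_one (by norm_num) (by linarith))
    exact ⟨P, le_rfl, C, h.sized hP h1, Or.inl ⟨_, _, h2⟩⟩
  push Not at hres
  obtain ⟨j, j', t, m, ht, htN, hle⟩ := hres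
  have h8 : P ^ 8 ≤ P ^ 64 := Nat.pow_le_pow_right (by omega) (by norm_num)
  obtain ⟨a, n, m0, hn, hnN, hz⟩ := hpre.orient (N := P ^ 8)
    (by rw [hξ]; exact p_le (by norm_num)) (fun t m ht h => by
      refine lt_of_le_of_lt ?_ (hfar t m ht (h.trans (by exact_mod_cast h8)))
      rw [hξ]; exact p_le (by norm_num)) ht htN hle
  set P' := P ^ 8 with hP'
  have hPP : P ≤ P' := Nat.le_self_pow (by norm_num) _
  have hx' : (1000 : ℝ) ≤ P' := by exact_mod_cast hP.trans hPP
  have hnP : (n : ℝ) ≤ P' := by exact_mod_cast hnN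
  have hn1 : 1 ≤ n := by simp only [base] at hn; omega
  have hn1' : (1 : ℝ) ≤ n := by exact_mod_cast hn1
  have hncast : ((n - 0 - 1 : ℕ) : ℝ) = n - 1 := by
    rw [Nat.sub_zero, Nat.cast_sub hn1, Nat.cast_one]
  obtain ⟨hq1, hq2⟩ := exponent_bounds (hP.trans hPP)
  have hK1 := h.one_le
  have hpn : ∀ (e : ℝ) (n : ℕ), c.p e ^ n = c.p (n * e) := p_pow
  have hN0 : (c.p (-(6 + 1 / P')) ^ (n - 0 - 1)) ^ 2 * (1 / c.lam * (3 * 1)) ^ 2 ≤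
      9 * K ^ 2 * c.p (-12 * (n - 1) - 20) := by
    rw [h.inv_lam, p_pow, p_pow, hncast]
    have e : (K * c.p (-10) * (3 * 1)) ^ 2 = 9 * K ^ 2 * c.p (-20) := by
      have : c.p (-10) ^ 2 = c.p (-20) := by rw [p_pow]; norm_num
      rw [← this]; ring
    rw [e, mul_left_comm, ← p_add]
    refine mul_le_mul_of_nonneg_left (p_le ?_) (by positivity)
    push_cast
    nlinarith
  have e10 : (c.b ^ (10 * (n - 0 - 1)))⁻¹ = c.p (-10 * (n - 1)) := by
    rw [p_nat, ← p_neg]; congr 1; push_cast [hncast]; ring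
  have hc0 : 0 < K ^ 2 / 12 * c.p (-20 * (n - 1) - 20) := by
    have := p_pos (c := c) (-20 * (n - 1) - 20)
    positivity
  have m10 : c.p (-10) ^ 2 = c.p (-20) := by rw [p_pow]; norm_num
  have key : c.p (-10) ^ 2 * c.p (-10 * (n - 1)) ^ 2 = c.p (-20 * (n - 1) - 20) := by
    rw [p_pow, p_pow, ← p_add]
    congr 1; push_cast; ring
  have hx2 : c.p (-(1 / 1000)) ^ 2 = c.p (-(2 / 1000)) := by simpa using hξ 2
  have hc : K ^ 2 / 12 * c.p (-20 * (n - 1) - 20) * (4 * (1 / c.lam * (3 * 1))) ≤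
      (c.b ^ (10 * (n - 0 - 1)))⁻¹ ^ 2 * ((1 / c.lam) ^ 2 * (1 / c.lam)) := by
    rw [e10, h.inv_lam, ← key]
    exact le_of_eq (by ring)
  have hNc : 8 * (9 * K ^ 2 * c.p (-12 * (n - 1) - 20)) ^ 2 ≤
      (c.p (-(1 / 1000)) / 2) ^ 2 * (K ^ 2 / 12 * c.p (-20 * (n - 1) - 20)) := by
    have e1 : (9 * K ^ 2 * c.p (-12 * (n - 1) - 20)) ^ 2 =
        81 * K ^ 4 * c.p (-24 * (n - 1) - 40) := by
      have : c.p (-12 * (n - 1) - 20) ^ 2 = c.p (-24 * (n - 1) - 40) := by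
        rw [p_pow]; congr 1; push_cast; ring
      rw [← this]; ring
    have e2 : (c.p (-(1 / 1000)) / 2) ^ 2 * (K ^ 2 / 12 * c.p (-20 * (n - 1) - 20)) =
        K ^ 2 / 48 * c.p (-20 * (n - 1) - 20 - 2 / 1000) := by
      have : c.p (-20 * (n - 1) - 20 - 2 / 1000) =
          c.p (-(1 / 1000)) ^ 2 * c.p (-20 * (n - 1) - 20) := by
        rw [hx2, ← p_add]; congr 1; ring
      rw [this]; ring
    rw [e1, e2]
    have := h.num (n := 2) (r := 31104) (x := -24 * (n - 1) - 40)
      (y := -20 * (n - 1) - 20 - 2 / 1000) (by norm_num) (by norm_num) (by linarith)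
    have hK2 : 0 < K ^ 2 := by positivity
    nlinarith
  have hN1 : 9 * K ^ 2 * c.p (-12 * (n - 1) - 20) ≤ c.p (-(1 / 1000)) ^ 200 := by
    rw [hξ]
    exact h.num (by norm_num) (by norm_num) (by push_cast; linarith)
  have hK'1 : (2 * K) ^ 2 + (1 / c.lam * (3 * 1)) ^ 2 ≤ c.p (20 * n + 21) := by
    have h1 := h.νb_le.trans ((p_le (c := c) (show (-9 : ℝ) ≤ 0 by norm_num)).trans_eq p_zero)
    have h0 := one_div_pos.2 c.hlam
    have h2 := h.num (n := 2) (r := 13) (x := 0) (y := 20 * n + 21) (by norm_num) (by norm_num)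
      (by linarith)
    rw [p_zero, mul_one] at h2
    nlinarith
  have hK'2 : c.b ^ (10 * (0 + n + 1)) ≤
      c.p (20 * n + 21) * ((1 / c.lam) ^ 2 * (c.b ^ (10 * (n - 0 - 1)))⁻¹) := by
    rw [e10, h.inv_lam, p_nat]
    have e1 : c.p (20 * n + 21) * ((K * c.p (-10)) ^ 2 * c.p (-10 * (n - 1))) =
        K ^ 2 * c.p (10 * n + 11) := by
      have : c.p (10 * n + 11) = c.p (20 * n + 21) * c.p (-10) ^ 2 * c.p (-10 * (n - 1)) := by
        rw [m10, ← p_add, ← p_add]; congr 1; ring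
      rw [this]; ring
    rw [e1]
    have h1 : c.p ((10 * (0 + n + 1) : ℕ) : ℝ) ≤ c.p (10 * n + 11) :=
      p_le (by push_cast; linarith)
    have h2 := p_pos (c := c) (10 * n + 11)
    nlinarith [one_le_pow₀ hK1 (n := 2)]
  have hκc : c.p (-(200 * P')) ≤ c.p (-(1 / 1000)) / 2 *
      (K ^ 2 / 12 * c.p (-20 * (n - 1) - 20)) / 8 := by
    have e1 : c.p (-(1 / 1000)) * c.p (-20 * (n - 1) - 20) =
        c.p (-20 * (n - 1) - 20 - 1 / 1000) := by rw [← p_add]; congr 1; ring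
    have h1 : 192 * c.p (-(200 * P')) ≤ c.p (-20 * (n - 1) - 20 - 1 / 1000) :=
      num_mul_le h.hb 8 (by norm_num) (by push_cast; linarith)
    rw [← e1] at h1
    have h2 := mul_pos (p_pos (c := c) (-(1 / 1000))) (p_pos (c := c) (-20 * (n - 1) - 20))
    nlinarith [one_le_pow₀ hK1 (n := 2)]
  have hκw : c.p (-(200 * P')) ≤ 1 / c.lam / 2 *
      (K ^ 2 / 12 * c.p (-20 * (n - 1) - 20)) / 8 := by
    rw [h.inv_lam]
    have e1 : c.p (-10) * c.p (-20 * (n - 1) - 20) = c.p (-20 * (n - 1) - 30) := by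
      rw [← p_add]; congr 1; ring
    have h1 : 192 * c.p (-(200 * P')) ≤ c.p (-20 * (n - 1) - 30) :=
      num_mul_le h.hb 8 (by norm_num) (by push_cast; linarith)
    rw [← e1] at h1
    have h2 := mul_pos (p_pos (c := c) (-10)) (p_pos (c := c) (-20 * (n - 1) - 20))
    nlinarith [one_le_pow₀ hK1 (n := 3)]
  have h64 : P' ^ 8 = P ^ 64 := by rw [hP', ← pow_mul]
  obtain ⟨C, h1, h2, -⟩ := hpre.merge (hD P' hPP) hε (h.le_wl (by norm_num)) hn hz
    (Ret := P' ^ 8) (fun t m ht htN => by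
      refine lt_of_le_of_lt ?_ (hfar t m ht (by rwa [h64] at htN))
      rw [hξ]
      exact h.small (by simpa using h.K_pow (n := 0) (r := 6) (by norm_num) (by norm_num))
        (by push_cast; norm_num))
    (ret_le (hP.trans hPP) (a := (c.base σ K hσ hK hK0).H1) (b := 0)
      (by simp only [H1, base]; omega) (by omega) hnN rfl)
    hN0 hc0 hc hNc hN1 hK'1 hK'2 (p_pos (-(200 * P')))
    (by rw [hξ]; exact p_le (by push_cast; linarith)) hκc hκw
    (by rw [← p_add]; exact (p_le (by linarith)).trans_eq p_zero)
  refine ⟨P', hPP, C, ?_, Or.inr h2⟩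
  have hl1 := h.νb_le.trans ((p_le (c := c) (show (-9 : ℝ) ≤ 0 by norm_num)).trans_eq p_zero)
  have hl0 := one_div_pos.2 c.hlam
  refine h1.sized h.hb (hP.trans hPP) (by simp only [base]; omega)
    (by simp only [H1, base]; omega) ?_ (p_le (by linarith)) (pow_le_one₀ hl0.le hl1) ?_
  · rw [← p_zero (c := c)]
    exact p_le (by linarith)
  · change c.p (-(100 * P')) ≤ (1 / c.lam) ^ 2 * (c.b ^ (10 * (n - 0 - 1)))⁻¹
    rw [e10, h.inv_lam, mul_pow, m10, mul_assoc, ← p_add]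
    have h3 : c.p (-(100 * P')) ≤ c.p (-20 + -10 * (n - 1)) := p_le (by linarith)
    nlinarith [one_le_pow₀ hK1 (n := 2), p_pos (c := c) (-20 + -10 * (n - 1))]

end Ctx

namespace Uni

variable {f f1 f2 : ℝ → ℝ} {κ a m : ℝ}

/-- Transversal solutions of `f = E` on the increasing arc. -/
lemma cross (h : Uni f f1 f2 κ a m) {E d ξ M : ℝ} (hd : 0 < d) (hd1 : d ≤ 1) (h1 : f a + d ≤ E)
    (h2 : E ≤ f m - d) (hM : ∀ x, |f2 x| ≤ M) (hξ : 0 < ξ) (hMξ : (M + 1) * ξ ≤ κ * d) :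
    ∃ z ∈ Set.Icc a m, f z = E ∧ (∀ t, |t - z| ≤ ξ → ξ ≤ f1 t) ∧
      ∀ x ∈ Set.Icc a m, |f x - E| < ξ ^ 2 → |x - z| ≤ ξ := by
  have ham : a ≤ m := by linarith [h.am, h.κ_pos]
  have hc : Continuous f := continuous_iff_continuousAt.2 fun x => (h.hf x).continuousAt
  obtain ⟨z, hz, hzE⟩ := intermediate_value_Icc ham hc.continuousOn
    (show E ∈ Set.Icc (f a) (f m) from ⟨by linarith, by linarith⟩)
  have hz1 : κ * d ≤ f1 z := by
    have := h.slope d hd hd1 z (by linarith) (by linarith)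
    rwa [abs_of_nonneg (h.up z hz)] at this
  have hz2 : ∀ t, |t - z| ≤ ξ → ξ ≤ f1 t := fun t ht => by
    have h3 := lip_le (f := f1) (f' := f2) (z := z) (R := ξ) (M := M) (fun x _ => h.hf1 x)
      (fun x _ => hM x) (p := z) (q := t) (by simpa using hξ.le) ht
    have hM0 : 0 ≤ M := (abs_nonneg _).trans (hM 0)
    have h4 : M * |t - z| ≤ M * ξ := by gcongr
    linarith [(abs_le.1 h3).1]
  refine ⟨z, hz, hzE, hz2, fun x hx hxE => ?_⟩
  rw [← hzE] at hxE
  have h5 := abs_lt.1 hxE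
  refine abs_le.2 ⟨?_, ?_⟩ <;> by_contra hcon <;> rw [not_le] at hcon
  · have h6 := h.mono hx.1 (show x ≤ z - ξ by linarith) (by linarith [hz.2])
    have h7 := slope_ge (m := ξ) (show z - ξ ≤ z by linarith) (fun x _ => h.hf x)
      (fun t ht => hz2 t (abs_le.2 ⟨by linarith [ht.1], by linarith [ht.2]⟩))
    nlinarith
  · have h6 := h.mono (show a ≤ z + ξ by linarith [hz.1]) (show z + ξ ≤ x by linarith) hx.2
    have h7 := slope_ge (m := ξ) (show z ≤ z + ξ by linarith) (fun x _ => h.hf x)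
      (fun t ht => hz2 t (abs_le.2 ⟨by linarith [ht.1], by linarith [ht.2]⟩))
    nlinarith

end Uni

namespace Ctx
open Core

variable {c : Ctx} {σ K : ℝ} {hσ : |σ| = 1}
  {hK : ∀ x E, |E| ≤ c.Emax → |E - c.v x| + |c.v1 x| + |c.v2 x / 2| + 1 ≤ K} {hK0 : 0 < K} {P : ℕ}
  {E1 κ a m : ℝ}

lemma base_G (j : Bool) (x E : ℝ) : ((c.base σ K hσ hK hK0).G j x E).v0 = σ * (E - c.v x) ∧
    ((c.base σ K hσ hK hK0).G j x E).dx = -σ * c.v1 x ∧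
    ((c.base σ K hσ hK hK0).G j x E).dxx = -σ * c.v2 x / 2 ∧
    ((c.base σ K hσ hK hK0).G j x E).dE = σ := by
  have hl := c.hlam.ne'
  simp only [base, cst_mul, aJ]
  refine ⟨?_, ?_, ?_, ?_⟩ <;> field_simp

lemma Strong.preII (h : c.Strong K) {f f1 f2 : ℝ → ℝ} {z : ℝ} (hf : ∀ x, f x = -σ * c.v x)
    (hf1 : ∀ x, f1 x = -σ * c.v1 x) (hf2 : ∀ x, f2 x = -σ * c.v2 x) (u : Uni f f1 f2 κ z m)
    (hK1 : 1000 ≤ K) (hκ : 1 ≤ K * κ) (hE : |E1| + 1 ≤ c.Emax) (hz : |z| ≤ 3)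
    (hbot : -c.p (-(1 / 4000)) ^ 2 ≤ σ * E1 + f z) :
    (c.base σ K hσ hK hK0).PreII E1 (1 / K) (c.p (-(1 / 4000))) (1 / c.lam) σ z true := by
  set y := c.p (-(1 / 4000)) with hy
  have hy0 : 0 < y := p_pos _
  have hG := @base_G c σ K hσ hK hK0
  have hκ' : 0 < 1 / K := by positivity
  have hκκ : 1 / K ≤ κ := by rw [div_le_iff₀ hK0]; linarith
  have hκ1 : 1 / K ≤ 1 / 1000 := one_div_le_one_div_of_le (by norm_num) hK1
  have hy10 : y ≤ (1 / K) ^ 10 := by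
    have h1 : K ^ 12 ≤ c.p (3 / 40000) := by
      have h2 : K ^ 4 ≤ c.p (1 / 40000) := by nlinarith [h.large, pow_pos hK0 4]
      calc K ^ 12 = (K ^ 4) ^ 3 := by ring
        _ ≤ c.p (1 / 40000) ^ 3 := by gcongr
        _ = _ := by rw [p_pow]; congr 1; norm_num
    have h2 : K ^ 10 ≤ K ^ 12 := pow_le_pow_right₀ h.one_le (by norm_num)
    have h3 : c.p (3 / 40000) * y ≤ 1 := by
      rw [hy, ← p_add]
      exact (p_le (by norm_num)).trans_eq p_zero
    rw [_root_.one_div_pow, le_div_iff₀ (by positivity)]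
    nlinarith
  have hR : y / (1 / K) ^ 3 ≤ (1 / K) ^ 7 := by
    rw [div_le_iff₀ (by positivity)]
    calc y ≤ _ := hy10
      _ = _ := by ring
  have h7 : (1 / K) ^ 7 ≤ 1 / K := pow_le_of_le_one hκ'.le (by linarith) (by norm_num)
  have hy1 : y ≤ 1 / 1000 :=
    (hy10.trans (pow_le_of_le_one hκ'.le (by linarith) (by norm_num))).trans hκ1
  have hσσ : σ * σ = 1 := by rw [← abs_mul_abs_self, hσ, one_mul]
  have hper : ∀ (x : ℝ) (n : ℤ), c.v (x - n) = c.v x := fun x n => by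
    rw [← per_int c.per (x - n) n, sub_add_cancel]
  have hy3 : y ^ 3 ≤ y ^ 2 / 1000 := by nlinarith [sq_nonneg y]
  refine ⟨fun E hE' => ?_, hκ', hκ1, hy0, hy10, one_div_pos.2 c.hlam, ?_, ?_, ?_, hσ, ?_, ?_, ?_,
    ?_, ?_, ?_⟩
  · change |E| ≤ c.Emax
    have : y ^ 3 ≤ 1 := pow_le_one₀ hy0.le (by linarith)
    calc |E| = |(E - E1) + E1| := by ring_nf
      _ ≤ |E - E1| + |E1| := abs_add_le _ _
      _ ≤ _ := by linarith
  · exact (mul_one_div_cancel hK0.ne').le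
  · simp only [base, sub_zero]
    linarith
  · simp only [base]
    linarith
  · rw [(hG _ _ _).2.1, ← hf1, u.crit]
  · rw [(hG _ _ _).1, mul_sub]
    linarith [hf z]
  · intro x E hx _
    rw [(hG _ _ _).2.2.1, ← hf2]
    linarith [u.cva x (hx.trans (hR.trans (h7.trans hκκ)))]
  · intro x E _ _ _
    rw [(hG _ _ _).2.2.2, hσσ]
    linarith
  · intro x E _ _ _
    simp only [base]
    rw [← mul_div_assoc, hσσ]
  · intro i x n E _ hE' hg
    rw [(hG _ _ _).1, hper, mul_sub] at hg
    have hg' := abs_lt.1 hg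
    have h1 : -(y ^ 3) ≤ σ * (E - E1) := by
      refine (abs_le.1 (?_ : |σ * (E - E1)| ≤ y ^ 3)).1
      rwa [abs_mul, hσ, one_mul]
    have hfx := hf x
    have hub : f x ≤ f z + 3 * y ^ 2 := by nlinarith [sq_nonneg y]
    have hκ3 : 3 * y ^ 2 < κ ^ 3 := by
      have h2 : y ≤ (1 / K) ^ 3 := hy10.trans
        (pow_le_pow_of_le_one hκ'.le (by linarith) (by norm_num))
      have h3 : (1 / K) ^ 3 ≤ κ ^ 3 := by gcongr
      nlinarith
    obtain ⟨n', hn | hn⟩ := u.gap x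
    · refine ⟨n', ?_, ?_⟩
      · have h2 := u.quad hn
        have e : f (x - n') = f x := by rw [hf, hf, hper]
        rw [e] at h2
        refine abs_le_of_sq_le_sq ?_ (by positivity)
        have h3 : 1 / K * (x - n' - z) ^ 2 ≤ 3 * y ^ 2 := by
          have := mul_le_mul_of_nonneg_right hκκ (sq_nonneg (x - n' - z))
          linarith
        have e2 : (y / (1 / K) ^ 3) ^ 2 = K ^ 6 * y ^ 2 := by field_simp
        rw [e2]
        have h4 : (x - n' - z) ^ 2 ≤ K * (3 * y ^ 2) := by
          rw [one_div, inv_mul_le_iff₀ hK0] at h3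
          exact h3
        have h5 : K * 3 ≤ K ^ 6 := by
          have : 3 ≤ K ^ 5 := by
            have := pow_le_pow_right₀ h.one_le (show 1 ≤ 5 by norm_num)
            linarith
          calc K * 3 ≤ K * K ^ 5 := by gcongr
            _ = _ := by ring
        nlinarith [sq_nonneg y]
      · rwa [(hG _ _ _).1, hper, mul_sub]
    · linarith

set_option maxHeartbeats 400000 in
lemma Strong.preI (h : c.Strong K) (u : Uni c.v c.v1 c.v2 κ a m)
    (hκ : 1 ≤ K * κ) (hE : |E1| + 1 ≤ c.Emax) (ha : 0 ≤ a) (ha1 : a < 1)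
    (h1 : c.v a + c.p (-(1 / 4000)) ^ 2 ≤ E1) (h2 : E1 ≤ c.v m - c.p (-(1 / 4000)) ^ 2)
    {hσ : |(1 : ℝ)| = 1} :
    ∃ z, (c.base 1 K hσ hK hK0).PreI E1 (c.p (-(1 / 1000))) (1 / c.lam) z id
      (fun j => if j then 1 else -1) (fun _ => 1) := by
  set y := c.p (-(1 / 4000)) with hy
  set ξ := c.p (-(1 / 1000)) with hξ
  have hy0 : 0 < y := p_pos _
  have hξ0 : 0 < ξ := p_pos _
  have hK1 := h.one_le
  have hG := @base_G c 1 K hσ hK hK0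
  have hM : ∀ x, |c.v2 x| ≤ 2 * K := fun x => by
    have := hK x E1 (by linarith)
    rw [abs_div, abs_two] at this
    linarith [abs_nonneg (E1 - c.v x), abs_nonneg (c.v1 x)]
  have hy1 : y ≤ 1 := (p_le (by norm_num)).trans_eq p_zero
  have hd1 : y ^ 2 ≤ 1 := pow_le_one₀ hy0.le hy1
  have hMξ : (2 * K + 1) * ξ ≤ κ * y ^ 2 := by
    have h3 := h.num (n := 2) (r := 3) (x := -(1 / 1000)) (y := -(1 / 2000)) (by norm_num)
      (by norm_num) (by norm_num)
    have e : c.p (-(1 / 2000)) = y ^ 2 := by rw [hy, p_pow]; congr 1; norm_num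
    rw [e] at h3
    have h4 : K * ((2 * K + 1) * ξ) ≤ K * (κ * y ^ 2) := by
      calc K * ((2 * K + 1) * ξ) ≤ K * ((3 * K) * ξ) := by gcongr; linarith
        _ = 3 * K ^ 2 * ξ := by ring
        _ ≤ 1 * y ^ 2 := by linarith
        _ ≤ K * κ * y ^ 2 := by gcongr
        _ = _ := by ring
    exact le_of_mul_le_mul_left h4 hK0
  have hξ1 : ξ ≤ 1 / 1000 := by
    have := h.num (n := 0) (r := 1000) (x := -(1 / 1000)) (y := 0) (by norm_num)
      (by norm_num) (by norm_num)
    rw [p_zero, pow_zero] at this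
    linarith
  obtain ⟨z0, hz0, e0, d0, c0⟩ := u.cross (pow_pos hy0 2) hd1 h1 h2 hM hξ0 hMξ
  obtain ⟨z1, hz1, e1, d1, c1⟩ := u.flip.cross (E := -E1) (pow_pos hy0 2) hd1 (by linarith)
    (by rw [u.per]; linarith) (fun x => by rw [abs_neg]; exact hM x) hξ0 hMξ
  have hper : ∀ (x : ℝ) (n : ℤ), c.v (x - n) = c.v x := fun x n => by
    rw [← per_int c.per (x - n) n, sub_add_cancel]
  have h100 : 2 * ξ ^ 100 ≤ ξ ^ 2 := by
    have : ξ ^ 100 ≤ ξ ^ 3 := pow_le_pow_of_le_one hξ0.le (by linarith) (by norm_num)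
    nlinarith [sq_nonneg ξ]
  have hκ0 := u.κ_pos
  have ham := u.am
  have hma := u.ma
  refine ⟨fun j => if j then z1 else z0, fun E hE' => ?_, hξ0, hξ1, one_div_pos.2 c.hlam, ?_, ?_,
    ?_, ?_, ?_, by simp, by simp, ?_, ?_, ?_, ?_, ?_⟩
  · change |E| ≤ c.Emax
    calc |E| = |(E - E1) + E1| := by ring_nf
      _ ≤ |E - E1| + |E1| := abs_add_le _ _
      _ ≤ _ := by linarith
  · have := h.K_one (r := 1) (x := -(1 / 1000)) (by norm_num) (by norm_num)
    rwa [one_mul] at this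
  · have b0 : |z0| ≤ 2 := abs_le.2 ⟨by linarith [hz0.1], by linarith [hz0.2]⟩
    have b1 : |z1| ≤ 2 := abs_le.2 ⟨by linarith [hz1.1], by linarith [hz1.2]⟩
    rintro (_ | _) <;> simp only [base, sub_zero, if_true, Bool.false_eq_true, if_false] <;>
      linarith
  · simp only [base]; linarith
  · rintro (_ | _) <;> simp
  · simp
  · rintro (_ | _) <;> simp only [(hG _ _ _).1, if_true, Bool.false_eq_true, if_false] <;> linarith
  · rintro (_ | _) t E ht _ <;>
      simp only [(hG _ _ _).2.1, if_true, Bool.false_eq_true, if_false] at ht ⊢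
    · linarith [d0 t ht]
    · linarith [d1 t ht]
  · intro j t E _ _
    rw [(hG _ _ _).2.2.2]
    linarith
  · intro j t E _ _
    simp [base]
  · intro i t n E _ hE' hg
    rw [(hG _ _ _).1, hper, one_mul] at hg
    obtain ⟨n', h3, h4⟩ := Uni.rep a t
    have h5 := abs_lt.1 hg
    have h6 := abs_le.1 hE'
    have key : |c.v t - E1| < ξ ^ 2 := abs_lt.2 ⟨by linarith, by linarith⟩
    rcases le_total (t - n') m with h7 | h7
    · exact ⟨false, n', c0 _ ⟨h3, h7⟩ (by rwa [hper]),
        by simp only [(hG _ _ _).1, hper]⟩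
    · refine ⟨true, n', c1 _ ⟨h7, h4⟩ ?_, by simp only [(hG _ _ _).1, hper]⟩
      rw [hper, ← abs_neg]
      convert key using 2
      ring

/-- Initial cores exist at every energy near the range of the potential. -/
lemma Strong.exists_staged (h : c.Strong K)
    (hK : ∀ x E, |E| ≤ c.Emax → |E - c.v x| + |c.v1 x| + |c.v2 x / 2| + 1 ≤ K)
    (u : Uni c.v c.v1 c.v2 κ a m) (hK1 : 1000 ≤ K)
    (hκ : 1 ≤ K * κ) (hE : |E1| + 1 ≤ c.Emax) (ha : 0 ≤ a) (ha1 : a < 1) (hP : 1000 ≤ P)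
    (hfar : ∀ t m : ℤ, t ≠ 0 → |t| ≤ (P ^ 64 : ℕ) → c.p (-(1 / 5000)) < |t * c.α - m|) :
    ∃ P' ≥ P, ∃ C : Core c, C.Staged P' E1 := by
  have hK0 : 0 < K := by linarith
  have h8 : P ^ 8 ≤ P ^ 64 := Nat.pow_le_pow_right (by omega) (by norm_num)
  have hfar' : ∀ t m : ℤ, t ≠ 0 → |t| ≤ (P ^ 8 : ℕ) → c.p (-(1 / 5000)) < |t * c.α - m| :=
    fun t m ht h => hfar t m ht (h.trans (by exact_mod_cast h8))
  have hKK : 1 ≤ K * (1 / K) := (mul_one_div_cancel hK0.ne').ge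
  have ham := u.am
  have hma := u.ma
  have hκ0 := u.κ_pos
  rcases le_total (c.v a + c.p (-(1 / 4000)) ^ 2) E1 with h1 | h1
  · rcases le_total E1 (c.v m - c.p (-(1 / 4000)) ^ 2) with h2 | h2
    · obtain ⟨z, hz⟩ := h.preI (hK := hK) (hK0 := hK0) (hσ := abs_one) u hκ hE ha ha1 h1 h2
      exact h.keepI hP hz hfar
    · obtain ⟨C, hC⟩ := h.keepII hP hKK (h.preII (hσ := abs_one) (hK := hK) (hK0 := hK0)
        (fun x => (neg_one_mul _).symm) (fun x => (neg_one_mul _).symm)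
        (fun x => (neg_one_mul _).symm) u.flip hK1 hκ hE
        (abs_le.2 ⟨by linarith, by linarith⟩) (by linarith)) hfar'
      exact ⟨P, le_rfl, C, hC⟩
  · obtain ⟨C, hC⟩ := h.keepII hP hKK (h.preII (σ := -1) (hσ := by simp) (hK := hK) (hK0 := hK0)
      (fun x => by ring) (fun x => by ring) (fun x => by ring) u hK1 hκ hE
      (abs_le.2 ⟨by linarith, by linarith⟩) (by linarith)) hfar'
    exact ⟨P, le_rfl, C, hC⟩

end Ctx

/-- A Schrödinger cocycle whose diagonal entry is uniformly large is uniformly hyperbolic. -/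
lemma isUH_of_large_entry {α lam : ℝ} {v : ℝ → ℝ} (hper : ∀ x, v (x + 1) = v x) {E A D : ℝ}
    (hA : 3 ≤ A) (hlow : ∀ x, A ≤ |E - lam * v x|) (hup : ∀ x, |E - lam * v x| ≤ D)
    (hAD : D + 2 < (A - 1) ^ 2) : IsUH α (schCocycle lam v E) := by
  have hD : A ≤ D := (hlow 0).trans (hup 0)
  refine isUH_of_growth (L := D + 2) (c := 1) (g := A - 1) (fun x => ?_) (fun x => ?_)
    (by linarith) (fun x => ?_) one_pos (by linarith) hAD (fun n x => ?_)
  · simp [schCocycle, det_fin_two]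
  · simp [schCocycle, hper]
  · have h2 := pow_le_pow_left₀ (abs_nonneg _) (hup x) 2
    rw [sq_abs] at h2
    simp only [hs, schCocycle, of_apply, cons_val', cons_val_zero, cons_val_one,
      cons_val_fin_one]
    nlinarith
  · have key : |fwdIter α (schCocycle lam v E) n x 1 0| ≤
        |fwdIter α (schCocycle lam v E) n x 0 0| ∧
        (A - 1) ^ n ≤ |fwdIter α (schCocycle lam v E) n x 0 0| := by
      induction n with
      | zero => simp [fwdIter]
      | succ n ih =>
        set p := fwdIter α (schCocycle lam v E) n x 0 0 with hp
        set q := fwdIter α (schCocycle lam v E) n x 1 0 with hq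
        have e0 : fwdIter α (schCocycle lam v E) (n + 1) x 0 0 =
            (E - lam * v (x + n * α)) * p - q := by
          simp [fwdIter, mul_apply, Fin.sum_univ_two, schCocycle, hp, hq]
          ring
        have e1 : fwdIter α (schCocycle lam v E) (n + 1) x 1 0 = p := by
          simp [fwdIter, mul_apply, Fin.sum_univ_two, schCocycle, hp]
        have h1 : A * |p| ≤ |(E - lam * v (x + n * α)) * p| := by
          rw [abs_mul]
          exact mul_le_mul_of_nonneg_right (hlow _) (abs_nonneg _)
        have h2 := abs_sub_abs_le_abs_sub ((E - lam * v (x + n * α)) * p) q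
        have h3 : (A - 1) * |p| ≤ |(E - lam * v (x + n * α)) * p - q| := by linarith [ih.1]
        rw [e0, e1]
        refine ⟨le_trans ?_ h3, le_trans ?_ h3⟩
        · nlinarith [abs_nonneg p]
        · rw [pow_succ']
          exact mul_le_mul_of_nonneg_left ih.2 (by linarith)
    have h0 : 0 ≤ (A - 1) ^ n := pow_nonneg (by linarith) n
    have := pow_le_pow_left₀ h0 key.2 2
    rw [sq_abs] at this
    unfold hs
    nlinarith [sq_nonneg (fwdIter α (schCocycle lam v E) n x 0 1),
      sq_nonneg (fwdIter α (schCocycle lam v E) n x 1 0),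
      sq_nonneg (fwdIter α (schCocycle lam v E) n x 1 1)]

/-- Energies away from the range of the potential. -/
lemma isUH_of_far {α lam V : ℝ} {v : ℝ → ℝ} (hper : ∀ x, v (x + 1) = v x) (hV : ∀ x, |v x| ≤ V)
    (hlam : 2 * V + 6 ≤ lam) {E : ℝ} (hE : V + 1 ≤ |E|) :
    IsUH α (schCocycle lam v (lam * E)) := by
  have hV0 : 0 ≤ V := (abs_nonneg _).trans (hV 0)
  have hl : 0 ≤ lam := by linarith
  have hA : lam ≤ lam * (|E| - V) := le_mul_of_one_le_right hl (by linarith)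
  have e : ∀ x, |lam * E - lam * v x| = lam * |E - v x| := fun x => by
    rw [← mul_sub, abs_mul, abs_of_nonneg hl]
  refine isUH_of_large_entry hper (A := lam * (|E| - V)) (D := lam * (|E| + V)) (by linarith)
    (fun x => ?_) (fun x => ?_) ?_
  · rw [e]
    have := abs_sub_abs_le_abs_sub E (v x)
    exact mul_le_mul_of_nonneg_left (by linarith [hV x]) hl
  · rw [e]
    have := abs_sub E (v x)
    exact mul_le_mul_of_nonneg_left (by linarith [hV x]) hl
  · set A := lam * (|E| - V) with hAdef
    have e1 : lam * (|E| + V) = A + 2 * V * lam := by rw [hAdef]; ring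
    rw [e1]
    nlinarith

lemma exists_bound {f : ℝ → ℝ} (hf : Continuous f) (hp : ∀ x, f (x + 1) = f x) :
    ∃ V, ∀ x, |f x| ≤ V := by
  obtain ⟨V, hV⟩ := (Function.Periodic.isBounded_of_continuous (c := 1) hp one_ne_zero
    hf).exists_norm_le
  exact ⟨V, fun x => hV _ ⟨x, rfl⟩⟩

lemma DC.exists_pow {τ α : ℝ} (h : DC τ α) : ∃ γ > 0, ∃ T : ℕ, ∀ p q : ℤ, q ≠ 0 →
    γ ≤ |q * α - p| * |(q : ℝ)| ^ T := by
  obtain ⟨γ, hγ, h⟩ := h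
  refine ⟨γ, hγ, ⌈τ⌉₊, fun p q hq => ?_⟩
  have hq1 : (1 : ℝ) ≤ |(q : ℝ)| := by exact_mod_cast Int.one_le_abs hq
  have hq0 : (q : ℝ) ≠ 0 := by exact_mod_cast hq
  have h1 := h p q hq
  rw [div_le_iff₀ (Real.rpow_pos_of_pos (by linarith) _)] at h1
  have h2 : |(q : ℝ)| ^ τ ≤ |(q : ℝ)| ^ ⌈τ⌉₊ := by
    rw [← Real.rpow_natCast]
    exact Real.rpow_le_rpow_of_exponent_le hq1 (Nat.le_ceil τ)
  have h3 : |α - p / q| ≤ |q * α - p| := by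
    have : (q : ℝ) * α - p = q * (α - p / q) := by field_simp
    rw [this, abs_mul]
    exact le_mul_of_one_le_left (abs_nonneg _) hq1
  exact h1.trans (mul_le_mul h3 h2 (by positivity) (abs_nonneg _))

namespace Ctx

variable {c : Ctx} {K γ Y : ℝ} {P : ℕ}

lemma p_neg_le (hb : 2 ≤ c.b) (P : ℕ) : c.p (-P) ≤ (1 / 2) ^ P := by
  rw [p_neg, ← p_nat, _root_.one_div_pow, one_div]
  exact inv_anti₀ (by positivity) (pow_le_pow_left₀ (by norm_num) hb P)

lemma exists_le_p (Y : ℝ) {x : ℝ} (hx : 0 < x) :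
    ∃ X, 0 ≤ X ∧ ∀ c : Ctx, X ≤ c.b → Y ≤ c.p x := by
  refine ⟨|Y| ^ x⁻¹, by positivity, fun c hc => ?_⟩
  calc Y ≤ |Y| := le_abs_self Y
    _ = (|Y| ^ x⁻¹) ^ x := (Real.rpow_inv_rpow (abs_nonneg Y) hx.ne').symm
    _ ≤ c.b ^ x := Real.rpow_le_rpow (by positivity) hc hx.le

/-- Short returns are excluded for large coupling. -/
lemma far_of_large (hY : (P : ℝ) ^ (64 * c.T) < c.γ * Y) (hb : Y ≤ c.p (1 / 5000))
    {t m : ℤ} (ht : t ≠ 0) (htP : |t| ≤ (P ^ 64 : ℕ)) : c.p (-(1 / 5000)) < |t * c.α - m| := by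
  have h1 := c.dc m t ht
  have h2 : |(t : ℝ)| ≤ (P : ℝ) ^ 64 := by exact_mod_cast htP
  have h3 : |(t : ℝ)| ^ c.T ≤ (P : ℝ) ^ (64 * c.T) := by
    rw [pow_mul]
    exact pow_le_pow_left₀ (abs_nonneg _) h2 _
  have h5 := p_pos (c := c) (1 / 5000)
  have hγ := c.hγ
  rw [p_neg, inv_lt_iff_one_lt_mul₀ h5]
  by_contra hcon
  rw [not_lt] at hcon
  have h6 : c.γ * c.p (1 / 5000) ≤ (P : ℝ) ^ (64 * c.T) := by
    calc c.γ * c.p (1 / 5000) ≤ |t * c.α - m| * |(t : ℝ)| ^ c.T * c.p (1 / 5000) := by gcongr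
      _ = c.p (1 / 5000) * |t * c.α - m| * |(t : ℝ)| ^ c.T := by ring
      _ ≤ 1 * (P : ℝ) ^ (64 * c.T) := by
        gcongr
        linarith
      _ = _ := one_mul _
  have h7 : c.γ * Y ≤ c.γ * c.p (1 / 5000) := by gcongr
  linarith

/-- Uniformly hyperbolic energies are dense near the range of the potential. -/
lemma Strong.dense (h : c.Strong K) {κ a m E1 : ℝ}
    (hK : ∀ x E, |E| ≤ c.Emax → |E - c.v x| + |c.v1 x| + |c.v2 x / 2| + 1 ≤ K)
    (u : Uni c.v c.v1 c.v2 κ a m) (hK1 : 1000 ≤ K)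
    (hκ : 1 ≤ K * κ) (hE : |E1| + 1 ≤ c.Emax) (ha : 0 ≤ a) (ha1 : a < 1) (hP : 1000 ≤ P)
    (hL : c.Large P)
    (hfar : ∀ t m : ℤ, t ≠ 0 → |t| ≤ (P ^ 64 : ℕ) → c.p (-(1 / 5000)) < |t * c.α - m|)
    {θ : ℝ} (hθ : 0 < θ) :
    ∃ E, |E - E1| ≤ θ ∧ IsUH c.α (schCocycle c.lam c.v (c.lam * E)) := by
  obtain ⟨P1, hP1, C, hC⟩ := h.exists_staged hK u hK1 hκ hE ha ha1 hP hfar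
  obtain ⟨N, hN⟩ := exists_pow_lt_of_lt_one hθ (show (1 / 2 : ℝ) < 1 by norm_num)
  obtain ⟨P2, hP2, hNP, C', hC'⟩ := hC.exists_fine h.hb (hP.trans hP1)
    (fun P' hP' => (hL.mono (hP1.trans hP')).sep h.hb) N
  obtain ⟨E, h1, h2⟩ := hC'.exists_uh h.hb (hL.mono (hP1.trans hP2))
  refine ⟨E, h1.trans ?_, h2⟩
  have h3 : c.p (-P2) ≤ c.p (-N) := p_le (by
    have : (N : ℝ) ≤ P2 := by exact_mod_cast hNP
    linarith)
  exact h3.trans ((p_neg_le h.hb N).trans hN.le)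

end Ctx

/-- **Theorem B.** For a Diophantine frequency α ∈ DC_τ (τ > 2) and a potential v satisfying
condition (V), there is λ₀ = λ₀(α,v) > 0 such that for all λ > λ₀ and every interval
S ⊂ ℝ with more than one point, some E ∈ S makes the Schrödinger cocycle (α, A^{(E-λv)})
uniformly hyperbolic. -/
theorem exists_uh_energy_in_interval (τ α : ℝ) (hτ : 2 < τ) (hα : DC τ α)
    (v : ℝ → ℝ) (hper : Function.Periodic v 1) (hV : ConditionV v) :
    ∃ lam₀ > (0 : ℝ), ∀ lam > lam₀, ∀ S : Set ℝ, S.OrdConnected → S.Nontrivial →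
      ∃ E ∈ S, IsUH α (schCocycle lam v E) := by
  obtain ⟨γ, hγ, T, hdc⟩ := hα.exists_pow
  obtain ⟨κ, a, m, ha, ha1, u⟩ := hV.uni hper
  have hC : ContDiff ℝ 2 v := hV.1
  have hc0 : Continuous v := hC.continuous
  have hc1 : Continuous (deriv v) := hC.continuous_deriv (by norm_num)
  have hc2 : Continuous (iteratedDeriv 2 v) := hC.continuous_iteratedDeriv 2 (by norm_num)
  obtain ⟨V0, hV0⟩ := exists_bound hc0 u.per
  obtain ⟨V1, hV1⟩ := exists_bound hc1 u.per1
  obtain ⟨V2, hV2⟩ := exists_bound hc2 u.per2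
  have hV00 : 0 ≤ V0 := (abs_nonneg _).trans (hV0 0)
  have hV10 : 0 ≤ V1 := (abs_nonneg _).trans (hV1 0)
  have hV20 : 0 ≤ V2 := (abs_nonneg _).trans (hV2 0)
  have hκ0 := u.κ_pos
  set K := 2 * V0 + V1 + V2 + 1000 + 1 / κ with hKdef
  have hκi : 0 < 1 / κ := by positivity
  have hK1000 : 1000 ≤ K := by linarith
  have hKκ : 1 ≤ K * κ := by
    have : 1 / κ * κ = 1 := div_mul_cancel₀ _ hκ0.ne'
    have : 1 / κ * κ ≤ K * κ := by gcongr; linarith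
    linarith
  obtain ⟨N, hN⟩ := exists_pow_lt_of_lt_one hγ (show (1 / 2 : ℝ) < 1 by norm_num)
  set P := 1000 * (T + 1) + N with hPdef
  obtain ⟨X, hX0, hX⟩ := Ctx.exists_le_p (10 ^ 6 * K ^ 4) (x := 1 / 40000) (by norm_num)
  obtain ⟨Y, hY0, hY⟩ := Ctx.exists_le_p (((P : ℝ) ^ (64 * T) + 1) / γ) (x := 1 / 5000)
    (by norm_num)
  obtain ⟨Z, hZ⟩ : ∃ Z, Z = 2 + X + Y := ⟨_, rfl⟩
  have hZ0 : 0 ≤ Z := by linarith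
  have hZ10 : 0 ≤ Z ^ 10 := by positivity
  refine ⟨2 * V0 + 6 + Z ^ 10, by positivity, fun lam hlam S hS hS2 => ?_⟩
  have hl1 : 1 ≤ lam := by linarith
  obtain ⟨s, hs1, t, ht1, hst⟩ := hS2.exists_lt
  set E1 := (s + t) / (2 * lam) with hE1
  set θ := (t - s) / (2 * lam) with hθ
  have hθ0 : 0 < θ := div_pos (by linarith) (by linarith)
  have hmem : ∀ E, |E - E1| ≤ θ → lam * E ∈ S := fun E hE => by
    have h1 : lam * |E - E1| ≤ lam * θ := by gcongr
    have e1 : lam * E1 = (s + t) / 2 := by rw [hE1]; field_simp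
    have e2 : lam * θ = (t - s) / 2 := by rw [hθ]; field_simp
    rw [← abs_of_pos (show 0 < lam by linarith), ← abs_mul, abs_of_pos (show 0 < lam by linarith),
      mul_sub, e1, e2] at h1
    have := abs_le.1 h1
    exact hS.out hs1 ht1 ⟨by linarith, by linarith⟩
  rcases le_or_gt (V0 + 1) |E1| with hfar | hnear
  · exact ⟨lam * E1, hmem E1 (by simpa using hθ0.le), isUH_of_far u.per hV0 (by linarith) hfar⟩
  have hb0 : 0 < K * lam := by positivity
  set b := (K * lam) ^ ((1 : ℝ) / 10) with hb
  have hb10 : b ^ 10 = K * lam := by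
    rw [hb, ← Real.rpow_natCast, ← Real.rpow_mul hb0.le]
    norm_num
  have hbpos : 0 ≤ b := by positivity
  have hbZ : Z ≤ b := by
    refine le_of_pow_le_pow_left₀ (n := 10) (by norm_num) hbpos ?_
    rw [hb10]
    nlinarith
  have hK' : ∀ x E, |E| ≤ V0 + 2 →
      |E - v x| + |deriv v x| + |iteratedDeriv 2 v x / 2| + 1 ≤ K - 1 := fun x E hE => by
    have h1 := abs_sub E (v x)
    rw [abs_div, abs_two]
    linarith [hV0 x, hV1 x, hV2 x]
  let c : Ctx :=
    { α := α, lam := lam, v := v, v1 := deriv v, v2 := iteratedDeriv 2 v, b := b, Emax := V0 + 2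
      γ := γ, T := T, hv := u.hf, hv1 := u.hf1, per := u.per, per1 := u.per1, per2 := u.per2
      hlam := by linarith
      hb := by linarith
      hΛ := fun x E hE => by
        have h1 := mul_le_mul_of_nonneg_left (hK' x E hE) (show 0 ≤ lam by linarith)
        have h0 : |lam| = lam := abs_of_pos (by linarith)
        rw [hb10, mul_div_assoc, abs_mul, abs_mul, abs_mul, h0]
        nlinarith
      hγ := hγ
      dc := hdc }
  have hs : c.Strong K := by
    refine ⟨?_, by linarith, hb10.symm, ?_⟩
    · change 2 ≤ b
      linarith
    · exact hX c (show X ≤ b by linarith)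
  have hL : c.Large P := by
    refine ⟨by change 1000 * (T + 1) ≤ P; omega, ?_⟩
    refine (Ctx.p_neg_le hs.hb P).trans (le_trans ?_ hN.le)
    exact pow_le_pow_of_le_one (by norm_num) (by norm_num) (by omega)
  obtain ⟨E, h1, h2⟩ := hs.dense (fun x E hE => (hK' x E hE).trans (by linarith)) u hK1000 hKκ
    (show |E1| + 1 ≤ V0 + 2 by linarith) ha ha1 (show 1000 ≤ P by omega) hL
    (fun t m ht htP => Ctx.far_of_large (c := c)
      (by
        change (P : ℝ) ^ (64 * T) < γ * (((P : ℝ) ^ (64 * T) + 1) / γ)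
        rw [mul_div_cancel₀ _ hγ.ne']
        linarith) (hY c (show Y ≤ b by linarith)) ht htP) hθ0
  exact ⟨lam * E, hmem E h1, h2⟩
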